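/- Assume the Generalized Riemann Hypothesis: for every positive integer q, every Dirichlet character χ modulo q, and every s ∈ ℂ with 0 < Re(s) < 1, if L(s,χ) = 0 then Re(s) = 1/2. Then there exists N₀ such that every even integer N ≥ N₀ can be written as N = p₁ + p₂ + 2^{ν₁} + ⋯ + 2^{ν₇}, where p₁ and p₂ are prime numbers and ν₁, …, ν₇ are positive integers (not necessarily distinct). -/

import Mathlib

namespace LinnikGRH
open MeasureTheory FourierTransform

/-- The `L²` Fourier transform of an integrable square-integrable function is the integral one. -/
lemma fourier_toLp_ae_eq {f : ℝ → ℂ} (hf : Integrable f) (hf2 : MemLp f 2) :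
    ((𝓕 (hf2.toLp f) : Lp ℂ 2 (volume : Measure ℝ)) : ℝ → ℂ) =ᵐ[volume] 𝓕 f := by
  have hcont : Continuous (𝓕 f) :=
    VectorFourier.fourierIntegral_continuous Real.continuous_fourierChar (by exact continuous_inner) hf
  refine ae_eq_of_integral_contDiff_smul_eq ((Lp.memLp _).locallyIntegrable (by norm_num))
    hcont.locallyIntegrable fun g hg hgc => ?_
  have hgC : ContDiff ℝ (⊤ : ℕ∞) (fun x => (g x : ℂ)) := Complex.ofRealCLM.contDiff.comp hg
  have hgcC : HasCompactSupport (fun x => (g x : ℂ)) := hgc.comp_left (g := fun x : ℝ => (x : ℂ)) rfl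
  let φ : SchwartzMap ℝ ℂ := hgcC.toSchwartzMap hgC
  have hφ : ∀ x, φ x = (g x : ℂ) := fun x => rfl
  have h1 := congrArg (fun T : TemperedDistribution ℝ ℂ => T φ)
    (MeasureTheory.Lp.fourier_toTemperedDistribution_eq (hf2.toLp f))
  simp only [TemperedDistribution.fourier_apply, Lp.toTemperedDistribution_apply] at h1
  have h2 : ∫ x, (𝓕 φ) x • (hf2.toLp f) x = ∫ x, (𝓕 φ) x • f x := by
    refine integral_congr_ae ?_
    filter_upwards [hf2.coeFn_toLp] with x hx
    rw [hx]
  have h3 : ∫ x, (𝓕 φ) x • f x = ∫ x, φ x • 𝓕 f x := by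
    simpa [SchwartzMap.fourier_coe] using! (VectorFourier.integral_fourierIntegral_smul_eq_flip
      (L := innerₗ ℝ) (f := (φ : ℝ → ℂ)) (g := f) Real.continuous_fourierChar continuous_inner
      φ.integrable hf)
  rw [h2, h3] at h1
  simpa [hφ] using h1.symm

lemma integral_norm_sq_fourier_eq {f : ℝ → ℂ} (hf : Integrable f) (hf2 : MemLp f 2) :
    MemLp (𝓕 f) 2 ∧ ∫ x, ‖𝓕 f x‖ ^ 2 = ∫ x, ‖f x‖ ^ 2 := by
  have h := fourier_toLp_ae_eq hf hf2
  have hm : MemLp (𝓕 f) 2 := (memLp_congr_ae h).mp (Lp.memLp _)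
  refine ⟨hm, ?_⟩
  have e1 : ∀ g : ℝ → ℂ, (hg : MemLp g 2) → ∫ x, ‖g x‖ ^ 2 = (eLpNorm g 2 volume).toReal ^ 2 := by
    intro g hg
    rw [hg.eLpNorm_eq_integral_rpow_norm (by norm_num) (by norm_num), ENNReal.toReal_ofReal]
    · have h0 : 0 ≤ ∫ a, ‖g a‖ ^ 2 := integral_nonneg fun _ => by positivity
      simp only [ENNReal.toReal_ofNat, Real.rpow_ofNat]
      rw [← Real.rpow_natCast, ← Real.rpow_mul h0]
      norm_num
    · exact Real.rpow_nonneg (integral_nonneg fun _ => by positivity) _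
  rw [e1 _ hm, e1 _ hf2, ← eLpNorm_congr_ae h]
  have h4 := MeasureTheory.Lp.norm_fourier_eq (hf2.toLp f)
  rw [Lp.norm_def, Lp.norm_def] at h4
  rw [h4, eLpNorm_congr_ae hf2.coeFn_toLp]
end LinnikGRH

namespace LinnikGRH
open MeasureTheory FourierTransform Set

/-- Continuously differentiable weights supported in `[0, 1]`, with explicit bounds. -/
structure IsWeight (u u' : ℝ → ℂ) (A B : ℝ) : Prop where
  pos : 0 < A
  one_le : 1 ≤ B
  hasDeriv : ∀ x, HasDerivAt u (u' x) x
  cont : Continuous u'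
  zero_left : ∀ x ≤ 0, u x = 0
  zero_right : ∀ x, 1 ≤ x → u x = 0
  bound : ∀ x, ‖u x‖ ≤ A
  bound' : ∀ x, ‖u' x‖ ≤ A * B

namespace IsWeight
variable {u u' : ℝ → ℂ} {A B : ℝ}

lemma continuous (h : IsWeight u u' A B) : Continuous u :=
  continuous_iff_continuousAt.mpr fun x => (h.hasDeriv x).continuousAt

lemma deriv_zero_right (h : IsWeight u u' A B) {x : ℝ} (hx : 1 < x) : u' x = 0 := by
  have : u =ᶠ[nhds x] fun _ => 0 := by
    filter_upwards [lt_mem_nhds hx] with y hy using h.zero_right y hy.le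
  exact (h.hasDeriv x).unique ((hasDerivAt_const x (0 : ℂ)).congr_of_eventuallyEq this)

end IsWeight

/-- The weight in logarithmic coordinates. -/
noncomputable def logWeight (u : ℝ → ℂ) (σ v : ℝ) : ℂ := (Real.exp (-σ * v) : ℂ) * u (Real.exp (-v))

noncomputable def logWeightDeriv (u u' : ℝ → ℂ) (σ v : ℝ) : ℂ :=
  (-σ * Real.exp (-σ * v) : ℝ) * u (Real.exp (-v)) +
    (Real.exp (-σ * v) : ℂ) * (-(Real.exp (-v)) * u' (Real.exp (-v)))

section
variable {u u' : ℝ → ℂ} {A B : ℝ} (h : IsWeight u u' A B) {σ : ℝ} (h1 : 1 / 2 ≤ σ) (h2 : σ ≤ 2)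
include h

lemma hasDerivAt_logWeight (σ v : ℝ) :
    HasDerivAt (logWeight u σ) (logWeightDeriv u u' σ v) v := by
  have e1 : HasDerivAt (fun v : ℝ => (Real.exp (-σ * v) : ℂ)) ((-σ * Real.exp (-σ * v) : ℝ) : ℂ) v := by
    have : HasDerivAt (fun v : ℝ => Real.exp (-σ * v)) (Real.exp (-σ * v) * (-σ * 1)) v :=
      ((hasDerivAt_id v).const_mul (-σ)).exp
    convert this.ofReal_comp using 2
    ring
  have e2 : HasDerivAt (fun v : ℝ => Real.exp (-v)) (-Real.exp (-v)) v := by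
    simpa using (hasDerivAt_id v).neg.exp
  have e3 := (h.hasDeriv (Real.exp (-v))).scomp v e2
  have := e1.mul e3
  refine this.congr_deriv ?_
  simp [logWeightDeriv, Function.comp]

lemma continuous_logWeightDeriv (σ : ℝ) : Continuous (logWeightDeriv u u' σ) := by
  have := h.continuous
  have := h.cont
  unfold logWeightDeriv
  fun_prop

lemma continuous_logWeight (σ : ℝ) : Continuous (logWeight u σ) := by
  have := h.continuous
  unfold logWeight
  fun_prop

include h1 in
lemma norm_logWeight_le (v : ℝ) :
    ‖logWeight u σ v‖ ≤ (Ioi (0 : ℝ)).indicator (fun v => A * Real.exp (-(1 / 2) * v)) v := by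
  unfold logWeight
  by_cases hv : 0 < v
  · rw [indicator_of_mem (by simpa using hv), norm_mul, Complex.norm_real, Real.norm_eq_abs,
      Real.abs_exp, mul_comm]
    have := h.pos
    gcongr
    · exact h.bound _
  · rw [indicator_of_notMem (by simpa using hv), h.zero_right]
    · simp
    · exact Real.one_le_exp (by linarith)

include h1 h2 in
lemma norm_logWeightDeriv_le {v : ℝ} (hv0 : v ≠ 0) :
    ‖logWeightDeriv u u' σ v‖ ≤
      (Ioi (0 : ℝ)).indicator (fun v => 3 * (A * B) * Real.exp (-(1 / 2) * v)) v := by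
  unfold logWeightDeriv
  have hA := h.pos
  have hB := h.one_le
  by_cases hv : 0 < v
  · rw [indicator_of_mem (by simpa using hv)]
    have e1 : Real.exp (-σ * v) ≤ Real.exp (-(1 / 2) * v) := by gcongr
    have e2 : Real.exp (-v) ≤ 1 := Real.exp_le_one_iff.mpr (by linarith)
    have e3 := h.bound (Real.exp (-v))
    have e4 := h.bound' (Real.exp (-v))
    have e5 : A ≤ A * B := le_mul_of_one_le_right hA.le hB
    refine (norm_add_le _ _).trans ?_
    rw [norm_mul, norm_mul, norm_mul, norm_neg, Complex.norm_real, Complex.norm_real,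
      Complex.norm_real, Real.norm_eq_abs, Real.norm_eq_abs, Real.norm_eq_abs, Real.abs_exp,
      Real.abs_exp, abs_mul, Real.abs_exp, abs_neg, abs_of_nonneg (by linarith)]
    calc σ * Real.exp (-σ * v) * ‖u (Real.exp (-v))‖ +
          Real.exp (-σ * v) * (Real.exp (-v) * ‖u' (Real.exp (-v))‖)
        ≤ 2 * Real.exp (-(1 / 2) * v) * (A * B) + Real.exp (-(1 / 2) * v) * (1 * (A * B)) := by
          gcongr
          linarith
      _ = _ := by ring
  · have hv' : v < 0 := lt_of_le_of_ne (not_lt.mp hv) hv0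
    rw [indicator_of_notMem (by simpa using hv), h.zero_right, h.deriv_zero_right]
    · simp
    · exact Real.one_lt_exp_iff.mpr (by linarith)
    · exact Real.one_le_exp (by linarith)

end

lemma integrable_expInd (c : ℝ) :
    Integrable ((Ioi (0 : ℝ)).indicator (fun v => c * Real.exp (-(1 / 2) * v))) := by
  rw [integrable_indicator_iff measurableSet_Ioi]
  exact (exp_neg_integrableOn_Ioi 0 (by norm_num)).const_mul c

lemma integral_expInd (c : ℝ) :
    ∫ v, (Ioi (0 : ℝ)).indicator (fun v => c * Real.exp (-(1 / 2) * v)) v = 2 * c := by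
  rw [integral_indicator measurableSet_Ioi, integral_const_mul,
    integral_exp_mul_Ioi (by norm_num)]
  norm_num
  ring

lemma sq_expInd (c v : ℝ) :
    ((Ioi (0 : ℝ)).indicator (fun v => c * Real.exp (-(1 / 2) * v)) v) ^ 2 =
      (Ioi (0 : ℝ)).indicator (fun v => c ^ 2 * Real.exp (-1 * v)) v := by
  by_cases hv : v ∈ Ioi (0 : ℝ)
  · simp only [indicator_of_mem hv, mul_pow, ← Real.exp_nat_mul]
    ring_nf
  · simp [indicator_of_notMem hv]

/-- Bounds for a function dominated by a one-sided exponential. -/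
lemma dominated_expInd {f : ℝ → ℂ} (hf : Continuous f) {c : ℝ}
    (hb : ∀ v, v ≠ 0 → ‖f v‖ ≤ (Ioi (0 : ℝ)).indicator (fun v => c * Real.exp (-(1 / 2) * v)) v) :
    Integrable f ∧ ∫ v, ‖f v‖ ≤ 2 * c ∧ MemLp f 2 ∧ ∫ v, ‖f v‖ ^ 2 ≤ c ^ 2 := by
  have hae : ∀ᵐ v : ℝ, v ≠ 0 := by simp [ae_iff]
  have hint : Integrable f := (integrable_expInd c).mono' hf.aestronglyMeasurable
    (hae.mono hb)
  have hs : Integrable ((Ioi (0 : ℝ)).indicator (fun v => c ^ 2 * Real.exp (-1 * v))) := by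
    rw [integrable_indicator_iff measurableSet_Ioi]
    exact (exp_neg_integrableOn_Ioi 0 (by norm_num)).const_mul _
  have hbs : ∀ᵐ v : ℝ, ‖f v‖ ^ 2 ≤ (Ioi (0 : ℝ)).indicator (fun v => c ^ 2 * Real.exp (-1 * v)) v := by
    filter_upwards [hae] with v hv
    rw [← sq_expInd]
    exact pow_le_pow_left₀ (norm_nonneg _) (hb v hv) 2
  have hsi : Integrable (fun v => ‖f v‖ ^ 2) := by
    refine hs.mono' (by fun_prop) ?_
    filter_upwards [hbs] with v hv
    rwa [Real.norm_eq_abs, abs_of_nonneg (by positivity)]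
  refine ⟨hint, ?_, (memLp_two_iff_integrable_sq_norm hf.aestronglyMeasurable).mpr hsi, ?_⟩
  · rw [← integral_expInd c]
    exact integral_mono_ae hint.norm (integrable_expInd c) (hae.mono hb)
  · refine (integral_mono_ae hsi hs hbs).trans ?_
    rw [integral_indicator measurableSet_Ioi, integral_const_mul,
      integral_exp_mul_Ioi (by norm_num)]
    norm_num

lemma mellin_eq_fourier_logWeight (u : ℝ → ℂ) (σ y : ℝ) :
    mellin u (σ + 2 * Real.pi * y * Complex.I) = 𝓕 (logWeight u σ) y := by
  have e : 2 * (Real.pi : ℂ) * y * Complex.I = ((2 * Real.pi * y : ℝ) : ℂ) * Complex.I := by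
    push_cast; ring
  rw [mellin_eq_fourier, e]
  simp only [Complex.add_re, Complex.ofReal_re, Complex.mul_re, Complex.I_re, mul_zero,
    Complex.ofReal_im, Complex.I_im, mul_one, sub_self, add_zero, Complex.add_im, Complex.mul_im,
    zero_add]
  have e2 : (fun v : ℝ => Real.exp (-σ * v) • u (Real.exp (-v))) = logWeight u σ := by
    funext v
    simp [logWeight]
  rw [e2]
  field_simp

section
variable {u u' : ℝ → ℂ} {A B : ℝ} (h : IsWeight u u' A B) {σ : ℝ} (h1 : 1 / 2 ≤ σ) (h2 : σ ≤ 2)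
include h h1

include h2 in
lemma fourier_logWeightDeriv (y : ℝ) :
    𝓕 (logWeightDeriv u u' σ) y = (2 * Real.pi * Complex.I * y) * 𝓕 (logWeight u σ) y := by
  have hd : deriv (logWeight u σ) = logWeightDeriv u u' σ :=
    funext fun v => (hasDerivAt_logWeight h σ v).deriv
  have := Real.fourier_deriv (f := logWeight u σ)
    (dominated_expInd (continuous_logWeight h σ) fun v _ => norm_logWeight_le h h1 v).1
    (fun v => (hasDerivAt_logWeight h σ v).differentiableAt)
    (by rw [hd]; exact (dominated_expInd (continuous_logWeightDeriv h σ)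
          fun v hv => norm_logWeightDeriv_le h h1 h2 hv).1)
  rw [hd] at this
  simp [this]

include h2 in
lemma norm_mellin_mul_le (y : ℝ) :
    ‖mellin u (σ + 2 * Real.pi * y * Complex.I)‖ * |y| ≤ A * B := by
  have h3 := fourier_logWeightDeriv h h1 h2 y
  have h4 : ‖𝓕 (logWeightDeriv u u' σ) y‖ ≤ 2 * (3 * (A * B)) := by
    refine (VectorFourier.norm_fourierIntegral_le_integral_norm _ _ _ _ _).trans ?_
    exact (dominated_expInd (continuous_logWeightDeriv h σ)
          fun v hv => norm_logWeightDeriv_le h h1 h2 hv).2.1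
  rw [mellin_eq_fourier_logWeight]
  rw [h3] at h4
  simp only [norm_mul, Complex.norm_real, Complex.norm_I, Complex.norm_ofNat, Real.norm_eq_abs,
    abs_of_pos Real.pi_pos, mul_one] at h4
  have := Real.pi_gt_three
  have h5 : 0 ≤ ‖𝓕 (logWeight u σ) y‖ * |y| := by positivity
  nlinarith

include h2 in
lemma integrable_mellin_sq :
    Integrable (fun y : ℝ => (B ^ 2 + y ^ 2) * ‖mellin u (σ + 2 * Real.pi * y * Complex.I)‖ ^ 2) ∧
    ∫ y : ℝ, (B ^ 2 + y ^ 2) * ‖mellin u (σ + 2 * Real.pi * y * Complex.I)‖ ^ 2 ≤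
      10 * (A * B) ^ 2 := by
  obtain ⟨i1, -, m1, s1⟩ := dominated_expInd (continuous_logWeight h σ)
    fun v _ => norm_logWeight_le h h1 v
  obtain ⟨i2, -, m2, s2⟩ := dominated_expInd (continuous_logWeightDeriv h σ)
    fun v hv => norm_logWeightDeriv_le h h1 h2 hv
  obtain ⟨n1, t1⟩ := integral_norm_sq_fourier_eq i1 m1
  obtain ⟨n2, t2⟩ := integral_norm_sq_fourier_eq i2 m2
  have j1 := (memLp_two_iff_integrable_sq_norm n1.aestronglyMeasurable).mp n1
  have j2 := (memLp_two_iff_integrable_sq_norm n2.aestronglyMeasurable).mp n2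
  have e : ∀ y : ℝ, (B ^ 2 + y ^ 2) * ‖mellin u (σ + 2 * Real.pi * y * Complex.I)‖ ^ 2 =
      B ^ 2 * ‖𝓕 (logWeight u σ) y‖ ^ 2 +
        ((2 * Real.pi) ^ 2)⁻¹ * ‖𝓕 (logWeightDeriv u u' σ) y‖ ^ 2 := by
    intro y
    rw [mellin_eq_fourier_logWeight, fourier_logWeightDeriv h h1 h2]
    simp only [norm_mul, Complex.norm_real, Complex.norm_I, Complex.norm_ofNat, Real.norm_eq_abs,
      abs_of_pos Real.pi_pos, mul_one, mul_pow, sq_abs]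
    field_simp
  simp_rw [e]
  refine ⟨(j1.const_mul _).add (j2.const_mul _), ?_⟩
  rw [integral_add (j1.const_mul _) (j2.const_mul _), integral_const_mul, integral_const_mul, t1, t2]
  have hp : ((2 * Real.pi) ^ 2)⁻¹ ≤ 1 := inv_le_one_of_one_le₀ (by nlinarith [Real.pi_gt_three])
  have : ((2 * Real.pi) ^ 2)⁻¹ * ∫ v, ‖logWeightDeriv u u' σ v‖ ^ 2 ≤ 1 * (3 * (A * B)) ^ 2 := by
    gcongr
  nlinarith [sq_nonneg B]

end

lemma integral_pow_abs {c κ : ℝ} (hc : 0 < c) (hκ : κ < -1) :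
    Integrable (fun y : ℝ => (c + |y|) ^ κ) ∧ ∫ y : ℝ, (c + |y|) ^ κ = 2 * (-c ^ (κ + 1) / (κ + 1)) := by
  have hI : IntegrableOn (fun y : ℝ => (c + y) ^ κ) (Ioi 0) := by
    have := (integrableOn_Ioi_rpow_of_lt hκ hc)
    have e := (measurePreserving_add_left volume c).integrableOn_comp_preimage
      (measurableEmbedding_addLeft c) (f := fun x : ℝ => x ^ κ) (s := Ioi c)
    rw [Set.preimage_const_add_Ioi, sub_self] at e
    exact e.mpr this
  have hv : ∫ y in Ioi (0 : ℝ), (c + y) ^ κ = -c ^ (κ + 1) / (κ + 1) := by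
    rw [← integral_Ioi_rpow_of_lt hκ hc]
    have e := (measurePreserving_add_left volume c).setIntegral_preimage_emb
      (measurableEmbedding_addLeft c) (fun x : ℝ => x ^ κ) (Ioi c)
    rw [Set.preimage_const_add_Ioi, sub_self] at e
    exact e
  refine ⟨?_, ?_⟩
  · have hJ : IntegrableOn (fun y : ℝ => (c + |y|) ^ κ) (Ioi 0) :=
      hI.congr_fun (fun y hy => by simp only [abs_of_pos (mem_Ioi.mp hy)]) measurableSet_Ioi
    have hJ' : IntegrableOn (fun y : ℝ => (c + |y|) ^ κ) (Iic 0) := by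
      rw [← Measure.map_neg_eq_self (volume : Measure ℝ)]
      let m : MeasurableEmbedding fun x : ℝ => -x := (Homeomorph.neg ℝ).measurableEmbedding
      rw [m.integrableOn_map_iff]
      simp_rw [Function.comp_def, abs_neg, neg_preimage, neg_Iic, neg_zero]
      exact Iff.mpr integrableOn_Ici_iff_integrableOn_Ioi hJ
    rw [← integrableOn_univ, ← Iic_union_Ioi (a := (0 : ℝ))]
    exact hJ'.union hJ
  · rw [integral_comp_abs (f := fun y : ℝ => (c + y) ^ κ), hv]

section
variable {u u' : ℝ → ℂ} {A B : ℝ} (h : IsWeight u u' A B) {σ : ℝ} (h1 : 1 / 2 ≤ σ) (h2 : σ ≤ 2)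
include h h1

include h2 in
/-- The weighted `L¹` bound for the Mellin transform of a weight on a vertical line. -/
lemma integrable_mellin_mul {κ : ℝ} (hκ0 : 0 ≤ κ) (hκ : κ ≤ 1 / 4) :
    Integrable (fun y : ℝ => ‖mellin u (σ + 2 * Real.pi * y * Complex.I)‖ * (1 + |y|) ^ κ) ∧
    ∫ y : ℝ, ‖mellin u (σ + 2 * Real.pi * y * Complex.I)‖ * (1 + |y|) ^ κ ≤
      9 * A * B ^ (1 / 2 + κ) := by
  have hA := h.pos
  have hB := h.one_le
  have hB0 : 0 < B := by linarith
  obtain ⟨i1, b1⟩ := integrable_mellin_sq h h1 h2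
  obtain ⟨i2, b2⟩ := integral_pow_abs (c := B) (κ := 2 * κ - 2) hB0 (by linarith)
  set c : ℝ := B ^ (κ - 3 / 2) / A with hc
  have hc0 : 0 < c := by positivity
  set F : ℝ → ℝ := fun y =>
    (c / 2) * ((B ^ 2 + y ^ 2) * ‖mellin u (σ + 2 * Real.pi * y * Complex.I)‖ ^ 2) +
      c⁻¹ * (B + |y|) ^ (2 * κ - 2) with hF
  have hFi : Integrable F := (i1.const_mul _).add (i2.const_mul _)
  have hle : ∀ y : ℝ, ‖mellin u (σ + 2 * Real.pi * y * Complex.I)‖ * (1 + |y|) ^ κ ≤ F y := by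
    intro y
    set m := ‖mellin u (σ + 2 * Real.pi * y * Complex.I)‖
    have hm : 0 ≤ m := norm_nonneg _
    set z := B + |y|
    have hz : 0 < z := by positivity
    have hz1 : (1 + |y|) ^ κ ≤ z ^ κ := Real.rpow_le_rpow (by positivity) (by simp [z, hB]) hκ0
    have hz2 : z ^ 2 ≤ 2 * (B ^ 2 + y ^ 2) := by
      have : z ^ 2 = B ^ 2 + 2 * (B * |y|) + y ^ 2 := by
        simp only [z, add_sq, sq_abs]; ring
      nlinarith [sq_nonneg (B - |y|), sq_abs y]
    have e1 : z ^ (2 * κ - 2) = (z ^ κ / z) ^ 2 := by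
      rw [div_pow, ← Real.rpow_natCast, ← Real.rpow_mul hz.le, ← Real.rpow_natCast,
        ← Real.rpow_sub hz]
      norm_num [mul_comm]
    calc m * (1 + |y|) ^ κ ≤ m * z ^ κ := by gcongr
      _ ≤ (c / 4) * (z ^ 2 * m ^ 2) + c⁻¹ * (z ^ κ / z) ^ 2 := by
        have : (c / 4) * (z ^ 2 * m ^ 2) + c⁻¹ * (z ^ κ / z) ^ 2 - m * z ^ κ =
            c⁻¹ * (c / 2 * (z * m) - z ^ κ / z) ^ 2 := by
          field_simp
          ring
        have : 0 ≤ c⁻¹ * (c / 2 * (z * m) - z ^ κ / z) ^ 2 := by positivity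
        linarith
      _ ≤ (c / 4) * (2 * (B ^ 2 + y ^ 2) * m ^ 2) + c⁻¹ * (z ^ κ / z) ^ 2 := by gcongr
      _ = F y := by rw [← e1]; simp only [hF, z, m]; ring
  have hcm : Continuous fun y : ℝ => mellin u (σ + 2 * Real.pi * y * Complex.I) := by
    simp_rw [mellin_eq_fourier_logWeight]
    exact VectorFourier.fourierIntegral_continuous Real.continuous_fourierChar
      (by exact continuous_inner)
      (dominated_expInd (continuous_logWeight h σ) fun v _ => norm_logWeight_le h h1 v).1
  have hint : Integrable
      (fun y : ℝ => ‖mellin u (σ + 2 * Real.pi * y * Complex.I)‖ * (1 + |y|) ^ κ) := by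
    refine hFi.mono' ?_ (Filter.Eventually.of_forall fun y => ?_)
    · refine (hcm.norm.mul ?_).aestronglyMeasurable
      exact Continuous.rpow_const (by fun_prop) fun y => Or.inl (by positivity)
    · rw [Real.norm_eq_abs, abs_of_nonneg (by positivity)]
      exact hle y
  refine ⟨hint, (integral_mono hint hFi hle).trans ?_⟩
  rw [hF, integral_add (i1.const_mul _) (i2.const_mul _), integral_const_mul, integral_const_mul, b2]
  have e3 : c * (A * B) ^ 2 = A * B ^ (1 / 2 + κ) := by
    have : B ^ (1 / 2 + κ) = B ^ (κ - 3 / 2) * B ^ 2 := by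
      rw [← Real.rpow_natCast, ← Real.rpow_add hB0]; congr 1; norm_num; ring
    rw [this, hc]; field_simp
  have e4 : c⁻¹ * B ^ (2 * κ - 2 + 1) = A * B ^ (1 / 2 + κ) := by
    have : B ^ (2 * κ - 2 + 1) = B ^ (κ - 3 / 2) * B ^ (1 / 2 + κ) := by
      rw [← Real.rpow_add hB0]; congr 1; ring
    rw [this, hc]; field_simp
  have hX : 0 ≤ A * B ^ (1 / 2 + κ) := by positivity
  have e5 : c⁻¹ * (2 * (-B ^ (2 * κ - 2 + 1) / (2 * κ - 2 + 1))) =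
      (2 / (1 - 2 * κ)) * (A * B ^ (1 / 2 + κ)) := by
    rw [← e4]
    have h7 : 1 - 2 * κ ≠ 0 := by linarith
    rw [show 2 * κ - 2 + 1 = -(1 - 2 * κ) by ring, neg_div_neg_eq]
    field_simp
  have e6 : 2 / (1 - 2 * κ) ≤ 4 := by
    rw [div_le_iff₀ (by linarith)]; linarith
  rw [e5]
  calc _ ≤ c / 2 * (10 * (A * B) ^ 2) + 4 * (A * B ^ (1 / 2 + κ)) := by gcongr
    _ = 5 * (c * (A * B) ^ 2) + 4 * (A * B ^ (1 / 2 + κ)) := by ring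
    _ = _ := by rw [e3]; ring

include h2 in
lemma integrable_mellin :
    Integrable (fun y : ℝ => mellin u (σ + 2 * Real.pi * y * Complex.I)) := by
  have hcm : Continuous fun y : ℝ => mellin u (σ + 2 * Real.pi * y * Complex.I) := by
    simp_rw [mellin_eq_fourier_logWeight]
    exact VectorFourier.fourierIntegral_continuous Real.continuous_fourierChar
      (by exact continuous_inner)
      (dominated_expInd (continuous_logWeight h σ) fun v _ => norm_logWeight_le h h1 v).1
  have := (integrable_mellin_mul h h1 h2 le_rfl (by norm_num)).1
  simp only [Real.rpow_zero, mul_one] at this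
  exact (integrable_norm_iff hcm.aestronglyMeasurable).mp this

include h2 in
lemma mellin_inversion {x : ℝ} (hx : 0 < x) :
    u x = ∫ y : ℝ, mellin u (σ + 2 * Real.pi * y * Complex.I) *
      (x : ℂ) ^ (-(σ + 2 * Real.pi * y * Complex.I)) := by
  have hi := (dominated_expInd (continuous_logWeight h σ) fun v _ => norm_logWeight_le h h1 v).1
  have hF : Integrable (𝓕 (logWeight u σ)) := by
    have := integrable_mellin h h1 h2
    simp_rw [mellin_eq_fourier_logWeight] at this
    exact this
  have := hi.fourierInv_fourier_eq hF (v := -Real.log x)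
    (continuous_logWeight h σ).continuousAt
  rw [Real.fourierInv_eq'] at this
  have e : logWeight u σ (-Real.log x) = (x : ℂ) ^ (σ : ℂ) * u x := by
    unfold logWeight
    rw [neg_neg, Real.exp_log hx, neg_mul_neg, mul_comm σ, ← Real.rpow_def_of_pos hx,
      Complex.ofReal_cpow hx.le]
  rw [e] at this
  have hx0 : (x : ℂ) ≠ 0 := by exact_mod_cast hx.ne'
  have e2 : u x = (x : ℂ) ^ (-σ : ℂ) * ((x : ℂ) ^ (σ : ℂ) * u x) := by
    rw [← mul_assoc, ← Complex.cpow_add _ _ hx0]; simp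
  rw [e2, ← this, ← integral_const_mul]
  congr 1
  funext y
  rw [mellin_eq_fourier_logWeight, neg_add, Complex.cpow_add _ _ hx0,
    Complex.cpow_def_of_ne_zero hx0 (-(2 * Real.pi * y * Complex.I)), ← Complex.ofReal_log hx.le]
  simp only [smul_eq_mul]
  have e3 : ((2 * Real.pi * inner ℝ y (-Real.log x) : ℝ) : ℂ) * Complex.I =
      (Real.log x : ℂ) * -(2 * Real.pi * y * Complex.I) := by
    simp
    ring
  rw [e3]
  ring

end

lemma differentiableAt_mellin_weight {u u' : ℝ → ℂ} {A B : ℝ} (h : IsWeight u u' A B) {s : ℂ}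
    (hs : 0 < s.re) : DifferentiableAt ℂ (mellin u) s := by
  refine mellin_differentiableAt_of_isBigO_rpow (a := s.re + 1) (b := 0)
    (h.continuous.locallyIntegrable.locallyIntegrableOn _) ?_ (by linarith) ?_ hs
  · refine Asymptotics.IsBigO.of_bound 0 ?_
    filter_upwards [Filter.eventually_ge_atTop 1] with x hx
    simp [h.zero_right x hx]
  · refine Asymptotics.IsBigO.of_bound A (Filter.Eventually.of_forall fun x => ?_)
    simpa using h.bound x

end LinnikGRH

namespace LinnikGRH
open MeasureTheory Set

section
variable {q : ℕ} [NeZero q] (χ : DirichletCharacter ℂ q)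

open Classical in
/-- The `L`-function with its possible pole at `1` removed. -/
noncomputable def regL : ℂ → ℂ :=
  if χ = 1 then DirichletCharacter.LFunctionTrivChar₁ q else DirichletCharacter.LFunction χ

open Classical in
noncomputable def poleFactor (s : ℂ) : ℂ := if χ = 1 then s - 1 else 1

lemma differentiable_regL : Differentiable ℂ (regL χ) := by
  unfold regL
  split_ifs with h
  · exact DirichletCharacter.differentiable_LFunctionTrivChar₁ q
  · exact DirichletCharacter.differentiable_LFunction h

lemma regL_eq_mul {s : ℂ} (hs : s ≠ 1) :
    regL χ s = poleFactor χ s * DirichletCharacter.LFunction χ s := by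
  unfold regL poleFactor
  split_ifs with h
  · subst h
    rw [DirichletCharacter.LFunctionTrivChar₁, Function.update_of_ne hs]
  · simp

lemma regL_ne_zero
    (GRH : ∀ (q : ℕ) [NeZero q] (χ : DirichletCharacter ℂ q) (s : ℂ),
      0 < s.re → s.re < 1 → DirichletCharacter.LFunction χ s = 0 → s.re = 1 / 2)
    {s : ℂ} (hs : 1 / 2 < s.re) : regL χ s ≠ 0 := by
  rcases eq_or_ne s 1 with rfl | h1
  · unfold regL
    split_ifs with h
    · exact DirichletCharacter.LFunctionTrivChar₁_apply_one_ne_zero q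
    · exact DirichletCharacter.LFunction_apply_one_ne_zero h
  · rw [regL_eq_mul χ h1]
    refine mul_ne_zero ?_ ?_
    · unfold poleFactor
      split_ifs
      · exact sub_ne_zero.mpr h1
      · exact one_ne_zero
    · rcases le_or_gt 1 s.re with h2 | h2
      · exact DirichletCharacter.LFunction_ne_zero_of_one_le_re χ (Or.inr h1) h2
      · intro h3
        have := GRH q χ s (by linarith) h2 h3
        linarith

omit [NeZero q] in
lemma norm_char_le (n : ZMod q) : ‖χ n‖ ≤ 1 := DirichletCharacter.norm_le_one χ n

lemma sum_range_eq_sum_zmod (f : ZMod q → ℂ) :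
    ∑ k ∈ Finset.range q, f (k : ZMod q) = ∑ a : ZMod q, f a := by
  refine Finset.sum_bij' (fun k _ => (k : ZMod q)) (fun a _ => a.val) ?_ ?_ ?_ ?_ ?_
  · simp
  · intro a _
    simpa using ZMod.val_lt a
  · intro k hk
    exact ZMod.val_cast_of_lt (Finset.mem_range.mp hk)
  · intro a _
    exact ZMod.natCast_zmod_val a
  · simp

noncomputable def charMean : ℂ := (∑ a : ZMod q, χ a) / q

lemma norm_charMean_le : ‖charMean χ‖ ≤ 1 := by
  have hq : (0 : ℝ) < q := by exact_mod_cast Nat.pos_of_neZero q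
  unfold charMean
  rw [norm_div, Complex.norm_natCast, div_le_one hq]
  refine (norm_sum_le _ _).trans ((Finset.sum_le_sum fun a _ => norm_char_le χ a).trans ?_)
  simp [ZMod.card]

lemma charMean_of_ne_one (h : χ ≠ 1) : charMean χ = 0 := by
  simp [charMean, MulChar.sum_eq_zero_of_ne_one h]

lemma norm_sum_range_sub_le (n : ℕ) :
    ‖∑ k ∈ Finset.range n, χ (k : ZMod q) - charMean χ * n‖ ≤ 2 * q := by
  induction n using Nat.strong_induction_on with
  | _ n ih =>
    have hq0 : 0 < q := Nat.pos_of_neZero q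
    rcases lt_or_ge n q with hn | hn
    · have h1 : ‖∑ k ∈ Finset.range n, χ (k : ZMod q)‖ ≤ n := by
        refine (norm_sum_le _ _).trans ((Finset.sum_le_sum fun a _ => norm_char_le χ _).trans ?_)
        simp
      have h2 : ‖charMean χ * n‖ ≤ 1 * n := by
        rw [norm_mul, Complex.norm_natCast]
        gcongr
        exact norm_charMean_le χ
      have h3 : (n : ℝ) ≤ q := by exact_mod_cast hn.le
      refine (norm_sub_le _ _).trans ?_
      linarith
    · obtain ⟨m, rfl⟩ := Nat.exists_eq_add_of_le hn
      have := ih m (by omega)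
      rw [Finset.sum_range_add]
      have e1 : ∑ k ∈ Finset.range m, χ ((q + k : ℕ) : ZMod q) = ∑ k ∈ Finset.range m, χ (k : ZMod q) := by
        simp
      have e2 : charMean χ * ((q + m : ℕ) : ℂ) = ∑ a : ZMod q, χ a + charMean χ * m := by
        have : (q : ℂ) ≠ 0 := by exact_mod_cast hq0.ne'
        unfold charMean
        push_cast
        field_simp
      rw [e1, e2, sum_range_eq_sum_zmod (fun a => χ a), add_sub_add_left_eq_sub]
      exact this

/-- The discrepancy of the partial sums of a character. -/
noncomputable def charDisc (t : ℝ) : ℂ :=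
  ∑ k ∈ Finset.Icc 1 ⌊t⌋₊, χ (k : ZMod q) - charMean χ * t

lemma norm_charDisc_le {t : ℝ} (ht : 0 ≤ t) : ‖charDisc χ t‖ ≤ 5 * q := by
  have hq : (1 : ℝ) ≤ q := by exact_mod_cast Nat.pos_of_neZero q
  have e : ∑ k ∈ Finset.Icc 1 ⌊t⌋₊, χ (k : ZMod q) =
      ∑ k ∈ Finset.range (⌊t⌋₊ + 1), χ (k : ZMod q) - χ 0 := by
    rw [Finset.range_eq_Ico, Finset.sum_eq_sum_Ico_succ_bot (by omega)]
    simp only [Nat.cast_zero, zero_add, add_sub_cancel_left]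
    rfl
  have e2 : charDisc χ t = (∑ k ∈ Finset.range (⌊t⌋₊ + 1), χ (k : ZMod q) -
      charMean χ * ((⌊t⌋₊ + 1 : ℕ) : ℂ)) - χ 0 + charMean χ * ((⌊t⌋₊ + 1 - t : ℝ) : ℂ) := by
    unfold charDisc
    rw [e]
    push_cast
    ring
  rw [e2]
  have h1 := norm_sum_range_sub_le χ (⌊t⌋₊ + 1)
  have h2 := norm_char_le χ 0
  have h3 : ‖charMean χ * ((⌊t⌋₊ + 1 - t : ℝ) : ℂ)‖ ≤ 1 * 1 := by
    rw [norm_mul, Complex.norm_real, Real.norm_eq_abs]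
    gcongr
    · exact norm_charMean_le χ
    · rw [abs_le]
      constructor <;> linarith [Nat.floor_le ht, Nat.lt_floor_add_one t]
  refine (norm_add_le _ _).trans ?_
  refine (add_le_add (norm_sub_le _ _) le_rfl).trans ?_
  linarith

lemma measurable_charDisc : Measurable (charDisc χ) := by
  unfold charDisc
  refine Measurable.sub ?_ (by fun_prop)
  exact (measurable_from_top (f := fun n : ℕ => ∑ k ∈ Finset.Icc 1 n, χ (k : ZMod q))).comp
    Nat.measurable_floor

/-- The remainder integral in the summation by parts formula. -/
noncomputable def discInt (s : ℂ) : ℂ := ∫ t in Ioi (1 : ℝ), charDisc χ t * (t : ℂ) ^ (-(s + 1))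

lemma integrableOn_disc {s : ℂ} (hs : 0 < s.re) :
    IntegrableOn (fun t : ℝ => charDisc χ t * (t : ℂ) ^ (-(s + 1))) (Ioi 1) := by
  have h1 := integrableOn_Ioi_cpow_of_lt (a := -(s + 1)) (c := 1) (by simpa using hs) one_pos
  refine h1.bdd_mul (c := 5 * q) ((measurable_charDisc χ).aestronglyMeasurable) ?_
  filter_upwards [ae_restrict_mem measurableSet_Ioi] with t ht
  exact norm_charDisc_le χ (by linarith [mem_Ioi.mp ht])

lemma norm_discInt_le {s : ℂ} (hs : 1 / 2 ≤ s.re) : ‖discInt χ s‖ ≤ 10 * q := by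
  have h1 := integrableOn_Ioi_rpow_of_lt (a := -(3 / 2 : ℝ)) (c := 1) (by norm_num) one_pos
  have h2 : ∫ t in Ioi (1 : ℝ), 5 * (q : ℝ) * t ^ (-(3 / 2 : ℝ)) = 10 * q := by
    rw [integral_const_mul, integral_Ioi_rpow_of_lt (by norm_num) one_pos]
    norm_num
    ring
  unfold discInt
  rw [← h2]
  refine norm_integral_le_of_norm_le (h1.const_mul _) ?_
  filter_upwards [ae_restrict_mem measurableSet_Ioi] with t ht
  have ht1 : 1 < t := ht
  rw [norm_mul, Complex.norm_cpow_eq_rpow_re_of_pos (by linarith)]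
  gcongr
  · exact norm_charDisc_le χ (by linarith)
  · exact ht1.le
  · simp only [Complex.neg_re, Complex.add_re, Complex.one_re]
    linarith

lemma differentiableAt_discInt {s : ℂ} (hs : 0 < s.re) : DifferentiableAt ℂ (discInt χ) s := by
  set f : ℝ → ℂ := (Ioi (1 : ℝ)).indicator (charDisc χ) with hf
  have hb : ∀ t, ‖f t‖ ≤ 5 * q := by
    intro t
    rw [hf]
    by_cases ht : t ∈ Ioi (1 : ℝ)
    · rw [indicator_of_mem ht]
      exact norm_charDisc_le χ (by linarith [mem_Ioi.mp ht])
    · rw [indicator_of_notMem ht]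
      simp
  have e : discInt χ = fun s => mellin f (-s) := by
    funext s
    unfold discInt mellin
    rw [hf]
    have : ∀ t : ℝ, (t : ℂ) ^ (-s - 1) • (Ioi (1 : ℝ)).indicator (charDisc χ) t =
        (Ioi (1 : ℝ)).indicator (fun t : ℝ => charDisc χ t * (t : ℂ) ^ (-(s + 1))) t := by
      intro t
      by_cases ht : t ∈ Ioi (1 : ℝ)
      · simp only [indicator_of_mem ht, smul_eq_mul]
        rw [mul_comm, neg_add']
      · simp [indicator_of_notMem ht]
    simp_rw [this]
    rw [setIntegral_indicator measurableSet_Ioi, Ioi_inter_Ioi]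
    simp
  rw [e]
  have hm : DifferentiableAt ℂ (mellin f) (-s) := by
    refine mellin_differentiableAt_of_isBigO_rpow (a := 0) (b := (-s).re - 1) ?_ ?_ (by simpa using hs)
      ?_ (by linarith)
    · refine LocallyIntegrable.locallyIntegrableOn ?_ _
      refine (locallyIntegrable_const (5 * q : ℝ)).mono
        ((measurable_charDisc χ).indicator measurableSet_Ioi).aestronglyMeasurable ?_
      refine Filter.Eventually.of_forall fun t => (hb t).trans (le_abs_self _)
    · refine Asymptotics.IsBigO.of_bound (5 * q) (Filter.Eventually.of_forall fun t => ?_)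
      simpa using hb t
    · refine Asymptotics.IsBigO.of_bound 0 ?_
      filter_upwards [nhdsWithin_le_nhds (Iio_mem_nhds (show (0 : ℝ) < 1 by norm_num))] with t ht
      have : t ∉ Ioi (1 : ℝ) := by simpa using (mem_Iio.mp ht).le
      simp [hf, indicator_of_notMem this]
  exact hm.comp s differentiableAt_id.neg

lemma LFunction_eq_discInt {s : ℂ} (hs : 1 < s.re) :
    DirichletCharacter.LFunction χ s = s * discInt χ s + charMean χ * s / (s - 1) := by
  rw [DirichletCharacter.LFunction_eq_LSeries χ hs,
    LSeries_eq_mul_integral (fun n : ℕ => χ (n : ZMod q)) (r := 1) zero_le_one hs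
      (DirichletCharacter.LSeriesSummable_of_one_lt_re χ hs)]
  · have h1 : ∀ t ∈ Ioi (1 : ℝ), (∑ k ∈ Finset.Icc 1 ⌊t⌋₊, χ (k : ZMod q)) * (t : ℂ) ^ (-(s + 1)) =
        charDisc χ t * (t : ℂ) ^ (-(s + 1)) + charMean χ * (t : ℂ) ^ (-s) := by
      intro t ht
      have ht0 : (t : ℂ) ≠ 0 := by
        have := mem_Ioi.mp ht
        exact_mod_cast (by linarith : t ≠ 0)
      have : (t : ℂ) ^ (-s) = t * (t : ℂ) ^ (-(s + 1)) := by
        rw [neg_add, Complex.cpow_add _ _ ht0, Complex.cpow_neg_one]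
        field_simp
      rw [this, charDisc]
      ring
    have h2 := integrableOn_Ioi_cpow_of_lt (a := -s) (c := 1) (by simpa using hs) one_pos
    rw [setIntegral_congr_fun measurableSet_Ioi h1,
      integral_add (integrableOn_disc χ (by linarith)) (h2.const_mul _), integral_const_mul,
      integral_Ioi_cpow_of_lt (by simpa using hs) one_pos, mul_add]
    congr 1
    have h3 : s - 1 ≠ 0 := sub_ne_zero.mpr (by rintro rfl; simp at hs)
    have h4 : -s + 1 ≠ 0 := by rw [neg_add_eq_sub]; exact sub_ne_zero.mpr (sub_ne_zero.mp h3).symm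
    simp only [Complex.ofReal_one, Complex.one_cpow]
    field_simp
    ring
  · refine Asymptotics.IsBigO.of_bound 1 (Filter.Eventually.of_forall fun n => ?_)
    refine (norm_sum_le _ _).trans ((Finset.sum_le_sum fun a _ => norm_char_le χ _).trans ?_)
    simp

lemma regL_eq_discInt {s : ℂ} (hs : 0 < s.re) :
    regL χ s = poleFactor χ s * s * discInt χ s + charMean χ * s := by
  have hpf : Differentiable ℂ (poleFactor χ) := by
    unfold poleFactor
    split_ifs <;> fun_prop
  have hU : IsOpen {s : ℂ | 0 < s.re} := isOpen_lt continuous_const Complex.continuous_re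
  have hc : IsPreconnected {s : ℂ | 0 < s.re} := (convex_halfSpace_re_gt 0).isPreconnected
  have hd : DifferentiableOn ℂ
      (fun s => poleFactor χ s * s * discInt χ s + charMean χ * s) {s : ℂ | 0 < s.re} := by
    intro z hz
    refine DifferentiableAt.differentiableWithinAt ?_
    have := differentiableAt_discInt χ hz
    fun_prop
  refine (((differentiable_regL χ).differentiableOn.analyticOnNhd hU)
    |>.eqOn_of_preconnected_of_eventuallyEq (hd.analyticOnNhd hU) hc (z₀ := 2) (by simp) ?_) hs
  filter_upwards [(isOpen_lt continuous_const Complex.continuous_re).mem_nhds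
    (show (1 : ℝ) < (2 : ℂ).re by norm_num)] with z hz
  have hz : 1 < z.re := hz
  have hz1 : z ≠ 1 := by rintro rfl; simp at hz
  rw [regL_eq_mul χ hz1, LFunction_eq_discInt χ hz]
  have : z - 1 ≠ 0 := sub_ne_zero.mpr hz1
  by_cases h : χ = 1
  · simp only [poleFactor, if_pos h]
    field_simp
  · simp only [poleFactor, if_neg h, charMean_of_ne_one χ h]
    ring

lemma norm_poleFactor_le (s : ℂ) : ‖poleFactor χ s‖ ≤ ‖s‖ + 1 := by
  unfold poleFactor
  split_ifs
  · simpa using norm_sub_le s 1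
  · simp

lemma norm_regL_le {s : ℂ} (hs : 1 / 2 ≤ s.re) : ‖regL χ s‖ ≤ 11 * q * (‖s‖ + 1) ^ 2 := by
  have hq : (1 : ℝ) ≤ q := by exact_mod_cast Nat.pos_of_neZero q
  rw [regL_eq_discInt χ (by linarith)]
  refine (norm_add_le _ _).trans ?_
  rw [norm_mul, norm_mul, norm_mul]
  have h1 := norm_poleFactor_le χ s
  have h2 := norm_discInt_le χ hs
  have h3 := norm_charMean_le χ
  calc ‖poleFactor χ s‖ * ‖s‖ * ‖discInt χ s‖ + ‖charMean χ‖ * ‖s‖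
      ≤ (‖s‖ + 1) * ‖s‖ * (10 * q) + 1 * ‖s‖ := by gcongr
    _ ≤ _ := by nlinarith [norm_nonneg s, mul_nonneg (norm_nonneg s) (norm_nonneg s)]

lemma one_le_norm_regL_mul {s : ℂ} (hs : s.re = 2) : 1 ≤ 2 * ‖regL χ s‖ := by
  have hs1 : 1 < s.re := by rw [hs]; norm_num
  have hne : s ≠ 1 := by rintro rfl; norm_num at hs
  rw [regL_eq_mul χ hne, norm_mul]
  have h1 : 1 ≤ ‖poleFactor χ s‖ := by
    unfold poleFactor
    split_ifs
    · have := Complex.abs_re_le_norm (s - 1)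
      simp only [Complex.sub_re, hs, Complex.one_re] at this
      norm_num at this
      exact this
    · simp
  have h2 : 1 ≤ 2 * ‖DirichletCharacter.LFunction χ s‖ := by
    have h3 := DirichletCharacter.LSeries.mul_mu_eq_one χ hs1
    rw [← DirichletCharacter.LFunction_eq_LSeries χ hs1] at h3
    have h4 : ‖LSeries ((fun n : ℕ => χ (n : ZMod q)) * fun n : ℕ => (ArithmeticFunction.moebius n : ℂ)) s‖ ≤ 2 := by
      have hz := hasSum_zeta_two
      have : Real.pi ^ 2 / 6 ≤ 2 := by nlinarith [Real.pi_lt_d2, Real.pi_pos]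
      refine (tsum_of_norm_bounded hz fun n => ?_).trans this
      rcases eq_or_ne n 0 with rfl | hn
      · simp
      · rw [LSeries.term_of_ne_zero hn, norm_div, Complex.norm_natCast_cpow_of_pos (by omega), hs]
        simp only [Pi.mul_apply, norm_mul]
        have h5 := norm_char_le χ (n : ZMod q)
        have h6 : ‖(ArithmeticFunction.moebius n : ℂ)‖ ≤ 1 := by
          rw [Complex.norm_intCast]
          exact_mod_cast ArithmeticFunction.abs_moebius_le_one
        have : (n : ℝ) ^ (2 : ℝ) = (n : ℝ) ^ 2 := by norm_cast
        rw [this]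
        gcongr
        exact mul_le_one₀ h5 (norm_nonneg _) h6
    have h5 := congrArg norm h3
    rw [norm_mul, norm_one] at h5
    nlinarith [norm_nonneg (DirichletCharacter.LFunction χ s)]
  nlinarith [norm_nonneg (DirichletCharacter.LFunction χ s)]

end
end LinnikGRH

namespace LinnikGRH
open MeasureTheory Set Metric Filter Topology

lemma norm_logDeriv_le_of_ball {F : ℂ → ℂ} {z₀ s : ℂ} {M η : ℝ} (hη : 0 < η) (hM : 0 < M)
    (hF : Differentiable ℂ F) (h0 : ∀ z ∈ ball z₀ (3 / 2), F z ≠ 0)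
    (hb : ∀ z ∈ ball z₀ (3 / 2), ‖F z‖ ≤ Real.exp M * ‖F z₀‖)
    (hs : dist s z₀ ≤ 3 / 2 - η) : ‖deriv F s / F s‖ ≤ 12 * M / η ^ 2 := by
  have hdF : DifferentiableOn ℂ (fun z => deriv F z / F z) (ball z₀ (3 / 2)) := by
    intro z hz
    have := (hF.contDiff (n := 2)).differentiable_deriv_two
    exact ((this z).div (hF z) (h0 z hz)).differentiableWithinAt
  obtain ⟨g, hg0, hg⟩ := hdF.isExactOn_ball.with_val_at z₀ 0
  have hz₀ : z₀ ∈ ball z₀ (3 / 2) := mem_ball_self (by norm_num)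
  have hexp : ∀ z ∈ ball z₀ (3 / 2), F z = F z₀ * Complex.exp (g z) := by
    have key : ∀ z ∈ ball z₀ (3 / 2), HasDerivAt (fun z => F z * Complex.exp (-g z)) 0 z := by
      intro z hz
      have h1 := (hF z).hasDerivAt.mul ((hg z hz).neg.cexp)
      have h2 := h0 z hz
      have e : deriv F z * Complex.exp (-g z) +
          F z * (Complex.exp (-g z) * -(deriv F z / F z)) = 0 := by
        field_simp
        ring
      rw [← e]
      exact h1
    intro z hz
    have hc := (convex_ball z₀ (3 / 2)).is_const_of_fderivWithin_eq_zero (𝕜 := ℂ)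
      (f := fun z => F z * Complex.exp (-g z))
      (fun z hz => (key z hz).differentiableAt.differentiableWithinAt)
      (fun z hz => by
        rw [fderivWithin_eq_fderiv (isOpen_ball.uniqueDiffWithinAt hz)
          (key z hz).differentiableAt]
        ext
        simp [(key z hz).deriv]) hz hz₀
    simp only [hg0, neg_zero, Complex.exp_zero, mul_one] at hc
    rw [← hc, mul_assoc, ← Complex.exp_add]
    simp
  have hre : ∀ z ∈ ball z₀ (3 / 2), (g z).re ≤ M := by
    intro z hz
    have h1 := hb z hz
    rw [hexp z hz, norm_mul, Complex.norm_exp, mul_comm] at h1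
    have h2 : 0 < ‖F z₀‖ := norm_pos_iff.mpr (h0 _ hz₀)
    exact Real.exp_le_exp.mp (le_of_mul_le_mul_right h1 h2)
  have hgb : ∀ z, dist z z₀ ≤ 3 / 2 - η / 2 → ‖g z‖ ≤ 6 * M / η := by
    intro z hz
    have hη3 : η ≤ 3 / 2 := by linarith [dist_nonneg (x := s) (y := z₀)]
    have hmap : MapsTo (fun w => z₀ + w) (ball (0 : ℂ) (3 / 2)) (ball z₀ (3 / 2)) := by
      intro w hw
      simpa [dist_eq_norm] using hw
    have hd : DifferentiableOn ℂ (fun w => g (z₀ + w)) (ball 0 (3 / 2)) := by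
      refine DifferentiableOn.comp (t := ball z₀ (3 / 2))
        (fun z hz => (hg z hz).differentiableAt.differentiableWithinAt) ?_ hmap
      fun_prop
    have hn : ‖z - z₀‖ ≤ 3 / 2 - η / 2 := by rwa [← dist_eq_norm]
    have h1 := Complex.borelCaratheodory_zero (f := fun w => g (z₀ + w)) (z := z - z₀) hM hd
      (fun w hw => hre _ (hmap hw)) (by norm_num)
      (by rw [mem_ball_zero_iff]; linarith) (by simp [hg0])
    simp only [add_sub_cancel] at h1
    refine h1.trans ?_
    rw [div_le_div_iff₀ (by linarith) hη]
    have : 0 ≤ ‖z - z₀‖ := norm_nonneg _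
    have h3 : 2 * M * ‖z - z₀‖ ≤ 3 * M := by nlinarith
    calc 2 * M * ‖z - z₀‖ * η ≤ 3 * M * η := by gcongr
      _ = 6 * M * (η / 2) := by ring
      _ ≤ 6 * M * (3 / 2 - ‖z - z₀‖) := by gcongr; linarith
  have hcl : closedBall s (η / 2) ⊆ ball z₀ (3 / 2) := by
    intro z hz
    rw [mem_closedBall] at hz
    rw [mem_ball]
    linarith [dist_triangle z s z₀]
  have hsb : s ∈ ball z₀ (3 / 2) := by rw [mem_ball]; linarith
  have h1 := Complex.norm_deriv_le_of_forall_mem_sphere_norm_le (c := s) (R := η / 2) (f := g)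
    (C := 6 * M / η) (by positivity)
    (DifferentiableOn.diffContOnCl (by
      rw [closure_ball _ (by positivity)]
      exact fun z hz => (hg z (hcl hz)).differentiableAt.differentiableWithinAt))
    (fun z hz => hgb z (by
      rw [mem_sphere] at hz
      linarith [dist_triangle z s z₀]))
  rw [(hg s hsb).deriv] at h1
  refine h1.trans (le_of_eq ?_)
  field_simp
  ring

section
variable (GRH : ∀ (q : ℕ) [NeZero q] (χ : DirichletCharacter ℂ q) (s : ℂ),
      0 < s.re → s.re < 1 → DirichletCharacter.LFunction χ s = 0 → s.re = 1 / 2)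
include GRH

lemma norm_logDeriv_regL_le {q : ℕ} [NeZero q] (χ : DirichletCharacter ℂ q) {η : ℝ} (hη : 0 < η)
    {s : ℂ} (h1 : 1 / 2 + η ≤ s.re) (h2 : s.re ≤ 2) :
    ‖deriv (regL χ) s / regL χ s‖ ≤ 13200 / η ^ 3 * (q : ℝ) ^ η * (1 + |s.im|) ^ η := by
  have hq : (1 : ℝ) ≤ q := by exact_mod_cast NeZero.one_le
  set t := |s.im| with ht
  have ht0 : 0 ≤ t := abs_nonneg _
  set X : ℝ := 550 * q * (1 + t) ^ 2 with hX
  have hX1 : 1 < X := by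
    have : (1 : ℝ) ≤ (1 + t) ^ 2 := by nlinarith
    nlinarith
  set z₀ : ℂ := 2 + s.im * Complex.I with hz₀
  have hre : ∀ z ∈ ball z₀ (3 / 2), 1 / 2 < z.re := by
    intro z hz
    rw [mem_ball, dist_eq_norm] at hz
    have := (Complex.abs_re_le_norm (z - z₀)).trans_lt hz
    simp [hz₀] at this
    rw [abs_lt] at this
    linarith
  have hdist : dist s z₀ ≤ 3 / 2 - η := by
    have : s - z₀ = ((s.re - 2 : ℝ) : ℂ) := by
      apply Complex.ext <;> simp [hz₀]
    rw [dist_eq_norm, this, Complex.norm_real, Real.norm_eq_abs, abs_of_nonpos (by linarith)]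
    linarith
  have hb := norm_logDeriv_le_of_ball (F := regL χ) (z₀ := z₀) (s := s) (M := Real.log X) hη
    (Real.log_pos hX1) (differentiable_regL χ)
    (fun z hz => regL_ne_zero χ GRH (hre z hz)) (fun z hz => by
      rw [Real.exp_log (by linarith)]
      have h3 := norm_regL_le χ (hre z hz).le
      have h4 := one_le_norm_regL_mul χ (s := z₀) (by simp [hz₀])
      have h5 : ‖z‖ ≤ t + 4 := by
        rw [mem_ball, dist_eq_norm] at hz
        have h6 : ‖z₀‖ ≤ 2 + t := by
          refine (norm_add_le _ _).trans ?_
          simp [ht]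
        have := norm_le_norm_add_norm_sub' z z₀
        linarith
      have h7 : (‖z‖ + 1) ^ 2 ≤ 25 * (1 + t) ^ 2 := by
        have : ‖z‖ + 1 ≤ 5 * (1 + t) := by linarith
        calc (‖z‖ + 1) ^ 2 ≤ (5 * (1 + t)) ^ 2 := by gcongr
          _ = _ := by ring
      calc ‖regL χ z‖ ≤ 11 * q * (25 * (1 + t) ^ 2) := h3.trans (by gcongr)
        _ ≤ 11 * q * (25 * (1 + t) ^ 2) * (2 * ‖regL χ z₀‖) := le_mul_of_one_le_right (by positivity) h4
        _ = X * ‖regL χ z₀‖ := by rw [hX]; ring) hdist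
  refine hb.trans ?_
  have hη3 : η ≤ 3 / 2 := by linarith
  have hlog := Real.log_le_rpow_div (x := X) (by linarith) (show 0 < η / 2 by positivity)
  have hXp : X ^ (η / 2) ≤ 550 * (q : ℝ) ^ η * (1 + t) ^ η := by
    rw [hX, Real.mul_rpow (by positivity) (by positivity), Real.mul_rpow (by norm_num) (by positivity)]
    have e1 : (550 : ℝ) ^ (η / 2) ≤ 550 := by
      conv_rhs => rw [← Real.rpow_one 550]
      exact Real.rpow_le_rpow_of_exponent_le (by norm_num) (by linarith)
    have e2 : (q : ℝ) ^ (η / 2) ≤ (q : ℝ) ^ η :=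
      Real.rpow_le_rpow_of_exponent_le hq (by linarith)
    have e3 : ((1 + t) ^ 2) ^ (η / 2) = (1 + t) ^ η := by
      rw [← Real.rpow_natCast, ← Real.rpow_mul (by positivity)]
      congr 1
      push_cast
      ring
    rw [e3]
    gcongr
  calc 12 * Real.log X / η ^ 2 ≤ 12 * ((550 * (q : ℝ) ^ η * (1 + t) ^ η) / (η / 2)) / η ^ 2 := by
        gcongr
        exact hlog.trans (by gcongr)
    _ = _ := by field_simp; ring

end
lemma integral_vertical_eq {H : ℂ → ℂ} {a b : ℝ} (hab : a ≤ b)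
    (hd : ∀ s : ℂ, a ≤ s.re → s.re ≤ b → DifferentiableAt ℂ H s)
    (hia : Integrable fun y : ℝ => H (a + y * Complex.I))
    (hib : Integrable fun y : ℝ => H (b + y * Complex.I)) {C : ℝ}
    (hC : ∀ σ t : ℝ, a ≤ σ → σ ≤ b → 1 ≤ |t| → ‖H (σ + t * Complex.I)‖ ≤ C * |t| ^ (-(1 / 2) : ℝ)) :
    ∫ y : ℝ, H (b + y * Complex.I) = ∫ y : ℝ, H (a + y * Complex.I) := by
  have key : ∀ T : ℝ, 1 ≤ T → ‖(∫ y in (-T)..T, H (b + y * Complex.I)) -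
      ∫ y in (-T)..T, H (a + y * Complex.I)‖ ≤ 2 * (b - a) * C * T ^ (-(1 / 2) : ℝ) := by
    intro T hT
    have h1 := Complex.integral_boundary_rect_eq_zero_of_differentiableOn H (a + (-T : ℝ) * Complex.I)
      (b + T * Complex.I) (by
        intro s hs
        rw [Complex.mem_reProdIm] at hs
        simp [uIcc_of_le hab] at hs
        exact (hd s hs.1.1 hs.1.2).differentiableWithinAt)
    simp only [Complex.add_re, Complex.ofReal_re, Complex.mul_re, Complex.I_re, mul_zero,
      Complex.ofReal_im, Complex.I_im, mul_one, sub_self, add_zero, Complex.add_im, Complex.mul_im,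
      zero_add, smul_eq_mul] at h1
    have hb : ∀ t : ℝ, |t| = T → ‖∫ x in a..b, H (x + t * Complex.I)‖ ≤
        (b - a) * C * T ^ (-(1 / 2) : ℝ) := by
      intro t ht
      have := intervalIntegral.norm_integral_le_of_norm_le_const (a := a) (b := b)
        (f := fun x : ℝ => H (x + t * Complex.I)) (C := C * T ^ (-(1 / 2) : ℝ)) (by
          intro x hx
          rw [uIoc_of_le hab] at hx
          rw [← ht]
          exact hC x t hx.1.le hx.2 (by rw [ht]; exact hT))
      rw [abs_of_nonneg (by linarith)] at this
      linarith
    have hT0 : |T| = T := abs_of_nonneg (by linarith)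
    have b1 := hb T hT0
    have b2 := hb (-T) (by rw [abs_neg, hT0])
    have e : (∫ y in (-T)..T, H (b + y * Complex.I)) - ∫ y in (-T)..T, H (a + y * Complex.I) =
        Complex.I * ((∫ x in a..b, H (x + (-T : ℝ) * Complex.I)) - ∫ x in a..b, H (x + T * Complex.I)) := by
      linear_combination (-Complex.I) * h1 + ((∫ y in (-T)..T, H (b + y * Complex.I)) -
        ∫ y in (-T)..T, H (a + y * Complex.I)) * Complex.I_sq
    rw [e, norm_mul, Complex.norm_I, one_mul]
    refine (norm_sub_le _ _).trans ?_
    linarith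
  have lim1 := (intervalIntegral_tendsto_integral hib tendsto_neg_atTop_atBot tendsto_id).sub
    (intervalIntegral_tendsto_integral hia tendsto_neg_atTop_atBot tendsto_id)
  have lim2 : Tendsto (fun T : ℝ => 2 * (b - a) * C * T ^ (-(1 / 2) : ℝ)) atTop (𝓝 0) := by
    simpa using (tendsto_rpow_neg_atTop (show (0 : ℝ) < 1 / 2 by norm_num)).const_mul (2 * (b - a) * C)
  have lim3 := squeeze_zero_norm' (by
    filter_upwards [eventually_ge_atTop 1] with T hT using key T hT) lim2
  exact sub_eq_zero.mp (tendsto_nhds_unique lim1 lim3)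

section
variable {q : ℕ} [NeZero q] (χ : DirichletCharacter ℂ q)

open Classical in
lemma neg_logDeriv_regL_eq {s : ℂ} (hs : 1 < s.re) :
    -(deriv (regL χ) s / regL χ s) =
      LSeries (fun n => χ n * ArithmeticFunction.vonMangoldt n) s - if χ = 1 then 1 / (s - 1) else 0 := by
  have hs1 : s ≠ 1 := by rintro rfl; simp at hs
  have hL : DirichletCharacter.LFunction χ s ≠ 0 :=
    DirichletCharacter.LFunction_ne_zero_of_one_le_re χ (Or.inr hs1) hs.le
  have hev : regL χ =ᶠ[𝓝 s] fun z => poleFactor χ z * DirichletCharacter.LFunction χ z := by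
    filter_upwards [isOpen_ne.mem_nhds hs1] with z hz using regL_eq_mul χ hz
  have hdp : HasDerivAt (poleFactor χ) (if χ = 1 then 1 else 0) s := by
    unfold poleFactor
    split_ifs
    · exact (hasDerivAt_id s).sub_const 1
    · exact hasDerivAt_const _ _
  have hdL : HasDerivAt (DirichletCharacter.LFunction χ) (deriv (DirichletCharacter.LFunction χ) s) s :=
    (DirichletCharacter.differentiableAt_LFunction χ s (Or.inl hs1)).hasDerivAt
  have e := DirichletCharacter.LSeries_twist_vonMangoldt_eq χ hs
  rw [← DirichletCharacter.deriv_LFunction_eq_deriv_LSeries χ hs,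
    ← DirichletCharacter.LFunction_eq_LSeries χ hs] at e
  have e2 : LSeries (fun n => χ n * ArithmeticFunction.vonMangoldt n) s =
    -deriv (DirichletCharacter.LFunction χ) s / DirichletCharacter.LFunction χ s := e
  have e3 : deriv (fun z => poleFactor χ z * DirichletCharacter.LFunction χ z) s = _ :=
    (hdp.mul hdL).deriv
  rw [e2, hev.deriv_eq, e3, regL_eq_mul χ hs1]
  unfold poleFactor
  have : s - 1 ≠ 0 := sub_ne_zero.mpr hs1
  split_ifs
  · field_simp
    ring
  · field_simp
    ring

section
variable {u u' : ℝ → ℂ} {A B : ℝ} (h : IsWeight u u' A B) {N : ℕ} (hN : 1 ≤ N)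
include h hN

lemma hasSum_vonMangoldt_weight :
    HasSum (fun n : ℕ => χ n * ArithmeticFunction.vonMangoldt n * u (n / N))
      (∫ y : ℝ, mellin u ((2 : ℝ) + 2 * Real.pi * y * Complex.I) *
        (N : ℂ) ^ ((2 : ℝ) + 2 * Real.pi * y * Complex.I) *
        LSeries (fun n => χ n * ArithmeticFunction.vonMangoldt n) ((2 : ℝ) + 2 * Real.pi * y * Complex.I)) := by
  set s : ℝ → ℂ := fun y => (2 : ℝ) + 2 * Real.pi * y * Complex.I with hs
  have hsre : ∀ y, (s y).re = 2 := by intro y; simp [hs]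
  have hsc : Continuous s := by fun_prop
  have hN0 : (N : ℂ) ≠ 0 := by exact_mod_cast (by omega : N ≠ 0)
  have hM : Integrable fun y => mellin u (s y) := integrable_mellin h (by norm_num) (by norm_num)
  have hMn : Integrable fun y => ‖mellin u (s y)‖ := hM.norm
  set a : ℕ → ℂ := fun n => χ n * ArithmeticFunction.vonMangoldt n with ha
  have hsum : LSeriesSummable a 2 :=
    DirichletCharacter.LSeriesSummable_twist_vonMangoldt χ (by norm_num)
  have hnt : ∀ n y, ‖LSeries.term a (s y) n‖ = ‖LSeries.term a 2 n‖ := by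
    intro n y
    rw [LSeries.norm_term_eq, LSeries.norm_term_eq, hsre]
    simp
  have hnN : ∀ y, ‖(N : ℂ) ^ s y‖ = (N : ℝ) ^ 2 := by
    intro y
    rw [Complex.norm_natCast_cpow_of_pos (by omega), hsre]
    norm_cast
  have hcN : Continuous fun y => (N : ℂ) ^ s y := by
    exact Continuous.const_cpow hsc (Or.inl hN0)
  have hct : ∀ n, Continuous fun y => LSeries.term a (s y) n := by
    intro n
    rcases eq_or_ne n 0 with rfl | hn
    · simp only [LSeries.term_zero]; exact continuous_const
    · simp only [LSeries.term_of_ne_zero hn]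
      have hn0 : (n : ℂ) ≠ 0 := by exact_mod_cast hn
      refine continuous_const.div (Continuous.const_cpow hsc (Or.inl hn0)) fun y => ?_
      simp [Complex.cpow_eq_zero_iff, hn0]
  have hnorm : ∀ n y, ‖mellin u (s y) * (N : ℂ) ^ s y * LSeries.term a (s y) n‖ =
      ‖mellin u (s y)‖ * ((N : ℝ) ^ 2 * ‖LSeries.term a 2 n‖) := by
    intro n y
    rw [norm_mul, norm_mul, hnt, hnN]; ring
  have hint : ∀ n, Integrable fun y => mellin u (s y) * (N : ℂ) ^ s y * LSeries.term a (s y) n := by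
    intro n
    refine (hMn.mul_const ((N : ℝ) ^ 2 * ‖LSeries.term a 2 n‖)).mono' ?_
      (Eventually.of_forall fun y => (hnorm n y).le)
    exact (hM.aestronglyMeasurable.mul hcN.aestronglyMeasurable).mul (hct n).aestronglyMeasurable
  have key := hasSum_integral_of_summable_integral_norm hint (by
    simp only [hnorm, integral_mul_const]
    exact (hsum.norm.mul_left _).mul_left _)
  have e1 : ∀ y, ∑' n, mellin u (s y) * (N : ℂ) ^ s y * LSeries.term a (s y) n =
      mellin u (s y) * (N : ℂ) ^ s y * LSeries a (s y) := fun y => tsum_mul_left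
  simp only [e1] at key
  rw [show (fun n : ℕ => a n * u (n / N)) = _ from funext fun n => ?_]
  · exact key
  rcases eq_or_ne n 0 with rfl | hn
  · simp [ha]
  · have hn0 : (n : ℂ) ≠ 0 := by exact_mod_cast hn
    have hnR : (0 : ℝ) < n := by exact_mod_cast Nat.pos_of_ne_zero hn
    have hNR : (0 : ℝ) < N := by exact_mod_cast hN
    rw [mellin_inversion h (σ := 2) (by norm_num) (by norm_num)
      (show (0 : ℝ) < n / N by positivity), ← integral_const_mul]
    congr 1
    funext y
    rw [LSeries.term_of_ne_zero hn]
    have : ((((n : ℝ) / N : ℝ)) : ℂ) ^ (-(s y)) = (N : ℂ) ^ s y / (n : ℂ) ^ s y := by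
      rw [Complex.cpow_neg, Complex.ofReal_div, Complex.div_cpow_ofReal_nonneg hnR.le hNR.le]
      simp
    change _ * (mellin u (s y) * _ ^ (-(s y))) = _
    rw [this]
    ring

lemma integral_weight_eq :
    N * ∫ x in (1 / N : ℝ)..1, u x = ∫ y : ℝ, mellin u ((2 : ℝ) + 2 * Real.pi * y * Complex.I) *
        (N : ℂ) ^ ((2 : ℝ) + 2 * Real.pi * y * Complex.I) *
        (1 / (((2 : ℝ) + 2 * Real.pi * y * Complex.I) - 1)) := by
  set s : ℝ → ℂ := fun y => (2 : ℝ) + 2 * Real.pi * y * Complex.I with hs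
  have hsre : ∀ y, (s y).re = 2 := by intro y; simp [hs]
  have hsc : Continuous s := by fun_prop
  have hN0 : (N : ℂ) ≠ 0 := by exact_mod_cast (by omega : N ≠ 0)
  have hNR : (0 : ℝ) < N := by exact_mod_cast hN
  have hM : Integrable fun y => mellin u (s y) := integrable_mellin h (by norm_num) (by norm_num)
  have hnN : ∀ y, ‖(N : ℂ) ^ s y‖ = (N : ℝ) ^ 2 := by
    intro y
    rw [Complex.norm_natCast_cpow_of_pos (by omega), hsre]
    norm_cast
  have hcN : Continuous fun y => (N : ℂ) ^ s y := by
    exact Continuous.const_cpow hsc (Or.inl hN0)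
  have hMN : Integrable fun y => mellin u (s y) * (N : ℂ) ^ s y :=
    hM.mul_bdd (c := (N : ℝ) ^ 2) hcN.aestronglyMeasurable (Eventually.of_forall fun y => (hnN y).le)
  have e1 : ∀ y, 1 / (s y - 1) = ∫ v in Ioi (1 : ℝ), (v : ℂ) ^ (-(s y)) := by
    intro y
    rw [integral_Ioi_cpow_of_lt (by simp [hsre]) one_pos]
    have : s y - 1 ≠ 0 := by
      intro h0
      have := congrArg Complex.re h0
      simp [hsre] at this
      norm_num at this
    have h3 : -s y + 1 ≠ 0 := by
      intro h4; apply this; linear_combination -h4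
    simp
    field_simp
    ring
  have hv : IntegrableOn (fun v : ℝ => v ^ (-2 : ℝ)) (Ioi 1) :=
    integrableOn_Ioi_rpow_of_lt (by norm_num) one_pos
  have hprod : Integrable (Function.uncurry fun (y : ℝ) (v : ℝ) =>
      mellin u (s y) * (N : ℂ) ^ s y * (v : ℂ) ^ (-(s y)))
      (volume.prod (volume.restrict (Ioi (1 : ℝ)))) := by
    have h1 : Integrable (fun p : ℝ × ℝ => ‖mellin u (s p.1) * (N : ℂ) ^ s p.1‖ * p.2 ^ (-2 : ℝ))
        (volume.prod (volume.restrict (Ioi (1 : ℝ)))) := hMN.norm.mul_prod hv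
    refine h1.mono' ?_ ?_
    · refine (hMN.aestronglyMeasurable.comp_fst).mul ?_
      refine Measurable.aestronglyMeasurable ?_
      have : Measurable s := hsc.measurable
      fun_prop
    · have : ∀ᵐ p : ℝ × ℝ ∂(volume.prod (volume.restrict (Ioi (1 : ℝ)))), p.2 ∈ Ioi (1 : ℝ) :=
        Measure.quasiMeasurePreserving_snd.ae (ae_restrict_mem measurableSet_Ioi)
      filter_upwards [this] with p hp
      simp only [Function.uncurry]
      rw [norm_mul, Complex.norm_cpow_eq_rpow_re_of_pos (lt_trans one_pos hp)]
      simp [hsre]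
  have e2 : ∀ y, mellin u (s y) * (N : ℂ) ^ s y * (1 / (s y - 1)) =
      ∫ v in Ioi (1 : ℝ), mellin u (s y) * (N : ℂ) ^ s y * (v : ℂ) ^ (-(s y)) := by
    intro y
    rw [e1, integral_const_mul]
  change _ = ∫ y : ℝ, mellin u (s y) * (N : ℂ) ^ (s y) * (1 / (s y - 1))
  simp only [e2]
  rw [integral_integral_swap hprod]
  have e3 : ∀ v ∈ Ioi (1 : ℝ), ∫ y, mellin u (s y) * (N : ℂ) ^ s y * (v : ℂ) ^ (-(s y)) = u (v / N) := by
    intro v hv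
    have hv0 : 0 < v := lt_trans one_pos hv
    rw [mellin_inversion h (σ := 2) (by norm_num) (by norm_num) (show (0 : ℝ) < v / N by positivity)]
    congr 1
    funext y
    have : ((v / N : ℝ) : ℂ) ^ (-(s y)) = (N : ℂ) ^ s y * (v : ℂ) ^ (-(s y)) := by
      rw [Complex.cpow_neg, Complex.ofReal_div, Complex.div_cpow_ofReal_nonneg hv0.le hNR.le,
        Complex.cpow_neg]
      simp [div_eq_mul_inv]
    change _ = mellin u (s y) * _ ^ (-(s y))
    rw [this]
    ring
  rw [setIntegral_congr_fun measurableSet_Ioi e3]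
  have e4 := integral_comp_mul_right_Ioi (fun x => u x) 1 (b := (N : ℝ)⁻¹) (by positivity)
  simp only [← div_eq_mul_inv] at e4
  rw [e4, inv_inv, Complex.real_smul, intervalIntegral.integral_of_le (by
    rw [div_le_one hNR]; exact_mod_cast hN)]
  simp only [Complex.ofReal_natCast]
  congr 1
  refine setIntegral_eq_of_subset_of_forall_sdiff_eq_zero measurableSet_Ioi (fun x hx => hx.1) ?_ |>.symm
  intro x hx
  refine h.zero_right x ?_
  simp only [Set.mem_sdiff, mem_Ioi, mem_Ioc, not_and, not_le] at hx
  exact (hx.2 hx.1).le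
end
end
end LinnikGRH

namespace LinnikGRH
open MeasureTheory Set Filter Topology

section
variable (GRH : ∀ (q : ℕ) [NeZero q] (χ : DirichletCharacter ℂ q) (s : ℂ),
      0 < s.re → s.re < 1 → DirichletCharacter.LFunction χ s = 0 → s.re = 1 / 2)
include GRH

open Classical in
lemma norm_sum_vonMangoldt_char_sub_le {η : ℝ} (hη : 0 < η) (hη4 : η ≤ 1 / 4) {q : ℕ} [NeZero q]
    (χ : DirichletCharacter ℂ q) {u u' : ℝ → ℂ} {A B : ℝ} (h : IsWeight u u' A B) {N : ℕ}
    (hN : 1 ≤ N) :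
    ‖∑ n ∈ Finset.range N, χ n * ArithmeticFunction.vonMangoldt n * u (n / N) -
      if χ = 1 then N * ∫ x in (0 : ℝ)..1, u x else 0‖ ≤
      (1000000 / η ^ 3) * A * (N : ℝ) ^ (1 / 2 + η) * (q : ℝ) ^ η * B ^ (1 / 2 + η) := by
  have hA := h.pos
  have hB := h.one_le
  have hq : (1 : ℝ) ≤ q := by exact_mod_cast NeZero.one_le
  have hNR : (1 : ℝ) ≤ N := by exact_mod_cast hN
  have hN0 : (N : ℂ) ≠ 0 := by exact_mod_cast (by omega : N ≠ 0)
  set D : ℂ → ℂ := fun s => -(deriv (regL χ) s / regL χ s) with hD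
  set H : ℂ → ℂ := fun s => mellin u s * (N : ℂ) ^ s * D s with hH
  set K : ℝ := 13200 / η ^ 3 * (q : ℝ) ^ η with hK
  have hK0 : 0 < K := by positivity
  have hDb : ∀ s : ℂ, 1 / 2 + η ≤ s.re → s.re ≤ 2 → ‖D s‖ ≤ K * (1 + |s.im|) ^ η := by
    intro s h1 h2
    simpa [hD] using norm_logDeriv_regL_le GRH χ hη h1 h2
  have hDd : ∀ s : ℂ, 1 / 2 + η ≤ s.re → DifferentiableAt ℂ D s := by
    intro s h1
    have := ((differentiable_regL χ).contDiff (n := 2)).differentiable_deriv_two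
    exact ((this s).div (differentiable_regL χ s) (regL_ne_zero χ GRH (by linarith))).neg
  have hHd : ∀ s : ℂ, 1 / 2 + η ≤ s.re → DifferentiableAt ℂ H s := by
    intro s h1
    refine ((differentiableAt_mellin_weight h (by linarith)).mul ?_).mul (hDd s h1)
    exact (differentiableAt_id).const_cpow (Or.inl hN0)
  have hNn : ∀ s : ℂ, ‖(N : ℂ) ^ s‖ = (N : ℝ) ^ s.re := fun s =>
    Complex.norm_natCast_cpow_of_pos (by omega) s
  have hpi := Real.pi_pos
  have hpi3 := Real.pi_gt_three
  have hpi4 := Real.pi_le_four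
  have h2pi : ∀ y : ℝ, (1 + |2 * Real.pi * y|) ^ η ≤ 8 * (1 + |y|) ^ η := by
    intro y
    have e1 : (1 + |2 * Real.pi * y|) ≤ 8 * (1 + |y|) := by
      rw [abs_mul, abs_of_pos (by positivity : 0 < 2 * Real.pi)]
      nlinarith [abs_nonneg y]
    calc (1 + |2 * Real.pi * y|) ^ η ≤ (8 * (1 + |y|)) ^ η :=
          Real.rpow_le_rpow (by positivity) e1 hη.le
      _ = 8 ^ η * (1 + |y|) ^ η := Real.mul_rpow (by norm_num) (by positivity)
      _ ≤ 8 * (1 + |y|) ^ η := by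
          gcongr
          conv_rhs => rw [← Real.rpow_one 8]
          exact Real.rpow_le_rpow_of_exponent_le (by norm_num) (by linarith)
  have hline : ∀ σ : ℝ, 1 / 2 + η ≤ σ → σ ≤ 2 → ∀ y : ℝ,
      ‖H (σ + 2 * Real.pi * y * Complex.I)‖ ≤ 8 * K * (N : ℝ) ^ σ *
        (‖mellin u (σ + 2 * Real.pi * y * Complex.I)‖ * (1 + |y|) ^ η) := by
    intro σ h1 h2 y
    have := hDb (σ + 2 * Real.pi * y * Complex.I) (by simpa using h1) (by simpa using h2)
    have e : (σ + 2 * Real.pi * y * Complex.I : ℂ).im = 2 * Real.pi * y := by simp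
    rw [e] at this
    have e2 : (σ + 2 * Real.pi * y * Complex.I : ℂ).re = σ := by simp
    rw [hH]
    simp only [norm_mul, hNn, e2]
    calc _ ≤ ‖mellin u (σ + 2 * Real.pi * y * Complex.I)‖ * (N : ℝ) ^ σ * (K * (8 * (1 + |y|) ^ η)) := by
          gcongr
          exact this.trans (by gcongr; exact h2pi y)
      _ = _ := by ring
  have hcont : ∀ σ : ℝ, 1 / 2 + η ≤ σ → Continuous fun y : ℝ => H (σ + 2 * Real.pi * y * Complex.I) := by
    intro σ h1
    rw [continuous_iff_continuousAt]
    intro y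
    have := (hHd (σ + 2 * Real.pi * y * Complex.I) (by simpa using h1)).continuousAt
    exact ContinuousAt.comp (f := fun y : ℝ => (σ + 2 * Real.pi * y * Complex.I : ℂ)) this (by fun_prop)
  have hint : ∀ σ : ℝ, 1 / 2 + η ≤ σ → σ ≤ 2 →
      Integrable fun y : ℝ => H (σ + 2 * Real.pi * y * Complex.I) := by
    intro σ h1 h2
    exact ((integrable_mellin_mul h (by linarith) h2 hη.le hη4).1.const_mul _).mono'
      (hcont σ h1).aestronglyMeasurable (Eventually.of_forall (hline σ h1 h2))
  have hscale : ∀ σ : ℝ, ∀ y : ℝ, H (σ + 2 * Real.pi * y * Complex.I) =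
      (fun t : ℝ => H (σ + t * Complex.I)) (2 * Real.pi * y) := by
    intro σ y; simp
  have hint' : ∀ σ : ℝ, 1 / 2 + η ≤ σ → σ ≤ 2 → Integrable fun t : ℝ => H (σ + t * Complex.I) := by
    intro σ h1 h2
    have := hint σ h1 h2
    simp only [hscale] at this
    exact (integrable_comp_mul_left_iff (fun t : ℝ => H (σ + t * Complex.I))
      (by positivity : 2 * Real.pi ≠ 0)).mp this
  have hshift := integral_vertical_eq (H := H) (a := 1 / 2 + η) (b := 2) (by linarith)
    (fun s h1 _ => hHd s h1) (hint' _ le_rfl (by linarith)) (hint' 2 (by linarith) le_rfl)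
    (C := 8 * (A * B) * (N : ℝ) ^ (2 : ℝ) * (K * 2)) (by
      intro σ t h1 h2 ht
      have ht0 : 0 < |t| := by linarith
      have e2 : (σ + t * Complex.I : ℂ).re = σ := by simp
      have e3 : (σ + t * Complex.I : ℂ).im = t := by simp
      have b1 := hDb (σ + t * Complex.I) (by rwa [e2]) (by rwa [e2])
      rw [e3] at b1
      have b2 := norm_mellin_mul_le h (by linarith : 1 / 2 ≤ σ) h2 (t / (2 * Real.pi))
      have e4 : (σ + 2 * Real.pi * ((t / (2 * Real.pi) : ℝ) : ℂ) * Complex.I : ℂ) = σ + t * Complex.I := by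
        have : (Real.pi : ℂ) ≠ 0 := by exact_mod_cast hpi.ne'
        push_cast
        field_simp
      rw [e4, abs_div, abs_of_pos (by positivity : 0 < 2 * Real.pi)] at b2
      have b3 : ‖mellin u (σ + t * Complex.I)‖ ≤ 8 * (A * B) * |t|⁻¹ := by
        rw [mul_div_assoc', div_le_iff₀ (by positivity)] at b2
        rw [← div_eq_mul_inv, le_div_iff₀ ht0]
        have : 0 < A * B := by positivity
        nlinarith
      have b4 : (1 + |t|) ^ η ≤ 2 * |t| ^ (1 / 2 : ℝ) := by
        calc (1 + |t|) ^ η ≤ (1 + |t|) ^ (1 / 2 : ℝ) :=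
              Real.rpow_le_rpow_of_exponent_le (by linarith) (by linarith)
          _ ≤ (4 * |t|) ^ (1 / 2 : ℝ) := Real.rpow_le_rpow (by positivity) (by linarith) (by norm_num)
          _ = 2 * |t| ^ (1 / 2 : ℝ) := by
            rw [Real.mul_rpow (by norm_num) ht0.le]
            congr 1
            rw [← Real.sqrt_eq_rpow, show (4 : ℝ) = 2 ^ 2 by norm_num, Real.sqrt_sq (by norm_num)]
      have b5 : |t|⁻¹ * |t| ^ (1 / 2 : ℝ) = |t| ^ (-(1 / 2) : ℝ) := by
        rw [← Real.rpow_neg_one, ← Real.rpow_add ht0]; norm_num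
      have b6 : (N : ℝ) ^ σ ≤ (N : ℝ) ^ (2 : ℝ) := Real.rpow_le_rpow_of_exponent_le hNR h2
      rw [hH]
      simp only [norm_mul, hNn, e2]
      calc _ ≤ (8 * (A * B) * |t|⁻¹) * (N : ℝ) ^ (2 : ℝ) * (K * (2 * |t| ^ (1 / 2 : ℝ))) := by
            gcongr
            exact b1.trans (by gcongr)
        _ = 8 * (A * B) * (N : ℝ) ^ (2 : ℝ) * (K * 2) * (|t|⁻¹ * |t| ^ (1 / 2 : ℝ)) := by ring
        _ = _ := by rw [b5])
  have hmain : ∫ y : ℝ, H ((2 : ℝ) + 2 * Real.pi * y * Complex.I) =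
      ∫ y : ℝ, H ((1 / 2 + η : ℝ) + 2 * Real.pi * y * Complex.I) := by
    simp only [hscale]
    rw [Measure.integral_comp_mul_left (fun t : ℝ => H ((2 : ℝ) + t * Complex.I)),
      Measure.integral_comp_mul_left (fun t : ℝ => H ((1 / 2 + η : ℝ) + t * Complex.I)), hshift]
  have hbound : ‖∫ y : ℝ, H ((1 / 2 + η : ℝ) + 2 * Real.pi * y * Complex.I)‖ ≤
      72 * K * A * (N : ℝ) ^ (1 / 2 + η) * B ^ (1 / 2 + η) := by
    have b := integrable_mellin_mul h (by linarith : 1 / 2 ≤ 1 / 2 + η) (by linarith) hη.le hη4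
    refine (norm_integral_le_of_norm_le (b.1.const_mul _)
      (Eventually.of_forall (hline _ le_rfl (by linarith)))).trans ?_
    rw [integral_const_mul]
    refine (mul_le_mul_of_nonneg_left b.2 (by positivity)).trans (le_of_eq (by ring))
  have hsum : HasSum (fun n : ℕ => χ n * ArithmeticFunction.vonMangoldt n * u (n / N))
      (∑ n ∈ Finset.range N, χ n * ArithmeticFunction.vonMangoldt n * u (n / N)) := by
    refine hasSum_sum_of_ne_finset_zero fun n hn => ?_
    rw [h.zero_right, mul_zero]
    rw [Finset.mem_range, not_lt] at hn
    rw [le_div_iff₀ (by linarith)]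
    simpa using (by exact_mod_cast hn : (N : ℝ) ≤ n)
  have hS := hsum.unique (hasSum_vonMangoldt_weight χ h hN)
  have hP := integral_weight_eq h hN
  have hre2 : ∀ y : ℝ, ((2 : ℝ) + 2 * Real.pi * y * Complex.I : ℂ).re = 2 := by intro y; simp
  have hdiff : ∑ n ∈ Finset.range N, χ n * ArithmeticFunction.vonMangoldt n * u (n / N) -
      (if χ = 1 then N * ∫ x in (1 / N : ℝ)..1, u x else 0) =
      ∫ y : ℝ, H ((2 : ℝ) + 2 * Real.pi * y * Complex.I) := by
    have hHe : ∀ y : ℝ, H ((2 : ℝ) + 2 * Real.pi * y * Complex.I) =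
      mellin u ((2 : ℝ) + 2 * Real.pi * y * Complex.I) *
        (N : ℂ) ^ ((2 : ℝ) + 2 * Real.pi * y * Complex.I) *
        LSeries (fun n => χ n * ArithmeticFunction.vonMangoldt n) ((2 : ℝ) + 2 * Real.pi * y * Complex.I) -
      (if χ = 1 then mellin u ((2 : ℝ) + 2 * Real.pi * y * Complex.I) *
        (N : ℂ) ^ ((2 : ℝ) + 2 * Real.pi * y * Complex.I) *
        (1 / (((2 : ℝ) + 2 * Real.pi * y * Complex.I) - 1)) else 0) := by
      intro y
      rw [hH, hD]
      simp only
      rw [neg_logDeriv_regL_eq χ (by rw [hre2]; norm_num)]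
      split_ifs <;> ring
    have hI := hint 2 (by linarith) le_rfl
    have hM : Integrable fun y : ℝ => mellin u ((2 : ℝ) + 2 * Real.pi * y * Complex.I) :=
      integrable_mellin h (by norm_num) le_rfl
    have hI2 : Integrable fun y : ℝ => mellin u ((2 : ℝ) + 2 * Real.pi * y * Complex.I) *
        (N : ℂ) ^ ((2 : ℝ) + 2 * Real.pi * y * Complex.I) *
        (1 / (((2 : ℝ) + 2 * Real.pi * y * Complex.I) - 1)) := by
      have hne : ∀ y : ℝ, ((2 : ℝ) + 2 * Real.pi * y * Complex.I : ℂ) - 1 ≠ 0 := by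
        intro y h0
        have := congrArg Complex.re h0
        rw [Complex.sub_re, hre2] at this
        norm_num at this
      have c1 : Continuous fun y : ℝ => (N : ℂ) ^ ((2 : ℝ) + 2 * Real.pi * y * Complex.I) :=
        Continuous.const_cpow (by fun_prop) (Or.inl hN0)
      have c2 : Continuous fun y : ℝ => (1 / (((2 : ℝ) + 2 * Real.pi * y * Complex.I) - 1) : ℂ) :=
        continuous_const.div (by fun_prop) hne
      refine (hM.mul_bdd (c := (N : ℝ) ^ (2 : ℝ)) c1.aestronglyMeasurable
        (Eventually.of_forall fun y => ?_)).mul_bdd (c := 1) c2.aestronglyMeasurable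
        (Eventually.of_forall fun y => ?_)
      · rw [hNn, hre2]
      · rw [norm_div, norm_one, div_le_one (norm_pos_iff.mpr (hne y))]
        refine le_trans ?_ (Complex.abs_re_le_norm _)
        rw [Complex.sub_re, hre2]
        norm_num
    rw [hS]
    split_ifs with hχ
    · simp only [hχ, if_true] at hHe
      rw [hP, ← integral_sub ?_ hI2]
      · subst hχ
        simp only [hHe]
      · have := hI.add hI2
        refine this.congr (Eventually.of_forall fun y => ?_)
        simp only [Pi.add_apply, hHe, hχ]
        ring
    · simp only [hχ, if_false, sub_zero] at hHe
      simp only [hHe, sub_zero]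
  have hsmall : ‖(if χ = 1 then N * ∫ x in (1 / N : ℝ)..1, u x else 0) -
      (if χ = 1 then N * ∫ x in (0 : ℝ)..1, u x else 0)‖ ≤ A := by
    split_ifs with hχ
    · have hi : ∀ a b : ℝ, IntervalIntegrable u volume a b := fun a b => h.continuous.intervalIntegrable a b
      rw [← intervalIntegral.integral_add_adjacent_intervals (hi 0 (1 / N)) (hi _ 1),
        mul_add, sub_add_cancel_right, norm_neg, norm_mul]
      have := intervalIntegral.norm_integral_le_of_norm_le_const (a := 0) (b := 1 / (N : ℝ)) (f := u)
        (C := A) (fun x _ => h.bound x)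
      rw [sub_zero, abs_of_pos (by positivity)] at this
      calc _ ≤ (N : ℝ) * (A * (1 / N)) := by
            gcongr
            simp
        _ = A := by field_simp
    · simpa using hA.le
  set G := (N : ℝ) ^ (1 / 2 + η) * (q : ℝ) ^ η * B ^ (1 / 2 + η) with hG
  have hG1 : 1 ≤ G := by
    have g1 := Real.one_le_rpow hNR (by linarith : 0 ≤ 1 / 2 + η)
    have g2 := Real.one_le_rpow hq hη.le
    have g3 := Real.one_le_rpow hB (by linarith : 0 ≤ 1 / 2 + η)
    exact one_le_mul_of_one_le_of_one_le (one_le_mul_of_one_le_of_one_le g1 g2) g3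
  have hη3 : 1 ≤ 1 / η ^ 3 := by
    rw [le_div_iff₀ (by positivity), one_mul]
    exact pow_le_one₀ hη.le (by linarith)
  calc _ ≤ 72 * K * A * (N : ℝ) ^ (1 / 2 + η) * B ^ (1 / 2 + η) + A := by
        refine (norm_sub_le_norm_sub_add_norm_sub _
          (if χ = 1 then N * ∫ x in (1 / N : ℝ)..1, u x else 0) _).trans ?_
        rw [hdiff, hmain]
        gcongr
    _ = 950400 * (1 / η ^ 3) * (A * G) + A := by rw [hK, hG]; ring
    _ ≤ 950400 * (1 / η ^ 3) * (A * G) + (1 / η ^ 3) * (A * G) := by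
        gcongr
        have : A ≤ A * G := le_mul_of_one_le_right hA.le hG1
        nlinarith
    _ ≤ 1000000 * (1 / η ^ 3) * (A * G) := by
        have : 0 ≤ (1 / η ^ 3) * (A * G) := by positivity
        linarith
    _ = _ := by rw [hG]; ring

end
end LinnikGRH

namespace LinnikGRH
open Finset

/-- `ex x = exp (2πix)`. -/
noncomputable def ex (x : ℝ) : ℂ := Complex.exp (2 * Real.pi * x * Complex.I)

lemma ex_add (x y : ℝ) : ex (x + y) = ex x * ex y := by
  rw [ex, ex, ex, ← Complex.exp_add]; push_cast; ring_nf

lemma ex_zero : ex 0 = 1 := by simp [ex]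

lemma ex_eq_exp_ofReal (x : ℝ) : ex x = Complex.exp ((2 * Real.pi * x : ℝ) * Complex.I) := by
  rw [ex]; push_cast; rfl

lemma norm_ex (x : ℝ) : ‖ex x‖ = 1 := by
  rw [ex_eq_exp_ofReal, Complex.norm_exp_ofReal_mul_I]

lemma ex_int (n : ℤ) : ex n = 1 := by
  rw [ex, Complex.exp_eq_one_iff]
  exact ⟨n, by push_cast; ring⟩

lemma conj_ex (x : ℝ) : (starRingEnd ℂ) (ex x) = ex (-x) := by
  rw [ex_eq_exp_ofReal, ex_eq_exp_ofReal, ← Complex.exp_conj]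
  congr 1
  rw [map_mul, Complex.conj_ofReal, Complex.conj_I]
  push_cast
  ring

lemma ex_nsmul (n : ℕ) (x : ℝ) : ex (n * x) = ex x ^ n := by
  rw [ex, ex, ← Complex.exp_nat_mul]; push_cast; ring_nf

lemma ex_add_int (x : ℝ) (n : ℤ) : ex (x + n) = ex x := by rw [ex_add, ex_int, mul_one]

lemma ex_eq_one_iff (x : ℝ) : ex x = 1 ↔ ∃ n : ℤ, x = n := by
  constructor
  · intro h
    rw [ex, Complex.exp_eq_one_iff] at h
    obtain ⟨n, hn⟩ := h
    refine ⟨n, ?_⟩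
    have hpi : (2 * Real.pi * Complex.I : ℂ) ≠ 0 := Complex.two_pi_I_ne_zero
    have : (2 * Real.pi * Complex.I : ℂ) * x = (2 * Real.pi * Complex.I : ℂ) * n := by
      rw [mul_comm _ (n : ℂ), ← hn]; ring
    exact_mod_cast mul_left_cancel₀ hpi this
  · rintro ⟨n, rfl⟩; exact ex_int n

lemma sum_ex_div (q : ℕ) (hq : q ≠ 0) (m : ℤ) :
    ∑ a ∈ range q, ex (m * (a / q)) = if (q : ℤ) ∣ m then (q : ℂ) else 0 := by
  have hq0 : (q : ℝ) ≠ 0 := by exact_mod_cast hq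
  have e : ∀ a : ℕ, ex (m * (a / q)) = ex (m / q) ^ a := by
    intro a
    rw [← ex_nsmul]
    congr 1
    field_simp
  simp only [e]
  split_ifs with h
  · obtain ⟨k, rfl⟩ := h
    have : ex (((q : ℤ) * k : ℤ) / (q : ℝ)) = 1 := by
      push_cast
      rw [mul_div_cancel_left₀ _ hq0]
      exact ex_int k
    simp only [this, one_pow, sum_const, card_range, nsmul_eq_mul, mul_one]
  · have h1 : ex (m / q) ≠ 1 := by
      rw [Ne, ex_eq_one_iff]
      rintro ⟨k, hk⟩
      apply h
      rw [div_eq_iff hq0] at hk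
      exact ⟨k, by rw [mul_comm]; exact_mod_cast hk⟩
    rw [geom_sum_eq h1, ← ex_nsmul, mul_div_cancel₀ _ hq0, ex_int, sub_self, zero_div]

lemma sum_range_div_eq_sum_divisors {R : Type*} [AddCommMonoid R] (q : ℕ) (hq : q ≠ 0) (F : ℝ → R) :
    ∑ a ∈ range q, F (a / q) = ∑ d ∈ q.divisors, ∑ b ∈ range d with d.Coprime b, F (b / d) := by
  rw [sum_sigma']
  refine sum_bij' (fun a _ => ⟨q / q.gcd a, a / q.gcd a⟩) (fun x _ => x.2 * (q / x.1)) ?_ ?_ ?_ ?_ ?_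
  · intro a ha
    have hg : 0 < q.gcd a := Nat.gcd_pos_of_pos_left _ (Nat.pos_of_ne_zero hq)
    simp only [mem_sigma, Nat.mem_divisors, mem_filter, mem_range] at ha ⊢
    refine ⟨⟨Nat.div_dvd_of_dvd (Nat.gcd_dvd_left _ _), hq⟩, ?_, Nat.coprime_div_gcd_div_gcd hg⟩
    exact Nat.div_lt_div_of_lt_of_dvd (Nat.gcd_dvd_left _ _) ha
  · rintro ⟨d, b⟩ h
    simp only [mem_sigma, Nat.mem_divisors, mem_filter, mem_range] at h ⊢
    obtain ⟨⟨⟨k, rfl⟩, -⟩, hb, -⟩ := h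
    have hd : 0 < d := by omega
    have hk : 0 < k := Nat.pos_of_ne_zero (by rintro rfl; simp at hq)
    rw [Nat.mul_div_cancel_left _ hd]
    exact Nat.mul_lt_mul_of_pos_right hb hk
  · intro a ha
    have hg : 0 < q.gcd a := Nat.gcd_pos_of_pos_left _ (Nat.pos_of_ne_zero hq)
    simp only
    rw [Nat.div_div_self (Nat.gcd_dvd_left _ _) hq, Nat.div_mul_cancel (Nat.gcd_dvd_right _ _)]
  · rintro ⟨d, b⟩ h
    simp only [mem_sigma, Nat.mem_divisors, mem_filter, mem_range] at h ⊢
    obtain ⟨⟨⟨k, rfl⟩, -⟩, hb, hc⟩ := h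
    have hd : 0 < d := by omega
    have hk : 0 < k := Nat.pos_of_ne_zero (by rintro rfl; simp at hq)
    rw [Nat.mul_div_cancel_left _ hd, Nat.gcd_mul_right, hc, one_mul,
      Nat.mul_div_cancel _ hk, Nat.mul_div_cancel _ hk]
  · intro a ha
    have hg : 0 < q.gcd a := Nat.gcd_pos_of_pos_left _ (Nat.pos_of_ne_zero hq)
    have hg0 : (q.gcd a : ℝ) ≠ 0 := by exact_mod_cast hg.ne'
    simp only
    rw [Nat.cast_div (Nat.gcd_dvd_left _ _) hg0, Nat.cast_div (Nat.gcd_dvd_right _ _) hg0,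
      div_div_div_cancel_right₀ hg0]

/-- Ramanujan sums as exponential sums. -/
noncomputable def expRamanujan (q : ℕ) (m : ℤ) : ℂ := ∑ a ∈ range q with q.Coprime a, ex (m * (a / q))

/-- The function of `d` that is `d` if `d ∣ m` and `0` otherwise. -/
def dvdId (m : ℤ) : ArithmeticFunction ℤ :=
  ⟨fun d => if (d : ℤ) ∣ m then d else 0, by simp⟩

lemma dvdId_apply (m : ℤ) (d : ℕ) : dvdId m d = if (d : ℤ) ∣ m then (d : ℤ) else 0 := rfl

lemma isMultiplicative_dvdId (m : ℤ) : (dvdId m).IsMultiplicative := by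
  rw [ArithmeticFunction.IsMultiplicative.iff_ne_zero]
  refine ⟨by simp [dvdId_apply], fun {a b} _ _ hab => ?_⟩
  simp only [dvdId_apply]
  have : ((a * b : ℕ) : ℤ) ∣ m ↔ (a : ℤ) ∣ m ∧ (b : ℤ) ∣ m := by
    push_cast
    exact ⟨fun h => ⟨(Dvd.intro _ rfl).trans h, (Dvd.intro_left _ rfl).trans h⟩,
      fun h => (Nat.isCoprime_iff_coprime.mpr hab).mul_dvd h.1 h.2⟩
  simp only [this]
  by_cases h1 : (a : ℤ) ∣ m <;> by_cases h2 : (b : ℤ) ∣ m <;> simp [h1, h2]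

/-- Ramanujan sums `q ↦ c_q(m)`. -/
def ramanujan (m : ℤ) : ArithmeticFunction ℤ := ArithmeticFunction.moebius * dvdId m

lemma isMultiplicative_ramanujan (m : ℤ) : (ramanujan m).IsMultiplicative :=
  ArithmeticFunction.isMultiplicative_moebius.mul (isMultiplicative_dvdId m)

lemma expRamanujan_eq (q : ℕ) (hq : 0 < q) (m : ℤ) : expRamanujan q m = ramanujan m q := by
  have h1 : ∀ n > 0, ∑ d ∈ n.divisors, expRamanujan d m = ((dvdId m n : ℤ) : ℂ) := by
    intro n hn
    have := sum_range_div_eq_sum_divisors n hn.ne' (fun x => ex (m * x))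
    unfold expRamanujan
    rw [← this, sum_ex_div n hn.ne', dvdId_apply]
    split_ifs <;> simp
  have h2 := (ArithmeticFunction.sum_eq_iff_sum_mul_moebius_eq (R := ℂ)).mp h1 q hq
  rw [← h2, ramanujan, ArithmeticFunction.mul_apply]
  push_cast
  rfl

lemma ramanujan_prime (m : ℤ) {p : ℕ} (hp : p.Prime) :
    ramanujan m p = if (p : ℤ) ∣ m then (p : ℤ) - 1 else -1 := by
  rw [ramanujan, ArithmeticFunction.mul_apply,
    Nat.sum_divisorsAntidiagonal (fun a b => ArithmeticFunction.moebius a * dvdId m b),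
    hp.divisors, sum_pair hp.one_lt.ne, Nat.div_one, Nat.div_self hp.pos]
  simp only [dvdId_apply, ArithmeticFunction.moebius_apply_one,
    ArithmeticFunction.moebius_apply_prime hp]
  simp
  split_ifs <;> ring

lemma ramanujan_of_coprime {m : ℤ} {q : ℕ} (h : Int.gcd m q = 1) :
    ramanujan m q = ArithmeticFunction.moebius q := by
  rw [ramanujan, ArithmeticFunction.mul_apply]
  rcases Nat.eq_zero_or_pos q with rfl | hq
  · simp
  rw [sum_eq_single (q, 1)]
  · simp [dvdId_apply]
  · rintro ⟨a, b⟩ hab hne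
    rw [Nat.mem_divisorsAntidiagonal] at hab
    simp only [dvdId_apply]
    rw [if_neg, mul_zero]
    intro hb
    have h1 : b ∣ Int.gcd m q := Int.dvd_gcd hb (by exact_mod_cast Dvd.intro_left _ hab.1)
    rw [h, Nat.dvd_one] at h1
    subst h1
    simp at hab
    exact hne (by rw [hab.1])
  · intro h; simp [hq.ne'] at h

end LinnikGRH

namespace LinnikGRH
open Finset

section characters
variable {q : ℕ} [NeZero q]

/-- Fourier coefficients of a function on the units mod `q`. -/
noncomputable def charCoeff (ψ : ZMod q → ℂ) (χ : DirichletCharacter ℂ q) : ℂ :=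
  (q.totient : ℂ)⁻¹ * ∑ b : (ZMod q)ˣ, ψ b * χ (b : ZMod q)⁻¹

omit [NeZero q] in
lemma totient_ne_zero' [NeZero q] : (q.totient : ℂ) ≠ 0 := by
  exact_mod_cast (Nat.totient_pos.mpr (NeZero.pos q)).ne'

lemma sum_charCoeff_mul (ψ : ZMod q → ℂ) (x : (ZMod q)ˣ) :
    ∑ χ : DirichletCharacter ℂ q, charCoeff ψ χ * χ x = ψ x := by
  have h0 := totient_ne_zero' (q := q)
  simp only [charCoeff, mul_assoc, sum_mul, ← mul_sum]
  rw [sum_comm]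
  simp only [mul_assoc, ← mul_sum]
  simp only [DirichletCharacter.sum_char_inv_mul_char_eq ℂ (Units.isUnit _), Units.val_inj]
  simp
  field_simp

lemma sum_norm_sq_charCoeff (ψ : ZMod q → ℂ) :
    ∑ χ : DirichletCharacter ℂ q, ‖charCoeff ψ χ‖ ^ 2 =
      (q.totient : ℝ)⁻¹ * ∑ b : (ZMod q)ˣ, ‖ψ b‖ ^ 2 := by
  have h0 := totient_ne_zero' (q := q)
  have hc : ∀ (χ : DirichletCharacter ℂ q) (b : (ZMod q)ˣ),
      (starRingEnd ℂ) (χ (b : ZMod q)⁻¹) = χ b := by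
    intro χ b
    rw [← RCLike.star_def, MulChar.star_apply', MulChar.inv_apply, ZMod.inv_coe_unit,
      Ring.inverse_unit, inv_inv]
  have : ∀ χ : DirichletCharacter ℂ q, ((‖charCoeff ψ χ‖ ^ 2 : ℝ) : ℂ) =
      (q.totient : ℂ)⁻¹ * ((starRingEnd ℂ) (∑ b : (ZMod q)ˣ, ψ b * χ (b : ZMod q)⁻¹) *
        charCoeff ψ χ) := by
    intro χ
    push_cast
    rw [← Complex.conj_mul']
    conv_lhs => rw [charCoeff]
    rw [map_mul, charCoeff]
    simp
    ring
  have key : ((∑ χ : DirichletCharacter ℂ q, ‖charCoeff ψ χ‖ ^ 2 : ℝ) : ℂ) =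
      (((q.totient : ℝ)⁻¹ * ∑ b : (ZMod q)ˣ, ‖ψ b‖ ^ 2 : ℝ) : ℂ) := by
    rw [Complex.ofReal_sum]
    simp only [this, map_sum, map_mul, hc, sum_mul, ← mul_sum]
    rw [sum_comm]
    push_cast
    congr 1
    refine sum_congr rfl fun b _ => ?_
    rw [← Complex.conj_mul', ← sum_charCoeff_mul ψ b, mul_sum]
    refine sum_congr rfl fun χ _ => ?_
    rw [sum_charCoeff_mul]
    ring
  exact_mod_cast key

lemma sum_norm_charCoeff_le (ψ : ZMod q → ℂ) (hψ : ∀ x, ‖ψ x‖ ≤ 1) :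
    ∑ χ : DirichletCharacter ℂ q, ‖charCoeff ψ χ‖ ≤ (q : ℝ) ^ (1 / 2 : ℝ) := by
  have hφ : (0 : ℝ) < q.totient := by exact_mod_cast Nat.totient_pos.mpr (NeZero.pos q)
  have hcard : (univ : Finset (DirichletCharacter ℂ q)).card = q.totient := by
    rw [card_univ, ← Nat.card_eq_fintype_card,
      DirichletCharacter.card_eq_totient_of_hasEnoughRootsOfUnity]
  have h1 := sq_sum_le_card_mul_sum_sq (s := univ) (f := fun χ : DirichletCharacter ℂ q => ‖charCoeff ψ χ‖)
  rw [sum_norm_sq_charCoeff, hcard, ← mul_assoc, mul_inv_cancel₀ hφ.ne', one_mul] at h1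
  have h2 : ∑ b : (ZMod q)ˣ, ‖ψ b‖ ^ 2 ≤ q := by
    calc _ ≤ ∑ b : (ZMod q)ˣ, (1 : ℝ) := sum_le_sum fun b _ => pow_le_one₀ (norm_nonneg _) (hψ _)
      _ = q.totient := by simp [ZMod.card_units_eq_totient]
      _ ≤ q := by exact_mod_cast Nat.totient_le q
  rw [← Real.sqrt_eq_rpow]
  exact Real.le_sqrt_of_sq_le (h1.trans h2)

end characters

section
variable (GRH : ∀ (q : ℕ) [NeZero q] (χ : DirichletCharacter ℂ q) (s : ℂ),
      0 < s.re → s.re < 1 → DirichletCharacter.LFunction χ s = 0 → s.re = 1 / 2)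
include GRH

lemma norm_sum_unit_vonMangoldt_sub_le {η : ℝ} (hη : 0 < η) (hη4 : η ≤ 1 / 4) {q : ℕ} [NeZero q]
    (ψ : ZMod q → ℂ) {u u' : ℝ → ℂ} {A B : ℝ} (h : IsWeight u u' A B) {N : ℕ}
    (hN : 1 ≤ N) :
    ‖∑ n ∈ range N with n.Coprime q, ψ n * ArithmeticFunction.vonMangoldt n * u (n / N) -
      (q.totient : ℂ)⁻¹ * (∑ b : (ZMod q)ˣ, ψ b) * (N * ∫ x in (0 : ℝ)..1, u x)‖ ≤
      (∑ χ : DirichletCharacter ℂ q, ‖charCoeff ψ χ‖) *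
      ((1000000 / η ^ 3) * A * (N : ℝ) ^ (1 / 2 + η) * (q : ℝ) ^ η * B ^ (1 / 2 + η)) := by
  classical
  have e1 : ∑ n ∈ range N with n.Coprime q, ψ n * ArithmeticFunction.vonMangoldt n * u (n / N) =
      ∑ χ : DirichletCharacter ℂ q, charCoeff ψ χ *
        ∑ n ∈ range N, χ n * ArithmeticFunction.vonMangoldt n * u (n / N) := by
    simp only [mul_sum]
    rw [sum_comm, sum_filter]
    refine sum_congr rfl fun n _ => ?_
    split_ifs with hn
    · obtain ⟨x, hx⟩ := (ZMod.isUnit_iff_coprime n q).mpr hn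
      rw [← hx, ← sum_charCoeff_mul ψ x]
      simp only [sum_mul]
      exact sum_congr rfl fun χ _ => by ring
    · have : ¬ IsUnit (n : ZMod q) := fun h => hn ((ZMod.isUnit_iff_coprime n q).mp h)
      simp [MulChar.map_nonunit _ this]
  have e2 : (q.totient : ℂ)⁻¹ * (∑ b : (ZMod q)ˣ, ψ b) * (N * ∫ x in (0 : ℝ)..1, u x) =
      ∑ χ : DirichletCharacter ℂ q, charCoeff ψ χ *
        (if χ = 1 then N * ∫ x in (0:ℝ)..1, u x else 0) := by
    simp only [mul_ite, mul_zero]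
    rw [sum_ite_eq' univ, if_pos (mem_univ _)]
    congr 1
    rw [charCoeff]
    congr 1
    refine sum_congr rfl fun b _ => ?_
    rw [ZMod.inv_coe_unit, MulChar.one_apply_coe, mul_one]
  rw [e1, e2, ← sum_sub_distrib, sum_mul]
  refine (norm_sum_le _ _).trans (sum_le_sum fun χ _ => ?_)
  rw [← mul_sub, norm_mul]
  gcongr
  exact norm_sum_vonMangoldt_char_sub_le GRH hη hη4 χ h hN

lemma norm_sum_arith_prog_sub_le {η : ℝ} (hη : 0 < η) (hη4 : η ≤ 1 / 4) {q : ℕ} [NeZero q]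
    (x : (ZMod q)ˣ) {u u' : ℝ → ℂ} {A B : ℝ} (h : IsWeight u u' A B) {N : ℕ}
    (hN : 1 ≤ N) :
    ‖∑ n ∈ range N with ((n : ℕ) : ZMod q) = x, ArithmeticFunction.vonMangoldt n * u (n / N) -
      (q.totient : ℂ)⁻¹ * (N * ∫ x in (0 : ℝ)..1, u x)‖ ≤
      (1000000 / η ^ 3) * A * (N : ℝ) ^ (1 / 2 + η) * (q : ℝ) ^ η * B ^ (1 / 2 + η) := by
  classical
  have hA := h.pos
  have hB := h.one_le
  have hφ : (0 : ℝ) < q.totient := by exact_mod_cast Nat.totient_pos.mpr (NeZero.pos q)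
  have := norm_sum_unit_vonMangoldt_sub_le GRH hη hη4 (fun y : ZMod q => if y = x then 1 else 0) h hN
  have e1 : ∑ b : (ZMod q)ˣ, (if (b : ZMod q) = x then (1 : ℂ) else 0) = 1 := by
    simp [Units.val_inj]
  have e2 : ∀ χ : DirichletCharacter ℂ q,
      ‖charCoeff (fun y : ZMod q => if y = x then 1 else 0) χ‖ ≤ (q.totient : ℝ)⁻¹ := by
    intro χ
    rw [charCoeff, norm_mul, norm_inv, Complex.norm_natCast]
    simp only [ite_mul, one_mul, zero_mul, Units.val_inj]
    rw [sum_ite_eq' univ, if_pos (mem_univ _)]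
    exact mul_le_of_le_one_right (by positivity) (χ.norm_le_one _)
  have e3 : ∑ χ : DirichletCharacter ℂ q, ‖charCoeff (fun y : ZMod q => if y = x then 1 else 0) χ‖ ≤ 1 := by
    refine (sum_le_sum fun χ _ => e2 χ).trans_eq ?_
    rw [sum_const, card_univ, ← Nat.card_eq_fintype_card,
      DirichletCharacter.card_eq_totient_of_hasEnoughRootsOfUnity, nsmul_eq_mul,
      mul_inv_cancel₀ hφ.ne']
  have e4 : ∑ n ∈ range N with n.Coprime q, (if (n : ZMod q) = x then (1 : ℂ) else 0) *
      ArithmeticFunction.vonMangoldt n * u (n / N) =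
      ∑ n ∈ range N with ((n : ℕ) : ZMod q) = x, ArithmeticFunction.vonMangoldt n * u (n / N) := by
    rw [sum_filter, sum_filter]
    refine sum_congr rfl fun n _ => ?_
    by_cases hn : (n : ZMod q) = x
    · have : n.Coprime q := (ZMod.isUnit_iff_coprime n q).mp (hn ▸ x.isUnit)
      simp [hn, this]
    · simp [hn]
  rw [e1, e4, mul_one] at this
  refine this.trans (mul_le_of_le_one_left (by positivity) e3)

end

lemma sum_units_eq_sum_coprime {q : ℕ} [NeZero q] (F : ZMod q → ℂ) :
    ∑ b : (ZMod q)ˣ, F b = ∑ b ∈ range q with q.Coprime b, F b := by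
  refine sum_bij' (fun b _ => (b : ZMod q).val)
    (fun b hb => ZMod.unitOfCoprime b (Nat.Coprime.symm (mem_filter.mp hb).2)) ?_ ?_ ?_ ?_ ?_
  · intro b _
    simp only [mem_filter, mem_range]
    exact ⟨ZMod.val_lt _, (ZMod.val_coe_unit_coprime b).symm⟩
  · simp
  · intro b _
    ext
    simp
  · intro b hb
    simp only [mem_filter, mem_range] at hb
    simp [ZMod.val_cast_of_lt hb.1]
  · simp

lemma ex_mul_div_eq_stdAddChar {q : ℕ} [NeZero q] (a : ℤ) (n : ℕ) :
    ex (a * (n / q)) = ZMod.stdAddChar ((a : ZMod q) * (n : ZMod q)) := by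
  have : ((a : ZMod q) * (n : ZMod q)) = ((a * n : ℤ) : ZMod q) := by push_cast; rfl
  rw [this, ZMod.stdAddChar_coe, ex]
  push_cast
  ring_nf

lemma card_primeFactors_le (q : ℕ) : (q.primeFactors.card : ℝ) ≤ 3 * (q : ℝ) ^ (1 / 2 : ℝ) := by
  rcases Nat.eq_zero_or_pos q with rfl | hq
  · simp
  have h1 : 2 ^ q.primeFactors.card ≤ q := by
    calc 2 ^ q.primeFactors.card ≤ ∏ p ∈ q.primeFactors, p :=
          pow_card_le_prod _ _ _ fun p hp => (Nat.prime_of_mem_primeFactors hp).two_le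
      _ ≤ q := Nat.le_of_dvd hq (Nat.prod_primeFactors_dvd q)
  have h2 : (q.primeFactors.card : ℝ) * Real.log 2 ≤ Real.log q := by
    rw [← Real.log_pow]
    exact Real.log_le_log (by positivity) (by exact_mod_cast h1)
  have h3 := Real.log_le_rpow_div (x := q) (by positivity) (by norm_num : (0 : ℝ) < 1 / 2)
  have h4 := Real.log_two_gt_d9
  have h5 : 0 ≤ (q : ℝ) ^ (1 / 2 : ℝ) := by positivity
  have h6 : (0 : ℝ) ≤ q.primeFactors.card := by positivity
  nlinarith

lemma sum_vonMangoldt_not_coprime_le_card {q N : ℕ} (hq : q ≠ 0) (hN : 1 ≤ N) :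
    ∑ n ∈ range N with ¬ n.Coprime q, ArithmeticFunction.vonMangoldt n ≤
      q.primeFactors.card * (Nat.log 2 N + 1) * Real.log N := by
  have hNR : (1 : ℝ) ≤ N := by exact_mod_cast hN
  set S := (range N).filter fun n => ¬ n.Coprime q with hS
  set T := (q.primeFactors ×ˢ range (Nat.log 2 N + 1)).image fun x => x.1 ^ x.2 with hT
  have hsub : S.filter (fun n => ArithmeticFunction.vonMangoldt n ≠ 0) ⊆ T := by
    intro n hn
    simp only [hS, mem_filter, mem_range, ArithmeticFunction.vonMangoldt_ne_zero_iff] at hn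
    obtain ⟨⟨hnN, hc⟩, hpp⟩ := hn
    rw [isPrimePow_nat_iff] at hpp
    obtain ⟨p, k, hp, hk, rfl⟩ := hpp
    simp only [hT, mem_image, mem_product, mem_range, Prod.exists]
    refine ⟨p, k, ⟨?_, ?_⟩, rfl⟩
    · rw [Nat.mem_primeFactors]
      refine ⟨hp, ?_, hq⟩
      by_contra hd
      exact hc (Nat.Coprime.pow_left _ ((Nat.Prime.coprime_iff_not_dvd hp).mpr hd))
    · have : 2 ^ k ≤ N := (Nat.pow_le_pow_left hp.two_le k).trans hnN.le
      exact Nat.lt_succ_of_le (Nat.le_log_of_pow_le (by norm_num) this)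
  have hl0 : 0 ≤ Real.log N := Real.log_nonneg hNR
  have h1 : ∑ n ∈ S, ArithmeticFunction.vonMangoldt n ≤ T.card * Real.log N := by
    rw [← sum_filter_ne_zero]
    calc _ ≤ ∑ n ∈ S.filter (fun n => ArithmeticFunction.vonMangoldt n ≠ 0), Real.log N := by
          refine sum_le_sum fun n hn => ?_
          have hn0 := (mem_filter.mp hn).2
          have hnN : n < N := by
            have := (mem_filter.mp (mem_filter.mp hn).1).1
            exact mem_range.mp this
          have hn1 : n ≠ 0 := by rintro rfl; simp at hn0
          refine ArithmeticFunction.vonMangoldt_le_log.trans (Real.log_le_log ?_ ?_)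
          · exact_mod_cast Nat.pos_of_ne_zero hn1
          · exact_mod_cast hnN.le
      _ ≤ _ := by
          rw [sum_const, nsmul_eq_mul]
          gcongr
  have h2 : (T.card : ℝ) ≤ q.primeFactors.card * (Nat.log 2 N + 1) := by
    have : T.card ≤ q.primeFactors.card * (Nat.log 2 N + 1) := by
      refine card_image_le.trans ?_
      rw [card_product, card_range]
    exact_mod_cast this
  exact h1.trans (by gcongr)

lemma sum_vonMangoldt_not_coprime_le {q N : ℕ} (hq : q ≠ 0) (hN : 1 ≤ N) :
    ∑ n ∈ range N with ¬ n.Coprime q, ArithmeticFunction.vonMangoldt n ≤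
      84 * (N : ℝ) ^ (1 / 2 : ℝ) * (q : ℝ) ^ (1 / 2 : ℝ) := by
  have hNR : (1 : ℝ) ≤ N := by exact_mod_cast hN
  have hl := Real.log_le_rpow_div (x := N) (by positivity) (by norm_num : (0 : ℝ) < 1 / 4)
  have hl0 : 0 ≤ Real.log N := Real.log_nonneg hNR
  have h3 : (Nat.log 2 N : ℝ) * Real.log 2 ≤ Real.log N := by
    rw [← Real.log_pow]
    exact Real.log_le_log (by positivity) (by exact_mod_cast Nat.pow_log_le_self 2 (by omega))
  have h4 := Real.log_two_gt_d9
  have h5 := card_primeFactors_le q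
  set y := (N : ℝ) ^ (1 / 4 : ℝ) with hy
  have hy1 : 1 ≤ y := Real.one_le_rpow hNR (by norm_num)
  have hyy : (N : ℝ) ^ (1 / 2 : ℝ) = y * y := by
    rw [hy, ← Real.rpow_add (by linarith)]; norm_num
  have h6 : (Nat.log 2 N + 1 : ℝ) ≤ 7 * y := by
    have : (0 : ℝ) ≤ Nat.log 2 N := by positivity
    have : Real.log N ≤ 4 * y := by rw [hy]; linarith
    nlinarith
  have h7 : Real.log N ≤ 4 * y := by rw [hy]; linarith
  calc _ ≤ q.primeFactors.card * (Nat.log 2 N + 1) * Real.log N :=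
        sum_vonMangoldt_not_coprime_le_card hq hN
    _ ≤ (3 * (q : ℝ) ^ (1 / 2 : ℝ) * (7 * y)) * (4 * y) := by gcongr
    _ = _ := by rw [hyy]; ring

section
variable (GRH : ∀ (q : ℕ) [NeZero q] (χ : DirichletCharacter ℂ q) (s : ℂ),
      0 < s.re → s.re < 1 → DirichletCharacter.LFunction χ s = 0 → s.re = 1 / 2)
include GRH

lemma norm_sum_twist_sub_le {η : ℝ} (hη : 0 < η) (hη4 : η ≤ 1 / 4) {q : ℕ} [NeZero q]
    {a : ℤ} (ha : Int.gcd a q = 1) {u u' : ℝ → ℂ} {A B : ℝ} (h : IsWeight u u' A B) {N : ℕ}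
    (hN : 1 ≤ N) :
    ‖∑ n ∈ range N, ArithmeticFunction.vonMangoldt n * u (n / N) * ex (n * (a / q)) -
      (ArithmeticFunction.moebius q / q.totient : ℂ) * (N * ∫ x in (0 : ℝ)..1, u x)‖ ≤
      (2000000 / η ^ 3) * A * (N * q * B : ℝ) ^ (1 / 2 + η) := by
  classical
  have hA := h.pos
  have hB := h.one_le
  have hq : (1 : ℝ) ≤ q := by exact_mod_cast NeZero.one_le
  have hNR : (1 : ℝ) ≤ N := by exact_mod_cast hN
  set ψ : ZMod q → ℂ := fun y => ZMod.stdAddChar ((a : ZMod q) * y) with hψ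
  have hψ1 : ∀ x, ‖ψ x‖ ≤ 1 := fun x => (AddChar.norm_apply _ _).le
  have hψn : ∀ n : ℕ, ψ n = ex (n * (a / q)) := by
    intro n
    rw [hψ]
    simp only
    rw [← ex_mul_div_eq_stdAddChar]
    congr 1; ring
  have hsum : ∑ b : (ZMod q)ˣ, ψ b = ArithmeticFunction.moebius q := by
    rw [sum_units_eq_sum_coprime ψ]
    have := expRamanujan_eq q (NeZero.pos q) a
    rw [ramanujan_of_coprime ha, expRamanujan] at this
    rw [← this]
    refine sum_congr rfl fun b _ => ?_
    rw [hψn]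
    congr 1; ring
  have main := norm_sum_unit_vonMangoldt_sub_le GRH hη hη4 ψ h hN
  have hcoef := sum_norm_charCoeff_le ψ hψ1
  have hsplit : ∑ n ∈ range N, ArithmeticFunction.vonMangoldt n * u (n / N) * ex (n * (a / q)) =
      ∑ n ∈ range N with n.Coprime q, ψ n * ArithmeticFunction.vonMangoldt n * u (n / N) +
      ∑ n ∈ range N with ¬ n.Coprime q, ψ n * ArithmeticFunction.vonMangoldt n * u (n / N) := by
    rw [sum_filter_add_sum_filter_not]
    refine sum_congr rfl fun n _ => ?_
    rw [hψn]; ring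
  have hbad : ‖∑ n ∈ range N with ¬ n.Coprime q, ψ n * ArithmeticFunction.vonMangoldt n * u (n / N)‖ ≤
      84 * (N : ℝ) ^ (1 / 2 : ℝ) * (q : ℝ) ^ (1 / 2 : ℝ) * A := by
    refine (norm_sum_le _ _).trans ?_
    calc _ ≤ ∑ n ∈ range N with ¬ n.Coprime q, ArithmeticFunction.vonMangoldt n * A := by
          refine sum_le_sum fun n _ => ?_
          have h0 : 0 ≤ ArithmeticFunction.vonMangoldt n := ArithmeticFunction.vonMangoldt_nonneg
          rw [norm_mul, norm_mul, Complex.norm_real, Real.norm_of_nonneg h0]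
          have := mul_le_mul (hψ1 n) (h.bound (n / N)) (norm_nonneg _) zero_le_one
          nlinarith
      _ ≤ _ := by
          rw [← sum_mul]
          gcongr
          exact sum_vonMangoldt_not_coprime_le (NeZero.ne q) hN
  have hη3 : 1 ≤ 1 / η ^ 3 := by
    rw [le_div_iff₀ (by positivity), one_mul]
    exact pow_le_one₀ hη.le (by linarith)
  set G := A * (N * q * B : ℝ) ^ (1 / 2 + η) with hG
  have hG0 : 0 ≤ G := by positivity
  have hexp : (N * q * B : ℝ) ^ (1 / 2 + η) =
      (N : ℝ) ^ (1 / 2 + η) * ((q : ℝ) ^ (1 / 2 : ℝ) * (q : ℝ) ^ η) * B ^ (1 / 2 + η) := by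
    rw [Real.mul_rpow (by positivity) (by positivity), Real.mul_rpow (by positivity) (by positivity),
      ← Real.rpow_add (by positivity : (0 : ℝ) < q)]
  have b1 : (∑ χ : DirichletCharacter ℂ q, ‖charCoeff ψ χ‖) *
      ((1000000 / η ^ 3) * A * (N : ℝ) ^ (1 / 2 + η) * (q : ℝ) ^ η * B ^ (1 / 2 + η)) ≤
      (1000000 / η ^ 3) * G := by
    calc _ ≤ (q : ℝ) ^ (1 / 2 : ℝ) *
      ((1000000 / η ^ 3) * A * (N : ℝ) ^ (1 / 2 + η) * (q : ℝ) ^ η * B ^ (1 / 2 + η)) := by gcongr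
      _ = _ := by rw [hG, hexp]; ring
  have b2 : 84 * (N : ℝ) ^ (1 / 2 : ℝ) * (q : ℝ) ^ (1 / 2 : ℝ) * A ≤ 84 * G := by
    have g1 : (N : ℝ) ^ (1 / 2 : ℝ) ≤ (N : ℝ) ^ (1 / 2 + η) :=
      Real.rpow_le_rpow_of_exponent_le hNR (by linarith)
    have g2 : 1 ≤ (q : ℝ) ^ η := Real.one_le_rpow hq hη.le
    have g3 : 1 ≤ B ^ (1 / 2 + η) := Real.one_le_rpow hB (by linarith)
    have : (N : ℝ) ^ (1 / 2 : ℝ) * (q : ℝ) ^ (1 / 2 : ℝ) ≤ (N * q * B : ℝ) ^ (1 / 2 + η) := by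
      rw [hexp]
      calc (N : ℝ) ^ (1 / 2 : ℝ) * (q : ℝ) ^ (1 / 2 : ℝ) =
          (N : ℝ) ^ (1 / 2 : ℝ) * ((q : ℝ) ^ (1 / 2 : ℝ) * 1) * 1 := by ring
        _ ≤ _ := by gcongr
    rw [hG]
    nlinarith
  rw [hsplit]
  rw [hsum] at main
  have e : (q.totient : ℂ)⁻¹ * ArithmeticFunction.moebius q =
      (ArithmeticFunction.moebius q / q.totient : ℂ) := by ring
  rw [e] at main
  calc _ ≤ (1000000 / η ^ 3) * G + 84 * G := by
        rw [add_sub_right_comm]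
        exact (norm_add_le _ _).trans (add_le_add (main.trans b1) (hbad.trans b2))
    _ ≤ (2000000 / η ^ 3) * G := by
        have : 1000000 / η ^ 3 * G = 1000000 * ((1 / η ^ 3) * G) := by ring
        have : 2000000 / η ^ 3 * G = 2000000 * ((1 / η ^ 3) * G) := by ring
        have : G ≤ (1 / η ^ 3) * G := le_mul_of_one_le_left hG0 hη3
        linarith
    _ = _ := by rw [hG]; ring

end
end LinnikGRH

namespace LinnikGRH
open Finset

lemma exists_pow_card_primeFactors_le (K ε : ℝ) (hK : 1 ≤ K) (hε : 0 < ε) :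
    ∃ C : ℝ, 0 < C ∧ ∀ m : ℕ, m ≠ 0 → K ^ m.primeFactors.card ≤ C * (m : ℝ) ^ ε := by
  obtain ⟨p₀, hp₀⟩ := exists_nat_ge (K ^ (1 / ε))
  refine ⟨K ^ p₀, by positivity, fun m hm => ?_⟩
  have hbig : ∀ p : ℕ, p₀ ≤ p → K ≤ (p : ℝ) ^ ε := by
    intro p hp
    have h1 : K ^ (1 / ε) ≤ p := hp₀.trans (by exact_mod_cast hp)
    have h2 := Real.rpow_le_rpow (by positivity) h1 hε.le
    rwa [← Real.rpow_mul (by linarith), one_div, inv_mul_cancel₀ hε.ne', Real.rpow_one] at h2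
  have h1 : K ^ m.primeFactors.card = (∏ _p ∈ m.primeFactors with _p < p₀, K) *
      ∏ _p ∈ m.primeFactors with ¬ _p < p₀, K := by
    rw [prod_filter_mul_prod_filter_not, prod_const]
  have h2 : ∏ _p ∈ m.primeFactors with _p < p₀, K ≤ K ^ p₀ := by
    rw [prod_const]
    refine pow_le_pow_right₀ hK ?_
    calc _ ≤ (range p₀).card := card_le_card fun p hp => by simpa using (mem_filter.mp hp).2
      _ = p₀ := card_range _
  have h3 : ∏ _p ∈ m.primeFactors with ¬ _p < p₀, K ≤ (m : ℝ) ^ ε := by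
    calc _ ≤ ∏ p ∈ m.primeFactors with ¬ p < p₀, (p : ℝ) ^ ε :=
          prod_le_prod (fun _ _ => by positivity) fun p hp => hbig p (not_lt.mp (mem_filter.mp hp).2)
      _ ≤ ∏ p ∈ m.primeFactors, (p : ℝ) ^ ε := by
          refine prod_le_prod_of_subset_of_one_le (filter_subset _ _) (fun _ _ => by positivity) fun p hp _ => ?_
          exact Real.one_le_rpow (by exact_mod_cast (Nat.prime_of_mem_primeFactors hp).one_lt.le) hε.le
      _ = ((∏ p ∈ m.primeFactors, p : ℕ) : ℝ) ^ ε := by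
          rw [Real.finsetProd_rpow _ _ fun p _ => by positivity]
          push_cast
          rfl
      _ ≤ _ := by
          gcongr
          exact Nat.le_of_dvd (Nat.pos_of_ne_zero hm) (Nat.prod_primeFactors_dvd m)
  rw [h1]
  exact mul_le_mul h2 h3 (by positivity) (by positivity)

/-- The summand of the singular series. -/
noncomputable def singTerm (m : ℤ) : ArithmeticFunction ℝ :=
  ⟨fun q => (ArithmeticFunction.moebius q : ℝ) ^ 2 * (ramanujan m q : ℝ) / (q.totient : ℝ) ^ 2, by simp⟩

lemma singTerm_apply (m : ℤ) (q : ℕ) : singTerm m q =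
    (ArithmeticFunction.moebius q : ℝ) ^ 2 * (ramanujan m q : ℝ) / (q.totient : ℝ) ^ 2 := rfl

lemma isMultiplicative_singTerm (m : ℤ) : (singTerm m).IsMultiplicative := by
  refine ⟨by simp [singTerm_apply, (isMultiplicative_ramanujan m).map_one], fun {a b} hab => ?_⟩
  simp only [singTerm_apply]
  rw [(isMultiplicative_ramanujan m).map_mul_of_coprime hab, Nat.totient_mul hab,
    ArithmeticFunction.isMultiplicative_moebius.map_mul_of_coprime hab]
  push_cast
  rw [div_mul_div_comm]
  ring_nf

lemma singTerm_prime (m : ℤ) {p : ℕ} (hp : p.Prime) :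
    singTerm m p = if (p : ℤ) ∣ m then 1 / ((p : ℝ) - 1) else -1 / ((p : ℝ) - 1) ^ 2 := by
  have h1 : (1 : ℝ) < p := by exact_mod_cast hp.one_lt
  have h0 : (p : ℝ) - 1 ≠ 0 := by linarith
  rw [singTerm_apply, ramanujan_prime m hp, ArithmeticFunction.moebius_apply_prime hp,
    Nat.totient_prime hp, Nat.cast_sub hp.one_lt.le]
  split_ifs
  · push_cast
    field_simp
  · push_cast
    norm_num

lemma singTerm_zero_nonneg (q : ℕ) : 0 ≤ singTerm 0 q := by
  rcases Nat.eq_zero_or_pos q with rfl | hq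
  · simp
  rw [singTerm_apply]
  have h := expRamanujan_eq q hq 0
  have h2 : (0 : ℝ) ≤ (ramanujan 0 q : ℝ) := by
    have h3 : expRamanujan q 0 = (((range q).filter (fun a => q.Coprime a)).card : ℂ) := by
      simp [expRamanujan, ex_zero]
    rw [h3] at h
    have : (((range q).filter (fun a => q.Coprime a)).card : ℤ) = ramanujan 0 q := by exact_mod_cast h
    rw [← this]
    positivity
  positivity

/-- The truncated singular series. -/
noncomputable def singTrunc (Q : ℕ) (m : ℤ) : ℝ := ∑ q ∈ Icc 1 Q, singTerm m q

lemma singTrunc_zero_nonneg (Q : ℕ) : 0 ≤ singTrunc Q 0 :=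
  sum_nonneg fun q _ => singTerm_zero_nonneg q

/-- The arithmetic factor `∏_{p ∣ m, p > 2} (1 + 1 / (p - 2))`. -/
noncomputable def singFactor (m : ℕ) : ℝ := ∏ p ∈ m.primeFactors.erase 2, (1 + 1 / ((p : ℝ) - 2))

lemma one_le_one_add_one_div {m p : ℕ} (hp : p ∈ m.primeFactors.erase 2) :
    1 ≤ 1 + 1 / ((p : ℝ) - 2) := by
  have h1 := (Nat.prime_of_mem_primeFactors (mem_of_mem_erase hp)).two_le
  have : (2 : ℝ) ≤ p := by exact_mod_cast h1
  have : 0 ≤ 1 / ((p : ℝ) - 2) := by apply div_nonneg <;> linarith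
  linarith

lemma one_le_singFactor (m : ℕ) : 1 ≤ singFactor m :=
  Finset.one_le_prod fun _ hp => one_le_one_add_one_div hp

open Nat in
lemma twin_prime_prod_ge (Y : ℕ) (hY : 128 ≤ Y) :
    (0.655 : ℝ) * (1 + 1 / (Y - 1)) ≤ ∏ p ∈ (primesLE Y).erase 2, (1 - 1 / ((p : ℝ) - 1) ^ 2) := by
  induction Y, hY using Nat.le_induction with
  | base =>
    have : (0.655 : ℚ) * (1 + 1 / (128 - 1)) ≤
        ∏ p ∈ (primesLE 128).erase 2, (1 - 1 / ((p : ℚ) - 1) ^ 2) := by decide +kernel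
    have h2 := (Rat.cast_le (K := ℝ)).mpr this
    push_cast at h2
    norm_num at h2 ⊢
    exact h2
  | succ Y hY ih =>
    have hYR : (128 : ℝ) ≤ Y := by exact_mod_cast hY
    have h0 : (0 : ℝ) < Y - 1 := by linarith
    have h00 : (0 : ℝ) < Y := by linarith
    push_cast
    rw [add_sub_cancel_right]
    have hmono : (0.655 : ℝ) * (1 + 1 / Y) ≤ 0.655 * (1 + 1 / (Y - 1)) := by
      gcongr
      linarith
    by_cases hp : (Y + 1).Prime
    · have e : (primesLE (Y + 1)).erase 2 = insert (Y + 1) ((primesLE Y).erase 2) := by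
        ext p
        simp only [mem_erase, mem_insert, mem_primesLE]
        constructor
        · rintro ⟨h1, h2, h3⟩
          by_cases h : p = Y + 1
          · exact Or.inl h
          · exact Or.inr ⟨h1, by omega, h3⟩
        · rintro (rfl | ⟨h1, h2, h3⟩)
          · exact ⟨by omega, le_rfl, hp⟩
          · exact ⟨h1, by omega, h3⟩
      rw [e, prod_insert (by simp [mem_primesLE])]
      have hfac : (0 : ℝ) ≤ 1 - 1 / (((Y + 1 : ℕ) : ℝ) - 1) ^ 2 := by
        push_cast
        rw [add_sub_cancel_right, sub_nonneg, div_le_one (by positivity)]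
        nlinarith
      refine le_trans (le_of_eq ?_) (mul_le_mul_of_nonneg_left ih hfac)
      push_cast
      rw [add_sub_cancel_right]
      field_simp
      ring
    · have e : (primesLE (Y + 1)).erase 2 = (primesLE Y).erase 2 := by
        ext p
        simp only [mem_erase, mem_primesLE]
        refine and_congr_right fun _ => ⟨fun ⟨h2, h3⟩ => ⟨?_, h3⟩, fun ⟨h2, h3⟩ => ⟨by omega, h3⟩⟩
        have : p ≠ Y + 1 := fun h => hp (h ▸ h3)
        omega
      rw [e]
      exact hmono.trans ih

open Nat in
lemma prod_one_add_singTerm_ge {m : ℤ} (hm : m ≠ 0) (h2 : Even m) {Y : ℕ} (hY : 128 ≤ Y)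
    (hmY : m.natAbs ≤ Y) :
    1.31 * singFactor m.natAbs ≤ ∏ p ∈ primesLE Y, (1 + singTerm m p) := by
  have hmem : 2 ∈ primesLE Y := by rw [mem_primesLE]; exact ⟨by omega, Nat.prime_two⟩
  have hsub : m.natAbs.primeFactors.erase 2 ⊆ (primesLE Y).erase 2 := by
    refine erase_subset_erase _ fun p hp => ?_
    rw [mem_primesLE]
    have := Nat.le_of_dvd (Int.natAbs_pos.mpr hm) (Nat.dvd_of_mem_primeFactors hp)
    exact ⟨by omega, Nat.prime_of_mem_primeFactors hp⟩
  have h2m : ((2 : ℕ) : ℤ) ∣ m := by exact_mod_cast h2.two_dvd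
  have e : ∀ p ∈ (primesLE Y).erase 2, 1 + singTerm m p = (1 - 1 / ((p : ℝ) - 1) ^ 2) *
      (if p ∈ m.natAbs.primeFactors.erase 2 then 1 + 1 / ((p : ℝ) - 2) else 1) := by
    intro p hp
    rw [mem_erase, mem_primesLE] at hp
    have hp3 : (3 : ℝ) ≤ p := by
      have := hp.2.2.two_le
      have : 3 ≤ p := by omega
      exact_mod_cast this
    have h1 : (p : ℝ) - 1 ≠ 0 := by linarith
    have h2 : (p : ℝ) - 2 ≠ 0 := by linarith
    rw [singTerm_prime m hp.2.2]
    by_cases hd : (p : ℤ) ∣ m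
    · have : p ∈ m.natAbs.primeFactors.erase 2 := by
        rw [mem_erase, Nat.mem_primeFactors]
        exact ⟨hp.1, hp.2.2, Int.natCast_dvd.mp hd, Int.natAbs_ne_zero.mpr hm⟩
      rw [if_pos hd, if_pos this]
      field_simp
      ring
    · have : p ∉ m.natAbs.primeFactors.erase 2 := by
        rw [mem_erase, Nat.mem_primeFactors]
        exact fun h => hd (Int.natCast_dvd.mpr h.2.2.1)
      rw [if_neg hd, if_neg this]
      ring
  rw [← mul_prod_erase _ _ hmem, prod_congr rfl e, prod_mul_distrib, prod_ite_mem,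
    inter_eq_right.mpr hsub, singTerm_prime m Nat.prime_two, if_pos h2m]
  have := twin_prime_prod_ge Y hY
  have hY1 : (0 : ℝ) ≤ 1 / ((Y : ℝ) - 1) := by
    have : (128 : ℝ) ≤ Y := by exact_mod_cast hY
    apply div_nonneg <;> linarith
  have h3 := one_le_singFactor m.natAbs
  have h4 : (0.655 : ℝ) ≤ ∏ p ∈ (primesLE Y).erase 2, (1 - 1 / ((p : ℝ) - 1) ^ 2) := by nlinarith
  change _ ≤ _ * (_ * singFactor m.natAbs)
  have h5 : (1 + 1 / (((2 : ℕ) : ℝ) - 1)) = 2 := by norm_num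
  rw [h5]
  nlinarith

/-- `|singTerm m q| √q`. -/
noncomputable def singMaj (m : ℤ) : ArithmeticFunction ℝ :=
  ⟨fun q => |singTerm m q| * (q : ℝ) ^ (1 / 2 : ℝ), by simp⟩

lemma isMultiplicative_singMaj (m : ℤ) : (singMaj m).IsMultiplicative := by
  have h := isMultiplicative_singTerm m
  refine ⟨by simp [singMaj, h.map_one], fun {a b} hab => ?_⟩
  simp only [singMaj, ArithmeticFunction.coe_mk]
  rw [h.map_mul_of_coprime hab, abs_mul, Nat.cast_mul, Real.mul_rpow (by positivity) (by positivity)]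
  ring

open Nat in
lemma exists_prod_one_add_singMaj_le (ε : ℝ) (hε : 0 < ε) :
    ∃ C : ℝ, 0 < C ∧ ∀ m : ℤ, m ≠ 0 → ∀ Y : ℕ,
      ∏ p ∈ primesLE Y, (1 + singMaj m p) ≤ C * (m.natAbs : ℝ) ^ ε := by
  obtain ⟨C, hC, hCm⟩ := exists_pow_card_primeFactors_le 3 ε (by norm_num) hε
  have hsum : Summable fun n : ℕ => 4 * (1 / (n : ℝ) ^ (3 / 2 : ℝ)) :=
    (Real.summable_one_div_nat_rpow.mpr (by norm_num)).mul_left _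
  refine ⟨C * Real.exp (∑' n : ℕ, 4 * (1 / (n : ℝ) ^ (3 / 2 : ℝ))), by positivity, fun m hm Y => ?_⟩
  have hle : ∀ p ∈ primesLE Y, 1 + singMaj m p ≤
      (if p ∈ m.natAbs.primeFactors then 3 else 1) * Real.exp (4 * (1 / (p : ℝ) ^ (3 / 2 : ℝ))) := by
    intro p hp
    rw [mem_primesLE] at hp
    have hp2 : (2 : ℝ) ≤ p := by exact_mod_cast hp.2.two_le
    have hs : (p : ℝ) ^ (1 / 2 : ℝ) = √p := (Real.sqrt_eq_rpow _).symm
    have hs1 : (p : ℝ) ^ (3 / 2 : ℝ) = p * √p := by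
      rw [Real.sqrt_eq_rpow, show (3 / 2 : ℝ) = 1 + 1 / 2 by norm_num, Real.rpow_add (by linarith),
        Real.rpow_one]
    have hss : √(p : ℝ) * √p = p := Real.mul_self_sqrt (by linarith)
    have hs0 : 0 < √(p : ℝ) := Real.sqrt_pos.mpr (by linarith)
    have hexp := Real.add_one_le_exp (4 * (1 / (p : ℝ) ^ (3 / 2 : ℝ)))
    simp only [singMaj, ArithmeticFunction.coe_mk]
    rw [singTerm_prime m hp.2, hs]
    by_cases hd : (p : ℤ) ∣ m
    · have : p ∈ m.natAbs.primeFactors := by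
        rw [Nat.mem_primeFactors]
        exact ⟨hp.2, Int.natCast_dvd.mp hd, Int.natAbs_ne_zero.mpr hm⟩
      rw [if_pos hd, if_pos this, abs_of_nonneg (by apply div_nonneg <;> linarith)]
      have h1 : 1 / ((p : ℝ) - 1) * √p ≤ 2 := by
        rw [div_mul_eq_mul_div, one_mul, div_le_iff₀ (by linarith)]
        nlinarith
      have h2 : 1 ≤ Real.exp (4 * (1 / (p : ℝ) ^ (3 / 2 : ℝ))) := Real.one_le_exp (by positivity)
      linarith
    · have : p ∉ m.natAbs.primeFactors := by
        rw [Nat.mem_primeFactors]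
        exact fun h => hd (Int.natCast_dvd.mpr h.2.1)
      rw [if_neg hd, if_neg this, one_mul, abs_div, abs_neg, abs_one, abs_of_nonneg (by positivity)]
      refine le_trans ?_ hexp
      rw [hs1, add_comm]
      refine add_le_add_left ?_ 1
      rw [div_mul_eq_mul_div, one_mul, mul_one_div, div_le_div_iff₀ (by nlinarith) (by positivity)]
      have : √(p : ℝ) * (p * √p) = p ^ 2 := by nlinarith
      rw [this]
      nlinarith
  have h0 : ∀ p ∈ primesLE Y, 0 ≤ 1 + singMaj m p := by
    intro p _
    have : 0 ≤ singMaj m p := by simp only [singMaj, ArithmeticFunction.coe_mk]; positivity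
    linarith
  refine (prod_le_prod h0 hle).trans ?_
  rw [prod_mul_distrib, ← Real.exp_sum, prod_ite_mem, prod_const]
  calc _ ≤ (3 : ℝ) ^ (m.natAbs.primeFactors).card * Real.exp (∑' n : ℕ, 4 * (1 / (n : ℝ) ^ (3 / 2 : ℝ))) := by
        gcongr
        · norm_num
        · exact inter_subset_right
        · exact hsum.sum_le_tsum _ fun n _ => by positivity
    _ ≤ (C * (m.natAbs : ℝ) ^ ε) * Real.exp (∑' n : ℕ, 4 * (1 / (n : ℝ) ^ (3 / 2 : ℝ))) := by
        gcongr
        exact hCm _ (Int.natAbs_ne_zero.mpr hm)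
    _ = _ := by ring

lemma abs_sum_mul_rpow_le (m : ℤ) (S : Finset ℕ) (Q : ℕ) :
    |∑ d ∈ S with ¬ d ≤ Q, singTerm m d| * (Q : ℝ) ^ (1 / 2 : ℝ) ≤ ∑ d ∈ S, singMaj m d := by
  calc _ ≤ (∑ d ∈ S with ¬ d ≤ Q, |singTerm m d|) * (Q : ℝ) ^ (1 / 2 : ℝ) := by
        gcongr
        exact abs_sum_le_sum_abs _ _
    _ ≤ ∑ d ∈ S with ¬ d ≤ Q, singMaj m d := by
        rw [sum_mul]
        refine sum_le_sum fun d hd => ?_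
        simp only [singMaj, ArithmeticFunction.coe_mk]
        have := (mem_filter.mp hd).2
        gcongr
        omega
    _ ≤ _ := by
        refine sum_le_sum_of_subset_of_nonneg (filter_subset _ _) fun d _ _ => ?_
        simp only [singMaj, ArithmeticFunction.coe_mk]
        positivity

open Nat in
lemma exists_singTrunc_ge (ε : ℝ) (hε : 0 < ε) :
    ∃ C : ℝ, 0 < C ∧ ∀ m : ℤ, m ≠ 0 → Even m → ∀ Q : ℕ, 1 ≤ Q →
      1.31 * singFactor m.natAbs - C * (m.natAbs : ℝ) ^ ε / (Q : ℝ) ^ (1 / 2 : ℝ) ≤ singTrunc Q m := by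
  obtain ⟨C, hC, hCm⟩ := exists_prod_one_add_singMaj_le ε hε
  refine ⟨C, hC, fun m hm hev Q hQ => ?_⟩
  set Y := m.natAbs + Q + 128 with hY
  have hQ0 : (0 : ℝ) < (Q : ℝ) ^ (1 / 2 : ℝ) := by
    have : (0 : ℝ) < Q := by exact_mod_cast hQ
    positivity
  have hsq : Squarefree (primorial Y) := by
    rw [primorial_eq_prod_primesLE]
    refine Finset.squarefree_prod_of_pairwise_isCoprime ?_ ?_
    · intro p hp q hq hpq
      simp only [mem_coe, mem_primesLE] at hp hq
      exact Nat.coprime_iff_isRelPrime.mp ((Nat.coprime_primes hp.2 hq.2).mpr hpq)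
    · intro p hp
      exact (mem_primesLE.mp hp).2.prime.squarefree
  have e1 := (isMultiplicative_singTerm m).prodPrimeFactors_one_add_of_squarefree hsq
  have e2 := (isMultiplicative_singMaj m).prodPrimeFactors_one_add_of_squarefree hsq
  rw [primeFactors_primorial] at e1 e2
  have hmain := prod_one_add_singTerm_ge hm hev (Y := Y) (by omega) (by omega)
  have hmaj := hCm m hm Y
  rw [e1] at hmain
  rw [e2] at hmaj
  have hsplit := sum_filter_add_sum_filter_not (primorial Y).divisors (fun d => d ≤ Q) (singTerm m)
  have hlow : ∑ d ∈ (primorial Y).divisors with d ≤ Q, singTerm m d = singTrunc Q m := by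
    rw [singTrunc]
    refine sum_subset ?_ ?_
    · intro d hd
      rw [mem_filter, Nat.mem_divisors] at hd
      rw [mem_Icc]
      exact ⟨Nat.pos_of_dvd_of_pos hd.1.1 (primorial_pos Y), hd.2⟩
    · intro d hd hnd
      rw [mem_Icc] at hd
      rw [mem_filter, not_and_or] at hnd
      rcases hnd with hnd | hnd
      · have : ¬ Squarefree d := by
          intro hs
          apply hnd
          rw [Nat.mem_divisors]
          refine ⟨?_, primorial_ne_zero Y⟩
          rw [← Nat.prod_primeFactors_of_squarefree hs, primorial_eq_prod_primesLE]
          refine prod_dvd_prod_of_subset _ _ _ fun p hp => ?_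
          rw [mem_primesLE]
          have := Nat.le_of_dvd (by omega) (Nat.dvd_of_mem_primeFactors hp)
          exact ⟨by omega, Nat.prime_of_mem_primeFactors hp⟩
        rw [singTerm_apply, ArithmeticFunction.moebius_eq_zero_of_not_squarefree this]
        simp
      · exact absurd hd.2 hnd
  have htail : |∑ d ∈ (primorial Y).divisors with ¬ d ≤ Q, singTerm m d| ≤
      C * (m.natAbs : ℝ) ^ ε / (Q : ℝ) ^ (1 / 2 : ℝ) := by
    rw [le_div_iff₀ hQ0]
    exact (abs_sum_mul_rpow_le m _ Q).trans hmaj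
  rw [← hsplit, hlow] at hmain
  have := abs_le.mp htail
  linarith

end LinnikGRH

namespace LinnikGRH
open Finset

lemma four_mul_abs_sub_round_le (θ : ℝ) : 4 * |θ - round θ| ≤ ‖ex θ - 1‖ := by
  set t := θ - round θ with ht
  have e : ex θ = ex t := by
    rw [← ex_add_int t (round θ), ht, sub_add_cancel]
  have h1 : |t| ≤ 1 / 2 := abs_sub_round θ
  rw [e, ex, show (2 * Real.pi * t * Complex.I : ℂ) = Complex.I * ((2 * Real.pi * t : ℝ) : ℂ) by
    push_cast; ring, Complex.norm_exp_I_mul_ofReal_sub_one, norm_mul, Real.norm_eq_abs,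
    Real.norm_eq_abs, abs_two, show 2 * Real.pi * t / 2 = Real.pi * t by ring]
  have h2 : |Real.sin (Real.pi * t)| = Real.sin (Real.pi * |t|) := by
    rcases abs_cases t with ⟨h, h'⟩ | ⟨h, h'⟩
    · rw [h, abs_of_nonneg]
      apply Real.sin_nonneg_of_nonneg_of_le_pi <;> nlinarith [Real.pi_pos]
    · rw [h, mul_neg, Real.sin_neg, abs_of_nonpos]
      have : 0 ≤ Real.sin (-(Real.pi * t)) := by
        apply Real.sin_nonneg_of_nonneg_of_le_pi <;> nlinarith [Real.pi_pos]
      rw [Real.sin_neg] at this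
      linarith
  have h3 := Real.mul_le_sin (x := Real.pi * |t|) (by positivity) (by nlinarith [Real.pi_pos])
  rw [h2]
  have : 2 / Real.pi * (Real.pi * |t|) = 2 * |t| := by field_simp
  linarith

lemma abs_sub_round_ge {θ : ℝ} {k : ℤ} {D : ℕ} (hD : 0 < D) (h : θ = k / D) (hk : ¬ (D : ℤ) ∣ k) :
    1 / (D : ℝ) ≤ |θ - round θ| := by
  have hD0 : (0 : ℝ) < D := by exact_mod_cast hD
  have e : θ - round θ = ((k - D * round θ : ℤ) : ℝ) / D := by
    push_cast
    field_simp
    rw [h]; field_simp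
  rw [e, abs_div, abs_of_pos hD0]
  gcongr
  have : k - D * round θ ≠ 0 := fun h0 => hk ⟨round θ, by linarith⟩
  exact_mod_cast Int.one_le_abs this

lemma sub_one_mul_sum_pow (z : ℂ) (g : ℕ → ℂ) (N : ℕ) :
    (z - 1) * ∑ n ∈ range N, g n * z ^ n =
      ∑ n ∈ range N, (g n - g (n + 1)) * z ^ (n + 1) + g N * z ^ N - g 0 := by
  induction N with
  | zero => simp
  | succ N ih =>
    rw [sum_range_succ, mul_add, ih, sum_range_succ]
    ring

namespace IsWeight
variable {u u' : ℝ → ℂ} {A B : ℝ}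

lemma norm_sub_le (h : IsWeight u u' A B) (x y : ℝ) : ‖u x - u y‖ ≤ A * B * |x - y| := by
  have := Convex.norm_image_sub_le_of_norm_hasDerivWithin_le (s := Set.univ) (f := u) (f' := u')
    (C := A * B) (x := y) (y := x) (fun z _ => (h.hasDeriv z).hasDerivWithinAt) (fun z _ => h.bound' z)
    convex_univ trivial trivial
  simpa using this

lemma norm_sum_mul_ex_le (h : IsWeight u u' A B) {N : ℕ} (hN : 1 ≤ N) {θ δ : ℝ} (hδ : 0 < δ)
    (hθ : δ ≤ |θ - round θ|) :
    ‖∑ n ∈ range N, u (n / N) * ex (n * θ)‖ ≤ A * B / δ := by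
  have hN0 : (0 : ℝ) < N := by exact_mod_cast hN
  have e := sub_one_mul_sum_pow (ex θ) (fun n => u (n / N)) N
  simp only [Nat.cast_zero, zero_div, h.zero_left 0 le_rfl, div_self hN0.ne',
    h.zero_right 1 le_rfl, zero_mul, add_zero, sub_zero] at e
  simp only [ex_nsmul]
  have h1 : ‖∑ n ∈ range N, (u (n / N) - u ((n + 1 : ℕ) / N)) * ex θ ^ (n + 1)‖ ≤ A * B := by
    refine (norm_sum_le _ _).trans ?_
    calc _ ≤ ∑ n ∈ range N, A * B / N := by
          refine sum_le_sum fun n _ => ?_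
          rw [norm_mul, norm_pow, norm_ex, one_pow, mul_one]
          refine (h.norm_sub_le _ _).trans_eq ?_
          rw [← sub_div, abs_div, abs_of_pos hN0]
          push_cast
          norm_num
          ring
      _ = A * B := by
          rw [sum_const, card_range, nsmul_eq_mul]
          field_simp
  rw [← e, norm_mul] at h1
  have h2 := four_mul_abs_sub_round_le θ
  rw [le_div_iff₀ hδ]
  have h3 : δ ≤ ‖ex θ - 1‖ := by linarith
  nlinarith [norm_nonneg (∑ n ∈ range N, u (n / N) * ex θ ^ n)]

lemma norm_sum_sub_integral_le (h : IsWeight u u' A B) {N : ℕ} (hN : 1 ≤ N) :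
    ‖∑ n ∈ range N, u (n / N) - N * ∫ x in (0 : ℝ)..1, u x‖ ≤ A * B := by
  have hN0 : (0 : ℝ) < N := by exact_mod_cast hN
  have hNc : (N : ℂ) ≠ 0 := by exact_mod_cast (by omega : N ≠ 0)
  have hi : ∀ a b : ℝ, IntervalIntegrable u MeasureTheory.volume a b :=
    fun a b => h.continuous.intervalIntegrable a b
  have e := intervalIntegral.sum_integral_adjacent_intervals (f := u) (μ := MeasureTheory.volume)
    (a := fun n : ℕ => (n : ℝ) / N) (n := N) (fun k _ => hi _ _)
  simp only [Nat.cast_zero, zero_div, div_self hN0.ne'] at e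
  rw [← e, mul_sum, ← sum_sub_distrib]
  refine (norm_sum_le _ _).trans ?_
  calc _ ≤ ∑ n ∈ range N, A * B / N := by
        refine sum_le_sum fun n _ => ?_
        have hlen : ((n + 1 : ℕ) : ℝ) / N - n / N = 1 / N := by push_cast; ring
        have e1 : u (n / N) = N * ∫ _x in (n / N : ℝ)..((n + 1 : ℕ) / N), u (n / N) := by
          rw [intervalIntegral.integral_const, hlen, Complex.real_smul]
          push_cast
          field_simp
        rw [e1, ← mul_sub, ← intervalIntegral.integral_sub (by simp) (hi _ _), norm_mul,
          Complex.norm_natCast]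
        have := intervalIntegral.norm_integral_le_of_norm_le_const (a := (n / N : ℝ))
          (b := (n + 1 : ℕ) / N) (f := fun x => u (n / N) - u x) (C := A * B * (1 / N)) (fun x hx => by
            refine (h.norm_sub_le _ _).trans ?_
            have hAB : 0 ≤ A * B := mul_nonneg h.pos.le (zero_le_one.trans h.one_le)
            refine mul_le_mul_of_nonneg_left ?_ hAB
            rw [Set.uIoc_of_le (by gcongr; push_cast; linarith)] at hx
            rw [abs_of_nonpos (by linarith [hx.1])]
            linarith [hx.2, hx.1])
        rw [hlen, abs_of_pos (by positivity)] at this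
        calc _ ≤ (N : ℝ) * (A * B * (1 / N) * (1 / N)) := by gcongr
          _ = _ := by field_simp
    _ = A * B := by
        rw [sum_const, card_range, nsmul_eq_mul]
        field_simp

end IsWeight

/-- The Farey fractions `a / q` with `q ≤ Q`, as pairs `(q, a)`. -/
def farey (Q : ℕ) : Finset (Σ _ : ℕ, ℕ) :=
  (Icc 1 Q).sigma fun q => (range q).filter fun a => q.Coprime a

lemma mem_farey {Q : ℕ} {x : Σ _ : ℕ, ℕ} :
    x ∈ farey Q ↔ (1 ≤ x.1 ∧ x.1 ≤ Q) ∧ x.2 < x.1 ∧ x.1.Coprime x.2 := by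
  simp [farey]

/-- The Ramanujan expansion model for the primes. -/
noncomputable def model (Q : ℕ) (m : ℤ) : ℝ :=
  ∑ q ∈ Icc 1 Q, (ArithmeticFunction.moebius q : ℝ) / q.totient * ramanujan m q

lemma model_eq (Q : ℕ) (m : ℤ) : (model Q m : ℂ) =
    ∑ x ∈ farey Q, (ArithmeticFunction.moebius x.1 / x.1.totient : ℂ) * ex (m * (x.2 / x.1)) := by
  rw [model, farey, sum_sigma]
  push_cast
  refine sum_congr rfl fun q hq => ?_
  rw [← mul_sum, ← expRamanujan_eq q (mem_Icc.mp hq).1, expRamanujan]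

lemma norm_moebius_div_totient_le (q : ℕ) :
    ‖(ArithmeticFunction.moebius q / q.totient : ℂ)‖ ≤ 1 / (q.totient : ℝ) := by
  rw [norm_div, Complex.norm_natCast]
  gcongr
  have := ArithmeticFunction.abs_moebius_le_one (n := q)
  rw [Complex.norm_intCast]
  exact_mod_cast this

lemma sum_farey_totient_le (Q : ℕ) (F : ℕ → ℝ) :
    ∑ x ∈ farey Q, 1 / (x.1.totient : ℝ) * F x.1 = ∑ q ∈ Icc 1 Q, F q := by
  rw [farey, sum_sigma]
  refine sum_congr rfl fun q hq => ?_
  have hq := (mem_Icc.mp hq).1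
  have : (0 : ℝ) < q.totient := by exact_mod_cast Nat.totient_pos.mpr hq
  simp only [sum_const, nsmul_eq_mul]
  rw [← Nat.totient_eq_card_coprime]
  field_simp

lemma farey_add_int {q q' : ℕ} (hq : 0 < q) (hq' : 0 < q') {k c c' : ℤ} (hc : Int.gcd c q = 1) (hc' : Int.gcd c' q' = 1)
    (h : (c : ℝ) / q + c' / q' = k) : q = q' := by
  have hq0 : (q : ℝ) ≠ 0 := by positivity
  have hq0' : (q' : ℝ) ≠ 0 := by positivity
  have e : c * q' + c' * q = k * q * q' := by
    field_simp at h
    have : ((c * q' + c' * q : ℤ) : ℝ) = ((k * q * q' : ℤ) : ℝ) := by push_cast; linarith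
    exact_mod_cast this
  have h1 : (q : ℤ) ∣ c * q' := ⟨k * q' - c', by linarith⟩
  have h2 : (q' : ℤ) ∣ c' * q := ⟨k * q - c, by linarith⟩
  have h1' : (q : ℤ) ∣ q' := (Int.isCoprime_iff_gcd_eq_one.mpr hc).symm.dvd_of_dvd_mul_left h1
  have h2' : (q' : ℤ) ∣ q := (Int.isCoprime_iff_gcd_eq_one.mpr hc').symm.dvd_of_dvd_mul_left h2
  exact Nat.dvd_antisymm (by exact_mod_cast h1') (by exact_mod_cast h2')

lemma exists_farey_eq {Q q : ℕ} (hq : 1 ≤ q) (hqQ : q ≤ Q) {a : ℤ} (ha : Int.gcd a q = 1) :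
    ∃ x₀ ∈ farey Q, x₀.1 = q ∧ (q : ℤ) ∣ x₀.2 + a := by
  have hqz : (q : ℤ) ≠ 0 := by positivity
  set b := ((-a) % q).toNat with hb
  have hbz : (b : ℤ) = (-a) % q := Int.toNat_of_nonneg (Int.emod_nonneg _ hqz)
  have hbq : b < q := by
    have := Int.emod_lt_of_pos (-a) (by exact_mod_cast hq : (0 : ℤ) < q)
    rw [← hbz] at this
    exact_mod_cast this
  have hbdvd : (q : ℤ) ∣ b + a := by
    rw [hbz]
    have := Int.emod_add_mul_ediv (-a) q
    exact ⟨-((-a) / q), by linarith⟩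
  have hbc : q.Coprime b := by
    rw [Nat.coprime_comm, Nat.Coprime, ← Int.gcd_natCast_natCast]
    rw [hbz, Int.gcd_emod, Int.neg_gcd]
    exact ha
  exact ⟨⟨q, b⟩, mem_farey.mpr ⟨⟨hq, hqQ⟩, hbq, hbc⟩, rfl, hbdvd⟩

lemma eq_of_mem_farey_of_dvd {Q q : ℕ} (hq : 1 ≤ q) {a : ℤ} (ha : Int.gcd a q = 1)
    {x : Σ _ : ℕ, ℕ} (hx : x ∈ farey Q) (h : ((x.1 * q : ℕ) : ℤ) ∣ x.2 * q + a * x.1) :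
    x.1 = q ∧ (q : ℤ) ∣ x.2 + a := by
  have hqz : (q : ℤ) ≠ 0 := by positivity
  have hq0 : (q : ℝ) ≠ 0 := by positivity
  obtain ⟨⟨hx1, hxQ⟩, hx2, hxc⟩ := mem_farey.mp hx
  have hx0 : (x.1 : ℝ) ≠ 0 := by positivity
  obtain ⟨k, hk⟩ := h
  have hreal : (x.2 : ℝ) * q + a * x.1 = x.1 * q * k := by exact_mod_cast hk
  have hqq : x.1 = q := farey_add_int (k := k) (c := x.2) (c' := a) (by omega) (by omega)
    (by rw [Int.gcd_natCast_natCast]; exact hxc.symm) ha (by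
      push_cast
      field_simp
      linarith)
  refine ⟨hqq, k, ?_⟩
  rw [hqq] at hk
  have : (q : ℤ) * (x.2 + a) = q * (q * k) := by push_cast at hk; linarith
  exact mul_left_cancel₀ hqz this

lemma not_dvd_of_mem_farey {Q q : ℕ} (hq : 1 ≤ q) {a : ℤ} (ha : Int.gcd a q = 1)
    {x x₀ : Σ _ : ℕ, ℕ} (hx₀ : x₀ ∈ farey Q) (h₁ : x₀.1 = q) (h₂ : (q : ℤ) ∣ x₀.2 + a)
    (hx : x ∈ farey Q) (hne : x ≠ x₀) : ¬ ((x.1 * q : ℕ) : ℤ) ∣ x.2 * q + a * x.1 := by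
  intro h
  obtain ⟨hqq, hk2⟩ := eq_of_mem_farey_of_dvd hq ha hx h
  obtain ⟨-, hx2, -⟩ := mem_farey.mp hx
  obtain ⟨-, hbq, -⟩ := mem_farey.mp hx₀
  rw [hqq] at hx2
  rw [h₁] at hbq
  have h3 : (q : ℤ) ∣ (x.2 : ℤ) - x₀.2 := by
    have := dvd_sub hk2 h₂
    rwa [add_sub_add_right_eq_sub] at this
  have h4 : (x.2 : ℤ) = x₀.2 := by
    have h6 := Int.emod_eq_emod_iff_emod_sub_eq_zero.mpr (Int.emod_eq_zero_of_dvd h3)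
    rwa [Int.emod_eq_of_lt (by positivity) (by exact_mod_cast hx2),
      Int.emod_eq_of_lt (by positivity) (by exact_mod_cast hbq)] at h6
  have h5 : x.2 = x₀.2 := by exact_mod_cast h4
  apply hne
  ext
  · rw [hqq, h₁]
  · simpa using h5

lemma norm_sum_model_twist_sub_le {u u' : ℝ → ℂ} {A B : ℝ} (h : IsWeight u u' A B) {N : ℕ}
    (hN : 1 ≤ N) {Q q : ℕ} (hq : 1 ≤ q) (hqQ : q ≤ Q) {a : ℤ} (ha : Int.gcd a q = 1) :
    ‖∑ n ∈ range N, model Q n * u (n / N) * ex (n * (a / q)) -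
      (ArithmeticFunction.moebius q / q.totient : ℂ) * (N * ∫ x in (0 : ℝ)..1, u x)‖ ≤
      2 * A * B * q * (Q : ℝ) ^ 2 := by
  have hA := h.pos
  have hB := h.one_le
  have hq0 : (q : ℝ) ≠ 0 := by positivity
  have hqz : (q : ℤ) ≠ 0 := by positivity
  have hQ1 : (1 : ℝ) ≤ Q := by exact_mod_cast hq.trans hqQ
  have hq1 : (1 : ℝ) ≤ q := by exact_mod_cast hq
  obtain ⟨x₀, hx₀m, hx₀q, hbdvd⟩ := exists_farey_eq hq hqQ ha
  set W : (Σ _ : ℕ, ℕ) → ℂ := fun x => ∑ n ∈ range N, u (n / N) * ex (n * (x.2 / x.1 + a / q)) with hW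
  have e1 : ∑ n ∈ range N, model Q n * u (n / N) * ex (n * (a / q)) =
      ∑ x ∈ farey Q, (ArithmeticFunction.moebius x.1 / x.1.totient : ℂ) * W x := by
    simp only [hW, mul_sum]
    rw [sum_comm]
    refine sum_congr rfl fun n _ => ?_
    have := model_eq Q n
    rw [this, sum_mul, sum_mul]
    refine sum_congr rfl fun x _ => ?_
    rw [mul_add, ex_add]
    push_cast
    ring
  have e2 : W x₀ = ∑ n ∈ range N, u (n / N) := by
    obtain ⟨k, hk⟩ := hbdvd
    refine sum_congr rfl fun n _ => ?_
    have : (n * ((x₀.2 : ℝ) / q + a / q) : ℝ) = ((n * k : ℤ) : ℝ) := by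
      have : ((x₀.2 + a : ℤ) : ℝ) = ((q * k : ℤ) : ℝ) := by rw [hk]
      push_cast at this ⊢
      rw [← add_div, this]
      field_simp
    rw [hx₀q, this, ex_int, mul_one]
  have hoff : ∀ x ∈ (farey Q).erase x₀, ‖W x‖ ≤ A * B * (q * x.1) := by
    intro x hx
    obtain ⟨hne, hx'⟩ := mem_erase.mp hx
    obtain ⟨⟨hx1, hxQ⟩, hx2, hxc⟩ := mem_farey.mp hx'
    have hx0 : (x.1 : ℝ) ≠ 0 := by positivity
    have hδ := abs_sub_round_ge (θ := x.2 / x.1 + a / q) (k := x.2 * q + a * x.1) (D := x.1 * q)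
      (by positivity) (by push_cast; field_simp) (not_dvd_of_mem_farey hq ha hx₀m hx₀q hbdvd hx' hne)
    refine (h.norm_sum_mul_ex_le hN (by positivity) hδ).trans_eq ?_
    push_cast
    field_simp
  have hint := h.norm_sum_sub_integral_le hN
  rw [e1, ← add_sum_erase _ _ hx₀m, e2, hx₀q, add_sub_right_comm, ← mul_sub]
  have hφ1 : ∀ x ∈ farey Q, 1 / (x.1.totient : ℝ) ≤ 1 := by
    intro x hx
    have := Nat.totient_pos.mpr (mem_farey.mp hx).1.1
    rw [div_le_one (by positivity)]
    exact_mod_cast this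
  have hφq : 1 / (q.totient : ℝ) ≤ 1 := hx₀q ▸ hφ1 _ hx₀m
  calc _ ≤ 1 * (A * B) + ∑ x ∈ (farey Q).erase x₀, 1 / (x.1.totient : ℝ) * (A * B * (q * x.1)) := by
        refine (norm_add_le _ _).trans (add_le_add ?_ ?_)
        · rw [norm_mul]
          exact mul_le_mul ((norm_moebius_div_totient_le _).trans hφq) hint (norm_nonneg _)
            zero_le_one
        · refine (norm_sum_le _ _).trans (sum_le_sum fun x hx => ?_)
          rw [norm_mul]
          exact mul_le_mul (norm_moebius_div_totient_le _) (hoff x hx) (norm_nonneg _) (by positivity)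
    _ ≤ A * B + ∑ x ∈ farey Q, 1 / (x.1.totient : ℝ) * (A * B * (q * x.1)) := by
        rw [one_mul]
        gcongr
        exact erase_subset _ _
    _ = A * B + ∑ r ∈ Icc 1 Q, A * B * (q * r) := by
        rw [sum_farey_totient_le Q fun r => A * B * (q * r)]
    _ ≤ A * B + ∑ r ∈ Icc 1 Q, A * B * (q * Q) := by
        gcongr with r hr
        exact (mem_Icc.mp hr).2
    _ = A * B + A * B * q * (Q : ℝ) ^ 2 := by
        rw [sum_const, Nat.card_Icc, nsmul_eq_mul, Nat.add_sub_cancel]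
        ring
    _ ≤ _ := by
        have : 1 ≤ q * (Q : ℝ) ^ 2 := one_le_mul_of_one_le_of_one_le hq1 (one_le_pow₀ hQ1)
        have hAB : 0 < A * B := by positivity
        nlinarith

lemma norm_sum_mul_model_sub_le {u : ℝ → ℂ} {N Q : ℕ} {g : ℕ → ℝ} {J : ℂ} {E : ℝ}
    (hg : ∀ q : ℕ, 1 ≤ q → q ≤ Q → ∀ a : ℤ, Int.gcd a q = 1 →
      ‖∑ n ∈ range N, g n * u (n / N) * ex (n * (a / q)) -
        (ArithmeticFunction.moebius q / q.totient : ℂ) * J‖ ≤ E) (m : ℤ) {σ : ℤ} (hσ : σ = 1 ∨ σ = -1) :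
    ‖∑ n ∈ range N, g n * u (n / N) * model Q (m + σ * n) - singTrunc Q m * J‖ ≤ Q * E := by
  set S : ℕ → ℤ → ℂ := fun q a => ∑ n ∈ range N, g n * u (n / N) * ex (n * (a / q)) with hS
  have e1 : ∑ n ∈ range N, g n * u (n / N) * model Q (m + σ * n) =
      ∑ x ∈ farey Q, (ArithmeticFunction.moebius x.1 / x.1.totient : ℂ) *
        (ex (m * (x.2 / x.1)) * S x.1 (σ * x.2)) := by
    simp only [hS, mul_sum]
    rw [sum_comm]
    refine sum_congr rfl fun n _ => ?_
    rw [model_eq, mul_sum]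
    refine sum_congr rfl fun x _ => ?_
    have : ((m + σ * n : ℤ) : ℝ) * (x.2 / x.1) = m * (x.2 / x.1) + n * ((σ * x.2 : ℤ) / x.1) := by
      push_cast; ring
    rw [this, ex_add]
    ring
  have e2 : singTrunc Q m * J = ∑ x ∈ farey Q, (ArithmeticFunction.moebius x.1 / x.1.totient : ℂ) *
      (ex (m * (x.2 / x.1)) * ((ArithmeticFunction.moebius x.1 / x.1.totient : ℂ) * J)) := by
    rw [singTrunc, farey, sum_sigma]
    push_cast
    rw [sum_mul]
    refine sum_congr rfl fun q hq => ?_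
    have := expRamanujan_eq q (mem_Icc.mp hq).1 m
    rw [← mul_sum, ← sum_mul, singTerm_apply]
    push_cast
    rw [← this, expRamanujan]
    ring
  rw [e1, e2, ← sum_sub_distrib]
  refine (norm_sum_le _ _).trans ?_
  calc _ ≤ ∑ x ∈ farey Q, 1 / (x.1.totient : ℝ) * E := by
        refine sum_le_sum fun x hx => ?_
        obtain ⟨⟨h1, h2⟩, h3, h4⟩ := mem_farey.mp hx
        rw [← mul_sub, ← mul_sub, norm_mul, norm_mul, norm_ex, one_mul]
        refine mul_le_mul (norm_moebius_div_totient_le _) (hg _ h1 h2 _ ?_) (norm_nonneg _) (by positivity)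
        have h5 : Int.gcd (x.2 : ℤ) x.1 = 1 := by rw [Int.gcd_natCast_natCast]; exact h4.symm
        rcases hσ with rfl | rfl
        · rwa [one_mul]
        · rwa [neg_one_mul, Int.neg_gcd]
    _ = _ := by
        rw [sum_farey_totient_le Q fun _ => E]
        simp

end LinnikGRH

namespace LinnikGRH
open Finset

lemma IsWeight.mul {u u' v v' : ℝ → ℂ} {A B D : ℝ} (h : IsWeight u u' A B) (hD : 0 ≤ D)
    (hv : ∀ x, HasDerivAt v (v' x) x) (hc : Continuous v') (h1 : ∀ x, ‖v x‖ ≤ 1)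
    (h2 : ∀ x, ‖v' x‖ ≤ D) :
    IsWeight (fun x => u x * v x) (fun x => u' x * v x + u x * v' x) A (B + D) where
  pos := h.pos
  one_le := by linarith [h.one_le]
  hasDeriv x := (h.hasDeriv x).mul (hv x)
  cont := by
    have hvc : Continuous v := continuous_iff_continuousAt.mpr fun x => (hv x).continuousAt
    exact (h.cont.mul hvc).add (h.continuous.mul hc)
  zero_left x hx := by rw [h.zero_left x hx, zero_mul]
  zero_right x hx := by rw [h.zero_right x hx, zero_mul]
  bound x := by
    rw [norm_mul]
    exact (mul_le_mul (h.bound x) (h1 x) (norm_nonneg _) h.pos.le).trans_eq (mul_one A)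
  bound' x := by
    refine (norm_add_le _ _).trans ?_
    rw [norm_mul, norm_mul, mul_add]
    have hA := h.pos.le
    have hB := h.one_le
    refine add_le_add ?_ ?_
    · exact (mul_le_mul (h.bound' x) (h1 x) (norm_nonneg _) (by positivity)).trans_eq (mul_one _)
    · exact mul_le_mul (h.bound x) (h2 x) (norm_nonneg _) hA

/-- The smooth cutoff `x²(1-x)²` on `[0, 1]`. -/
noncomputable def wt (x : ℝ) : ℝ := (max 0 (x * (1 - x))) ^ 2

noncomputable def wtDeriv (x : ℝ) : ℝ := 2 * max 0 (x * (1 - x)) * (1 - 2 * x)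

lemma hasDerivAt_max_sq (t : ℝ) : HasDerivAt (fun t : ℝ => (max 0 t) ^ 2) (2 * max 0 t) t := by
  rcases lt_trichotomy t 0 with h | rfl | h
  · rw [max_eq_left h.le, mul_zero]
    refine (hasDerivAt_const t (0 : ℝ)).congr_of_eventuallyEq ?_
    filter_upwards [gt_mem_nhds h] with s hs
    rw [max_eq_left hs.le]; norm_num
  · rw [max_self, mul_zero, hasDerivAt_iff_isLittleO]
    simp only [max_self, sub_zero, smul_zero]
    refine Asymptotics.IsBigO.trans_isLittleO (g := fun x : ℝ => x ^ 2) ?_ ?_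
    · refine Asymptotics.IsBigO.of_bound 1 (Filter.Eventually.of_forall fun x => ?_)
      rw [one_mul, zero_pow two_ne_zero, sub_zero, norm_pow, norm_pow]
      gcongr
      rw [Real.norm_eq_abs, Real.norm_eq_abs, abs_of_nonneg (le_max_left _ _)]
      exact max_le (abs_nonneg _) (le_abs_self _)
    · exact Asymptotics.isLittleO_pow_id (by norm_num)
  · rw [max_eq_right h.le]
    have := hasDerivAt_pow 2 t
    simp only [Nat.cast_ofNat, Nat.add_one_sub_one, pow_one] at this
    refine this.congr_of_eventuallyEq ?_
    filter_upwards [lt_mem_nhds h] with s hs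
    rw [max_eq_right hs.le]

lemma hasDerivAt_wt (x : ℝ) : HasDerivAt wt (wtDeriv x) x := by
  have h1 : HasDerivAt (fun x : ℝ => x * (1 - x)) (1 - 2 * x) x := by
    have := (hasDerivAt_id' x).mul ((hasDerivAt_id' x).const_sub 1)
    exact this.congr_deriv (by ring)
  exact (hasDerivAt_max_sq _).comp x h1

lemma wt_nonneg (x : ℝ) : 0 ≤ wt x := sq_nonneg _

lemma max_mul_one_sub_le (x : ℝ) : max 0 (x * (1 - x)) ≤ 1 / 4 :=
  max_le (by norm_num) (by nlinarith [sq_nonneg (x - 1 / 2)])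

lemma wt_le (x : ℝ) : wt x ≤ 1 := by
  have h1 := max_mul_one_sub_le x
  have h2 : 0 ≤ max 0 (x * (1 - x)) := le_max_left _ _
  rw [wt]
  nlinarith

lemma wt_of_le {x : ℝ} (hx : x ≤ 0) : wt x = 0 := by
  rw [wt, max_eq_left (by nlinarith)]; norm_num

lemma wt_of_ge {x : ℝ} (hx : 1 ≤ x) : wt x = 0 := by
  rw [wt, max_eq_left (by nlinarith)]; norm_num

lemma wt_one_sub (x : ℝ) : wt (1 - x) = wt x := by
  rw [wt, wt]; congr 2; ring

lemma wtDeriv_eq (x : ℝ) : wtDeriv x =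
    2 * max 0 (min x 1) * (1 - max 0 (min x 1)) * (1 - 2 * max 0 (min x 1)) := by
  rw [wtDeriv]
  rcases le_total x 0 with h | h
  · rw [max_eq_left (by nlinarith), min_eq_left (by linarith), max_eq_left h]; ring
  · rcases le_total x 1 with h1 | h1
    · rw [max_eq_right (by nlinarith), min_eq_left h1, max_eq_right h]; ring
    · rw [max_eq_left (by nlinarith), min_eq_right h1, max_eq_right zero_le_one]; ring

lemma abs_wtDeriv_sub_le (x y : ℝ) : |wtDeriv x - wtDeriv y| ≤ 14 * |x - y| := by
  rw [wtDeriv_eq, wtDeriv_eq]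
  set c := max 0 (min x 1) with hc
  set d := max 0 (min y 1) with hd
  have hc0 : 0 ≤ c := le_max_left _ _
  have hd0 : 0 ≤ d := le_max_left _ _
  have hc1 : c ≤ 1 := max_le zero_le_one (min_le_right _ _)
  have hd1 : d ≤ 1 := max_le zero_le_one (min_le_right _ _)
  have hcd : |c - d| ≤ |x - y| := by
    rw [hc, hd, max_comm 0, max_comm 0]
    refine (abs_max_sub_max_le_abs (min x 1) (min y 1) 0).trans ?_
    simpa using abs_min_sub_min_le_max x 1 y 1
  have e : 2 * c * (1 - c) * (1 - 2 * c) - 2 * d * (1 - d) * (1 - 2 * d) =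
      (2 - 6 * (c + d) + 4 * (c ^ 2 + c * d + d ^ 2)) * (c - d) := by ring
  rw [e, abs_mul]
  refine mul_le_mul ?_ hcd (abs_nonneg _) (by norm_num)
  rw [abs_le]
  constructor <;> nlinarith [mul_nonneg hc0 hd0]

lemma abs_wtDeriv_le (x : ℝ) : |wtDeriv x| ≤ 1 := by
  rw [wtDeriv_eq]
  set c := max 0 (min x 1) with hc
  have hc0 : 0 ≤ c := le_max_left _ _
  have hc1 : c ≤ 1 := max_le zero_le_one (min_le_right _ _)
  have h1 : c * (1 - c) ≤ 1 / 4 := by nlinarith [sq_nonneg (c - 1 / 2)]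
  have h2 : 0 ≤ c * (1 - c) := by nlinarith
  rw [abs_le]
  constructor <;> nlinarith

lemma continuous_wtDeriv : Continuous wtDeriv := by
  unfold wtDeriv; fun_prop

lemma continuous_wt : Continuous wt := by
  unfold wt; fun_prop

/-- The complex-valued cutoff. -/
noncomputable def wtc (x : ℝ) : ℂ := wt x

lemma isWeight_wtc : IsWeight wtc (fun x => (wtDeriv x : ℂ)) 1 1 where
  pos := one_pos
  one_le := le_rfl
  hasDeriv x := (hasDerivAt_wt x).ofReal_comp
  cont := Complex.continuous_ofReal.comp continuous_wtDeriv
  zero_left x hx := by simp [wtc, wt_of_le hx]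
  zero_right x hx := by simp [wtc, wt_of_ge hx]
  bound x := by
    rw [wtc, Complex.norm_real, Real.norm_of_nonneg (wt_nonneg x)]; exact wt_le x
  bound' x := by
    rw [Complex.norm_real, Real.norm_eq_abs]; simpa using abs_wtDeriv_le x

lemma abs_second_diff_wt_le (x t : ℝ) (ht : 0 ≤ t) :
    |(wt x - wt (x + t)) - (wt (x + t) - wt (x + t + t))| ≤ 14 * t ^ 2 := by
  have := Convex.norm_image_sub_le_of_norm_hasDerivWithin_le (s := Set.univ)
    (f := fun y => wt y - wt (y + t)) (f' := fun y => wtDeriv y - wtDeriv (y + t))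
    (C := 14 * t) (x := x + t) (y := x) (fun z _ => by
      refine HasDerivAt.hasDerivWithinAt ?_
      exact (hasDerivAt_wt z).sub ((hasDerivAt_wt (z + t)).comp_add_const z t))
    (fun z _ => by
      have := abs_wtDeriv_sub_le z (z + t)
      rw [sub_add_cancel_left, abs_neg, abs_of_nonneg ht] at this
      rwa [Real.norm_eq_abs])
    convex_univ trivial trivial
  rw [Real.norm_eq_abs, Real.norm_eq_abs, sub_add_cancel_left, abs_neg, abs_of_nonneg ht] at this
  calc _ ≤ _ := this
    _ = _ := by ring

/-- The smooth exponential sum `∑ w(n/N) e(nθ)`. -/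
noncomputable def wtSum (N : ℕ) (θ : ℝ) : ℂ := ∑ n ∈ range N, wtc (n / N) * ex (n * θ)

lemma wtSum_add_int (N : ℕ) (θ : ℝ) (k : ℤ) : wtSum N (θ + k) = wtSum N θ := by
  refine sum_congr rfl fun n _ => ?_
  have : (n * (θ + k) : ℝ) = n * θ + (n * k : ℤ) := by push_cast; ring
  rw [this, ex_add_int]

lemma norm_wtSum_le (N : ℕ) (θ : ℝ) : ‖wtSum N θ‖ ≤ N := by
  refine (norm_sum_le _ _).trans ?_
  calc _ ≤ ∑ n ∈ range N, (1 : ℝ) := sum_le_sum fun n _ => by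
        rw [norm_mul, norm_ex, mul_one]; exact isWeight_wtc.bound _
    _ = N := by simp

lemma norm_wtSum_le_div {N : ℕ} (hN : 1 ≤ N) {θ δ : ℝ} (hδ : 0 < δ) (hθ : δ ≤ |θ - round θ|) :
    ‖wtSum N θ‖ ≤ 1 / (N * δ ^ 2) := by
  have hN0 : (0 : ℝ) < N := by exact_mod_cast hN
  have hN1 : (1 : ℝ) ≤ N := by exact_mod_cast hN
  set f : ℕ → ℂ := fun n => wtc (n / N) with hf
  set g : ℕ → ℂ := fun n => f n - f (n + 1) with hg
  set z := ex θ with hz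
  have e0 : wtSum N θ = ∑ n ∈ range N, f n * z ^ n := by
    refine sum_congr rfl fun n _ => ?_
    rw [ex_nsmul]
  have hfN : ∀ n, N ≤ n → f n = 0 := by
    intro n hn
    have : (1 : ℝ) ≤ n / N := by rw [one_le_div hN0]; exact_mod_cast hn
    exact isWeight_wtc.zero_right _ this
  have hf0 : f 0 = 0 := isWeight_wtc.zero_left _ (by simp)
  have e1 := sub_one_mul_sum_pow z f N
  have e2 := sub_one_mul_sum_pow z g N
  rw [hfN N le_rfl, hf0] at e1
  have hgN : g N = 0 := by simp only [hg, hfN N le_rfl, hfN (N + 1) (by omega), sub_zero]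
  rw [hgN] at e2
  have e3 : (z - 1) ^ 2 * wtSum N θ = z * (∑ n ∈ range N, (g n - g (n + 1)) * z ^ (n + 1) - g 0) := by
    rw [e0, sq, mul_assoc, e1]
    have : ∑ n ∈ range N, (f n - f (n + 1)) * z ^ (n + 1) = z * ∑ n ∈ range N, g n * z ^ n := by
      rw [mul_sum]
      refine sum_congr rfl fun n _ => ?_
      simp only [hg]; ring
    rw [this]
    calc _ = z * ((z - 1) * ∑ n ∈ range N, g n * z ^ n) := by ring
      _ = _ := by rw [e2]; ring
  have hg2 : ∀ n, ‖g n - g (n + 1)‖ ≤ 14 * (1 / (N : ℝ)) ^ 2 := by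
    intro n
    have := abs_second_diff_wt_le (n / N) (1 / N) (by positivity)
    have a1 : (n / N : ℝ) + 1 / N = ((n + 1 : ℕ) : ℝ) / N := by push_cast; ring
    have a2 : ((n + 1 : ℕ) : ℝ) / N + 1 / N = ((n + 1 + 1 : ℕ) : ℝ) / N := by push_cast; ring
    rw [a1, a2] at this
    simp only [hg, hf, wtc]
    rw [← Complex.ofReal_sub, ← Complex.ofReal_sub, ← Complex.ofReal_sub, Complex.norm_real]
    exact this
  have hg0 : ‖g 0‖ ≤ (1 / (N : ℝ)) ^ 2 := by
    simp only [hg]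
    rw [hf0, zero_sub, norm_neg]
    simp only [hf, wtc]
    rw [Complex.norm_real, Real.norm_of_nonneg (wt_nonneg _), wt]
    have : max 0 (((0 + 1 : ℕ) : ℝ) / N * (1 - ((0 + 1 : ℕ) : ℝ) / N)) ≤ 1 / N := by
      push_cast
      have : 0 ≤ 1 / (N : ℝ) := by positivity
      refine max_le this ?_
      nlinarith
    gcongr
  have hR : ‖(z - 1) ^ 2 * wtSum N θ‖ ≤ 16 / N := by
    rw [e3, norm_mul, hz, norm_ex, one_mul, ← hz]
    refine (norm_sub_le _ _).trans ?_
    have : ‖∑ n ∈ range N, (g n - g (n + 1)) * z ^ (n + 1)‖ ≤ 14 / N := by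
      refine (norm_sum_le _ _).trans ?_
      calc _ ≤ ∑ n ∈ range N, 14 * (1 / (N : ℝ)) ^ 2 := by
            refine sum_le_sum fun n _ => ?_
            rw [norm_mul, norm_pow, hz, norm_ex, one_pow, mul_one]
            exact hg2 n
        _ = _ := by
            rw [sum_const, card_range, nsmul_eq_mul]; field_simp
    have h3 : (1 / (N : ℝ)) ^ 2 ≤ 1 / N := by
      rw [sq]
      exact mul_le_of_le_one_left (by positivity) (by rw [div_le_one hN0]; exact hN1)
    calc _ ≤ 14 / (N : ℝ) + 1 / N := add_le_add this (hg0.trans h3)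
      _ ≤ 16 / N := by rw [← add_div]; gcongr; norm_num
  rw [norm_mul, norm_pow] at hR
  have h4 := four_mul_abs_sub_round_le θ
  have h5 : (4 * δ) ^ 2 ≤ ‖z - 1‖ ^ 2 := by gcongr; linarith
  rw [le_div_iff₀ (by positivity)]
  have h6 : (4 * δ) ^ 2 * ‖wtSum N θ‖ ≤ 16 / N := (mul_le_mul_of_nonneg_right h5 (norm_nonneg _)).trans hR
  rw [le_div_iff₀ hN0] at h6
  nlinarith

end LinnikGRH

namespace LinnikGRH
open Finset

lemma norm_wtSum_add_le {N q q' : ℕ} (hN : 1 ≤ N) (hq : 1 ≤ q) (hq' : 1 ≤ q') {β : ℝ}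
    (hβ : |β| ≤ 1 / (2 * q * q')) {ρ : ℝ} {k : ℤ} (hρ : ρ = k / (q' * q : ℕ))
    (hk : ¬ ((q' * q : ℕ) : ℤ) ∣ k) : ‖wtSum N (β + ρ)‖ ≤ 4 * q ^ 2 * q' ^ 2 / N := by
  have h1 := abs_sub_round_ge (by positivity) hρ hk
  have h2 : 1 / (2 * q * q' : ℝ) ≤ |(β + ρ) - round (β + ρ)| := by
    have h3 := round_le ρ (round (β + ρ))
    have h4 : |ρ - round (β + ρ)| ≤ |(β + ρ) - round (β + ρ)| + |β| := by
      have := abs_sub ((β + ρ) - round (β + ρ)) β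
      rwa [show (β + ρ) - round (β + ρ) - β = ρ - round (β + ρ) by ring] at this
    have h5 : 1 / ((q' * q : ℕ) : ℝ) = 2 * (1 / (2 * q * q' : ℝ)) := by
      push_cast; field_simp
    linarith
  refine (norm_wtSum_le_div hN (by positivity) h2).trans_eq ?_
  field_simp
  norm_num

lemma sum_model_wtc_mul_ex (N Q : ℕ) (α : ℝ) :
    ∑ n ∈ range N, model Q n * wtc (n / N) * ex (n * α) =
      ∑ x ∈ farey Q, (ArithmeticFunction.moebius x.1 / x.1.totient : ℂ) * wtSum N (α + x.2 / x.1) := by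
  simp only [wtSum, mul_sum]
  rw [sum_comm]
  refine sum_congr rfl fun n _ => ?_
  have := model_eq Q n
  rw [this, sum_mul, sum_mul]
  refine sum_congr rfl fun x _ => ?_
  rw [mul_add, ex_add]
  push_cast
  ring

lemma norm_sum_model_wtc_mul_ex_sub_le {N Q q : ℕ} (hN : 1 ≤ N) (hq : 1 ≤ q) {a : ℤ}
    (ha : Int.gcd a q = 1) {β : ℝ} (hβ : |β| * (2 * q * Q) ≤ 1) (hqN : q ^ 2 ≤ N) :
    ‖∑ n ∈ range N, model Q n * wtc (n / N) * ex (n * (β + a / q)) -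
      (if q ≤ Q then (ArithmeticFunction.moebius q / q.totient : ℂ) * wtSum N β else 0)‖ ≤
      4 * (Q : ℝ) ^ 3 := by
  have hq0 : (q : ℝ) ≠ 0 := by positivity
  have hNR : (0 : ℝ) < N := by exact_mod_cast hN
  have hqN' : (q : ℝ) ^ 2 ≤ N := by exact_mod_cast hqN
  have hoff : ∀ x ∈ farey Q, ¬ ((x.1 * q : ℕ) : ℤ) ∣ x.2 * q + a * x.1 →
      ‖(ArithmeticFunction.moebius x.1 / x.1.totient : ℂ) * wtSum N (β + a / q + x.2 / x.1)‖ ≤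
        1 / (x.1.totient : ℝ) * (4 * (x.1 : ℝ) ^ 2) := by
    intro x hx hnd
    obtain ⟨⟨hx1, hxQ⟩, -, -⟩ := mem_farey.mp hx
    have hx0 : (x.1 : ℝ) ≠ 0 := by positivity
    have hxQ' : (x.1 : ℝ) ≤ Q := by exact_mod_cast hxQ
    rw [norm_mul]
    refine mul_le_mul (norm_moebius_div_totient_le _) ?_ (norm_nonneg _) (by positivity)
    rw [add_assoc]
    refine (norm_wtSum_add_le hN hq hx1 ?_ (k := x.2 * q + a * x.1) ?_ hnd).trans ?_
    · rw [le_div_iff₀ (by positivity)]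
      refine le_trans ?_ hβ
      gcongr
    · push_cast
      field_simp
      ring
    · rw [div_le_iff₀ hNR]
      nlinarith [sq_nonneg (x.1 : ℝ)]
  have htot : ∑ x ∈ farey Q, 1 / (x.1.totient : ℝ) * (4 * (x.1 : ℝ) ^ 2) ≤ 4 * (Q : ℝ) ^ 3 := by
    rw [sum_farey_totient_le Q fun r => 4 * (r : ℝ) ^ 2]
    calc _ ≤ ∑ r ∈ Icc 1 Q, 4 * (Q : ℝ) ^ 2 := by
          gcongr with r hr
          exact (mem_Icc.mp hr).2
      _ = _ := by
          rw [sum_const, Nat.card_Icc, nsmul_eq_mul, Nat.add_sub_cancel]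
          ring
  rw [sum_model_wtc_mul_ex]
  split_ifs with hqQ
  · obtain ⟨x₀, hx₀m, hx₀q, k, hk⟩ := exists_farey_eq hq hqQ ha
    have e : wtSum N (β + a / q + x₀.2 / x₀.1) = wtSum N β := by
      have : β + a / q + x₀.2 / x₀.1 = β + k := by
        have : ((x₀.2 + a : ℤ) : ℝ) = ((q * k : ℤ) : ℝ) := by rw [hk]
        push_cast at this
        rw [hx₀q]
        field_simp
        linarith
      rw [this, wtSum_add_int]
    rw [← add_sum_erase _ _ hx₀m, e, hx₀q, add_sub_cancel_left]
    refine (norm_sum_le _ _).trans (le_trans ?_ htot)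
    refine (sum_le_sum (s := (farey Q).erase x₀) fun x hx => ?_).trans
      (sum_le_sum_of_subset_of_nonneg (erase_subset x₀ _) fun x _ _ => by positivity)
    obtain ⟨hne, hx'⟩ := mem_erase.mp hx
    exact hoff x hx' (not_dvd_of_mem_farey hq ha hx₀m hx₀q ⟨k, hk⟩ hx' hne)
  · rw [sub_zero]
    refine (norm_sum_le _ _).trans (le_trans (sum_le_sum fun x hx => hoff x hx fun h => ?_) htot)
    have := (eq_of_mem_farey_of_dvd hq ha hx h).1
    have := (mem_farey.mp hx).1.2
    omega

lemma le_two_pow_mul_totient (q : ℕ) : (q : ℝ) ≤ 2 ^ q.primeFactors.card * q.totient := by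
  have h := Nat.totient_eq_mul_prod_factors q
  have h2 : (q.totient : ℝ) = q * ∏ p ∈ q.primeFactors, (1 - (p : ℝ)⁻¹) := by
    have := congrArg (fun x : ℚ => (x : ℝ)) h
    push_cast at this
    exact this
  have h3 : (1 / 2 : ℝ) ^ q.primeFactors.card ≤ ∏ p ∈ q.primeFactors, (1 - (p : ℝ)⁻¹) := by
    rw [← prod_const]
    refine prod_le_prod (fun _ _ => by norm_num) fun p hp => ?_
    have : (2 : ℝ) ≤ p := by exact_mod_cast (Nat.prime_of_mem_primeFactors hp).two_le
    have : (p : ℝ)⁻¹ ≤ 2⁻¹ := by gcongr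
    linarith
  calc (q : ℝ) = 2 ^ q.primeFactors.card * (q * (1 / 2 : ℝ) ^ q.primeFactors.card) := by
        rw [one_div, inv_pow]; field_simp
    _ ≤ _ := by rw [h2]; gcongr

/-- The level of the singular series model. -/
noncomputable def lev (N : ℕ) : ℕ := ⌊(N : ℝ) ^ (999 / 4000 : ℝ)⌋₊

lemma lev_le (N : ℕ) : (lev N : ℝ) ≤ (N : ℝ) ^ (999 / 4000 : ℝ) := Nat.floor_le (by positivity)

lemma lt_lev_add_one (N : ℕ) : (N : ℝ) ^ (999 / 4000 : ℝ) < lev N + 1 := Nat.lt_floor_add_one _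

lemma one_le_lev {N : ℕ} (hN : 1 ≤ N) : 1 ≤ lev N := by
  rw [lev, Nat.one_le_floor_iff]
  exact Real.one_le_rpow (by exact_mod_cast hN) (by norm_num)

/-- The weighted difference between the von Mangoldt function and its model. -/
noncomputable def err (N : ℕ) (n : ℕ) : ℝ :=
  (ArithmeticFunction.vonMangoldt n - model (lev N) n) * wt (n / N)

noncomputable def errSum (N : ℕ) (α : ℝ) : ℂ := ∑ n ∈ range N, (err N n : ℂ) * ex (n * α)

lemma hasDerivAt_ex_mul (c x : ℝ) :
    HasDerivAt (fun x : ℝ => ex (c * x)) (2 * Real.pi * c * Complex.I * ex (c * x)) x := by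
  have h1 : HasDerivAt (fun x : ℝ => (2 * Real.pi * (c * x : ℝ) * Complex.I : ℂ))
      (2 * Real.pi * c * Complex.I) x := by
    have := ((Complex.ofRealCLM.hasDerivAt (x := x)).const_mul (2 * Real.pi * c : ℂ)).mul_const Complex.I
    refine (this.congr_deriv (by simp)).congr_of_eventuallyEq (Filter.Eventually.of_forall fun y => ?_)
    simp
    ring
  exact h1.cexp.congr_deriv (by rw [ex]; ring)

lemma isWeight_wtc_mul_ex (c : ℝ) :
    IsWeight (fun x => wtc x * ex (c * x)) (fun x => (wtDeriv x : ℂ) * ex (c * x) +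
      wtc x * (2 * Real.pi * c * Complex.I * ex (c * x))) 1 (1 + 2 * Real.pi * |c|) := by
  refine isWeight_wtc.mul (v' := fun x => 2 * Real.pi * c * Complex.I * ex (c * x)) (by positivity)
    (hasDerivAt_ex_mul c) ?_ (fun x => (norm_ex _).le) fun x => ?_
  · unfold ex; fun_prop
  · rw [norm_mul, norm_ex]
    simp [abs_of_pos Real.pi_pos]

section
variable (GRH : ∀ (q : ℕ) [NeZero q] (χ : DirichletCharacter ℂ q) (s : ℂ),
      0 < s.re → s.re < 1 → DirichletCharacter.LFunction χ s = 0 → s.re = 1 / 2)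
include GRH

lemma exists_norm_errSum_le : ∃ C : ℝ, 0 < C ∧ ∀ N : ℕ, 16 ≤ N → ∀ α : ℝ,
    ‖errSum N α‖ ≤ C * (N : ℝ) ^ (3 / 4 + 1 / 2000 : ℝ) := by
  obtain ⟨C₁, hC₁, hω⟩ := exists_pow_card_primeFactors_le 2 (1 / 1000) (by norm_num) (by norm_num)
  set K : ℝ := 2000000 / (1 / 10000 : ℝ) ^ 3 with hK
  refine ⟨K * 8 + 8 + 4 + C₁, by positivity, fun N hN α => ?_⟩
  have hN1 : 1 ≤ N := by omega
  have hNR : (1 : ℝ) ≤ N := by exact_mod_cast hN1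
  have hN0 : (0 : ℝ) < N := by linarith
  set Q := lev N with hQ
  set X : ℝ := (N : ℝ) ^ (3 / 4 + 1 / 2000 : ℝ) with hX
  have hs : 0 < Nat.sqrt N := Nat.sqrt_pos.mpr hN1
  obtain ⟨r, hr, hrs⟩ := Real.exists_rat_abs_sub_le_and_den_le α hs
  set q := r.den with hq
  have hq1 : 1 ≤ q := r.den_pos
  have : NeZero q := ⟨by omega⟩
  have hq1R : (1 : ℝ) ≤ q := by exact_mod_cast hq1
  set a := r.num with ha
  have hac : Int.gcd a q = 1 := r.reduced
  have hrq : (r : ℝ) = a / q := by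
    rw [ha, hq]; exact_mod_cast (Rat.num_div_den r).symm
  set β := α - r with hβ
  have hα : α = β + a / q := by rw [← hrq, hβ]; ring
  have hqN : q ^ 2 ≤ N := by
    rw [sq]; exact (Nat.mul_le_mul hrs hrs).trans (Nat.sqrt_le N)
  have hsq : Real.sqrt N ≤ Nat.sqrt N + 1 := by
    rw [Real.sqrt_le_left (by positivity)]
    have := Nat.lt_succ_sqrt N
    rw [← sq] at this
    exact_mod_cast this.le
  have hsN : Real.sqrt N * Real.sqrt N = N := Real.mul_self_sqrt hN0.le
  have hsN0 : 0 < Real.sqrt N := Real.sqrt_pos.mpr hN0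
  have hs4 : 4 ≤ Real.sqrt N := by
    rw [Real.le_sqrt (by norm_num) hN0.le]
    norm_num; exact_mod_cast hN
  have hqs : (q : ℝ) ≤ Real.sqrt N := by
    rw [Real.le_sqrt (by positivity) hN0.le]; exact_mod_cast hqN
  have hβq : |β| * q * Real.sqrt N ≤ 1 := by
    rw [le_div_iff₀ (by positivity)] at hr
    calc _ = |β| * (Real.sqrt N * q) := by ring
      _ ≤ |β| * ((Nat.sqrt N + 1) * q) := by gcongr
      _ ≤ 1 := hr
  have hQs : 2 * (Q : ℝ) ≤ Real.sqrt N := by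
    have h1 : (Q : ℝ) ≤ (N : ℝ) ^ (1 / 4 : ℝ) :=
      (lev_le N).trans (Real.rpow_le_rpow_of_exponent_le hNR (by norm_num))
    have h2 : (N : ℝ) ^ (1 / 4 : ℝ) * (N : ℝ) ^ (1 / 4 : ℝ) = Real.sqrt N := by
      rw [← Real.rpow_add hN0, Real.sqrt_eq_rpow]; norm_num
    have h3 : 2 ≤ (N : ℝ) ^ (1 / 4 : ℝ) := by
      by_contra hcon
      have : 0 < (N : ℝ) ^ (1 / 4 : ℝ) := by positivity
      nlinarith
    nlinarith
  have hV := norm_sum_model_wtc_mul_ex_sub_le (Q := Q) hN1 hq1 hac (β := β) (by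
    calc |β| * (2 * q * Q) = |β| * q * (2 * Q) := by ring
      _ ≤ |β| * q * Real.sqrt N := by gcongr
      _ ≤ 1 := hβq) hqN
  rw [← hα] at hV
  set B : ℝ := 1 + 2 * Real.pi * |N * β| with hB
  have hW := isWeight_wtc_mul_ex (N * β)
  rw [← hB] at hW
  have hU := norm_sum_twist_sub_le GRH (η := 1 / 10000) (by norm_num) (by norm_num) hac hW hN1
  have hI := hW.norm_sum_sub_integral_le hN1
  set J : ℂ := ∫ x in (0 : ℝ)..1, wtc x * ex (N * β * x) with hJ
  have hNb : ∀ n : ℕ, (N * β * (n / N) : ℝ) = n * β := fun n => by field_simp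
  have hB1 : 1 ≤ B := by rw [hB]; have := Real.pi_pos; linarith [show 0 ≤ 2 * Real.pi * |N * β| by positivity]
  have hBq : B * q ≤ 8 * Real.sqrt N := by
    rw [hB, abs_mul, abs_of_pos hN0]
    have : (1 + 2 * Real.pi * (N * |β|)) * q = q + 2 * Real.pi * Real.sqrt N * (|β| * q * Real.sqrt N) := by
      linear_combination (-2 * Real.pi * |β| * q) * hsN
    rw [this]
    have h3 : 2 * Real.pi * Real.sqrt N * (|β| * q * Real.sqrt N) ≤ 2 * Real.pi * Real.sqrt N * 1 := by
      gcongr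
    nlinarith [Real.pi_lt_d2]
  have hX1 : Real.sqrt N ≤ X := by
    rw [hX, Real.sqrt_eq_rpow]
    exact Real.rpow_le_rpow_of_exponent_le hNR (by norm_num)
  have hE1 : ‖∑ n ∈ range N, (ArithmeticFunction.vonMangoldt n : ℂ) * wtc (n / N) * ex (n * α) -
      (ArithmeticFunction.moebius q / q.totient : ℂ) * (N * J)‖ ≤ K * 8 * X := by
    have e : ∑ n ∈ range N, (ArithmeticFunction.vonMangoldt n : ℂ) * wtc (n / N) * ex (n * α) =
        ∑ n ∈ range N, (ArithmeticFunction.vonMangoldt n : ℂ) *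
          (wtc (n / N) * ex (N * β * (n / N))) * ex (n * (a / q)) := by
      refine sum_congr rfl fun n _ => ?_
      rw [hNb, hα, mul_add, ex_add]
      ring
    rw [e]
    refine hU.trans ?_
    rw [mul_one, mul_assoc K]
    gcongr
    calc (N * q * B : ℝ) ^ (1 / 2 + 1 / 10000 : ℝ) ≤ (8 * (N : ℝ) ^ (3 / 2 : ℝ)) ^ (1 / 2 + 1 / 10000 : ℝ) := by
          refine Real.rpow_le_rpow (by positivity) ?_ (by norm_num)
          rw [show (3 / 2 : ℝ) = 1 + 1 / 2 by norm_num, Real.rpow_add hN0, Real.rpow_one,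
            ← Real.sqrt_eq_rpow]
          nlinarith
      _ ≤ 8 * X := by
          rw [Real.mul_rpow (by norm_num) (by positivity), ← Real.rpow_mul hN0.le]
          gcongr
          · exact Real.rpow_le_self_of_one_le (by norm_num) (by norm_num)
          · exact Real.rpow_le_rpow_of_exponent_le hNR (by norm_num)
  have hφ : (0 : ℝ) < q.totient := by exact_mod_cast Nat.totient_pos.mpr hq1
  have hφ1 : ‖(ArithmeticFunction.moebius q / q.totient : ℂ)‖ ≤ 1 := by
    refine (norm_moebius_div_totient_le q).trans ?_
    rw [div_le_one hφ]
    exact_mod_cast Nat.totient_pos.mpr hq1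
  have hwt : wtSum N β = ∑ n ∈ range N, wtc (n / N) * ex (N * β * (n / N)) :=
    sum_congr rfl fun n _ => by rw [hNb]
  have hE2 : ‖(ArithmeticFunction.moebius q / q.totient : ℂ) * (N * J) -
      (ArithmeticFunction.moebius q / q.totient : ℂ) * wtSum N β‖ ≤ 8 * X := by
    rw [← mul_sub, norm_mul, hwt, norm_sub_rev]
    calc _ ≤ 1 * (1 * B) := mul_le_mul hφ1 hI (norm_nonneg _) zero_le_one
      _ ≤ B * q := by rw [one_mul, one_mul]; exact le_mul_of_one_le_right (by linarith) hq1R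
      _ ≤ 8 * X := hBq.trans (by linarith)
  have hE3 : ‖(ArithmeticFunction.moebius q / q.totient : ℂ) * wtSum N β -
      (if q ≤ Q then (ArithmeticFunction.moebius q / q.totient : ℂ) * wtSum N β else 0)‖ ≤ C₁ * X := by
    split_ifs with hqQ
    · rw [sub_self, norm_zero]; positivity
    · rw [sub_zero, norm_mul]
      have h1 : (q : ℝ) ≤ C₁ * (q : ℝ) ^ (1 / 1000 : ℝ) * q.totient :=
        (le_two_pow_mul_totient q).trans (by gcongr; exact hω q (by omega))
      have h2 : (N : ℝ) ^ (999 / 4000 : ℝ) ≤ q := by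
        refine (lt_lev_add_one N).le.trans ?_
        exact_mod_cast (show lev N + 1 ≤ q by omega)
      have h3 : (N : ℝ) ^ (999 / 4000 * (1 - 1 / 1000) : ℝ) ≤ C₁ * q.totient := by
        rw [Real.rpow_mul hN0.le]
        calc _ ≤ (q : ℝ) ^ (1 - 1 / 1000 : ℝ) := by gcongr
          _ ≤ _ := by
            rw [Real.rpow_sub (by linarith), Real.rpow_one, div_le_iff₀ (by positivity)]
            linarith
      calc _ ≤ 1 / (q.totient : ℝ) * N := mul_le_mul (norm_moebius_div_totient_le q) (norm_wtSum_le N β)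
            (norm_nonneg _) (by positivity)
        _ ≤ C₁ * X := by
          rw [div_mul_eq_mul_div, one_mul, div_le_iff₀ hφ]
          calc (N : ℝ) ≤ X * (N : ℝ) ^ (999 / 4000 * (1 - 1 / 1000) : ℝ) := by
                rw [hX, ← Real.rpow_add hN0]
                nth_rw 1 [← Real.rpow_one (N : ℝ)]
                exact Real.rpow_le_rpow_of_exponent_le hNR (by norm_num)
            _ ≤ X * (C₁ * q.totient) := by gcongr
            _ = _ := by ring
  have hE4 : 4 * (Q : ℝ) ^ 3 ≤ 4 * X := by
    gcongr
    calc (Q : ℝ) ^ 3 ≤ ((N : ℝ) ^ (999 / 4000 : ℝ)) ^ 3 := by gcongr; exact lev_le N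
      _ ≤ X := by
        rw [← Real.rpow_natCast, ← Real.rpow_mul hN0.le]
        exact Real.rpow_le_rpow_of_exponent_le hNR (by norm_num)
  have e : errSum N α = ∑ n ∈ range N, (ArithmeticFunction.vonMangoldt n : ℂ) * wtc (n / N) * ex (n * α) -
      ∑ n ∈ range N, model Q n * wtc (n / N) * ex (n * α) := by
    rw [errSum, ← sum_sub_distrib]
    refine sum_congr rfl fun n _ => ?_
    rw [err, wtc]
    push_cast
    ring
  rw [e]
  set S₁ := ∑ n ∈ range N, (ArithmeticFunction.vonMangoldt n : ℂ) * wtc (n / N) * ex (n * α)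
  set S₂ := ∑ n ∈ range N, model Q n * wtc (n / N) * ex (n * α)
  set M₁ := (ArithmeticFunction.moebius q / q.totient : ℂ) * (N * J)
  set M₂ := (ArithmeticFunction.moebius q / q.totient : ℂ) * wtSum N β
  set M₃ := if q ≤ Q then M₂ else 0
  have t1 := norm_sub_le_norm_sub_add_norm_sub S₁ M₁ S₂
  have t2 := norm_sub_le_norm_sub_add_norm_sub M₁ M₂ S₂
  have t3 := norm_sub_le_norm_sub_add_norm_sub M₂ M₃ S₂
  rw [norm_sub_rev M₃ S₂] at t3
  calc ‖S₁ - S₂‖ ≤ K * 8 * X + (8 * X + (C₁ * X + 4 * X)) := by linarith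
    _ = _ := by ring

end

end LinnikGRH

namespace LinnikGRH
open Finset BoundingSieve

lemma sum_moebius_filter {P k l : ℕ} (hP : Squarefree P) (hk : k ∣ P) (hl : l ∣ P) :
    ∑ d ∈ P.divisors with k ∣ d ∧ d ∣ l, ArithmeticFunction.moebius d =
      if k = l then ArithmeticFunction.moebius k else 0 := by
  have hP0 := hP.ne_zero
  by_cases hkl : k ∣ l
  · obtain ⟨m, rfl⟩ := hkl
    have hsq := hP.squarefree_of_dvd hl
    have hk0 : k ≠ 0 := by rintro rfl; simp at hsq
    have hm0 : m ≠ 0 := by rintro rfl; simp at hsq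
    have hc : k.Coprime m := Nat.coprime_of_squarefree_mul hsq
    have e : P.divisors.filter (fun d => k ∣ d ∧ d ∣ k * m) = m.divisors.image (k * ·) := by
      ext d
      simp only [mem_filter, Nat.mem_divisors, mem_image]
      constructor
      · rintro ⟨-, ⟨e, rfl⟩, h⟩
        exact ⟨e, ⟨Nat.dvd_of_mul_dvd_mul_left (Nat.pos_of_ne_zero hk0) h, hm0⟩, rfl⟩
      · rintro ⟨e, ⟨he, -⟩, rfl⟩
        have := Nat.mul_dvd_mul_left k he
        exact ⟨⟨this.trans hl, hP0⟩, dvd_mul_right _ _, this⟩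
    rw [e, sum_image fun a _ b _ h => Nat.eq_of_mul_eq_mul_left (Nat.pos_of_ne_zero hk0) h]
    have h1 : ∀ e ∈ m.divisors, ArithmeticFunction.moebius (k * e) =
        ArithmeticFunction.moebius k * ArithmeticFunction.moebius e := fun e he =>
      ArithmeticFunction.isMultiplicative_moebius.map_mul_of_coprime
        (hc.coprime_dvd_right (Nat.dvd_of_mem_divisors he))
    rw [sum_congr rfl h1, ← mul_sum]
    have h2 := congrArg (fun f => f m) ArithmeticFunction.moebius_mul_coe_zeta
    rw [ArithmeticFunction.coe_mul_zeta_apply, ArithmeticFunction.one_apply] at h2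
    rw [h2]
    have : k = k * m ↔ m = 1 := by
      constructor
      · intro h; exact (Nat.eq_of_mul_eq_mul_left (Nat.pos_of_ne_zero hk0) (by omega : k * 1 = k * m)).symm
      · rintro rfl; omega
    simp only [this]
    split_ifs <;> simp
  · rw [if_neg (by rintro rfl; exact hkl dvd_rfl), filter_false_of_mem, sum_empty]
    rintro d - ⟨h1, h2⟩
    exact hkl (h1.trans h2)

/-- The normalising sum in Selberg's sieve. -/
noncomputable def selbergSum (s : BoundingSieve) (R : ℕ) : ℝ :=
  ∑ l ∈ s.prodPrimes.divisors with l ≤ R, s.selbergTerms l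

/-- Selberg's optimal weights at level `R`. -/
noncomputable def selbergWeight (s : BoundingSieve) (R d : ℕ) : ℝ :=
  ArithmeticFunction.moebius d / (s.nu d * selbergSum s R) *
    ∑ l ∈ s.prodPrimes.divisors with l ≤ R ∧ d ∣ l, s.selbergTerms l

variable {s : BoundingSieve} {R : ℕ}

lemma selbergSum_pos (hR : 1 ≤ R) : 0 < selbergSum s R := by
  have h1 : 1 ∈ s.prodPrimes.divisors.filter (· ≤ R) := by
    simp [hR, s.prodPrimes_squarefree.ne_zero]
  refine sum_pos (fun l hl => selbergTerms_pos (Nat.dvd_of_mem_divisors (mem_filter.mp hl).1)) ⟨1, h1⟩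

lemma selbergWeight_one (hR : 1 ≤ R) : selbergWeight s R 1 = 1 := by
  have := selbergSum_pos (s := s) hR
  rw [selbergWeight, s.nu_mult.map_one, ArithmeticFunction.moebius_apply_one]
  simp only [one_dvd, and_true]
  rw [← selbergSum]
  push_cast
  field_simp

lemma selbergWeight_eq_zero {d : ℕ} (hd : R < d) : selbergWeight s R d = 0 := by
  rw [selbergWeight, filter_false_of_mem, sum_empty, mul_zero]
  rintro l hl ⟨h1, h2⟩
  have := Nat.le_of_dvd (Nat.pos_of_mem_divisors hl) h2
  omega

lemma abs_selbergWeight_le {W : ℝ} (hR : 1 ≤ R) {d : ℕ} (hd : d ∣ s.prodPrimes)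
    (hW : s.selbergTerms d ≤ W * s.nu d) : |selbergWeight s R d| ≤ W := by
  have hJ := selbergSum_pos (s := s) hR
  have hν := nu_pos_of_dvd_prodPrimes hd
  have hg := selbergTerms_pos hd
  have hP0 := s.prodPrimes_squarefree.ne_zero
  have hd0 : 0 < d := Nat.pos_of_dvd_of_pos hd (Nat.pos_of_ne_zero hP0)
  have h1 : ∑ l ∈ s.prodPrimes.divisors with l ≤ R ∧ d ∣ l, s.selbergTerms l ≤
      s.selbergTerms d * selbergSum s R := by
    rw [selbergSum, mul_sum]
    have : ∀ l ∈ s.prodPrimes.divisors.filter (fun l => l ≤ R ∧ d ∣ l),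
        s.selbergTerms l = s.selbergTerms d * s.selbergTerms (l / d) := by
      intro l hl
      obtain ⟨hl1, -, m, rfl⟩ := mem_filter.mp hl
      have hsq := s.prodPrimes_squarefree.squarefree_of_dvd (Nat.dvd_of_mem_divisors hl1)
      rw [Nat.mul_div_cancel_left _ hd0]
      exact selbergTerms_isMultiplicative.map_mul_of_coprime (Nat.coprime_of_squarefree_mul hsq)
    rw [sum_congr rfl this]
    have hinj : Set.InjOn (fun l => l / d) (s.prodPrimes.divisors.filter (fun l => l ≤ R ∧ d ∣ l) : Set ℕ) := by
      intro a ha b hb hab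
      simp only [coe_filter, Set.mem_ofPred_eq] at ha hb
      exact (Nat.div_left_inj ha.2.2 hb.2.2).mp hab
    rw [← sum_image (g := fun l => l / d) (f := fun m => s.selbergTerms d * s.selbergTerms m) hinj]
    refine sum_le_sum_of_subset_of_nonneg ?_ fun m hm _ =>
      (mul_pos hg (selbergTerms_pos (Nat.dvd_of_mem_divisors (mem_filter.mp hm).1))).le
    intro m hm
    obtain ⟨l, hl, rfl⟩ := mem_image.mp hm
    obtain ⟨hl1, hl2, hl3⟩ := mem_filter.mp hl
    refine mem_filter.mpr ⟨?_, (Nat.div_le_self _ _).trans hl2⟩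
    exact Nat.mem_divisors.mpr ⟨(Nat.div_dvd_of_dvd hl3).trans (Nat.dvd_of_mem_divisors hl1), hP0⟩
  have h0 : 0 ≤ ∑ l ∈ s.prodPrimes.divisors with l ≤ R ∧ d ∣ l, s.selbergTerms l :=
    sum_nonneg fun l hl => (selbergTerms_pos (Nat.dvd_of_mem_divisors (mem_filter.mp hl).1)).le
  have hμ : |(ArithmeticFunction.moebius d : ℝ)| ≤ 1 := by
    exact_mod_cast ArithmeticFunction.abs_moebius_le_one (n := d)
  rw [selbergWeight, abs_mul, abs_div, abs_of_pos (mul_pos hν hJ), abs_of_nonneg h0, div_mul_eq_mul_div,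
    div_le_iff₀ (mul_pos hν hJ)]
  calc _ ≤ 1 * (s.selbergTerms d * selbergSum s R) := by gcongr
    _ ≤ (W * s.nu d) * selbergSum s R := by rw [one_mul]; gcongr
    _ = _ := by ring

lemma sum_nu_mul_selbergWeight {k : ℕ} (hk : k ∣ s.prodPrimes) :
    (∑ d ∈ s.prodPrimes.divisors, if k ∣ d then s.nu d * selbergWeight s R d else 0) =
      if k ≤ R then ArithmeticFunction.moebius k * s.selbergTerms k / selbergSum s R else 0 := by
  have hP0 := s.prodPrimes_squarefree.ne_zero
  have e : ∀ d ∈ s.prodPrimes.divisors, (if k ∣ d then s.nu d * selbergWeight s R d else 0) =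
      ∑ l ∈ s.prodPrimes.divisors with l ≤ R, s.selbergTerms l / selbergSum s R *
        (if k ∣ d ∧ d ∣ l then ArithmeticFunction.moebius d else 0 : ℤ) := by
    intro d hd
    have hν := (nu_pos_of_dvd_prodPrimes (Nat.dvd_of_mem_divisors hd)).ne'
    split_ifs with hkd
    · rw [selbergWeight, ← filter_filter, sum_filter _ (fun l => s.selbergTerms l), mul_sum, mul_sum]
      refine sum_congr rfl fun l _ => ?_
      simp only [hkd, true_and]
      split_ifs
      · field_simp
      · simp
    · simp [hkd]
  rw [sum_congr rfl e, sum_comm]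
  simp only [← mul_sum]
  have e2 : ∀ l ∈ s.prodPrimes.divisors.filter (· ≤ R), s.selbergTerms l / selbergSum s R *
      ∑ d ∈ s.prodPrimes.divisors, ((if k ∣ d ∧ d ∣ l then ArithmeticFunction.moebius d else 0 : ℤ) : ℝ) =
      if k = l then ArithmeticFunction.moebius k * s.selbergTerms k / selbergSum s R else 0 := by
    intro l hl
    rw [← Int.cast_sum, ← sum_filter, sum_moebius_filter s.prodPrimes_squarefree hk
      (Nat.dvd_of_mem_divisors (mem_filter.mp hl).1)]
    split_ifs with h
    · rw [h]; ring
    · simp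
  rw [sum_congr rfl e2, sum_ite_eq]
  simp [hk, hP0]

lemma mainSum_selbergWeight (hR : 1 ≤ R) :
    s.mainSum (lambdaSquared (selbergWeight s R)) = 1 / selbergSum s R := by
  have hJ := selbergSum_pos (s := s) hR
  rw [mainSum_lambdaSquared_eq_sum_mul_sum_sq]
  have e : ∀ l ∈ s.prodPrimes.divisors, (s.selbergTerms l)⁻¹ *
      (∑ d ∈ s.prodPrimes.divisors, if l ∣ d then s.nu d * selbergWeight s R d else 0) ^ 2 =
      if l ≤ R then s.selbergTerms l / selbergSum s R ^ 2 else 0 := by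
    intro l hl
    have hlP := Nat.dvd_of_mem_divisors hl
    have hg := (selbergTerms_pos hlP).ne'
    rw [sum_nu_mul_selbergWeight hlP]
    split_ifs
    · have : (ArithmeticFunction.moebius l : ℝ) ^ 2 = 1 := by
        exact_mod_cast ArithmeticFunction.moebius_sq_eq_one_of_squarefree
          (s.prodPrimes_squarefree.squarefree_of_dvd hlP)
      rw [div_pow, mul_pow, this]
      field_simp
    · simp
  rw [sum_congr rfl e, ← sum_filter, ← sum_div, ← selbergSum]
  field_simp

lemma errSum_selbergWeight_le {W E : ℝ} (hR : 1 ≤ R) (hW0 : 0 ≤ W) (hE0 : 0 ≤ E)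
    (hW : ∀ d, d ∣ s.prodPrimes → d ≤ R → s.selbergTerms d ≤ W * s.nu d)
    (hE : ∀ d, d ∣ s.prodPrimes → d ≤ R ^ 2 → |s.rem d| ≤ E) :
    s.errSum (lambdaSquared (selbergWeight s R)) ≤ (R * W) ^ 2 * E := by
  have hP0 := s.prodPrimes_squarefree.ne_zero
  set D := s.prodPrimes.divisors with hD
  set w := selbergWeight s R with hw
  have habs : ∀ d ∈ D, |w d| ≤ if d ∈ Icc 1 R then W else 0 := by
    intro d hd
    have := Nat.pos_of_mem_divisors hd
    split_ifs with h
    · exact abs_selbergWeight_le hR (Nat.dvd_of_mem_divisors hd) (hW d (Nat.dvd_of_mem_divisors hd) (mem_Icc.mp h).2)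
    · rw [hw, selbergWeight_eq_zero (by rw [mem_Icc] at h; omega), abs_zero]
  have hsum : ∑ d ∈ D, |w d| ≤ R * W := by
    calc _ ≤ ∑ d ∈ D, if d ∈ Icc 1 R then W else 0 := sum_le_sum habs
      _ = ∑ d ∈ D.filter (· ∈ Icc 1 R), W := by rw [sum_filter]
      _ ≤ ∑ d ∈ Icc 1 R, W := sum_le_sum_of_subset_of_nonneg (fun d hd => (mem_filter.mp hd).2) fun _ _ _ => hW0
      _ = _ := by simp
  have hlam : ∀ d ∈ D, |lambdaSquared w d| * |s.rem d| ≤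
      ∑ d1 ∈ D, ∑ d2 ∈ D, if d = Nat.lcm d1 d2 then |w d1| * |w d2| * E else 0 := by
    intro d hd
    have hdP := Nat.dvd_of_mem_divisors hd
    have hsub : d.divisors ⊆ D := Nat.divisors_subset_of_dvd hP0 hdP
    rw [lambdaSquared]
    refine (mul_le_mul_of_nonneg_right (abs_sum_le_sum_abs _ _) (abs_nonneg _)).trans ?_
    rw [sum_mul]
    refine le_trans (sum_le_sum fun d1 _ => ?_)
      (sum_le_sum_of_subset_of_nonneg hsub fun d1 _ _ => sum_nonneg fun d2 _ => ?_)
    · refine (mul_le_mul_of_nonneg_right (abs_sum_le_sum_abs _ _) (abs_nonneg _)).trans ?_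
      rw [sum_mul]
      refine le_trans (sum_le_sum fun d2 _ => ?_)
        (sum_le_sum_of_subset_of_nonneg hsub fun d2 _ _ => ?_)
      · split_ifs with h
        · rw [abs_mul]
          by_cases h0 : w d1 = 0 ∨ w d2 = 0
          · rcases h0 with h0 | h0 <;> simp [h0]
          · push Not at h0
            refine mul_le_mul_of_nonneg_left (hE d hdP ?_) (by positivity)
            have h1 : d1 ≤ R := by
              by_contra hc
              exact h0.1 (selbergWeight_eq_zero (by omega))
            have h2 : d2 ≤ R := by
              by_contra hc
              exact h0.2 (selbergWeight_eq_zero (by omega))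
            have hd0 : d1 * d2 ≠ 0 := by
              intro hz
              rcases Nat.mul_eq_zero.mp hz with hz | hz <;>
              · rw [hz] at h
                simp at h
                rw [h] at hd
                simp [hD] at hd
            rw [h, sq]
            exact (Nat.le_of_dvd (Nat.pos_of_ne_zero hd0) (Nat.lcm_dvd_mul d1 d2)).trans (Nat.mul_le_mul h1 h2)
        · simp
      · split_ifs <;> positivity
    · split_ifs <;> positivity
  rw [BoundingSieve.errSum]
  calc _ ≤ ∑ d ∈ D, ∑ d1 ∈ D, ∑ d2 ∈ D, (if d = Nat.lcm d1 d2 then |w d1| * |w d2| * E else 0) :=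
        sum_le_sum hlam
    _ = ∑ d1 ∈ D, ∑ d2 ∈ D, ∑ d ∈ D, (if d = Nat.lcm d1 d2 then |w d1| * |w d2| * E else 0) := by
        rw [sum_comm]
        exact sum_congr rfl fun _ _ => sum_comm
    _ ≤ ∑ d1 ∈ D, ∑ d2 ∈ D, |w d1| * |w d2| * E := by
        refine sum_le_sum fun d1 _ => sum_le_sum fun d2 _ => ?_
        rw [sum_ite_eq']
        split_ifs
        · exact le_rfl
        · positivity
    _ = (∑ d ∈ D, |w d|) * (∑ d ∈ D, |w d|) * E := by
        rw [sum_mul_sum, sum_mul]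
        simp only [sum_mul]
    _ ≤ (R * W) * (R * W) * E := by gcongr
    _ = _ := by ring

/-- Selberg's upper bound sieve. -/
theorem siftedSum_le_selberg {W E : ℝ} (hR : 1 ≤ R) (hW0 : 0 ≤ W) (hE0 : 0 ≤ E)
    (hW : ∀ d, d ∣ s.prodPrimes → d ≤ R → s.selbergTerms d ≤ W * s.nu d)
    (hE : ∀ d, d ∣ s.prodPrimes → d ≤ R ^ 2 → |s.rem d| ≤ E) :
    s.siftedSum ≤ s.totalMass / selbergSum s R + (R * W) ^ 2 * E := by
  have h := siftedSum_le_mainSum_errSum_of_upperMoebius (s := s) _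
    (upperMoebius_lambdaSquared (selbergWeight s R) (selbergWeight_one hR))
  rw [mainSum_selbergWeight hR, mul_one_div] at h
  exact h.trans (by gcongr; exact errSum_selbergWeight_le hR hW0 hE0 hW hE)

end LinnikGRH

namespace LinnikGRH
open Finset

/-- The sum of `∏ p ∣ l, f p` over the squarefree `l ≤ x` divisible by no element of `A`. -/
noncomputable def sqfSum (f : ℕ → ℝ) (A : Finset ℕ) (x : ℕ) : ℝ :=
  ∑ l ∈ Icc 1 x with Squarefree l ∧ ∀ p ∈ A, ¬ p ∣ l, ∏ p ∈ l.primeFactors, f p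

section
variable {f : ℕ → ℝ} (hf : ∀ p : ℕ, p.Prime → 0 ≤ f p)
include hf

lemma prod_primeFactors_nonneg (l : ℕ) : 0 ≤ ∏ p ∈ l.primeFactors, f p :=
  prod_nonneg fun p hp => hf p (Nat.prime_of_mem_primeFactors hp)

lemma sqfSum_nonneg (A : Finset ℕ) (x : ℕ) : 0 ≤ sqfSum f A x :=
  sum_nonneg fun l _ => prod_primeFactors_nonneg hf l

lemma sqfSum_mono (A : Finset ℕ) {x y : ℕ} (h : x ≤ y) : sqfSum f A x ≤ sqfSum f A y := by
  refine sum_le_sum_of_subset_of_nonneg ?_ fun l _ _ => prod_primeFactors_nonneg hf l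
  intro l
  simp only [mem_filter, mem_Icc]
  rintro ⟨⟨h1, h2⟩, h3⟩
  exact ⟨⟨h1, by omega⟩, h3⟩

omit hf in
lemma sqfSum_eq_add {A : Finset ℕ} (hA : ∀ q ∈ A, q.Prime) {p : ℕ} (hp : p.Prime) (hpA : p ∉ A)
    (x : ℕ) :
    sqfSum f A x = sqfSum f (insert p A) x + f p * sqfSum f (insert p A) (x / p) := by
  rw [sqfSum, ← sum_filter_not_add_sum_filter _ (fun l => p ∣ l)]
  congr 1
  · rw [sqfSum, filter_filter]
    refine sum_congr (filter_congr fun l _ => ?_) fun _ _ => rfl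
    simp only [forall_mem_insert]
    tauto
  · rw [sqfSum, mul_sum, filter_filter]
    refine sum_nbij' (fun l => l / p) (fun m => p * m) ?_ ?_ ?_ ?_ ?_
    · intro l hl
      simp only [mem_filter, mem_Icc, forall_mem_insert] at hl ⊢
      obtain ⟨⟨h1, h2⟩, ⟨h3, h4⟩, ⟨m, rfl⟩⟩ := hl
      rw [Nat.mul_div_cancel_left _ hp.pos]
      have hsq := (Nat.squarefree_mul_iff).1 h3
      refine ⟨⟨?_, ?_⟩, hsq.2.2, ?_, fun q hq hd => h4 q hq (hd.mul_left p)⟩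
      · rcases Nat.eq_zero_or_pos m with h | h
        · simp [h] at h1
        · exact h
      · exact (Nat.le_div_iff_mul_le hp.pos).2 (by linarith)
      · exact (Nat.Prime.coprime_iff_not_dvd hp).1 hsq.1
    · intro m hm
      simp only [mem_filter, mem_Icc, forall_mem_insert] at hm ⊢
      obtain ⟨⟨h1, h2⟩, h3, h4, h5⟩ := hm
      have := (Nat.le_div_iff_mul_le hp.pos).1 h2
      refine ⟨⟨Nat.mul_pos hp.pos h1, by linarith⟩, ⟨?_, ?_⟩, dvd_mul_right _ _⟩
      · exact Nat.squarefree_mul_iff.2 ⟨(Nat.Prime.coprime_iff_not_dvd hp).2 h4, hp.squarefree, h3⟩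
      · intro q hq hd
        rcases (Nat.Prime.dvd_mul (hA q hq)).1 hd with h | h
        · exact hpA (((Nat.prime_dvd_prime_iff_eq (hA q hq) hp).1 h) ▸ hq)
        · exact h5 q hq h
    · intro l hl
      simp only [mem_filter] at hl
      exact Nat.mul_div_cancel' hl.2.2
    · intro m _
      exact Nat.mul_div_cancel_left _ hp.pos
    · intro l hl
      simp only [mem_filter, mem_Icc] at hl
      obtain ⟨⟨h1, h2⟩, ⟨h3, h4⟩, ⟨m, rfl⟩⟩ := hl
      have hsq := (Nat.squarefree_mul_iff).1 h3
      have hm : m ≠ 0 := by rintro rfl; simp at h1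
      have hpm : p ∉ m.primeFactors := fun h =>
        (Nat.Prime.coprime_iff_not_dvd hp).1 hsq.1 (Nat.dvd_of_mem_primeFactors h)
      rw [Nat.mul_div_cancel_left _ hp.pos, Nat.primeFactors_mul hp.ne_zero hm, hp.primeFactors,
        ← insert_eq, prod_insert hpm]

lemma sqfSum_le_prod_mul {A B : Finset ℕ} (hA : ∀ q ∈ A, q.Prime) (hB : ∀ q ∈ B, q.Prime)
    (hAB : Disjoint A B) (x : ℕ) :
    sqfSum f A x ≤ (∏ p ∈ B, (1 + f p)) * sqfSum f (A ∪ B) x := by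
  induction B using Finset.induction_on with
  | empty => simp
  | insert p B hpB ih =>
    rw [disjoint_insert_right] at hAB
    have hp : p.Prime := hB p (mem_insert_self _ _)
    have hB' : ∀ q ∈ B, q.Prime := fun q hq => hB q (mem_insert_of_mem hq)
    have hAB' : ∀ q ∈ A ∪ B, q.Prime := fun q hq =>
      (mem_union.1 hq).elim (hA q) (hB' q)
    refine (ih hB' hAB.2).trans ?_
    rw [prod_insert hpB, mul_comm (1 + f p), mul_assoc, union_insert]
    refine mul_le_mul_of_nonneg_left ?_ (prod_nonneg fun q hq => by linarith [hf q (hB' q hq)])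
    rw [sqfSum_eq_add hAB' hp (by simp [hAB.1, hpB]), add_mul, one_mul]
    gcongr
    · exact hf p hp
    · exact sqfSum_mono hf _ (Nat.div_le_self _ _)

lemma sqfSum_growth {A B : Finset ℕ} (hA : ∀ q ∈ A, q.Prime) (hB : ∀ q ∈ B, q.Prime)
    (hAB : Disjoint A B) {c : ℝ} (hc : 0 ≤ c)
    (h : ∃ K : ℝ, 0 ≤ K ∧ ∀ x : ℕ, 1 ≤ x → c * Real.log x - K ≤ sqfSum f (A ∪ B) x) :
    ∃ K : ℝ, 0 ≤ K ∧ ∀ x : ℕ, 1 ≤ x →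
      (c * ∏ p ∈ B, (1 + f p)) * Real.log x - K ≤ sqfSum f A x := by
  induction B using Finset.induction_on generalizing c with
  | empty => simpa using h
  | insert p B hpB ih =>
    rw [disjoint_insert_right] at hAB
    have hp : p.Prime := hB p (mem_insert_self _ _)
    have hB' : ∀ q ∈ B, q.Prime := fun q hq => hB q (mem_insert_of_mem hq)
    have hAB' : ∀ q ∈ A ∪ B, q.Prime := fun q hq =>
      (mem_union.1 hq).elim (hA q) (hB' q)
    have hfp := hf p hp
    rw [prod_insert hpB, ← mul_assoc]
    refine ih hB' hAB.2 (by positivity) ?_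
    obtain ⟨K, hK0, hK⟩ := h
    have hlogp : 0 ≤ Real.log (2 * p) :=
      Real.log_nonneg (by have : (1 : ℝ) ≤ p := by exact_mod_cast hp.one_le
                          linarith)
    refine ⟨K + f p * (c * Real.log (2 * p) + K), by positivity, fun x hx => ?_⟩
    rw [sqfSum_eq_add hAB' hp (by simp [hAB.1, hpB])]
    rw [union_insert] at hK
    have h1 := hK x hx
    have hx0 : (0 : ℝ) < x := by exact_mod_cast hx
    have hp0 : (0 : ℝ) < p := by exact_mod_cast hp.pos
    have h2 : c * Real.log x - c * Real.log (2 * p) - K ≤ sqfSum f (insert p (A ∪ B)) (x / p) := by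
      rcases Nat.lt_or_ge x p with hxp | hxp
      · have h3 := sqfSum_nonneg hf (insert p (A ∪ B)) (x / p)
        have h4 : Real.log x ≤ Real.log (2 * p) := by
          apply Real.log_le_log hx0
          have : (x : ℝ) ≤ p := by exact_mod_cast hxp.le
          linarith
        nlinarith [mul_le_mul_of_nonneg_left h4 hc]
      · have h3 : 1 ≤ x / p := (Nat.one_le_div_iff hp.pos).2 hxp
        refine le_trans ?_ (hK _ h3)
        have h4 : Real.log x ≤ Real.log (2 * p) + Real.log ((x / p : ℕ) : ℝ) := by
          have h5 : (0 : ℝ) < ((x / p : ℕ) : ℝ) := by exact_mod_cast h3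
          rw [← Real.log_mul (by positivity) h5.ne']
          apply Real.log_le_log hx0
          have h6 : x ≤ 2 * p * (x / p) := by
            have := Nat.lt_mul_div_succ x hp.pos
            nlinarith
          exact_mod_cast h6
        nlinarith [mul_le_mul_of_nonneg_left h4 hc]
    nlinarith [mul_le_mul_of_nonneg_left h2 hfp]

end

lemma sum_inv_primeFactors_eq_le {l : ℕ} (hl : Squarefree l) (x : ℕ) :
    ∑ n ∈ Icc 1 x with ∏ p ∈ n.primeFactors, p = l, (n : ℝ)⁻¹
      ≤ ∏ p ∈ l.primeFactors, 1 / ((p : ℝ) - 1) := by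
  have hl0 : l ≠ 0 := hl.ne_zero
  let φ : ℕ →* ℝ := ⟨⟨fun n => ((n : ℝ))⁻¹, by simp⟩, fun a b => by simp [mul_comm]⟩
  have hφ : ∀ n, φ n = (n : ℝ)⁻¹ := fun n => rfl
  obtain ⟨-, hs⟩ := EulerProduct.summable_and_hasSum_factoredNumbers_prod_filter_prime_geometric
    (f := φ) (fun {p} hp => by
      rw [hφ, norm_inv, Real.norm_natCast]
      exact inv_lt_one_of_one_lt₀ (by exact_mod_cast hp.one_lt)) l.primeFactors
  rw [filter_true_of_mem fun p hp => Nat.prime_of_mem_primeFactors hp] at hs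
  have hmem : ∀ n ∈ {n ∈ Icc 1 x | ∏ p ∈ n.primeFactors, p = l},
      l ∣ n ∧ n / l ∈ Nat.factoredNumbers l.primeFactors := by
    intro n hn
    simp only [mem_filter, mem_Icc] at hn
    have hd : l ∣ n := hn.2 ▸ Nat.prod_primeFactors_dvd n
    refine ⟨hd, ?_⟩
    have hne : n / l ≠ 0 := (Nat.div_pos (Nat.le_of_dvd (by omega) hd) (Nat.pos_of_ne_zero hl0)).ne'
    apply Nat.mem_factoredNumbers_of_primeFactors_subset hne
    intro p hp
    have hpp := Nat.prime_of_mem_primeFactors hp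
    refine Nat.mem_primeFactors.2 ⟨hpp, ?_, hl0⟩
    rw [← hn.2]
    apply dvd_prod_of_mem
    exact Nat.mem_primeFactors.2 ⟨hpp, (Nat.dvd_of_mem_primeFactors hp).trans (Nat.div_dvd_of_dvd hd), by omega⟩
  have h1 : ∑ n ∈ Icc 1 x with ∏ p ∈ n.primeFactors, p = l, ((n / l : ℕ) : ℝ)⁻¹
      ≤ ∏ p ∈ l.primeFactors, (1 - φ p)⁻¹ := by
    rw [← hs.tsum_eq, ← sum_attach]
    have hinj : Function.Injective (fun n : {n // n ∈ {n ∈ Icc 1 x | ∏ p ∈ n.primeFactors, p = l}} =>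
        (⟨n.1 / l, (hmem n.1 n.2).2⟩ : Nat.factoredNumbers l.primeFactors)) := by
      intro a b hab
      have : a.1 / l = b.1 / l := congrArg Subtype.val hab
      apply Subtype.ext
      rw [← Nat.mul_div_cancel' (hmem a.1 a.2).1, this, Nat.mul_div_cancel' (hmem b.1 b.2).1]
    refine le_trans (le_of_eq ?_) (hs.summable.sum_le_tsum
      ({n ∈ Icc 1 x | ∏ p ∈ n.primeFactors, p = l}.attach.image (fun n =>
        (⟨n.1 / l, (hmem n.1 n.2).2⟩ : Nat.factoredNumbers l.primeFactors)))
        fun n _ => by rw [hφ]; positivity)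
    rw [sum_image hinj.injOn]
    rfl
  calc _ = ∑ n ∈ Icc 1 x with ∏ p ∈ n.primeFactors, p = l, (l : ℝ)⁻¹ * ((n / l : ℕ) : ℝ)⁻¹ := by
        refine sum_congr rfl fun n hn => ?_
        rw [← mul_inv]
        congr 1
        exact_mod_cast (Nat.mul_div_cancel' (hmem n hn).1).symm
    _ ≤ (l : ℝ)⁻¹ * ∏ p ∈ l.primeFactors, (1 - φ p)⁻¹ := by
        rw [← mul_sum]
        gcongr
    _ = _ := by
        have : (l : ℝ) = ∏ p ∈ l.primeFactors, (p : ℝ) := by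
          conv_lhs => rw [← Nat.prod_primeFactors_of_squarefree hl]
          push_cast
          rfl
        rw [this, ← prod_inv_distrib, ← prod_mul_distrib]
        refine prod_congr rfl fun p hp => ?_
        have hp1 : (1 : ℝ) < p := by exact_mod_cast (Nat.prime_of_mem_primeFactors hp).one_lt
        have : (p : ℝ) - 1 ≠ 0 := by linarith
        have h2 : (p : ℝ) ≠ 0 := by linarith
        rw [hφ, ← mul_inv, mul_sub, mul_inv_cancel₀ h2, mul_one, one_div]

lemma log_le_sqfSum (x : ℕ) : Real.log x ≤ sqfSum (fun p => 1 / ((p : ℝ) - 1)) ∅ x := by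
  rcases Nat.eq_zero_or_pos x with rfl | hx
  · simp [sqfSum]
  have h1 : Real.log x ≤ ∑ n ∈ Icc 1 x, (n : ℝ)⁻¹ := by
    have h := log_add_one_le_harmonic x
    rw [harmonic_eq_sum_Icc] at h
    push_cast at h
    refine le_trans (Real.log_le_log (by exact_mod_cast hx) (by linarith)) h
  refine h1.trans ?_
  rw [sqfSum]
  rw [← sum_fiberwise_of_maps_to (s := Icc 1 x) (t := {l ∈ Icc 1 x | Squarefree l ∧ ∀ p ∈ (∅ : Finset ℕ), ¬ p ∣ l})
    (g := fun n => ∏ p ∈ n.primeFactors, p)]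
  · refine sum_le_sum fun l hl => ?_
    simp only [mem_filter] at hl
    exact sum_inv_primeFactors_eq_le hl.2.1 x
  · intro n hn
    simp only [mem_Icc] at hn
    have hd := Nat.prod_primeFactors_dvd n
    have hle := Nat.le_of_dvd (by omega) hd
    simp only [mem_filter, mem_Icc, notMem_empty, false_implies, implies_true, and_true]
    refine ⟨⟨Nat.pos_of_dvd_of_pos hd (by omega), by omega⟩, ?_⟩
    apply Finset.squarefree_prod_of_pairwise_isCoprime
    · intro p hp q hq hpq
      exact Nat.coprime_iff_isRelPrime.1 ((Nat.coprime_primes (Nat.prime_of_mem_primeFactors hp) (Nat.prime_of_mem_primeFactors hq)).2 hpq)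
    · exact fun p hp => (Nat.prime_of_mem_primeFactors hp).squarefree

/-- The weight `1 / (p - 2)` of the Selberg sieve for pairs of primes. -/
noncomputable def twinWt (p : ℕ) : ℝ := 1 / ((p : ℝ) - 2)

lemma twinWt_nonneg {p : ℕ} (hp : p.Prime) : 0 ≤ twinWt p := by
  have : (2 : ℝ) ≤ p := by exact_mod_cast hp.two_le
  exact one_div_nonneg.2 (by linarith)

lemma exists_sqfSum_two_ge :
    ∃ K : ℝ, 0 ≤ K ∧ ∀ x : ℕ, 1 ≤ x → 0.75 * Real.log x - K ≤ sqfSum twinWt {2} x := by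
  have hB : ∀ q ∈ ({3, 5, 7, 11, 13, 17, 19, 23} : Finset ℕ), q.Prime := by
    intro q hq
    simp only [mem_insert, mem_singleton] at hq
    rcases hq with h | h | h | h | h | h | h | h <;> rw [h] <;> norm_num
  have hA : ∀ q ∈ ({2} : Finset ℕ), q.Prime := by simp [Nat.prime_two]
  have hdis : Disjoint ({2} : Finset ℕ) {3, 5, 7, 11, 13, 17, 19, 23} := by decide
  set B : Finset ℕ := {3, 5, 7, 11, 13, 17, 19, 23} with hBdef
  have hAB : ∀ q ∈ {2} ∪ B, q.Prime := fun q hq => (mem_union.1 hq).elim (hA q) (hB q)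
  have hf1 : ∀ p : ℕ, p.Prime → 0 ≤ 1 / ((p : ℝ) - 1) := fun p hp => by
    have : (1 : ℝ) ≤ p := by exact_mod_cast hp.one_le
    exact one_div_nonneg.2 (by linarith)
  have hstart : ∀ x : ℕ, (∏ p ∈ {2} ∪ B, (1 + 1 / ((p : ℝ) - 1)))⁻¹ * Real.log x - 0
      ≤ sqfSum twinWt ({2} ∪ B) x := by
    intro x
    have h1 := (log_le_sqfSum x).trans
      (sqfSum_le_prod_mul hf1 (A := ∅) (by simp) hAB (disjoint_empty_left _) x)
    rw [empty_union] at h1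
    rw [sub_zero, inv_mul_le_iff₀ (prod_pos fun p hp => by linarith [hf1 p (hAB p hp)])]
    refine h1.trans (mul_le_mul_of_nonneg_left ?_
      (prod_nonneg fun p hp => by linarith [hf1 p (hAB p hp)]))
    refine sum_le_sum fun l hl => prod_le_prod (fun p hp => hf1 p (Nat.prime_of_mem_primeFactors hp))
      fun p hp => ?_
    simp only [mem_filter] at hl
    have hpp := Nat.prime_of_mem_primeFactors hp
    have hp2 : p ≠ 2 := by
      rintro rfl
      exact hl.2.2 2 (by simp) (Nat.dvd_of_mem_primeFactors hp)
    have h3 : (3 : ℝ) ≤ p := by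
      exact_mod_cast lt_of_le_of_ne hpp.two_le (Ne.symm hp2)
    rw [twinWt]
    apply one_div_le_one_div_of_le <;> linarith
  obtain ⟨K, hK0, hK⟩ := sqfSum_growth (f := twinWt) (fun p hp => twinWt_nonneg hp) hA hB hdis
    (inv_nonneg.2 (prod_nonneg fun p hp => by linarith [hf1 p (hAB p hp)]))
    ⟨0, le_rfl, fun x _ => hstart x⟩
  refine ⟨K, hK0, fun x hx => le_trans ?_ (hK x hx)⟩
  have hlog : 0 ≤ Real.log x := Real.log_natCast_nonneg x
  have : (0.75 : ℝ) ≤ (∏ p ∈ {2} ∪ B, (1 + 1 / ((p : ℝ) - 1)))⁻¹ * ∏ p ∈ B, (1 + twinWt p) := by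
    rw [prod_union hdis, hBdef]
    norm_num [twinWt]
  nlinarith

lemma sqfSum_two_le {h : ℕ} (h0 : h ≠ 0) (h2 : Even h) (x : ℕ) :
    sqfSum twinWt {2} x ≤ singFactor h * sqfSum twinWt h.primeFactors x := by
  have hm : 2 ∈ h.primeFactors := Nat.mem_primeFactors.2 ⟨Nat.prime_two, h2.two_dvd, h0⟩
  have := sqfSum_le_prod_mul (f := twinWt) (fun p hp => twinWt_nonneg hp) (A := {2})
    (B := h.primeFactors.erase 2) (by simp [Nat.prime_two])
    (fun q hq => Nat.prime_of_mem_primeFactors (mem_of_mem_erase hq)) (by simp) x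
  rwa [← insert_eq, insert_erase hm] at this

end LinnikGRH

namespace LinnikGRH
open Finset BoundingSieve

lemma isWeight_wtc_mul_affine (c : ℝ) {σ : ℝ} (hσ : σ = 1 ∨ σ = -1) :
    IsWeight (fun x => wtc x * wtc (c + σ * x)) (fun x => (wtDeriv x : ℂ) * wtc (c + σ * x) +
      wtc x * ((wtDeriv (c + σ * x) * σ : ℝ) : ℂ)) 1 2 := by
  have h := isWeight_wtc.mul (v := fun x => wtc (c + σ * x))
    (v' := fun x => ((wtDeriv (c + σ * x) * σ : ℝ) : ℂ)) zero_le_one (fun x => ?_) ?_ (fun x => ?_)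
    fun x => ?_
  · rwa [one_add_one_eq_two] at h
  · have h1 : HasDerivAt (fun x : ℝ => c + σ * x) σ x := by
      simpa using ((hasDerivAt_id x).const_mul σ).const_add c
    exact ((hasDerivAt_wt (c + σ * x)).comp x h1).ofReal_comp
  · exact Complex.continuous_ofReal.comp
      ((continuous_wtDeriv.comp (by fun_prop)).mul continuous_const)
  · exact isWeight_wtc.bound _
  · rw [Complex.norm_real, Real.norm_eq_abs, abs_mul]
    have : |σ| = 1 := by rcases hσ with rfl | rfl <;> simp
    rw [this, mul_one]
    exact abs_wtDeriv_le _

/-- The correlation integral of the cutoff with its translate (or reflection). -/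
noncomputable def wtCorr (c σ : ℝ) : ℝ := ∫ x in (0 : ℝ)..1, wt x * wt (c + σ * x)

lemma integral_wtc_mul_affine (c σ : ℝ) :
    ∫ x in (0 : ℝ)..1, wtc x * wtc (c + σ * x) = (wtCorr c σ : ℂ) := by
  rw [wtCorr, ← intervalIntegral.integral_ofReal]
  simp [wtc]

lemma wtCorr_nonneg (c σ : ℝ) : 0 ≤ wtCorr c σ :=
  intervalIntegral.integral_nonneg zero_le_one fun _ _ => mul_nonneg (wt_nonneg _) (wt_nonneg _)

lemma wtCorr_le_one (c σ : ℝ) : wtCorr c σ ≤ 1 := by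
  have hc : Continuous fun x => wt x * wt (c + σ * x) :=
    continuous_wt.mul (continuous_wt.comp (by fun_prop))
  have := intervalIntegral.integral_mono_on (μ := MeasureTheory.volume) zero_le_one
    (hc.intervalIntegrable 0 1) (continuous_const.intervalIntegrable (μ := MeasureTheory.volume) 0 1)
    (fun x _ => mul_le_one₀ (wt_le x) (wt_nonneg _) (wt_le (c + σ * x)))
  simpa [wtCorr] using this

/-- The reciprocal of Euler's function, as an arithmetic function. -/
noncomputable def invTotient : ArithmeticFunction ℝ := ⟨fun n => (n.totient : ℝ)⁻¹, by simp⟩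

lemma invTotient_apply (n : ℕ) : invTotient n = (n.totient : ℝ)⁻¹ := rfl

lemma isMultiplicative_invTotient : invTotient.IsMultiplicative := by
  refine ⟨by simp [invTotient_apply], fun {m n} h => ?_⟩
  simp [invTotient_apply, Nat.totient_mul h, mul_comm]

/-- The product of the primes up to `R` not dividing `h`. -/
noncomputable def siftPrimes (h R : ℕ) : ℕ := ∏ p ∈ range (R + 1) with p.Prime ∧ ¬ p ∣ h, p

lemma prime_dvd_siftPrimes {h R p : ℕ} (hp : p.Prime) :
    p ∣ siftPrimes h R ↔ p ≤ R ∧ ¬ p ∣ h := by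
  rw [siftPrimes, hp.prime.dvd_finsetProd_iff]
  simp only [mem_filter, mem_range]
  constructor
  · rintro ⟨q, ⟨h1, h2, h3⟩, h4⟩
    obtain rfl := (Nat.prime_dvd_prime_iff_eq hp h2).1 h4
    exact ⟨by omega, h3⟩
  · rintro ⟨h1, h2⟩
    exact ⟨p, ⟨by omega, hp, h2⟩, dvd_rfl⟩

lemma squarefree_siftPrimes (h R : ℕ) : Squarefree (siftPrimes h R) := by
  apply Finset.squarefree_prod_of_pairwise_isCoprime
  · intro p hp q hq hpq
    simp only [coe_filter, Set.mem_ofPred_eq] at hp hq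
    exact Nat.coprime_iff_isRelPrime.1 ((Nat.coprime_primes hp.2.1 hq.2.1).2 hpq)
  · exact fun p hp => (mem_filter.1 hp).2.1.squarefree

lemma dvd_siftPrimes {h R l : ℕ} (hl : Squarefree l) (hlR : l ≤ R)
    (hc : ∀ p ∈ h.primeFactors, ¬ p ∣ l) (hh : h ≠ 0) : l ∣ siftPrimes h R := by
  rw [← Nat.prod_primeFactors_of_squarefree hl, siftPrimes]
  refine prod_dvd_prod_of_subset _ _ _ fun p hp => ?_
  have hpp := Nat.prime_of_mem_primeFactors hp
  have hpl := Nat.dvd_of_mem_primeFactors hp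
  have := Nat.le_of_dvd (Nat.pos_of_ne_zero hl.ne_zero) hpl
  simp only [mem_filter, mem_range]
  exact ⟨by omega, hpp, fun hd => hc p (Nat.mem_primeFactors.2 ⟨hpp, hd, hh⟩) hpl⟩

lemma card_primeFactors_siftPrimes_le (h R : ℕ) : (siftPrimes h R).primeFactors.card ≤ R := by
  have : (siftPrimes h R).primeFactors ⊆ Icc 1 R := fun p hp => by
    have hpp := Nat.prime_of_mem_primeFactors hp
    exact mem_Icc.2 ⟨hpp.pos, ((prime_dvd_siftPrimes hpp).1 (Nat.dvd_of_mem_primeFactors hp)).1⟩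
  simpa using card_le_card this

lemma three_le_of_dvd_siftPrimes {h R p : ℕ} (he : Even h) (hp : p.Prime)
    (hd : p ∣ siftPrimes h R) : 3 ≤ p := by
  have h1 := hp.two_le
  have h2 : p ≠ 2 := by
    rintro rfl
    exact ((prime_dvd_siftPrimes hp).1 hd).2 he.two_dvd
  omega

/-- The sieve counting prime pairs at even distance `h`, with smooth weights. -/
noncomputable def pairSieve (N h R : ℕ) (he : Even h) : BoundingSieve where
  support := range N
  prodPrimes := siftPrimes h R
  prodPrimes_squarefree := squarefree_siftPrimes h R
  weights n := ArithmeticFunction.vonMangoldt (n + h) * (wt (n / N) * wt ((n + h : ℕ) / N))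
  weights_nonneg n := mul_nonneg ArithmeticFunction.vonMangoldt_nonneg
    (mul_nonneg (wt_nonneg _) (wt_nonneg _))
  totalMass := N * wtCorr (-(h / N)) 1
  nu := invTotient
  nu_mult := isMultiplicative_invTotient
  nu_pos_of_prime p hp _ := by
    rw [invTotient_apply]
    exact inv_pos.2 (by exact_mod_cast Nat.totient_pos.2 hp.pos)
  nu_lt_one_of_prime p hp hd := by
    have := three_le_of_dvd_siftPrimes he hp hd
    rw [invTotient_apply, Nat.totient_prime hp]
    exact inv_lt_one_of_one_lt₀ (by exact_mod_cast (by omega : 1 < p - 1))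

section
variable {N h R : ℕ} (he : Even h)

lemma pairSieve_prime {p : ℕ} (hp : p.Prime) (hd : p ∣ siftPrimes h R) :
    (pairSieve N h R he).nu p * (1 - (pairSieve N h R he).nu p)⁻¹ = twinWt p ∧
      (1 - (pairSieve N h R he).nu p)⁻¹ ≤ 2 := by
  have h3 : (3 : ℝ) ≤ p := by exact_mod_cast three_le_of_dvd_siftPrimes he hp hd
  have e : (pairSieve N h R he).nu p = ((p : ℝ) - 1)⁻¹ := by
    change invTotient p = _
    rw [invTotient_apply, Nat.totient_prime hp, Nat.cast_sub hp.one_le, Nat.cast_one]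
  have h1 : (p : ℝ) - 1 ≠ 0 := by linarith
  have h2 : (p : ℝ) - 2 ≠ 0 := by linarith
  have e2 : 1 - ((p : ℝ) - 1)⁻¹ = ((p : ℝ) - 2) / (p - 1) := by
    field_simp
    ring
  rw [e, e2, inv_div, twinWt]
  constructor
  · field_simp
  · rw [div_le_iff₀ (by linarith)]
    linarith

lemma pairSieve_selbergTerms {d : ℕ} (hd : d ∣ siftPrimes h R) :
    (pairSieve N h R he).selbergTerms d = ∏ p ∈ d.primeFactors, twinWt p ∧
      (pairSieve N h R he).selbergTerms d ≤ 2 ^ d.primeFactors.card * (pairSieve N h R he).nu d := by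
  have hp : ∀ p ∈ d.primeFactors, p.Prime ∧ p ∣ siftPrimes h R := fun p hp =>
    ⟨Nat.prime_of_mem_primeFactors hp, (Nat.dvd_of_mem_primeFactors hp).trans hd⟩
  rw [selbergTerms_apply]
  constructor
  · rw [← prod_primeFactors_nu (s := pairSieve N h R he) hd, ← prod_mul_distrib]
    exact prod_congr rfl fun p h => (pairSieve_prime he (hp p h).1 (hp p h).2).1
  · rw [mul_comm]
    refine mul_le_mul_of_nonneg_right ?_ (nu_pos_of_dvd_prodPrimes (s := pairSieve N h R he) hd).le
    rw [← prod_const]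
    refine prod_le_prod (fun p hm => ?_) fun p hm => (pairSieve_prime he (hp p hm).1 (hp p hm).2).2
    rw [inv_nonneg]
    have := (pairSieve N h R he).nu_lt_one_of_prime p (hp p hm).1 (hp p hm).2
    linarith

lemma sqfSum_le_selbergSum (h0 : h ≠ 0) :
    sqfSum twinWt h.primeFactors R ≤ selbergSum (pairSieve N h R he) R := by
  rw [selbergSum]
  have : ∀ l ∈ (siftPrimes h R).divisors.filter (· ≤ R),
      (pairSieve N h R he).selbergTerms l = ∏ p ∈ l.primeFactors, twinWt p := fun l hl =>
    (pairSieve_selbergTerms he (Nat.dvd_of_mem_divisors (mem_filter.1 hl).1)).1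
  change _ ≤ ∑ l ∈ (siftPrimes h R).divisors.filter (· ≤ R), _
  rw [sum_congr rfl this]
  refine sum_le_sum_of_subset_of_nonneg (fun l hl => ?_) fun l _ _ =>
    prod_primeFactors_nonneg (fun p hp => twinWt_nonneg hp) l
  simp only [mem_filter, mem_Icc, Nat.mem_divisors] at hl ⊢
  exact ⟨⟨dvd_siftPrimes hl.2.1 hl.1.2 hl.2.2 h0, (squarefree_siftPrimes h R).ne_zero⟩, hl.1.2⟩

lemma pairSieve_multSum (d : ℕ) :
    (((pairSieve N h R he).multSum d : ℝ) : ℂ) =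
      ∑ m ∈ range N with ((m : ℕ) : ZMod d) = (h : ZMod d), ArithmeticFunction.vonMangoldt m *
        (wtc (m / N) * wtc (-(h / N) + 1 * (m / N : ℝ))) := by
  change ((∑ n ∈ range N, if d ∣ n then ArithmeticFunction.vonMangoldt (n + h) *
    (wt (n / N) * wt ((n + h : ℕ) / N)) else 0 : ℝ) : ℂ) = _
  rcases Nat.eq_zero_or_pos N with rfl | hN
  · simp
  have hN0 : (0 : ℝ) < N := by exact_mod_cast hN
  rw [← sum_filter, Complex.ofReal_sum]
  refine sum_bij_ne_zero (fun n _ _ => n + h) ?_ ?_ ?_ ?_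
  · intro n hn hne
    simp only [mem_filter, mem_range] at hn ⊢
    refine ⟨?_, by simp [(ZMod.natCast_eq_zero_iff n d).2 hn.2]⟩
    by_contra hc
    apply hne
    rw [wt_of_ge (x := (n + h : ℕ) / N), mul_zero, mul_zero, Complex.ofReal_zero]
    rw [one_le_div hN0]
    exact_mod_cast not_lt.1 hc
  · intro a _ _ b _ _ hab
    omega
  · intro m hm hne
    simp only [mem_filter, mem_range] at hm
    have hhm : h ≤ m := by
      by_contra hc
      apply hne
      rw [wtc, wtc, wt_of_le (x := -(h / N) + 1 * (m / N : ℝ)), Complex.ofReal_zero, mul_zero, mul_zero]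
      have : (m : ℝ) / N ≤ h / N := by
        gcongr
        omega
      linarith
    obtain ⟨n, rfl⟩ := Nat.exists_eq_add_of_le' hhm
    refine ⟨n, ?_, ?_, rfl⟩
    · simp only [mem_filter, mem_range]
      refine ⟨by omega, (ZMod.natCast_eq_zero_iff n d).1 (by simpa using hm.2)⟩
    · intro hz
      apply hne
      rw [← hz]
      have : (-(h / N) + 1 * ((n + h : ℕ) / N : ℝ) : ℝ) = n / N := by
        push_cast
        ring
      rw [this, wtc, wtc]
      push_cast
      ring
  · intro n hn hne
    have : (-(h / N) + 1 * ((n + h : ℕ) / N : ℝ) : ℝ) = n / N := by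
      push_cast
      ring
    rw [this, wtc, wtc]
    push_cast
    ring

end

section
variable (GRH : ∀ (q : ℕ) [NeZero q] (χ : DirichletCharacter ℂ q) (s : ℂ),
      0 < s.re → s.re < 1 → DirichletCharacter.LFunction χ s = 0 → s.re = 1 / 2)
include GRH

lemma abs_pairSieve_rem_le {κ : ℝ} (hκ : 0 < κ) (hκ4 : κ ≤ 1 / 4) {N h R d : ℕ} (he : Even h)
    (hN : 1 ≤ N) (hd : d ∣ siftPrimes h R) :
    |(pairSieve N h R he).rem d| ≤
      (1000000 / κ ^ 3) * 1 * (N : ℝ) ^ (1 / 2 + κ) * (d : ℝ) ^ κ * 2 ^ (1 / 2 + κ) := by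
  have hd0 : d ≠ 0 := by
    rintro rfl
    exact (squarefree_siftPrimes h R).ne_zero (zero_dvd_iff.1 hd)
  have : NeZero d := ⟨hd0⟩
  have hc : h.Coprime d := by
    apply Nat.Coprime.symm
    apply Nat.Coprime.coprime_dvd_left hd
    rw [Nat.coprime_comm]
    refine Nat.coprime_of_dvd fun p hp h1 h2 => ?_
    exact ((prime_dvd_siftPrimes hp).1 h2).2 h1
  have h1 := norm_sum_arith_prog_sub_le GRH hκ hκ4 (ZMod.unitOfCoprime h hc)
    (isWeight_wtc_mul_affine (-(h / N)) (Or.inl rfl)) hN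
  rw [ZMod.coe_unitOfCoprime] at h1
  have e := pairSieve_multSum (N := N) (h := h) (R := R) he d
  rw [integral_wtc_mul_affine] at h1
  refine le_trans (le_of_eq ?_) h1
  rw [← Real.norm_eq_abs, ← Complex.norm_real]
  congr 1
  rw [BoundingSieve.rem, Complex.ofReal_sub, e]
  congr 1
  · change ((invTotient d * (N * wtCorr (-(h / N)) 1) : ℝ) : ℂ) = _
    rw [invTotient_apply]
    push_cast
    ring

lemma exists_pairSieve_siftedSum_le : ∃ C : ℝ, 0 < C ∧ ∀ N h : ℕ, ∀ he : Even h, 1 ≤ N →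
    (pairSieve N h (lev N) he).siftedSum ≤
      N * wtCorr (-(h / N)) 1 / selbergSum (pairSieve N h (lev N) he) (lev N) +
        C * (N : ℝ) ^ (1 - 3 / 10000 : ℝ) := by
  obtain ⟨C0, hC0, hC⟩ := exists_pow_card_primeFactors_le 2 (1 / 20000) (by norm_num) (by norm_num)
  refine ⟨C0 ^ 2 * ((1000000 / (1 / 20000 : ℝ) ^ 3) * 2 ^ (1 / 2 + 1 / 20000 : ℝ)), by positivity,
    fun N h he hN => ?_⟩
  have hN1 : (1 : ℝ) ≤ N := by exact_mod_cast hN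
  have hN0 : (0 : ℝ) < N := by linarith
  set R := lev N with hR
  have hRle : (R : ℝ) ≤ (N : ℝ) ^ (999 / 4000 : ℝ) := lev_le N
  have hRN : (R : ℝ) ^ 2 ≤ N := by
    calc (R : ℝ) ^ 2 ≤ ((N : ℝ) ^ (999 / 4000 : ℝ)) ^ 2 := by gcongr
      _ = (N : ℝ) ^ (999 / 2000 : ℝ) := by
        rw [← Real.rpow_natCast, ← Real.rpow_mul hN0.le]
        norm_num
      _ ≤ (N : ℝ) ^ (1 : ℝ) := Real.rpow_le_rpow_of_exponent_le hN1 (by norm_num)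
      _ = N := Real.rpow_one _
  have hR1 : 1 ≤ R := one_le_lev hN
  have hRN' : (R : ℝ) ≤ N := by
    have : (1 : ℝ) ≤ R := by exact_mod_cast hR1
    nlinarith
  have hkey := siftedSum_le_selberg (s := pairSieve N h R he) (R := R)
    (W := C0 * (N : ℝ) ^ (1 / 20000 : ℝ))
    (E := (1000000 / (1 / 20000 : ℝ) ^ 3) * 1 * (N : ℝ) ^ (1 / 2 + 1 / 20000 : ℝ) *
      (N : ℝ) ^ (1 / 20000 : ℝ) * 2 ^ (1 / 2 + 1 / 20000 : ℝ)) hR1 (by positivity) (by positivity)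
    (fun d hd hdR => ?_) (fun d hd hdR => ?_)
  · refine hkey.trans ?_
    rw [show (pairSieve N h R he).totalMass = N * wtCorr (-(h / N)) 1 from rfl]
    refine add_le_add le_rfl ?_
    have e1 : (N : ℝ) ^ (999 / 2000 : ℝ) * ((N : ℝ) ^ (1 / 20000 : ℝ)) ^ 2 *
        ((N : ℝ) ^ (1 / 2 + 1 / 20000 : ℝ) * (N : ℝ) ^ (1 / 20000 : ℝ)) =
        (N : ℝ) ^ (1 - 3 / 10000 : ℝ) := by
      rw [← Real.rpow_natCast, ← Real.rpow_mul hN0.le, ← Real.rpow_add hN0, ← Real.rpow_add hN0,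
        ← Real.rpow_add hN0]
      norm_num
    have hR2 : (R : ℝ) ^ 2 ≤ (N : ℝ) ^ (999 / 2000 : ℝ) := by
      calc (R : ℝ) ^ 2 ≤ ((N : ℝ) ^ (999 / 4000 : ℝ)) ^ 2 := by gcongr
        _ = (N : ℝ) ^ (999 / 2000 : ℝ) := by
          rw [← Real.rpow_natCast, ← Real.rpow_mul hN0.le]
          norm_num
    rw [← e1]
    calc _ = (R : ℝ) ^ 2 * (C0 ^ 2 * ((1000000 / (1 / 20000 : ℝ) ^ 3) * 2 ^ (1 / 2 + 1 / 20000 : ℝ)) *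
          (((N : ℝ) ^ (1 / 20000 : ℝ)) ^ 2 *
        ((N : ℝ) ^ (1 / 2 + 1 / 20000 : ℝ) * (N : ℝ) ^ (1 / 20000 : ℝ)))) := by ring
      _ ≤ (N : ℝ) ^ (999 / 2000 : ℝ) * _ := mul_le_mul_of_nonneg_right hR2 (by positivity)
      _ = _ := by ring
  · have hd0 : d ≠ 0 := ne_zero_of_dvd_ne_zero (squarefree_siftPrimes h R).ne_zero hd
    refine (pairSieve_selbergTerms he hd).2.trans (mul_le_mul_of_nonneg_right ?_
      (nu_pos_of_dvd_prodPrimes (s := pairSieve N h R he) hd).le)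
    refine (hC d hd0).trans ?_
    gcongr
    exact hdR.trans (by exact_mod_cast hRN')
  · refine (abs_pairSieve_rem_le GRH (κ := 1 / 20000) (by norm_num) (by norm_num) he hN hd).trans ?_
    gcongr
    exact hdR.trans (by exact_mod_cast hRN)

end

end LinnikGRH

namespace LinnikGRH
open Finset BoundingSieve

lemma eventually_le_natCast_rpow (C : ℝ) {ε : ℝ} (hε : 0 < ε) :
    ∀ᶠ N : ℕ in Filter.atTop, C ≤ (N : ℝ) ^ ε :=
  ((tendsto_rpow_atTop hε).comp tendsto_natCast_atTop_atTop).eventually_ge_atTop C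

lemma eventually_le_log_natCast (C : ℝ) : ∀ᶠ N : ℕ in Filter.atTop, C ≤ Real.log N :=
  (Real.tendsto_log_atTop.comp tendsto_natCast_atTop_atTop).eventually_ge_atTop C

lemma log_lev_ge {N : ℕ} (hN : 1 ≤ N) : 999 / 4000 * Real.log N - 1 ≤ Real.log (lev N) := by
  have h1 : (1 : ℝ) ≤ lev N := by exact_mod_cast one_le_lev hN
  have h2 := lt_lev_add_one N
  have hN0 : (0 : ℝ) < N := by exact_mod_cast hN
  have h3 : Real.log ((N : ℝ) ^ (999 / 4000 : ℝ)) ≤ Real.log (2 * lev N) :=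
    Real.log_le_log (by positivity) (by linarith)
  rw [Real.log_rpow hN0, Real.log_mul (by norm_num) (by positivity)] at h3
  have := Real.log_two_lt_d9
  linarith

lemma vonMangoldt_mul_wt_le {m N : ℕ} :
    ArithmeticFunction.vonMangoldt m * wt (m / N) ≤ Real.log N * wt (m / N) := by
  rcases Nat.eq_zero_or_pos m with rfl | hm
  · simp [wt_of_le]
  rcases Nat.lt_or_ge m N with h | h
  · refine mul_le_mul_of_nonneg_right (ArithmeticFunction.vonMangoldt_le_log.trans ?_) (wt_nonneg _)
    exact Real.log_le_log (by exact_mod_cast hm) (by exact_mod_cast h.le)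
  · rcases Nat.eq_zero_or_pos N with rfl | hN
    · simp [wt_of_le]
    rw [wt_of_ge]
    · simp
    · rw [one_le_div (by exact_mod_cast hN)]
      exact_mod_cast h

lemma natLog_two_le (N : ℕ) : (Nat.log 2 N : ℝ) ≤ 2 * Real.log N := by
  rcases Nat.eq_zero_or_pos N with rfl | hN
  · simp
  have h1 : (2 : ℝ) ^ Nat.log 2 N ≤ N := by exact_mod_cast Nat.pow_log_le_self 2 hN.ne'
  have h2 := Real.log_le_log (by positivity) h1
  rw [Real.log_pow] at h2
  have h3 := Real.log_two_gt_d9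
  have : (0 : ℝ) ≤ Nat.log 2 N := by positivity
  nlinarith

lemma sum_pair_le_siftedSum {N h R : ℕ} (he : Even h) (hN : 1 ≤ N) :
    ∑ n ∈ range N, ArithmeticFunction.vonMangoldt n * ArithmeticFunction.vonMangoldt (n + h) *
        (wt (n / N) * wt ((n + h : ℕ) / N)) ≤
      Real.log N * (pairSieve N h R he).siftedSum +
        Real.log N * (R * (Nat.log 2 N + 1) * Real.log N) := by
  have hlog : 0 ≤ Real.log N := Real.log_natCast_nonneg N
  rw [← sum_filter_add_sum_filter_not _ (fun n => (siftPrimes h R).Coprime n)]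
  refine add_le_add ?_ ?_
  · rw [siftedSum, ← sum_filter, mul_sum]
    refine sum_le_sum fun n hn => ?_
    change _ ≤ Real.log N * (ArithmeticFunction.vonMangoldt (n + h) *
      (wt (n / N) * wt ((n + h : ℕ) / N)))
    have h1 := vonMangoldt_mul_wt_le (m := n) (N := N)
    have h2 := mul_le_mul_of_nonneg_right h1 (mul_nonneg
      (ArithmeticFunction.vonMangoldt_nonneg (n := n + h)) (wt_nonneg ((n + h : ℕ) / N)))
    linarith
  · calc _ ≤ ∑ n ∈ range N with ¬ n.Coprime (siftPrimes h R),
          ArithmeticFunction.vonMangoldt n * Real.log N := by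
          rw [filter_congr (q := fun n => ¬ n.Coprime (siftPrimes h R))
            fun n _ => by rw [Nat.coprime_comm]]
          refine sum_le_sum fun n _ => ?_
          rw [mul_assoc]
          refine mul_le_mul_of_nonneg_left ?_ ArithmeticFunction.vonMangoldt_nonneg
          have h1 := vonMangoldt_mul_wt_le (m := n + h) (N := N)
          have h2 := mul_le_mul_of_nonneg_left h1 (wt_nonneg (n / N))
          have h3 : wt (n / N) * (Real.log N * wt ((n + h : ℕ) / N)) ≤ 1 * (Real.log N * 1) :=
            mul_le_mul (wt_le _) (mul_le_mul_of_nonneg_left (wt_le _) hlog)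
              (mul_nonneg hlog (wt_nonneg _)) zero_le_one
          linarith
      _ ≤ _ := by
          rw [← sum_mul, mul_comm]
          refine mul_le_mul_of_nonneg_left ?_ hlog
          refine (sum_vonMangoldt_not_coprime_le_card (squarefree_siftPrimes h R).ne_zero hN).trans ?_
          gcongr
          exact card_primeFactors_siftPrimes_le h R

section
variable (GRH : ∀ (q : ℕ) [NeZero q] (χ : DirichletCharacter ℂ q) (s : ℂ),
      0 < s.re → s.re < 1 → DirichletCharacter.LFunction χ s = 0 → s.re = 1 / 2)
include GRH

theorem eventually_sum_pair_le : ∀ᶠ N : ℕ in Filter.atTop, ∀ h : ℕ, Even h → h ≠ 0 →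
    ∑ n ∈ range N, ArithmeticFunction.vonMangoldt n * ArithmeticFunction.vonMangoldt (n + h) *
        (wt (n / N) * wt ((n + h : ℕ) / N)) ≤
      5.34 * singFactor h * (N * wtCorr (-(h / N)) 1) + (N : ℝ) ^ (1 - 1 / 10000 : ℝ) := by
  obtain ⟨C, hC0, hC⟩ := exists_pairSieve_siftedSum_le GRH
  obtain ⟨K, hK0, hK⟩ := exists_sqfSum_two_ge
  filter_upwards [Filter.eventually_ge_atTop 1, eventually_le_log_natCast (100000 * (K + 1)),
    eventually_le_natCast_rpow (20000 * C + (20000 * 20000 * (40000 + 1)))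
      (show (0 : ℝ) < 1 / 20000 by norm_num)] with N hN hlogN hpow h he h0
  have hlog : 0 ≤ Real.log N := Real.log_natCast_nonneg N
  have hN1 : (1 : ℝ) ≤ N := by exact_mod_cast hN
  have hN0 : (0 : ℝ) < N := by linarith
  have h1 := sum_pair_le_siftedSum (R := lev N) he hN
  have h2 := hC N h he hN
  have h3 := log_lev_ge hN
  have h4 := hK _ (one_le_lev hN)
  have h5 := (sqfSum_two_le h0 he (lev N)).trans (mul_le_mul_of_nonneg_left
    (sqfSum_le_selbergSum (N := N) he h0) (zero_le_one.trans (one_le_singFactor h)))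
  set S := selbergSum (pairSieve N h (lev N) he) (lev N) with hS
  have hSpos : 0 < S := selbergSum_pos (one_le_lev hN)
  have hP := one_le_singFactor h
  have hI : 0 ≤ N * wtCorr (-(h / N)) 1 := mul_nonneg hN0.le (wtCorr_nonneg _ _)
  have h6 : Real.log N ≤ 5.34 * singFactor h * S := by linarith
  have h7 : Real.log N * (N * wtCorr (-(h / N)) 1 / S) ≤
      5.34 * singFactor h * (N * wtCorr (-(h / N)) 1) := by
    rw [mul_div_assoc', div_le_iff₀ hSpos]
    nlinarith
  set y := (N : ℝ) ^ (1 / 20000 : ℝ) with hy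
  have hy1 : 1 ≤ y := Real.one_le_rpow hN1 (by norm_num)
  have hlogy : Real.log N ≤ 20000 * y := by
    have := Real.log_le_rpow_div hN0.le (show (0 : ℝ) < 1 / 20000 by norm_num)
    rw [← hy] at this
    linarith
  have hlev : (lev N : ℝ) ≤ (N : ℝ) ^ (1 - 3 / 10000 : ℝ) :=
    (lev_le N).trans (Real.rpow_le_rpow_of_exponent_le hN1 (by norm_num))
  have hfin : (N : ℝ) ^ (1 - 3 / 10000 : ℝ) * y ^ 4 = (N : ℝ) ^ (1 - 1 / 10000 : ℝ) := by
    rw [hy, ← Real.rpow_natCast, ← Real.rpow_mul hN0.le, ← Real.rpow_add hN0]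
    norm_num
  have hX : 0 < (N : ℝ) ^ (1 - 3 / 10000 : ℝ) := by positivity
  set X := (N : ℝ) ^ (1 - 3 / 10000 : ℝ) with hXdef
  have h8 : Real.log N * (C * X) ≤ 20000 * C * (X * y ^ 3) := by
    have : Real.log N ≤ 20000 * y ^ 3 := hlogy.trans (by nlinarith [pow_le_pow_right₀ hy1 (show 1 ≤ 3 by norm_num)])
    calc Real.log N * (C * X) ≤ 20000 * y ^ 3 * (C * X) := by gcongr
      _ = _ := by ring
  have h9 : Real.log N * (lev N * (Nat.log 2 N + 1) * Real.log N) ≤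
      20000 * 20000 * (40000 + 1) * (X * y ^ 3) := by
    have : (Nat.log 2 N : ℝ) + 1 ≤ (40000 + 1) * y := by
      have := natLog_two_le N
      linarith
    calc Real.log N * (lev N * (Nat.log 2 N + 1) * Real.log N) ≤
        (20000 * y) * (X * ((40000 + 1) * y) * (20000 * y)) := by gcongr
      _ = _ := by ring
  have h10 : Real.log N * (pairSieve N h (lev N) he).siftedSum ≤
      Real.log N * (N * wtCorr (-(h / N)) 1 / S + C * X) := mul_le_mul_of_nonneg_left h2 hlog
  have h11 : (20000 * C + (20000 * 20000 * (40000 + 1))) * (X * y ^ 3) ≤ y * (X * y ^ 3) := by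
    gcongr
  rw [← hfin]
  linarith

end

end LinnikGRH

namespace LinnikGRH
open Finset

/-- The Euler factor `1 + 1 / (p - 2)`. -/
noncomputable def eulerFac (p : ℕ) : ℝ := 1 + 1 / ((p : ℝ) - 2)

/-- The primes exceeding `7` modulo which `2` has order at most `m`. -/
noncomputable def mersennePrimes (m : ℕ) : Finset ℕ :=
  (∏ e ∈ Icc 1 m, (2 ^ e - 1)).primeFactors.filter (7 < ·)

/-- The product of the Euler factors over `mersennePrimes m`. -/
noncomputable def mersenneProd (m : ℕ) : ℝ := ∏ p ∈ mersennePrimes m, eulerFac p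

lemma two_pow_sub_one_ne_zero {e : ℕ} (he : 1 ≤ e) : 2 ^ e - 1 ≠ 0 := by
  have := Nat.one_lt_two_pow (n := e) (by omega)
  omega

lemma mem_mersennePrimes {m p : ℕ} :
    p ∈ mersennePrimes m ↔ p.Prime ∧ 7 < p ∧ ∃ e, 1 ≤ e ∧ e ≤ m ∧ p ∣ 2 ^ e - 1 := by
  have h0 : ∏ e ∈ Icc 1 m, (2 ^ e - 1) ≠ 0 :=
    prod_ne_zero_iff.2 fun e he => two_pow_sub_one_ne_zero (mem_Icc.1 he).1
  simp only [mersennePrimes, mem_filter, Nat.mem_primeFactors]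
  constructor
  · rintro ⟨⟨hp, hd, -⟩, h7⟩
    obtain ⟨e, he, hd⟩ := (hp.prime.dvd_finsetProd_iff _).1 hd
    exact ⟨hp, h7, e, (mem_Icc.1 he).1, (mem_Icc.1 he).2, hd⟩
  · rintro ⟨hp, h7, e, h1, h2, hd⟩
    exact ⟨⟨hp, hd.trans (dvd_prod_of_mem _ (mem_Icc.2 ⟨h1, h2⟩)), h0⟩, h7⟩

lemma mersennePrimes_mono {m n : ℕ} (h : m ≤ n) : mersennePrimes m ⊆ mersennePrimes n := by
  intro p hp
  obtain ⟨h1, h2, e, h3, h4, h5⟩ := mem_mersennePrimes.1 hp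
  exact mem_mersennePrimes.2 ⟨h1, h2, e, h3, h4.trans h, h5⟩

lemma mersennePrimes_zero : mersennePrimes 0 = ∅ := by simp [mersennePrimes]

lemma mersenneProd_zero : mersenneProd 0 = 1 := by simp [mersenneProd, mersennePrimes_zero]

lemma one_le_eulerFac {p : ℕ} (hp : 2 < p) : 1 ≤ eulerFac p := by
  have : (2 : ℝ) < p := by exact_mod_cast hp
  have : 0 < 1 / ((p : ℝ) - 2) := by apply one_div_pos.2; linarith
  unfold eulerFac; linarith

lemma dvd_two_pow_sub_one_of_mem_sdiff {m p : ℕ}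
    (hp : p ∈ mersennePrimes (m + 1) \ mersennePrimes m) : p ∣ 2 ^ (m + 1) - 1 := by
  obtain ⟨h1, h2⟩ := mem_sdiff.1 hp
  obtain ⟨hp, h7, e, h3, h4, h5⟩ := mem_mersennePrimes.1 h1
  obtain rfl : e = m + 1 := by
    by_contra hne
    exact h2 (mem_mersennePrimes.2 ⟨hp, h7, e, h3, by omega, h5⟩)
  exact h5

lemma dvd_two_pow_sub_one_iff_of_mem_sdiff {m p : ℕ}
    (hp : p ∈ mersennePrimes (m + 1) \ mersennePrimes m) (k : ℕ) :
    p ∣ 2 ^ k - 1 ↔ m + 1 ∣ k := by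
  have h5 := dvd_two_pow_sub_one_of_mem_sdiff hp
  obtain ⟨h1, h2⟩ := mem_sdiff.1 hp
  obtain ⟨hp, h7, -⟩ := mem_mersennePrimes.1 h1
  constructor
  · intro hk
    have h6 : p ∣ 2 ^ (Nat.gcd (m + 1) k) - 1 := by
      rw [← Nat.pow_sub_one_gcd_pow_sub_one]; exact Nat.dvd_gcd h5 hk
    have h8 : Nat.gcd (m + 1) k ∣ m + 1 := Nat.gcd_dvd_left _ _
    have h9 := Nat.gcd_pos_of_pos_left k (Nat.succ_pos m)
    have h10 : Nat.gcd (m + 1) k = m + 1 := by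
      by_contra hne
      refine h2 (mem_mersennePrimes.2 ⟨hp, h7, _, h9, ?_, h6⟩)
      have : Nat.gcd (m + 1) k ≤ m + 1 := Nat.le_of_dvd (Nat.succ_pos m) h8
      simp only [Nat.succ_eq_add_one] at *
      omega
    exact Nat.gcd_eq_left_iff_dvd.1 h10
  · intro hk
    exact h5.trans (Nat.pow_sub_one_dvd_pow_sub_one 2 hk)

lemma mersenneProd_succ (m : ℕ) : mersenneProd (m + 1) =
    (∏ p ∈ mersennePrimes (m + 1) \ mersennePrimes m, eulerFac p) * mersenneProd m :=
  (prod_sdiff (mersennePrimes_mono (Nat.le_succ m))).symm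

lemma one_le_prod_eulerFac {s : Finset ℕ} (hs : ∀ p ∈ s, 2 < p) : 1 ≤ ∏ p ∈ s, eulerFac p :=
  Finset.one_le_prod fun p hp => one_le_eulerFac (hs p hp)

lemma two_lt_of_mem_mersennePrimes {m p : ℕ} (hp : p ∈ mersennePrimes m) : 2 < p := by
  have := (mem_mersennePrimes.1 hp).2.1
  omega

lemma mersenneProd_le_succ (m : ℕ) : mersenneProd m ≤ mersenneProd (m + 1) := by
  rw [mersenneProd_succ]
  refine le_mul_of_one_le_left (zero_le_one.trans
    (one_le_prod_eulerFac fun p hp => two_lt_of_mem_mersennePrimes hp)) ?_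
  exact one_le_prod_eulerFac fun p hp => two_lt_of_mem_mersennePrimes (mem_sdiff.1 hp).1

/-- The contribution of the primes `3`, `5`, `7` to `singFactor (2 ^ k - 1)`. -/
noncomputable def smallFactor (k : ℕ) : ℝ :=
  (if 2 ∣ k then 2 else 1) * (if 4 ∣ k then 4 / 3 else 1) * (if 3 ∣ k then 6 / 5 else 1)

lemma smallFactor_le (k : ℕ) : smallFactor k ≤ 3.2 := by
  unfold smallFactor; split_ifs <;> norm_num

lemma sum_ite_dvd_le (d K : ℕ) :
    ∑ k ∈ Ioc 0 K, (if d ∣ k then (1 : ℝ) else 0) ≤ K / d := by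
  rw [← sum_filter, sum_const, nsmul_eq_mul, mul_one, Nat.Ioc_filter_dvd_card_eq_div]
  exact Nat.cast_div_le

lemma smallFactor_eq (k : ℕ) : smallFactor k =
    1 + (if 2 ∣ k then 1 else 0) + 2 / 3 * (if 4 ∣ k then 1 else 0)
      + 1 / 5 * (if 3 ∣ k then 1 else 0) + 1 / 5 * (if 6 ∣ k then 1 else 0)
      + 2 / 15 * (if 12 ∣ k then 1 else 0) := by
  unfold smallFactor
  split_ifs <;> first | omega | norm_num

lemma sum_smallFactor_le (K : ℕ) : ∑ k ∈ Ioc 0 K, smallFactor k ≤ 16 / 9 * K := by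
  simp_rw [smallFactor_eq, sum_add_distrib, ← mul_sum]
  have h2 := sum_ite_dvd_le 2 K
  have h3 := sum_ite_dvd_le 3 K
  have h4 := sum_ite_dvd_le 4 K
  have h6 := sum_ite_dvd_le 6 K
  have h12 := sum_ite_dvd_le 12 K
  push_cast at *
  simp only [sum_const, Nat.card_Ioc, tsub_zero, nsmul_eq_mul, mul_one]
  linarith

lemma sum_smallFactor_mul_le (K m : ℕ) :
    ∑ k ∈ Ioc 0 K, smallFactor k * ∏ p ∈ mersennePrimes m with p ∣ 2 ^ k - 1, eulerFac p ≤
      (16 / 9 + 3.2 * ∑ i ∈ range m, (mersenneProd (i + 1) - mersenneProd i) / (i + 1)) * K := by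
  induction m with
  | zero => simpa [mersennePrimes_zero] using sum_smallFactor_le K
  | succ m ih =>
    set W := mersenneProd (m + 1) - mersenneProd m with hW
    have hW0 : 0 ≤ W := sub_nonneg.2 (mersenneProd_le_succ m)
    have hstep : ∀ k, smallFactor k * ∏ p ∈ mersennePrimes (m + 1) with p ∣ 2 ^ k - 1, eulerFac p
        ≤ smallFactor k * (∏ p ∈ mersennePrimes m with p ∣ 2 ^ k - 1, eulerFac p)
          + 3.2 * W * (if m + 1 ∣ k then 1 else 0) := by
      intro k
      set s := mersennePrimes (m + 1) \ mersennePrimes m with hs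
      have hdisj : Disjoint s (mersennePrimes m) := sdiff_disjoint
      have hun : mersennePrimes (m + 1) = s ∪ mersennePrimes m :=
        (sdiff_union_of_subset (mersennePrimes_mono (Nat.le_succ m))).symm
      have hprod : ∏ p ∈ mersennePrimes (m + 1) with p ∣ 2 ^ k - 1, eulerFac p =
          (∏ p ∈ s with p ∣ 2 ^ k - 1, eulerFac p) *
            ∏ p ∈ mersennePrimes m with p ∣ 2 ^ k - 1, eulerFac p := by
        rw [hun, filter_union, prod_union (disjoint_filter_filter hdisj)]
      rw [hprod]
      by_cases hk : m + 1 ∣ k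
      · have h1 : s.filter (fun p => p ∣ 2 ^ k - 1) = s :=
          filter_true_of_mem fun p hp => (dvd_two_pow_sub_one_iff_of_mem_sdiff hp k).2 hk
        rw [h1, if_pos hk, mul_one]
        have h2 : W = (∏ p ∈ s, eulerFac p - 1) * mersenneProd m := by
          rw [hW, mersenneProd_succ]; ring
        have h3 : ∏ p ∈ mersennePrimes m with p ∣ 2 ^ k - 1, eulerFac p ≤ mersenneProd m :=
          Finset.prod_le_prod_of_subset_of_one_le (filter_subset _ _)
            (fun p hp => zero_le_one.trans (one_le_eulerFac (two_lt_of_mem_mersennePrimes (mem_filter.1 hp).1)))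
            fun p hp _ => one_le_eulerFac (two_lt_of_mem_mersennePrimes hp)
        have h4 : 1 ≤ ∏ p ∈ s, eulerFac p :=
          one_le_prod_eulerFac fun p hp => two_lt_of_mem_mersennePrimes (mem_sdiff.1 hp).1
        have h5 : 1 ≤ ∏ p ∈ mersennePrimes m with p ∣ 2 ^ k - 1, eulerFac p :=
          one_le_prod_eulerFac fun p hp => two_lt_of_mem_mersennePrimes (mem_filter.1 hp).1
        have h6 : smallFactor k * ((∏ p ∈ s, eulerFac p - 1) *
            ∏ p ∈ mersennePrimes m with p ∣ 2 ^ k - 1, eulerFac p) ≤ 3.2 * W := by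
          rw [h2]
          refine mul_le_mul (smallFactor_le k) (mul_le_mul_of_nonneg_left h3 (by linarith))
            (mul_nonneg (by linarith) (by linarith)) (by norm_num)
        nlinarith
      · have h1 : s.filter (fun p => p ∣ 2 ^ k - 1) = ∅ :=
          filter_false_of_mem fun p hp h => hk ((dvd_two_pow_sub_one_iff_of_mem_sdiff hp k).1 h)
        simp [h1, hk]
    refine (sum_le_sum fun k _ => hstep k).trans ?_
    rw [sum_add_distrib, ← mul_sum, sum_range_succ]
    have h1 := mul_le_mul_of_nonneg_left (sum_ite_dvd_le (m + 1) K)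
      (mul_nonneg (by norm_num : (0 : ℝ) ≤ 3.2) hW0)
    push_cast at h1
    have h2 : 3.2 * W * ((K : ℝ) / (m + 1)) = 3.2 * (W / (m + 1)) * K := by ring
    rw [h2] at h1
    rw [mul_add, ← add_assoc, add_mul]
    exact add_le_add ih h1

lemma three_dvd_two_pow_sub_one (k : ℕ) : 3 ∣ 2 ^ k - 1 ↔ 2 ∣ k := by
  constructor
  · intro h
    have h1 : 3 ∣ 2 ^ (Nat.gcd 2 k) - 1 := by
      rw [← Nat.pow_sub_one_gcd_pow_sub_one]; exact Nat.dvd_gcd (by norm_num) h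
    have h2 : Nat.gcd 2 k ∣ 2 := Nat.gcd_dvd_left _ _
    have h3 : Nat.gcd 2 k ≤ 2 := Nat.le_of_dvd (by norm_num) h2
    refine Nat.gcd_eq_left_iff_dvd.1 ?_
    generalize Nat.gcd 2 k = g at *
    interval_cases g <;> simp_all
  · exact fun h => (by norm_num : 3 ∣ 2 ^ 2 - 1).trans (Nat.pow_sub_one_dvd_pow_sub_one 2 h)

lemma five_dvd_two_pow_sub_one (k : ℕ) : 5 ∣ 2 ^ k - 1 ↔ 4 ∣ k := by
  constructor
  · intro h
    have h1 : 5 ∣ 2 ^ (Nat.gcd 4 k) - 1 := by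
      rw [← Nat.pow_sub_one_gcd_pow_sub_one]; exact Nat.dvd_gcd (by norm_num) h
    have h2 : Nat.gcd 4 k ∣ 4 := Nat.gcd_dvd_left _ _
    have h3 : Nat.gcd 4 k ≤ 4 := Nat.le_of_dvd (by norm_num) h2
    refine Nat.gcd_eq_left_iff_dvd.1 ?_
    generalize Nat.gcd 4 k = g at *
    interval_cases g <;> simp_all
  · exact fun h => (by norm_num : 5 ∣ 2 ^ 4 - 1).trans (Nat.pow_sub_one_dvd_pow_sub_one 2 h)

lemma seven_dvd_two_pow_sub_one (k : ℕ) : 7 ∣ 2 ^ k - 1 ↔ 3 ∣ k := by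
  constructor
  · intro h
    have h1 : 7 ∣ 2 ^ (Nat.gcd 3 k) - 1 := by
      rw [← Nat.pow_sub_one_gcd_pow_sub_one]; exact Nat.dvd_gcd (by norm_num) h
    have h2 : Nat.gcd 3 k ∣ 3 := Nat.gcd_dvd_left _ _
    have h3 : Nat.gcd 3 k ≤ 3 := Nat.le_of_dvd (by norm_num) h2
    refine Nat.gcd_eq_left_iff_dvd.1 ?_
    generalize Nat.gcd 3 k = g at *
    interval_cases g <;> simp_all
  · exact fun h => (by norm_num : 7 ∣ 2 ^ 3 - 1).trans (Nat.pow_sub_one_dvd_pow_sub_one 2 h)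

lemma prod_eulerFac_small (k : ℕ) :
    ∏ p ∈ ({3, 5, 7} : Finset ℕ) with p ∣ 2 ^ k - 1, eulerFac p = smallFactor k := by
  rw [prod_filter, prod_insert (by simp), prod_insert (by simp), prod_singleton]
  simp only [three_dvd_two_pow_sub_one, five_dvd_two_pow_sub_one, seven_dvd_two_pow_sub_one]
  have h3 : eulerFac 3 = 2 := by norm_num [eulerFac]
  have h5 : eulerFac 5 = 4 / 3 := by norm_num [eulerFac]
  have h7 : eulerFac 7 = 6 / 5 := by norm_num [eulerFac]
  rw [h3, h5, h7, smallFactor, mul_assoc]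

lemma singFactor_two_pow_sub_one_eq {K k : ℕ} (hk : k ∈ Ioc 0 K) :
    singFactor (2 ^ k - 1) =
      smallFactor k * ∏ p ∈ mersennePrimes K with p ∣ 2 ^ k - 1, eulerFac p := by
  obtain ⟨h0, hK⟩ := mem_Ioc.1 hk
  have hne := two_pow_sub_one_ne_zero h0
  rw [← prod_eulerFac_small, ← prod_union]
  · refine prod_congr ?_ fun _ _ => rfl
    ext p
    simp only [mem_erase, Nat.mem_primeFactors, mem_union, mem_filter, mem_insert, mem_singleton,
      mem_mersennePrimes]
    constructor
    · rintro ⟨h2, hp, hd, -⟩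
      by_cases h7 : 7 < p
      · exact Or.inr ⟨⟨hp, h7, k, h0, hK, hd⟩, hd⟩
      · refine Or.inl ⟨?_, hd⟩
        interval_cases p <;> first | omega | (revert hp; norm_num)
    · rintro (⟨h, hd⟩ | ⟨⟨hp, h7, -⟩, hd⟩)
      · rcases h with rfl | rfl | rfl <;> exact ⟨by norm_num, by norm_num, hd, hne⟩
      · exact ⟨by omega, hp, hd, hne⟩
  · rw [disjoint_left]
    intro p hp hp'
    have h7 := (mem_mersennePrimes.1 (mem_filter.1 hp').1).2.1
    have := (mem_filter.1 hp).1
    simp only [mem_insert, mem_singleton] at this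
    omega

lemma sum_mersenneProd_sub_div (m : ℕ) :
    ∑ i ∈ range m, (mersenneProd (i + 1) - mersenneProd i) / (i + 1) =
      mersenneProd m / (m + 1) - 1
        + ∑ i ∈ range m, mersenneProd (i + 1) / ((i + 1) * (i + 2)) := by
  induction m with
  | zero => simp [mersenneProd_zero]
  | succ m ih =>
    rw [sum_range_succ, ih, sum_range_succ]
    push_cast
    have h1 : (m : ℝ) + 1 ≠ 0 := by positivity
    have h2 : (m : ℝ) + 2 ≠ 0 := by positivity
    have h3 : (m : ℝ) + 1 + 1 ≠ 0 := by positivity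
    field_simp
    ring

end LinnikGRH

namespace LinnikGRH
open Finset

/-- The primes `7 < p < 2048` modulo which `2` has order less than `200`, with that order. -/
def smallPrimeOrders : List (ℕ × ℕ) :=
  [(11, 10), (13, 12), (17, 8), (19, 18), (23, 11), (29, 28), (31, 5), (37, 36), (41, 20),
  (43, 14), (47, 23), (53, 52), (59, 58), (61, 60), (67, 66), (71, 35), (73, 9), (79, 39),
  (83, 82), (89, 11), (97, 48), (101, 100), (103, 51), (107, 106), (109, 36), (113, 28),
  (127, 7), (131, 130), (137, 68), (139, 138), (149, 148), (151, 15), (157, 52), (163, 162),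
  (167, 83), (173, 172), (179, 178), (181, 180), (191, 95), (193, 96), (197, 196), (199, 99),
  (223, 37), (229, 76), (233, 29), (239, 119), (241, 24), (251, 50), (257, 16), (263, 131),
  (271, 135), (277, 92), (281, 70), (283, 94), (307, 102), (311, 155), (313, 156), (331, 30),
  (337, 21), (353, 88), (359, 179), (367, 183), (383, 191), (397, 44), (431, 43), (433, 72),
  (439, 73), (457, 76), (499, 166), (571, 114), (577, 144), (593, 148), (601, 25), (617, 154),
  (631, 45), (641, 64), (673, 48), (683, 22), (727, 121), (881, 55), (911, 91), (919, 153),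
  (937, 117), (953, 68), (971, 194), (1013, 92), (1103, 29), (1163, 166), (1217, 152),
  (1249, 156), (1289, 161), (1321, 60), (1429, 84), (1433, 179), (1553, 194), (1613, 52),
  (1657, 92), (1753, 146), (1777, 74), (1801, 25)]

/-- The primes `7 < p < 2048` modulo which `2` has order at least `200`. -/
def otherSmallPrimes : List ℕ :=
  [211, 227, 269, 293, 317, 347, 349, 373, 379, 389, 401, 409, 419, 421, 443, 449, 461, 463, 467,
  479, 487, 491, 503, 509, 521, 523, 541, 547, 557, 563, 569, 587, 599, 607, 613, 619, 643, 647,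
  653, 659, 661, 677, 691, 701, 709, 719, 733, 739, 743, 751, 757, 761, 769, 773, 787, 797, 809,
  811, 821, 823, 827, 829, 839, 853, 857, 859, 863, 877, 883, 887, 907, 929, 941, 947, 967, 977,
  983, 991, 997, 1009, 1019, 1021, 1031, 1033, 1039, 1049, 1051, 1061, 1063, 1069, 1087, 1091,
  1093, 1097, 1109, 1117, 1123, 1129, 1151, 1153, 1171, 1181, 1187, 1193, 1201, 1213, 1223, 1229,
  1231, 1237, 1259, 1277, 1279, 1283, 1291, 1297, 1301, 1303, 1307, 1319, 1327, 1361, 1367, 1373,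
  1381, 1399, 1409, 1423, 1427, 1439, 1447, 1451, 1453, 1459, 1471, 1481, 1483, 1487, 1489, 1493,
  1499, 1511, 1523, 1531, 1543, 1549, 1559, 1567, 1571, 1579, 1583, 1597, 1601, 1607, 1609, 1619,
  1621, 1627, 1637, 1663, 1667, 1669, 1693, 1697, 1699, 1709, 1721, 1723, 1733, 1741, 1747, 1759,
  1783, 1787, 1789, 1811, 1823, 1831, 1847, 1861, 1867, 1871, 1873, 1877, 1879, 1889, 1901, 1907,
  1913, 1931, 1933, 1949, 1951, 1973, 1979, 1987, 1993, 1997, 1999, 2003, 2011, 2017, 2027, 2029,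
  2039]

lemma otherSmallPrimes_order :
    ∀ q ∈ otherSmallPrimes, ∀ e < 199, 2 ^ (e + 1) % q ≠ 1 := by decide +kernel

lemma smallPrimeOrders_order :
    ∀ x ∈ smallPrimeOrders, ∀ e < x.2 - 1, 2 ^ (e + 1) % x.1 ≠ 1 := by decide +kernel

lemma small_primes_complete : ∀ i < 32, ∀ j < 64, 64 * i + j < 8 ∨
    (∃ d ∈ [2, 3, 5, 7, 11, 13, 17, 19, 23, 29, 31, 37, 41, 43],
      (64 * i + j) % d = 0 ∧ 64 * i + j ≠ d) ∨
    64 * i + j ∈ otherSmallPrimes ∨ 64 * i + j ∈ smallPrimeOrders.map Prod.fst := by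
  decide +kernel

lemma three_le_of_mem_otherSmallPrimes : ∀ q ∈ otherSmallPrimes, 3 ≤ q := by decide +kernel

lemma three_le_of_mem_smallPrimeOrders : ∀ x ∈ smallPrimeOrders, 3 ≤ x.1 := by decide +kernel

lemma mem_small_primes {p : ℕ} (hp : p.Prime) (h7 : 7 < p) (h : p < 2048) :
    p ∈ otherSmallPrimes ∨ p ∈ smallPrimeOrders.map Prod.fst := by
  have h1 := small_primes_complete (p / 64) (by omega) (p % 64) (by omega)
  rw [Nat.div_add_mod] at h1
  rcases h1 with h1 | ⟨d, hd, h1, h2⟩ | h1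
  · omega
  · have h3 := (Nat.dvd_prime hp).1 (Nat.dvd_of_mod_eq_zero h1)
    rcases h3 with rfl | rfl
    · simp at hd
    · exact absurd rfl h2
  · exact h1

/-- An upper bound for a product of Euler factors, in units of `10⁻¹²`. -/
def eulerUpper (l : List ℕ) : ℕ := l.foldr (fun p a => a * (p - 1) / (p - 2) + 1) (10 ^ 12)

lemma natCast_div_add_one_ge (a b : ℕ) : (a : ℝ) / b ≤ ((a / b + 1 : ℕ) : ℝ) := by
  push_cast
  exact (Nat.lt_floor_add_one ((a : ℝ) / b)).le.trans_eq (by rw [Nat.floor_div_eq_div])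

lemma prod_toFinset_eulerFac_le (l : List ℕ) (hl : ∀ p ∈ l, 3 ≤ p) :
    ∏ p ∈ l.toFinset, eulerFac p ≤ (eulerUpper l : ℝ) / 10 ^ 12 := by
  induction l with
  | nil => norm_num [eulerUpper]
  | cons p l ih =>
    have hp : 3 ≤ p := hl p (by simp)
    have hl' : ∀ q ∈ l, 3 ≤ q := fun q hq => hl q (by simp [hq])
    have h1 : 1 ≤ eulerFac p := one_le_eulerFac (by omega)
    have h2 : 1 ≤ ∏ q ∈ l.toFinset, eulerFac q :=
      one_le_prod_eulerFac fun q hq => by have := hl' q (List.mem_toFinset.1 hq); omega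
    have h3 : ∏ q ∈ (p :: l).toFinset, eulerFac q ≤ eulerFac p * ∏ q ∈ l.toFinset, eulerFac q := by
      rw [List.toFinset_cons]
      by_cases hm : p ∈ l.toFinset
      · rw [insert_eq_of_mem hm]; exact le_mul_of_one_le_left (by linarith) h1
      · rw [prod_insert hm]
    have h4 : (eulerUpper l : ℝ) * eulerFac p ≤ eulerUpper (p :: l) := by
      have h5 := natCast_div_add_one_ge (eulerUpper l * (p - 1)) (p - 2)
      have h6 : eulerUpper (p :: l) = eulerUpper l * (p - 1) / (p - 2) + 1 := rfl
      rw [h6]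
      refine le_trans (le_of_eq ?_) h5
      push_cast [Nat.cast_sub (show 1 ≤ p by omega), Nat.cast_sub (show 2 ≤ p by omega)]
      have : (3 : ℝ) ≤ p := by exact_mod_cast hp
      have : (p : ℝ) - 2 ≠ 0 := by linarith
      unfold eulerFac
      field_simp
      ring
    refine h3.trans ?_
    rw [le_div_iff₀ (by positivity)]
    have h7 := ih hl'
    rw [le_div_iff₀ (by positivity)] at h7
    nlinarith

/-- The primes of `mersennePrimes m` below `2048`. -/
noncomputable def mersenneSmall (m : ℕ) : Finset ℕ := (mersennePrimes m).filter (· < 2048)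

/-- The primes of `mersennePrimes m` above `2048`. -/
noncomputable def mersenneLarge (m : ℕ) : Finset ℕ := (mersennePrimes m).filter (¬ · < 2048)

lemma mersenneProd_eq (m : ℕ) : mersenneProd m =
    (∏ p ∈ mersenneSmall m, eulerFac p) * ∏ p ∈ mersenneLarge m, eulerFac p :=
  (prod_filter_mul_prod_filter_not _ _ _).symm

lemma prod_mersenneSmall_le {m : ℕ} (hm : m < 200) : ∏ p ∈ mersenneSmall m, eulerFac p ≤
    (eulerUpper ((smallPrimeOrders.filter (·.2 ≤ m)).map Prod.fst) : ℝ) / 10 ^ 12 := by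
  have h3 : ∀ p ∈ (smallPrimeOrders.filter (·.2 ≤ m)).map Prod.fst, 3 ≤ p := by
    intro p hp
    obtain ⟨x, hx, rfl⟩ := List.mem_map.1 hp
    exact three_le_of_mem_smallPrimeOrders x (List.mem_filter.1 hx).1
  refine le_trans ?_ (prod_toFinset_eulerFac_le _ h3)
  refine Finset.prod_le_prod_of_subset_of_one_le ?_ ?_ ?_
  · intro p hp
    obtain ⟨hp, h2048⟩ := mem_filter.1 hp
    obtain ⟨hp, h7, e, h1, hem, hd⟩ := mem_mersennePrimes.1 hp
    have hmod : 2 ^ e % p = 1 := by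
      have h5 : 1 ≤ 2 ^ e := Nat.one_le_two_pow
      have h6 : 1 ≡ 2 ^ e [MOD p] := (Nat.modEq_iff_dvd' h5).2 hd
      rw [← h6, Nat.mod_eq_of_lt (by omega)]
    rw [List.mem_toFinset, List.mem_map]
    rcases mem_small_primes hp h7 h2048 with h | h
    · exact absurd (by rwa [Nat.sub_add_cancel h1]) (otherSmallPrimes_order p h (e - 1) (by omega))
    · obtain ⟨x, hx, rfl⟩ := List.mem_map.1 h
      refine ⟨x, List.mem_filter.2 ⟨hx, ?_⟩, rfl⟩
      by_contra hlt
      have hlt : m < x.2 := by simpa using hlt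
      exact absurd (by rwa [Nat.sub_add_cancel h1])
        (smallPrimeOrders_order x hx (e - 1) (by omega))
  · intro p hp
    exact zero_le_one.trans (one_le_eulerFac (two_lt_of_mem_mersennePrimes (mem_filter.1 hp).1))
  · intro p hp _
    have := h3 p (List.mem_toFinset.1 hp)
    exact one_le_eulerFac (by omega)

lemma prod_mersenneSmall_le_const (m : ℕ) : ∏ p ∈ mersenneSmall m, eulerFac p ≤ 3.2222 := by
  have h3 : ∀ p ∈ otherSmallPrimes ++ smallPrimeOrders.map Prod.fst, 3 ≤ p := by
    intro p hp
    rcases List.mem_append.1 hp with hp | hp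
    · exact three_le_of_mem_otherSmallPrimes p hp
    · obtain ⟨x, hx, rfl⟩ := List.mem_map.1 hp
      exact three_le_of_mem_smallPrimeOrders x hx
  have h4 : eulerUpper (otherSmallPrimes ++ smallPrimeOrders.map Prod.fst) ≤ 3222200000000 := by
    decide +kernel
  have h5 : ∏ p ∈ mersenneSmall m, eulerFac p ≤
      ∏ p ∈ (otherSmallPrimes ++ smallPrimeOrders.map Prod.fst).toFinset, eulerFac p := by
    refine Finset.prod_le_prod_of_subset_of_one_le ?_ ?_ ?_
    · intro p hp
      obtain ⟨hp, h2048⟩ := mem_filter.1 hp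
      obtain ⟨hp, h7, -⟩ := mem_mersennePrimes.1 hp
      exact List.mem_toFinset.2 (List.mem_append.2 (mem_small_primes hp h7 h2048))
    · intro p hp
      exact zero_le_one.trans (one_le_eulerFac (two_lt_of_mem_mersennePrimes (mem_filter.1 hp).1))
    · intro p hp _
      have := h3 p (List.mem_toFinset.1 hp)
      exact one_le_eulerFac (by omega)
  refine h5.trans ((prod_toFinset_eulerFac_le _ h3).trans ?_)
  rw [div_le_iff₀ (by positivity)]
  have : (eulerUpper (otherSmallPrimes ++ smallPrimeOrders.map Prod.fst) : ℝ) ≤ 3222200000000 := by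
    exact_mod_cast h4
  linarith

set_option maxRecDepth 10000 in
lemma prod_eulerFac_cube_le (T : Finset ℕ) :
    (∀ p ∈ T, 2048 < p ∧ p % 2 = 1 ∧ p % 3 ≠ 0) →
      (∏ p ∈ T, eulerFac p) ^ 3 ≤ 1 + 3 * (T.card : ℝ) / 2045 := by
  refine Finset.induction_on_max T (by simp) fun a s hs ih => ?_
  intro hT
  have hT' : ∀ p ∈ s, 2048 < p ∧ p % 2 = 1 ∧ p % 3 ≠ 0 := fun p hp => hT p (mem_insert_of_mem hp)
  have ha := hT a (mem_insert_self a s)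
  have hns : a ∉ s := fun h => lt_irrefl _ (hs a h)
  have hcard : (insert a s).card ≤ (Icc 683 (a / 3)).card := by
    refine card_le_card_of_injOn (· / 3) ?_ ?_
    · intro p hp
      have h1 := hT p hp
      have h2 : p ≤ a := by
        rcases mem_insert.1 hp with rfl | h
        · exact le_rfl
        · exact (hs p h).le
      simp only [coe_Icc, Set.mem_Icc]
      omega
    · intro p hp q hq hpq
      have h1 := hT p hp
      have h2 := hT q hq
      simp only at hpq
      omega
  rw [card_insert_of_notMem hns, Nat.card_Icc] at hcard
  have h1 : 2047 + 3 * (s.card + 1) ≤ a := by omega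
  have h2 : (2047 : ℝ) + 3 * (s.card + 1) ≤ a := by exact_mod_cast h1
  rw [prod_insert hns, card_insert_of_notMem hns, mul_pow]
  push_cast
  have h0 : (0 : ℝ) ≤ s.card := Nat.cast_nonneg _
  have h3 : eulerFac a ^ 3 ≤ 1 + 3 / (2045 + 3 * (s.card : ℝ)) := by
    set t : ℝ := (a : ℝ) - 2 with ht
    have ht3 : 2048 + 3 * (s.card : ℝ) ≤ t := by rw [ht]; linarith
    have h4 : eulerFac a ^ 3 ≤ 1 + 3 / (t - 3) := by
      have ht0 : (0 : ℝ) < t := by linarith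
      have : eulerFac a = (t + 1) / t := by rw [eulerFac, ← ht]; field_simp
      have h5 : 1 + 3 / (t - 3) = t / (t - 3) := by
        have : t - 3 ≠ 0 := by linarith
        field_simp; ring
      rw [this, h5, div_pow, div_le_div_iff₀ (by positivity) (by linarith)]
      nlinarith [sq_nonneg t]
    refine h4.trans ?_
    have : 3 / (t - 3) ≤ 3 / (2045 + 3 * (s.card : ℝ)) := by
      apply div_le_div_of_nonneg_left <;> linarith
    linarith
  calc eulerFac a ^ 3 * (∏ p ∈ s, eulerFac p) ^ 3
      ≤ (1 + 3 / (2045 + 3 * (s.card : ℝ))) * (1 + 3 * (s.card : ℝ) / 2045) := by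
        refine mul_le_mul h3 (ih hT') (pow_nonneg ?_ 3) (by positivity)
        exact zero_le_one.trans (one_le_prod_eulerFac fun p hp => by have := hT' p hp; omega)
    _ = 1 + 3 * ((s.card : ℝ) + 1) / 2045 := by
        have : (2045 : ℝ) + 3 * s.card ≠ 0 := by positivity
        field_simp
        ring

/-- A bound for the number of binary digits of the product of `mersennePrimes m`. -/
def mersenneBits : ℕ → ℕ
  | 0 => 0
  | m + 1 => mersenneBits m + if (m + 1) % 2 = 0 then (m + 1) / 2 + 1 else m + 1

lemma mersenneBits_eq (m : ℕ) :
    8 * mersenneBits m + (if m % 2 = 0 then 2 * m else 3) = 3 * m ^ 2 + 8 * m := by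
  induction m with
  | zero => rfl
  | succ m ih =>
    rw [mersenneBits]
    rcases Nat.even_or_odd' m with ⟨j, rfl | rfl⟩
    · have h1 : 2 * j % 2 = 0 := by omega
      have h2 : (2 * j + 1) % 2 ≠ 0 := by omega
      rw [if_pos h1] at ih
      rw [if_neg h2, if_neg h2]
      nlinarith
    · have h1 : (2 * j + 1) % 2 ≠ 0 := by omega
      have h2 : (2 * j + 1 + 1) % 2 = 0 := by omega
      have h3 : (2 * j + 1 + 1) / 2 = j + 1 := by omega
      rw [if_neg h1] at ih
      rw [if_pos h2, if_pos h2, h3]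
      nlinarith

lemma prod_mersennePrimes_le (m : ℕ) : ∏ p ∈ mersennePrimes m, p ≤ 2 ^ mersenneBits m := by
  induction m with
  | zero => simp [mersennePrimes_zero, mersenneBits]
  | succ m ih =>
    rw [← prod_sdiff (mersennePrimes_mono (Nat.le_succ m)), mersenneBits, pow_add, mul_comm]
    refine Nat.mul_le_mul ih ?_
    have hprime : ∀ p ∈ mersennePrimes (m + 1) \ mersennePrimes m, p.Prime :=
      fun p hp => (mem_mersennePrimes.1 (mem_sdiff.1 hp).1).1
    have key : ∀ n, n ≠ 0 → (∀ p ∈ mersennePrimes (m + 1) \ mersennePrimes m, p ∣ n) →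
        ∏ p ∈ mersennePrimes (m + 1) \ mersennePrimes m, p ≤ n := fun n hn h =>
      Nat.le_of_dvd (Nat.pos_of_ne_zero hn)
        (prod_primes_dvd n (fun p hp => (hprime p hp).prime) h)
    split_ifs with hpar
    · refine (key (2 ^ ((m + 1) / 2) + 1) (Nat.succ_ne_zero _) fun p hp => ?_).trans ?_
      · have h1 := dvd_two_pow_sub_one_of_mem_sdiff hp
        have h2 : 2 ^ (m + 1) - 1 = (2 ^ ((m + 1) / 2) + 1) * (2 ^ ((m + 1) / 2) - 1) := by
          rw [← Nat.sq_sub_sq, ← pow_mul, Nat.div_mul_cancel (Nat.dvd_of_mod_eq_zero hpar), one_pow]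
        rw [h2] at h1
        refine ((hprime p hp).dvd_mul.1 h1).resolve_right fun h => ?_
        have := (dvd_two_pow_sub_one_iff_of_mem_sdiff hp _).1 h
        have := Nat.le_of_dvd (by omega) this
        omega
      · rw [pow_succ]
        have := Nat.one_le_two_pow (n := (m + 1) / 2)
        omega
    · exact (key _ (two_pow_sub_one_ne_zero (by omega))
        fun p hp => dvd_two_pow_sub_one_of_mem_sdiff hp).trans (Nat.sub_le _ _)

lemma card_mersenneLarge_le (m : ℕ) : (mersenneLarge m).card ≤ mersenneBits m / 11 := by
  rw [Nat.le_div_iff_mul_le (by norm_num)]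
  refine (Nat.pow_le_pow_iff_right (a := 2) (by norm_num)).1 ?_
  calc 2 ^ ((mersenneLarge m).card * 11) = ∏ _p ∈ mersenneLarge m, 2048 := by
        rw [prod_const, mul_comm, pow_mul]; norm_num
    _ ≤ ∏ p ∈ mersenneLarge m, p := prod_le_prod' fun p hp => not_lt.1 (mem_filter.1 hp).2
    _ ≤ ∏ p ∈ mersennePrimes m, p := prod_le_prod_of_subset_of_one_le' (filter_subset _ _)
        fun p hp _ => by have := two_lt_of_mem_mersennePrimes hp; omega
    _ ≤ _ := prod_mersennePrimes_le m

lemma prod_mersenneLarge_cube_le (m : ℕ) : (∏ p ∈ mersenneLarge m, eulerFac p) ^ 3 ≤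
    1 + 3 * ((mersenneBits m / 11 : ℕ) : ℝ) / 2045 := by
  refine (prod_eulerFac_cube_le _ fun p hp => ?_).trans ?_
  · obtain ⟨h1, h2⟩ := mem_filter.1 hp
    obtain ⟨h3, h4, -⟩ := mem_mersennePrimes.1 h1
    have h5 : ¬ 2 ∣ p := fun h => by have := (Nat.prime_dvd_prime_iff_eq Nat.prime_two h3).1 h; omega
    have h6 : ¬ 3 ∣ p := fun h => by
      have := (Nat.prime_dvd_prime_iff_eq Nat.prime_three h3).1 h; omega
    omega
  · have : ((mersenneLarge m).card : ℝ) ≤ ((mersenneBits m / 11 : ℕ) : ℝ) := by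
      exact_mod_cast card_mersenneLarge_le m
    gcongr

lemma one_le_prod_mersenneLarge (m : ℕ) : 1 ≤ ∏ p ∈ mersenneLarge m, eulerFac p :=
  one_le_prod_eulerFac fun _ hp => two_lt_of_mem_mersennePrimes (mem_filter.1 hp).1

/-- A Newton step for the cube root, rounded up, in units of `10⁻¹²`. -/
def cbrtStep (v c : ℕ) : ℕ := (v * 10 ^ 24 + 2 * c ^ 3) / (3 * c ^ 2) + 1

lemma le_cbrtStep {v c : ℕ} (hc : 0 < c) {B : ℝ} (hB0 : 0 ≤ B) (hB : B ^ 3 ≤ (v : ℝ) / 10 ^ 12) :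
    B ≤ (cbrtStep v c : ℝ) / 10 ^ 12 := by
  have h1 := natCast_div_add_one_ge (v * 10 ^ 24 + 2 * c ^ 3) (3 * c ^ 2)
  rw [le_div_iff₀ (by positivity)]
  refine le_trans ?_ h1
  have hc' : (0 : ℝ) < c := by exact_mod_cast hc
  push_cast
  rw [le_div_iff₀ (by positivity)]
  rw [le_div_iff₀ (by positivity)] at hB
  set D : ℝ := B * 10 ^ 12 with hD
  have hD0 : 0 ≤ D := by positivity
  have h2 : D ^ 3 ≤ v * 10 ^ 24 := by
    have : D ^ 3 = (B ^ 3 * 10 ^ 12) * 10 ^ 24 := by rw [hD]; ring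
    rw [this]; gcongr
  nlinarith [mul_nonneg (by positivity : 0 ≤ D + 2 * (c : ℝ)) (sq_nonneg (D - c))]

/-- An upper bound for the cube of the product over `mersenneLarge m`, in units of `10⁻¹²`. -/
def largeUpper (m : ℕ) : ℕ := 10 ^ 12 + (3 * (mersenneBits m / 11) * 10 ^ 12 / 2045 + 1)

/-- An upper bound for `mersenneProd m`, in units of `10⁻¹²`. -/
def mersenneUpper (m : ℕ) : ℕ :=
  eulerUpper ((smallPrimeOrders.filter (·.2 ≤ m)).map Prod.fst) *
    cbrtStep (largeUpper m) (cbrtStep (largeUpper m) (cbrtStep (largeUpper m) (10 ^ 12)))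
      / 10 ^ 12 + 1

lemma mersenneProd_le_mersenneUpper {m : ℕ} (hm : m < 200) :
    mersenneProd m ≤ (mersenneUpper m : ℝ) / 10 ^ 12 := by
  have h1 := prod_mersenneSmall_le hm
  have h2 : ∏ p ∈ mersenneLarge m, eulerFac p ≤ (cbrtStep (largeUpper m) (cbrtStep (largeUpper m)
      (cbrtStep (largeUpper m) (10 ^ 12))) : ℝ) / 10 ^ 12 := by
    refine le_cbrtStep (Nat.succ_pos _) (zero_le_one.trans (one_le_prod_mersenneLarge m))
      ((prod_mersenneLarge_cube_le m).trans ?_)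
    have h3 := natCast_div_add_one_ge (3 * (mersenneBits m / 11) * 10 ^ 12) 2045
    rw [le_div_iff₀ (by positivity), largeUpper, Nat.cast_add]
    refine le_trans (le_of_eq ?_) (add_le_add_right h3 _)
    push_cast
    ring
  rw [mersenneProd_eq]
  refine (mul_le_mul h1 h2 (zero_le_one.trans (one_le_prod_mersenneLarge m))
    (by positivity)).trans ?_
  have h4 := natCast_div_add_one_ge (eulerUpper ((smallPrimeOrders.filter (·.2 ≤ m)).map Prod.fst) *
    cbrtStep (largeUpper m) (cbrtStep (largeUpper m) (cbrtStep (largeUpper m) (10 ^ 12)))) (10 ^ 12)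
  rw [mersenneUpper]
  refine le_trans (le_of_eq ?_) (div_le_div_of_nonneg_right h4 (by positivity))
  push_cast
  ring

/-- An upper bound for `∑_{x ≤ m} mersenneProd x / (x (x + 1))`, in units of `10⁻¹²`. -/
def mersenneSumUpper : ℕ → ℕ
  | 0 => 0
  | m + 1 => mersenneSumUpper m + (mersenneUpper (m + 1) / ((m + 1) * (m + 2)) + 1)

lemma sum_mersenneProd_le {m : ℕ} (hm : m < 200) :
    ∑ i ∈ range m, mersenneProd (i + 1) / (((i : ℝ) + 1) * (i + 2)) ≤
      (mersenneSumUpper m : ℝ) / 10 ^ 12 := by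
  induction m with
  | zero => simp [mersenneSumUpper]
  | succ m ih =>
    rw [sum_range_succ, mersenneSumUpper, Nat.cast_add, add_div]
    refine add_le_add (ih (by omega)) ?_
    have h1 := natCast_div_add_one_ge (mersenneUpper (m + 1)) ((m + 1) * (m + 2))
    refine le_trans ?_ (div_le_div_of_nonneg_right h1 (by positivity))
    push_cast
    rw [div_right_comm]
    gcongr
    exact mersenneProd_le_mersenneUpper hm

lemma mersenneSumUpper_le : mersenneSumUpper 199 ≤ 1068950000000 := by decide +kernel

lemma mersenneProd_le_rpow {m : ℕ} (hm : 200 ≤ m) :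
    mersenneProd m ≤ 0.1367 * (m : ℝ) ^ (2 / 3 : ℝ) := by
  have hm' : (200 : ℝ) ≤ m := by exact_mod_cast hm
  have hm0 : (0 : ℝ) ≤ m := by linarith
  have hbits : (8 * mersenneBits m : ℝ) ≤ 3 * (m : ℝ) ^ 2 + 8 * m := by
    have := mersenneBits_eq m
    exact_mod_cast (Nat.le_add_right _ _).trans this.le
  have h11 : ((mersenneBits m / 11 : ℕ) : ℝ) ≤ (mersenneBits m : ℝ) / 11 := Nat.cast_div_le
  have h1 : (∏ p ∈ mersenneLarge m, eulerFac p) ^ 3 ≤ (0.0424 * (m : ℝ) ^ (2 / 3 : ℝ)) ^ 3 := by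
    have h2 : ((m : ℝ) ^ (2 / 3 : ℝ)) ^ 3 = (m : ℝ) ^ 2 := by
      rw [← Real.rpow_natCast, ← Real.rpow_mul hm0]; norm_num
    rw [mul_pow, h2]
    refine (prod_mersenneLarge_cube_le m).trans ?_
    nlinarith
  have h2 := le_of_pow_le_pow_left₀ (by norm_num) (by positivity) h1
  rw [mersenneProd_eq]
  refine (mul_le_mul (prod_mersenneSmall_le_const m) h2
    (zero_le_one.trans (one_le_prod_mersenneLarge m)) (by norm_num)).trans ?_
  have : 0 ≤ (m : ℝ) ^ (2 / 3 : ℝ) := by positivity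
  nlinarith

lemma rpow_two_thirds_div_le {x : ℝ} (hx : 0 < x) : x ^ (2 / 3 : ℝ) / (x * (x + 1)) ≤
    3 * (x ^ (-(1 / 3) : ℝ) - (x + 1) ^ (-(1 / 3) : ℝ)) := by
  have hx1 : 0 < x + 1 := by linarith
  set a : ℝ := x ^ (1 / 3 : ℝ) with ha
  set b : ℝ := (x + 1) ^ (1 / 3 : ℝ) with hb
  have ha0 : 0 < a := by positivity
  have hb0 : 0 < b := by positivity
  have h1 : x = a ^ 3 := by
    rw [ha, ← Real.rpow_natCast, ← Real.rpow_mul hx.le]; norm_num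
  have h2 : x + 1 = b ^ 3 := by
    rw [hb, ← Real.rpow_natCast, ← Real.rpow_mul hx1.le]; norm_num
  have h3 : x ^ (2 / 3 : ℝ) = a ^ 2 := by
    rw [ha, ← Real.rpow_natCast, ← Real.rpow_mul hx.le]; norm_num
  have hab : a ≤ b := Real.rpow_le_rpow hx.le (by linarith) (by norm_num)
  rw [Real.rpow_neg hx.le, Real.rpow_neg hx1.le, ← ha, ← hb, h3, h2]
  conv_lhs => rw [h1]
  have h4 : b ^ 3 - a ^ 3 = 1 := by linarith
  have h5 : 1 ≤ 3 * b ^ 2 * (b - a) := by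
    nlinarith [mul_nonneg (sub_nonneg.2 hab) (mul_nonneg hb0.le (sub_nonneg.2 hab)),
      mul_nonneg (sub_nonneg.2 hab) (mul_nonneg ha0.le (sub_nonneg.2 hab))]
  have h6 : a ^ 2 / (a ^ 3 * b ^ 3) = 1 / (a * b ^ 3) := by field_simp
  have h7 : 3 * (a⁻¹ - b⁻¹) = 3 * b ^ 2 * (b - a) / (a * b ^ 3) := by field_simp
  rw [h6, h7]
  gcongr

lemma sum_mersenneProd_tail_le {m : ℕ} (hm : 199 ≤ m) :
    ∑ i ∈ range m, mersenneProd (i + 1) / (((i : ℝ) + 1) * (i + 2)) ≤ 1.06895 +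
      0.4101 * ((200 : ℝ) ^ (-(1 / 3) : ℝ) - ((m : ℝ) + 1) ^ (-(1 / 3) : ℝ)) := by
  induction m, hm using Nat.le_induction with
  | base =>
    have h1 := sum_mersenneProd_le (m := 199) (by norm_num)
    have h2 : (mersenneSumUpper 199 : ℝ) ≤ 1068950000000 := by exact_mod_cast mersenneSumUpper_le
    have h3 : ((199 : ℕ) : ℝ) + 1 = 200 := by norm_num
    rw [h3, sub_self, mul_zero, add_zero]
    refine h1.trans ?_
    rw [div_le_iff₀ (by positivity)]
    linarith
  | succ m hm ih =>
    rw [sum_range_succ]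
    have h1 := mersenneProd_le_rpow (m := m + 1) (by omega)
    have h2 := rpow_two_thirds_div_le (x := (m : ℝ) + 1) (by positivity)
    push_cast at h1 ⊢
    have h3 : mersenneProd (m + 1) / (((m : ℝ) + 1) * (m + 2)) ≤
        0.1367 * (((m : ℝ) + 1) ^ (2 / 3 : ℝ) / (((m : ℝ) + 1) * (m + 1 + 1))) := by
      rw [← mul_div_assoc, show (m : ℝ) + 1 + 1 = m + 2 by ring]
      gcongr
    linarith

lemma sum_mersenneProd_sub_div_le (m : ℕ) :
    ∑ i ∈ range m, (mersenneProd (i + 1) - mersenneProd i) / ((i : ℝ) + 1) ≤ 0.1413 := by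
  have hbig : ∀ n, 199 ≤ n →
      ∑ i ∈ range n, (mersenneProd (i + 1) - mersenneProd i) / ((i : ℝ) + 1) ≤ 0.1413 := by
    intro n hn
    rw [sum_mersenneProd_sub_div]
    have h1 := sum_mersenneProd_tail_le hn
    have h2 : mersenneProd n / (n + 1) ≤ 0.1367 * ((n : ℝ) + 1) ^ (-(1 / 3) : ℝ) := by
      have hn0 : (0 : ℝ) < (n : ℝ) + 1 := by positivity
      rw [div_le_iff₀ hn0, mul_assoc]
      have h3 : ((n : ℝ) + 1) ^ (-(1 / 3) : ℝ) * ((n : ℝ) + 1) = ((n : ℝ) + 1) ^ (2 / 3 : ℝ) := by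
        nth_rewrite 2 [← Real.rpow_one ((n : ℝ) + 1)]
        rw [← Real.rpow_add hn0]; norm_num
      rw [h3]
      have h4 := mersenneProd_le_rpow (m := n + 1) (by omega)
      push_cast at h4
      exact (mersenneProd_le_succ n).trans h4
    have h3 : (200 : ℝ) ^ (-(1 / 3) : ℝ) ≤ 0.1711 := by
      refine le_of_pow_le_pow_left₀ (n := 3) (by norm_num) (by norm_num) ?_
      rw [← Real.rpow_natCast, ← Real.rpow_mul (by norm_num)]
      norm_num [Real.rpow_neg_one]
    have h4 : 0 ≤ ((n : ℝ) + 1) ^ (-(1 / 3) : ℝ) := by positivity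
    linarith
  refine le_trans ?_ (hbig (max m 199) (le_max_right _ _))
  refine sum_le_sum_of_subset_of_nonneg (range_mono (le_max_left _ _)) fun i _ _ => ?_
  exact div_nonneg (sub_nonneg.2 (mersenneProd_le_succ i)) (by positivity)

/-- The mean value of `singFactor` along the Mersenne numbers. -/
lemma sum_singFactor_two_pow_sub_one_le (K : ℕ) :
    ∑ k ∈ Ioc 0 K, singFactor (2 ^ k - 1) ≤ 2.23 * K := by
  rw [sum_congr rfl fun k hk => singFactor_two_pow_sub_one_eq hk]
  refine (sum_smallFactor_mul_le K K).trans ?_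
  gcongr
  have := sum_mersenneProd_sub_div_le K
  linarith

end LinnikGRH

namespace LinnikGRH
open Finset

lemma singFactor_two_pow_mul (a : ℕ) {m : ℕ} (hm : m ≠ 0) :
    singFactor (2 ^ a * m) = singFactor m := by
  unfold singFactor
  refine prod_congr ?_ fun _ _ => rfl
  rw [Nat.primeFactors_mul (by positivity) hm]
  ext p
  simp only [mem_erase, mem_union, Nat.mem_primeFactors]
  constructor
  · rintro ⟨h2, ⟨hp, hd, -⟩ | h⟩
    · exact absurd ((Nat.prime_dvd_prime_iff_eq hp Nat.prime_two).1 (hp.dvd_of_dvd_pow hd)) h2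
    · exact ⟨h2, h⟩
  · exact fun h => ⟨h.1, Or.inr h.2⟩

lemma singFactor_two_pow_sub {μ ν : ℕ} (h : μ < ν) :
    singFactor (2 ^ ν - 2 ^ μ) = singFactor (2 ^ (ν - μ) - 1) := by
  have h1 : 2 ^ ν - 2 ^ μ = 2 ^ μ * (2 ^ (ν - μ) - 1) := by
    rw [Nat.mul_sub, ← pow_add, Nat.add_sub_cancel' h.le, mul_one]
  rw [h1, singFactor_two_pow_mul _ (two_pow_sub_one_ne_zero (by omega))]

/-- The mean value of `singFactor` over differences of powers of two. -/
lemma sum_singFactor_sub_le (L : ℕ) :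
    2 * ∑ ν ∈ Ioc 0 L, ∑ μ ∈ Ioo 0 ν, singFactor (2 ^ ν - 2 ^ μ) ≤ 2.23 * (L : ℝ) ^ 2 := by
  have h1 : ∀ ν, ∑ μ ∈ Ioo 0 ν, singFactor (2 ^ ν - 2 ^ μ) ≤ 2.23 * ((ν - 1 : ℕ) : ℝ) := by
    intro ν
    refine le_trans (le_of_eq ?_) (sum_singFactor_two_pow_sub_one_le (ν - 1))
    refine sum_nbij' (fun μ => ν - μ) (fun k => ν - k) ?_ ?_ ?_ ?_ ?_
    · intro μ hμ; simp only [mem_Ioo, mem_Ioc] at *; omega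
    · intro μ hμ; simp only [mem_Ioo, mem_Ioc] at *; omega
    · intro μ hμ; simp only [mem_Ioo] at *; omega
    · intro μ hμ; simp only [mem_Ioc] at *; omega
    · intro μ hμ; exact singFactor_two_pow_sub (mem_Ioo.1 hμ).2
  have h2 : ∑ ν ∈ Ioc 0 L, ((ν - 1 : ℕ) : ℝ) * 2 ≤ (L : ℝ) ^ 2 := by
    induction L with
    | zero => simp
    | succ L ih =>
      rw [sum_Ioc_succ_top (Nat.zero_le _)]
      push_cast [Nat.add_sub_cancel]
      nlinarith
  calc 2 * ∑ ν ∈ Ioc 0 L, ∑ μ ∈ Ioo 0 ν, singFactor (2 ^ ν - 2 ^ μ)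
      ≤ 2 * ∑ ν ∈ Ioc 0 L, 2.23 * ((ν - 1 : ℕ) : ℝ) := by gcongr with ν; exact h1 ν
    _ = 2.23 * ∑ ν ∈ Ioc 0 L, ((ν - 1 : ℕ) : ℝ) * 2 := by rw [← mul_sum, ← sum_mul]; ring
    _ ≤ _ := by gcongr

end LinnikGRH

namespace LinnikGRH
open Finset

lemma sinh_mul_le {a u : ℝ} (ha : 0 ≤ a) (hu0 : 0 ≤ u) (hu1 : u ≤ 1) :
    Real.sinh (a * u) ≤ u * Real.sinh a := by
  refine hasSum_le (fun n => ?_) (Real.hasSum_sinh (a * u)) ((Real.hasSum_sinh a).mul_left u)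
  have h1 : u ^ (2 * n + 1) ≤ u := by
    calc u ^ (2 * n + 1) ≤ u ^ 1 := pow_le_pow_of_le_one hu0 hu1 (by omega)
      _ = u := pow_one u
  calc (a * u) ^ (2 * n + 1) / ((2 * n + 1).factorial : ℝ)
      = u ^ (2 * n + 1) * (a ^ (2 * n + 1) / ((2 * n + 1).factorial : ℝ)) := by rw [mul_pow]; ring
    _ ≤ u * (a ^ (2 * n + 1) / ((2 * n + 1).factorial : ℝ)) := by gcongr

lemma cosh_mul_le {a u : ℝ} (hu : |u| ≤ 1) :
    Real.cosh (a * u) ≤ 1 + u ^ 2 * (Real.cosh a - 1) := by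
  have hu2 : u ^ 2 ≤ 1 := by rw [← sq_abs]; exact pow_le_one₀ (abs_nonneg u) hu
  have h1 := (hasSum_nat_add_iff' 1).2 (Real.hasSum_cosh (a * u))
  have h2 := ((hasSum_nat_add_iff' 1).2 (Real.hasSum_cosh a)).mul_left (u ^ 2)
  simp only [range_one, sum_singleton, mul_zero, pow_zero, Nat.factorial_zero, Nat.cast_one,
    div_one] at h1 h2
  have h3 : Real.cosh (a * u) - 1 ≤ u ^ 2 * (Real.cosh a - 1) := by
    refine hasSum_le (fun n => ?_) h1 h2
    have h4 : (u ^ 2) ^ (n + 1) ≤ u ^ 2 := by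
      calc (u ^ 2) ^ (n + 1) ≤ (u ^ 2) ^ 1 := pow_le_pow_of_le_one (sq_nonneg u) hu2 (by omega)
        _ = u ^ 2 := pow_one _
    have h5 : 0 ≤ a ^ (2 * (n + 1)) := by rw [pow_mul]; positivity
    calc (a * u) ^ (2 * (n + 1)) / ((2 * (n + 1)).factorial : ℝ)
        = (u ^ 2) ^ (n + 1) * (a ^ (2 * (n + 1)) / ((2 * (n + 1)).factorial : ℝ)) := by
          rw [mul_pow, pow_mul u]; ring
      _ ≤ u ^ 2 * (a ^ (2 * (n + 1)) / ((2 * (n + 1)).factorial : ℝ)) := by gcongr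
  linarith

lemma exp_nine_tenths : 2.4596 < Real.exp 0.9 ∧ Real.exp 0.9 < 2.45961 := by
  have h : Real.exp 0.9 = Real.exp 1 * Real.exp (-0.1) := by rw [← Real.exp_add]; norm_num
  have h1 := Real.exp_one_gt_d9
  have h2 := Real.exp_one_lt_d9
  have h3 := Real.exp_bound (x := -0.1) (by norm_num [abs_of_neg]) (n := 6) (by norm_num)
  rw [abs_le] at h3
  norm_num [sum_range_succ, Nat.factorial] at h3
  rw [h]
  constructor <;> norm_num at * <;> nlinarith

lemma transfer_ineq {u : ℝ} (hu : |u| ≤ 1) :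
    Real.exp (0.9 * u) * (1 + 0.258 * u) + Real.exp (-(0.9 * u)) * (1 - 0.258 * u) ≤
      2 * (1.3498 * (1 + 0.258 * (2 * u ^ 2 - 1))) := by
  have hu2 : u ^ 2 ≤ 1 := by rw [← sq_abs]; exact pow_le_one₀ (abs_nonneg u) hu
  have h1 : Real.exp (0.9 * u) * (1 + 0.258 * u) + Real.exp (-(0.9 * u)) * (1 - 0.258 * u) =
      2 * (Real.cosh (0.9 * u) + 0.258 * (u * Real.sinh (0.9 * u))) := by
    rw [Real.cosh_eq, Real.sinh_eq]; ring
  have h2 : u * Real.sinh (0.9 * u) ≤ u ^ 2 * Real.sinh 0.9 := by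
    have h3 := mul_le_mul_of_nonneg_left
      (sinh_mul_le (a := 0.9) (by norm_num) (abs_nonneg u) hu) (abs_nonneg u)
    rcases abs_cases u with ⟨h, -⟩ | ⟨h, -⟩
    · rw [h] at h3; linarith
    · rw [h, mul_neg, Real.sinh_neg] at h3; linarith
  have h3 := cosh_mul_le (a := 0.9) hu
  obtain ⟨h4, h5⟩ := exp_nine_tenths
  have h6 : Real.exp (-0.9) ≤ 0.40658 := by
    rw [Real.exp_neg, inv_le_comm₀ (Real.exp_pos _) (by norm_num)]
    norm_num at h4 ⊢; linarith
  have h8 : 0.40656 ≤ Real.exp (-0.9) := by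
    rw [Real.exp_neg, le_inv_comm₀ (by norm_num) (Real.exp_pos _)]
    norm_num at h5 ⊢; linarith
  have h7 : Real.cosh 0.9 + 0.258 * Real.sinh 0.9 ≤ 1.69800 := by
    rw [Real.cosh_eq, Real.sinh_eq]; linarith
  rw [h1]
  nlinarith [sq_nonneg u]

/-- The sum of `cos (2 π 2 ^ i x)` over `i < n`. -/
noncomputable def cosSum (n : ℕ) (x : ℝ) : ℝ :=
  ∑ i ∈ range n, Real.cos (2 * Real.pi * (2 ^ i * x))

lemma cosSum_succ (n : ℕ) (x : ℝ) :
    cosSum (n + 1) x = Real.cos (2 * Real.pi * x) + cosSum n (2 * x) := by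
  unfold cosSum
  rw [sum_range_succ', add_comm]
  congr 1
  · simp
  · refine sum_congr rfl fun i _ => ?_
    rw [pow_succ, mul_assoc (2 ^ i : ℝ)]

lemma cosSum_add_one (n : ℕ) (x : ℝ) : cosSum n (x + 1) = cosSum n x := by
  unfold cosSum
  refine sum_congr rfl fun i _ => ?_
  have := Real.cos_add_nat_mul_two_pi (2 * Real.pi * (2 ^ i * x)) (2 ^ i)
  rw [← this]
  push_cast
  ring_nf

lemma sum_exp_cosSum_mul_le (n : ℕ) : ∀ K, n ≤ K →
    ∑ j ∈ range (2 ^ K), (1 + 0.258 * Real.cos (2 * Real.pi * (j / 2 ^ K))) *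
      Real.exp (0.9 * cosSum n (j / 2 ^ K)) ≤ 1.258 * 1.3498 ^ n * 2 ^ K := by
  induction n with
  | zero =>
    intro K _
    calc _ ≤ ∑ j ∈ range (2 ^ K), (1.258 : ℝ) := by
          refine sum_le_sum fun j _ => ?_
          have := Real.cos_le_one (2 * Real.pi * (j / 2 ^ K))
          simp only [cosSum, range_zero, sum_empty, mul_zero, Real.exp_zero, mul_one]
          linarith
      _ = _ := by rw [sum_const, card_range, nsmul_eq_mul]; push_cast; ring
  | succ n ih =>
    intro K hK
    obtain ⟨k, rfl⟩ : ∃ k, K = k + 1 := ⟨K - 1, by omega⟩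
    have hpow : 2 ^ (k + 1) = 2 ^ k + 2 ^ k := by ring
    rw [hpow, sum_range_add, ← sum_add_distrib]
    calc _ ≤ ∑ j ∈ range (2 ^ k), 2 * (1.3498 *
          ((1 + 0.258 * Real.cos (2 * Real.pi * (j / 2 ^ k))) *
            Real.exp (0.9 * cosSum n (j / 2 ^ k)))) := by
          refine sum_le_sum fun j _ => ?_
          set x : ℝ := (j : ℝ) / 2 ^ (k + 1) with hx
          have h2x : (j : ℝ) / 2 ^ k = 2 * x := by rw [hx, pow_succ]; field_simp
          have hx2 : ((2 ^ k + j : ℕ) : ℝ) / 2 ^ (k + 1) = x + 1 / 2 := by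
            rw [hx, pow_succ]; push_cast; field_simp; ring
          rw [hx2, h2x, cosSum_succ, cosSum_succ,
            show 2 * (x + 1 / 2) = 2 * x + 1 by ring, cosSum_add_one,
            show 2 * Real.pi * (x + 1 / 2) = 2 * Real.pi * x + Real.pi by ring, Real.cos_add_pi,
            show 2 * Real.pi * (2 * x) = 2 * (2 * Real.pi * x) by ring, Real.cos_two_mul]
          set u := Real.cos (2 * Real.pi * x)
          have hT := transfer_ineq (u := u) (Real.abs_cos_le_one _)
          set S := cosSum n (2 * x)
          have hS := (Real.exp_pos (0.9 * S)).le
          simp only [mul_add, Real.exp_add, mul_neg] at hT ⊢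
          have := mul_le_mul_of_nonneg_right hT hS
          linarith
      _ = 2 * (1.3498 * ∑ j ∈ range (2 ^ k), (1 + 0.258 * Real.cos (2 * Real.pi * (j / 2 ^ k))) *
            Real.exp (0.9 * cosSum n (j / 2 ^ k))) := by rw [mul_sum, mul_sum]
      _ ≤ 2 * (1.3498 * (1.258 * 1.3498 ^ n * 2 ^ k)) := by
          gcongr; exact ih k (by omega)
      _ = _ := by ring

lemma sum_exp_cosSum_le {n K : ℕ} (h : n ≤ K) :
    ∑ j ∈ range (2 ^ K), Real.exp (0.9 * cosSum n (j / 2 ^ K)) ≤ 2 * 1.3498 ^ n * 2 ^ K := by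
  have h1 := sum_exp_cosSum_mul_le n K h
  have h2 : 0.742 * ∑ j ∈ range (2 ^ K), Real.exp (0.9 * cosSum n (j / 2 ^ K)) ≤
      ∑ j ∈ range (2 ^ K), (1 + 0.258 * Real.cos (2 * Real.pi * (j / 2 ^ K))) *
        Real.exp (0.9 * cosSum n (j / 2 ^ K)) := by
    rw [mul_sum]
    refine sum_le_sum fun j _ => mul_le_mul_of_nonneg_right ?_ (Real.exp_pos _).le
    have := Real.neg_one_le_cos (2 * Real.pi * (j / 2 ^ K))
    linarith
  have h3 : (0 : ℝ) ≤ 1.3498 ^ n * 2 ^ K := by positivity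
  nlinarith

end LinnikGRH

namespace LinnikGRH
open Finset
open scoped ComplexOrder

/-- The exponential sum over powers of two. -/
noncomputable def powSum (L : ℕ) (x : ℝ) : ℂ := ∑ ν ∈ Ioc 0 L, ex (2 ^ ν * x)

lemma norm_powSum_le (L : ℕ) (x : ℝ) : ‖powSum L x‖ ≤ L := by
  refine (norm_sum_le _ _).trans ?_
  simp [norm_ex]

lemma re_ex (x : ℝ) : (ex x).re = Real.cos (2 * Real.pi * x) := by
  rw [ex_eq_exp_ofReal, Complex.exp_ofReal_mul_I_re]

/-- All Fourier coefficients of a function on `ℤ / M` are nonnegative. -/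
def NonnegCoeff (M : ℕ) (g : ℕ → ℂ) : Prop :=
  ∀ h : ℤ, 0 ≤ ∑ j ∈ range M, g j * ex (h * (j / M))

lemma nonnegCoeff_one {M : ℕ} (hM : M ≠ 0) : NonnegCoeff M fun _ => 1 := by
  intro h
  simp_rw [one_mul]
  rw [sum_ex_div M hM h]
  split_ifs
  · exact Nat.cast_nonneg M
  · exact le_rfl

lemma NonnegCoeff.sum_ex_mul {M : ℕ} {g : ℕ → ℂ} (hg : NonnegCoeff M g) (s : Finset ℕ) (σ : ℤ) :
    NonnegCoeff M fun j => (∑ ν ∈ s, ex (σ * (2 ^ ν * (j / M)))) * g j := by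
  intro h
  have h1 : ∑ j ∈ range M, (∑ ν ∈ s, ex (σ * (2 ^ ν * (j / M)))) * g j * ex (h * (j / M)) =
      ∑ ν ∈ s, ∑ j ∈ range M, g j * ex ((σ * 2 ^ ν + h : ℤ) * (j / M)) := by
    simp_rw [sum_mul]
    rw [sum_comm]
    refine sum_congr rfl fun ν _ => sum_congr rfl fun j _ => ?_
    push_cast
    rw [add_mul, ex_add, mul_assoc (σ : ℝ)]
    ring
  rw [h1]
  exact sum_nonneg fun ν _ => hg _

lemma NonnegCoeff.powSum_mul {M L : ℕ} {g : ℕ → ℂ} (hg : NonnegCoeff M g) :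
    NonnegCoeff M fun j => powSum L (j / M) * g j := by
  have := hg.sum_ex_mul (Ioc 0 L) 1
  simpa [powSum] using this

lemma NonnegCoeff.conj_powSum_mul {M L : ℕ} {g : ℕ → ℂ} (hg : NonnegCoeff M g) :
    NonnegCoeff M fun j => (starRingEnd ℂ) (powSum L (j / M)) * g j := by
  have := hg.sum_ex_mul (Ioc 0 L) (-1)
  simpa [powSum, conj_ex] using this

lemma nonnegCoeff_powSum_pow {M : ℕ} (hM : M ≠ 0) (L a b : ℕ) :
    NonnegCoeff M fun j => powSum L (j / M) ^ a * (starRingEnd ℂ) (powSum L (j / M)) ^ b := by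
  induction a with
  | zero =>
    induction b with
    | zero => simpa using nonnegCoeff_one hM
    | succ b ih =>
      convert ih.conj_powSum_mul (L := L) using 2 with j
      ring
  | succ a ih =>
    convert ih.powSum_mul (L := L) using 2 with j
    ring

lemma sum_powSum_pow_nonneg {M : ℕ} (hM : M ≠ 0) (L a b : ℕ) :
    0 ≤ ∑ j ∈ range M, powSum L (j / M) ^ a * (starRingEnd ℂ) (powSum L (j / M)) ^ b := by
  simpa [ex_zero] using nonnegCoeff_powSum_pow hM L a b 0

lemma two_mul_re_pow (c z : ℂ) (k : ℕ) : (((2 * (c * z).re) ^ k : ℝ) : ℂ) =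
    ∑ m ∈ range (k + 1), c ^ m * (starRingEnd ℂ) c ^ (k - m) * (k.choose m) *
      (z ^ m * (starRingEnd ℂ) z ^ (k - m)) := by
  have h1 : ((2 * (c * z).re : ℝ) : ℂ) = c * z + (starRingEnd ℂ) c * (starRingEnd ℂ) z := by
    rw [← map_mul, Complex.add_conj]
  rw [Complex.ofReal_pow, h1, add_pow]
  refine sum_congr rfl fun m _ => ?_
  ring

lemma sum_re_pow_le {M : ℕ} (hM : M ≠ 0) (L k : ℕ) {c : ℂ} (hc : ‖c‖ = 1) :
    ∑ j ∈ range M, (2 * (c * powSum L (j / M)).re) ^ k ≤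
      ∑ j ∈ range M, (2 * (powSum L (j / M)).re) ^ k := by
  have key : ∀ c : ℂ, ((∑ j ∈ range M, (2 * (c * powSum L (j / M)).re) ^ k : ℝ) : ℂ) =
      ∑ m ∈ range (k + 1), c ^ m * (starRingEnd ℂ) c ^ (k - m) * (k.choose m) *
        ∑ j ∈ range M, powSum L (j / M) ^ m * (starRingEnd ℂ) (powSum L (j / M)) ^ (k - m) := by
    intro c
    rw [Complex.ofReal_sum]
    simp_rw [two_mul_re_pow, mul_sum]
    rw [sum_comm]
  have h1 := key c
  have h2 := key 1
  simp only [one_mul, one_pow, map_one] at h2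
  have hnorm : ‖((∑ j ∈ range M, (2 * (c * powSum L (j / M)).re) ^ k : ℝ) : ℂ)‖ ≤
      ∑ m ∈ range (k + 1), ((k.choose m : ℕ) : ℝ) *
        (∑ j ∈ range M, powSum L (j / M) ^ m * (starRingEnd ℂ) (powSum L (j / M)) ^ (k - m)).re := by
    rw [h1]
    refine (norm_sum_le _ _).trans (sum_le_sum fun m _ => le_of_eq ?_)
    rw [norm_mul, norm_mul, norm_mul, norm_pow, norm_pow, Complex.norm_conj, hc, one_pow, one_pow,
      one_mul, one_mul, Complex.norm_natCast]
    congr 1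
    exact_mod_cast congrArg Complex.re
      (Complex.norm_of_nonneg' (sum_powSum_pow_nonneg hM L m (k - m)))
  have h3 := congrArg Complex.re h2
  rw [Complex.ofReal_re, Complex.re_sum] at h3
  rw [h3]
  rw [Complex.norm_real] at hnorm
  refine (le_abs_self _).trans (hnorm.trans (le_of_eq (sum_congr rfl fun m _ => ?_)))
  rw [← Complex.ofReal_natCast, Complex.re_ofReal_mul]

lemma sum_exp_re_le {M : ℕ} (hM : M ≠ 0) (L : ℕ) {c : ℂ} (hc : ‖c‖ = 1) {ξ : ℝ} (hξ : 0 ≤ ξ) :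
    ∑ j ∈ range M, Real.exp (ξ * (c * powSum L (j / M)).re) ≤
      ∑ j ∈ range M, Real.exp (ξ * (powSum L (j / M)).re) := by
  have hexp : ∀ x : ℝ, HasSum (fun n : ℕ => x ^ n / (n.factorial : ℝ)) (Real.exp x) := by
    intro x
    rw [Real.exp_eq_exp_ℝ]
    exact NormedSpace.expSeries_div_hasSum_exp x
  have h1 := hasSum_sum (s := range M) fun j _ => hexp (ξ * (c * powSum L (j / M)).re)
  have h2 := hasSum_sum (s := range M) fun j _ => hexp (ξ * (powSum L (j / M)).re)
  refine hasSum_le (fun k => ?_) h1 h2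
  have h3 := mul_le_mul_of_nonneg_left (sum_re_pow_le hM L k hc)
    (by positivity : 0 ≤ (ξ / 2) ^ k / (k.factorial : ℝ))
  rw [mul_sum, mul_sum] at h3
  refine le_trans (le_of_eq ?_) (h3.trans (le_of_eq ?_)) <;>
  · refine sum_congr rfl fun j _ => ?_
    rw [div_mul_eq_mul_div, ← mul_pow]
    ring_nf

lemma re_powSum_le (L : ℕ) (x : ℝ) : (powSum L x).re ≤ cosSum (L + 1) x + 1 := by
  have h1 : (powSum L x).re = ∑ ν ∈ Ioc 0 L, Real.cos (2 * Real.pi * (2 ^ ν * x)) := by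
    rw [powSum, Complex.re_sum]
    exact sum_congr rfl fun ν _ => re_ex _
  have h2 : range (L + 1) = insert 0 (Ioc 0 L) := by ext i; simp
  rw [h1, cosSum, h2, sum_insert (by simp)]
  have := Real.neg_one_le_cos (2 * Real.pi * (2 ^ 0 * x))
  linarith

/-- Some of a thousand equally spaced rotations almost aligns a complex number with `ℝ≥0`. -/
lemma exists_rotation (z : ℂ) :
    ∃ k ∈ range 1000, (1 - 5 / 10 ^ 6) * ‖z‖ ≤ (ex ((k : ℝ) / 1000) * z).re := by
  set θ : ℝ := z.arg / (2 * Real.pi) with hθ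
  set m : ℤ := round (-(1000 * θ)) with hm
  have hπ := Real.pi_pos
  have hz : z = (‖z‖ : ℂ) * ex θ := by
    rw [ex_eq_exp_ofReal, hθ, mul_div_cancel₀ _ (by positivity)]
    exact (Complex.norm_mul_exp_arg_mul_I z).symm
  have hmod : 0 ≤ m % 1000 := Int.emod_nonneg _ (by norm_num)
  have hmod' : m % 1000 < 1000 := Int.emod_lt_of_pos _ (by norm_num)
  refine ⟨(m % 1000).toNat, mem_range.2 (by omega), ?_⟩
  have h1 : (((m % 1000).toNat : ℕ) : ℝ) = m - 1000 * ((m / 1000 : ℤ) : ℝ) := by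
    have h2 : (((m % 1000).toNat : ℕ) : ℤ) = m - 1000 * (m / 1000) := by
      rw [Int.toNat_of_nonneg hmod]; omega
    exact_mod_cast h2
  have h3 : ex ((((m % 1000).toNat : ℕ) : ℝ) / 1000) = ex ((m : ℝ) / 1000) := by
    rw [h1, ← ex_add_int ((m : ℝ) / 1000) (-(m / 1000))]
    congr 1
    push_cast
    ring
  have h4 : ex ((m : ℝ) / 1000) * z = (‖z‖ : ℂ) * ex (m / 1000 + θ) := by
    conv_lhs => rw [hz]
    rw [ex_add]; ring
  rw [h3, h4, Complex.re_ofReal_mul, re_ex, mul_comm]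
  refine mul_le_mul_of_nonneg_left ?_ (norm_nonneg z)
  refine le_trans ?_ (Real.one_sub_sq_div_two_le_cos)
  have h5 : |(m : ℝ) / 1000 + θ| ≤ 1 / 2000 := by
    have h6 := abs_sub_round (-(1000 * θ))
    rw [← hm] at h6
    have h7 : (m : ℝ) / 1000 + θ = -((-(1000 * θ) - m) / 1000) := by ring
    rw [h7, abs_neg, abs_div, abs_of_pos (by norm_num : (0 : ℝ) < 1000)]
    linarith
  have h6 : ((m : ℝ) / 1000 + θ) ^ 2 ≤ (1 / 2000) ^ 2 := by
    rw [← sq_abs]; gcongr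
  have h7 : Real.pi ^ 2 ≤ 10 := by nlinarith [Real.pi_lt_d2]
  rw [mul_pow, mul_pow]
  nlinarith [sq_nonneg ((m : ℝ) / 1000 + θ)]

open Classical in
/-- The points `j / M` where the sum over powers of two is large. -/
noncomputable def largeSet (L M : ℕ) : Finset ℕ :=
  (range M).filter fun j : ℕ => 0.72 * (L : ℝ) ≤ ‖powSum L ((j : ℝ) / M)‖

lemma card_powSum_ge_mul_exp_le {L K : ℕ} (h : L < K) :
    ((largeSet L (2 ^ K)).card : ℝ) *
      Real.exp (0.9 * ((1 - 5 / 10 ^ 6) * (0.72 * L))) ≤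
      1000 * (Real.exp 0.9 * (2 * 1.3498 ^ (L + 1) * 2 ^ K)) := by
  have hM : 2 ^ K ≠ 0 := by positivity
  calc _ = ∑ _j ∈ largeSet L (2 ^ K),
        Real.exp (0.9 * ((1 - 5 / 10 ^ 6) * (0.72 * L))) := by rw [sum_const, nsmul_eq_mul]
    _ ≤ ∑ j ∈ largeSet L (2 ^ K),
        ∑ k ∈ range 1000,
          Real.exp (0.9 * (ex ((k : ℝ) / 1000) * powSum L ((j : ℝ) / (2 ^ K : ℕ))).re) := by
        refine sum_le_sum fun j hj => ?_
        obtain ⟨k, hk, h1⟩ := exists_rotation (powSum L ((j : ℝ) / (2 ^ K : ℕ)))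
        refine le_trans ?_ (single_le_sum (f := fun k : ℕ =>
          Real.exp (0.9 * (ex ((k : ℝ) / 1000) * powSum L ((j : ℝ) / (2 ^ K : ℕ))).re))
          (fun i _ => (Real.exp_pos _).le) hk)
        refine Real.exp_le_exp.2 (mul_le_mul_of_nonneg_left (le_trans ?_ h1) (by norm_num))
        exact mul_le_mul_of_nonneg_left (mem_filter.1 hj).2 (by norm_num)
    _ ≤ ∑ j ∈ range (2 ^ K), ∑ k ∈ range 1000,
          Real.exp (0.9 * (ex ((k : ℝ) / 1000) * powSum L ((j : ℝ) / (2 ^ K : ℕ))).re) :=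
        sum_le_sum_of_subset_of_nonneg (filter_subset _ _)
          fun j _ _ => sum_nonneg fun k _ => (Real.exp_pos _).le
    _ = ∑ k ∈ range 1000, ∑ j ∈ range (2 ^ K),
          Real.exp (0.9 * (ex ((k : ℝ) / 1000) * powSum L ((j : ℝ) / (2 ^ K : ℕ))).re) := sum_comm
    _ ≤ ∑ _k ∈ range 1000, Real.exp 0.9 * (2 * 1.3498 ^ (L + 1) * 2 ^ K) := by
        refine sum_le_sum fun k _ => ?_
        refine (sum_exp_re_le hM L (norm_ex _) (by norm_num)).trans ?_
        refine le_trans ?_ (mul_le_mul_of_nonneg_left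
          (sum_exp_cosSum_le (n := L + 1) (K := K) h) (Real.exp_pos 0.9).le)
        rw [mul_sum]
        refine sum_le_sum fun j _ => ?_
        rw [← Real.exp_add]
        refine Real.exp_le_exp.2 ?_
        have := re_powSum_le L ((j : ℝ) / (2 ^ K : ℕ))
        push_cast at this ⊢
        linarith
    _ = _ := by rw [sum_const, card_range, nsmul_eq_mul]; norm_num

lemma two_rpow_mul_le_exp : 1.3498 * (2 : ℝ) ^ (0.502 : ℝ) ≤ Real.exp (0.9 * ((1 - 5 / 10 ^ 6) * 0.72)) := by
  have h1 : (1.3498 : ℝ) ≤ Real.exp 0.29997 := by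
    have h3 := Real.exp_bound (x := 0.29997) (by norm_num [abs_of_pos]) (n := 7) (by norm_num)
    rw [abs_le] at h3
    norm_num [sum_range_succ, Nat.factorial] at h3
    norm_num at h3 ⊢
    linarith
  have h2 : (2 : ℝ) ^ (0.502 : ℝ) ≤ Real.exp 0.34798 := by
    rw [Real.rpow_def_of_pos (by norm_num)]
    refine Real.exp_le_exp.2 ?_
    have := Real.log_two_lt_d9
    norm_num at this ⊢
    linarith
  calc _ ≤ Real.exp 0.29997 * Real.exp 0.34798 := by gcongr
    _ = Real.exp (0.29997 + 0.34798) := (Real.exp_add _ _).symm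
    _ ≤ _ := Real.exp_le_exp.2 (by norm_num)

/-- Large deviations for `powSum`. -/
lemma card_powSum_ge_le {L K : ℕ} (h : L < K) :
    ((largeSet L (2 ^ K)).card : ℝ)
      * (2 : ℝ) ^ (0.502 * (L : ℝ)) ≤ 6700 * 2 ^ K := by
  have h1 := card_powSum_ge_mul_exp_le h
  set A := ((largeSet L (2 ^ K)).card : ℝ)
  have hA : 0 ≤ A := Nat.cast_nonneg _
  have h2 : (1.3498 : ℝ) ^ L * (2 : ℝ) ^ (0.502 * (L : ℝ)) ≤
      Real.exp (0.9 * ((1 - 5 / 10 ^ 6) * (0.72 * L))) := by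
    have h3 := pow_le_pow_left₀ (by positivity) two_rpow_mul_le_exp L
    rw [mul_pow, ← Real.rpow_natCast ((2 : ℝ) ^ (0.502 : ℝ)), ← Real.rpow_mul (by norm_num),
      ← Real.exp_nat_mul] at h3
    refine h3.trans (le_of_eq ?_)
    ring_nf
  have h3 : (1.3498 : ℝ) ^ L * (A * (2 : ℝ) ^ (0.502 * (L : ℝ))) ≤
      (1.3498 : ℝ) ^ L * (6700 * 2 ^ K) := by
    calc _ = A * ((1.3498 : ℝ) ^ L * (2 : ℝ) ^ (0.502 * (L : ℝ))) := by ring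
      _ ≤ A * Real.exp (0.9 * ((1 - 5 / 10 ^ 6) * (0.72 * L))) := by gcongr
      _ ≤ 1000 * (Real.exp 0.9 * (2 * 1.3498 ^ (L + 1) * 2 ^ K)) := h1
      _ ≤ 1000 * (2.45961 * (2 * 1.3498 ^ (L + 1) * 2 ^ K)) := by
          have := exp_nine_tenths.2.le
          gcongr
      _ = 1.3498 ^ L * (6639.963156 * 2 ^ K) := by rw [pow_succ]; ring
      _ ≤ _ := by gcongr; norm_num
  exact le_of_mul_le_mul_left h3 (by positivity)

end LinnikGRH

namespace LinnikGRH
open Finset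

lemma sum_piFinset_succ {M : Type*} [AddCommMonoid M] (s : Finset ℕ) (k : ℕ) (F : ℕ → M) :
    ∑ ν ∈ Fintype.piFinset (fun _ : Fin (k + 1) => s), F (∑ i, 2 ^ ν i) =
      ∑ a ∈ s, ∑ ν ∈ Fintype.piFinset (fun _ : Fin k => s), F (2 ^ a + ∑ i, 2 ^ ν i) := by
  rw [← sum_product' (f := fun a (ν : Fin k → ℕ) => F (2 ^ a + ∑ i, 2 ^ ν i))]
  refine sum_bij' (fun ν _ => (ν 0, fun i => ν i.succ))
    (fun p _ => (Fin.cons p.1 p.2 : Fin (k + 1) → ℕ)) ?_ ?_ ?_ ?_ ?_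
  · intro ν hν
    rw [Fintype.mem_piFinset] at hν
    simp [Fintype.mem_piFinset, hν]
  · intro p hp
    rw [mem_product, Fintype.mem_piFinset] at hp
    rw [Fintype.mem_piFinset]
    intro i
    refine Fin.cases ?_ (fun i => ?_) i
    · simpa using hp.1
    · simpa using hp.2 i
  · intro ν _
    exact Fin.cons_self_tail ν
  · intro p _
    simp
  · intro ν _
    rw [Fin.sum_univ_succ]

/-- Fifteen times the local factor of `singFactor` at `3, 5, 7`. -/
def smallFac (m : ℕ) : ℕ :=
  (if m % 3 = 0 then 2 else 1) * (if m % 5 = 0 then 4 else 3) * (if m % 7 = 0 then 6 else 5)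

/-- Convolution, over a period, with the negatives of powers of two modulo `105`. -/
def powConv (g : ℕ → ℕ) (m : ℕ) : ℕ := ∑ k ∈ range 12, g (m + 104 * 2 ^ (k + 1))

/-- The effect of `powConv` on tables of values modulo `105`. -/
def tableConv (l : List ℕ) : List ℕ := (List.range 105).map fun r =>
  ((List.range 12).map fun k => l.getD ((r + 104 * 2 ^ (k + 1)) % 105) 0).sum

set_option maxRecDepth 100000 in
lemma le_of_mem_tableConv_iterate :
    ∀ x ∈ tableConv^[7] ((List.range 105).map smallFac), 15 * 1455 * 12 ^ 7 ≤ 1000 * x := by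
  decide +kernel

lemma powConv_eq_getD {g : ℕ → ℕ} {l : List ℕ} (h : ∀ m, g m = l.getD (m % 105) 0) (m : ℕ) :
    powConv g m = (tableConv l).getD (m % 105) 0 := by
  have hm : m % 105 < 105 := Nat.mod_lt _ (by norm_num)
  have h1 : (tableConv l).getD (m % 105) 0 =
      ((List.range 12).map fun k => l.getD ((m % 105 + 104 * 2 ^ (k + 1)) % 105) 0).sum := by
    rw [tableConv, List.getD_eq_getElem _ _ (by simpa using hm)]
    simp
  rw [h1, powConv, ← List.sum_toFinset _ (List.nodup_range), List.toFinset_range]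
  refine sum_congr rfl fun k _ => ?_
  rw [h, Nat.mod_add_mod]

lemma powConv_iterate_eq_getD (k m : ℕ) :
    powConv^[k] smallFac m =
      (tableConv^[k] ((List.range 105).map smallFac)).getD (m % 105) 0 := by
  induction k generalizing m with
  | zero =>
    have hm : m % 105 < 105 := Nat.mod_lt _ (by norm_num)
    simp only [Function.iterate_zero, id_eq]
    rw [List.getD_eq_getElem _ _ (by simpa using hm)]
    simp [smallFac, Nat.mod_mod_of_dvd]
  | succ k ih =>
    rw [Function.iterate_succ_apply', Function.iterate_succ_apply']
    exact powConv_eq_getD ih m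

lemma length_tableConv_iterate (k : ℕ) :
    (tableConv^[k] ((List.range 105).map smallFac)).length = 105 := by
  cases k with
  | zero => simp
  | succ k => rw [Function.iterate_succ_apply']; simp [tableConv]

lemma le_powConv_iterate (m : ℕ) :
    15 * 1455 * 12 ^ 7 ≤ 1000 * powConv^[7] smallFac m := by
  have hm : m % 105 < 105 := Nat.mod_lt _ (by norm_num)
  rw [powConv_iterate_eq_getD, List.getD_eq_getElem _ _ (by rwa [length_tableConv_iterate])]
  exact le_of_mem_tableConv_iterate _ (List.getElem_mem _)

lemma powConv_iterate_congr (k : ℕ) {m n : ℕ} (h : m % 105 = n % 105) :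
    powConv^[k] smallFac m = powConv^[k] smallFac n := by
  rw [powConv_iterate_eq_getD, powConv_iterate_eq_getD, h]

lemma sum_Ioc_pow_eq {g : ℕ → ℕ} (hg : ∀ m n, m % 105 = n % 105 → g m = g n) (m t : ℕ) :
    ∑ a ∈ Ioc 0 (12 * t), g (m + 104 * 2 ^ a) = t * powConv g m := by
  have h1 : ∀ n, ∑ a ∈ Ioc 0 n, g (m + 104 * 2 ^ a) = ∑ k ∈ range n, g (m + 104 * 2 ^ (k + 1)) := by
    intro n
    rw [range_eq_Ico, sum_Ico_add' (fun a => g (m + 104 * 2 ^ a)) 0 n 1]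
    refine sum_congr ?_ fun _ _ => rfl
    ext i; simp; omega
  rw [h1]
  induction t with
  | zero => simp
  | succ t ih =>
    rw [mul_add, mul_one, sum_range_add, ih, add_mul, one_mul, powConv]
    congr 1
    refine sum_congr rfl fun k _ => hg _ _ ?_
    have h2 : 2 ^ (12 * t) ≡ 1 [MOD 105] := by
      rw [pow_mul]
      simpa using Nat.ModEq.pow t (show 2 ^ 12 ≡ 1 [MOD 105] by decide)
    have h3 : 2 ^ (12 * t + k + 1) ≡ 2 ^ (k + 1) [MOD 105] := by
      have := h2.mul_right (2 ^ (k + 1))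
      rwa [one_mul, ← pow_add, ← add_assoc] at this
    exact Nat.ModEq.add_left m (h3.mul_left 104)

lemma sum_piFinset_smallFac (k m t : ℕ) :
    ∑ ν ∈ Fintype.piFinset (fun _ : Fin k => Ioc 0 (12 * t)), smallFac (m + 104 * ∑ i, 2 ^ ν i) =
      t ^ k * powConv^[k] smallFac m := by
  induction k generalizing m with
  | zero => simp
  | succ k ih =>
    rw [sum_piFinset_succ _ k (fun s => smallFac (m + 104 * s))]
    simp_rw [mul_add, ← add_assoc]
    simp_rw [ih]
    rw [← mul_sum, sum_Ioc_pow_eq (fun a b h => powConv_iterate_congr k h),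
      Function.iterate_succ_apply', pow_succ, mul_assoc]

lemma smallFac_le_singFactor {m : ℕ} (hm : m ≠ 0) : (smallFac m : ℝ) ≤ 15 * singFactor m := by
  have h1 : ∀ p, p ∈ ({3, 5, 7} : Finset ℕ) → p.Prime ∧ 3 ≤ p := by
    intro p hp
    simp only [mem_insert, mem_singleton] at hp
    rcases hp with rfl | rfl | rfl <;> norm_num
  have h2 : ∏ p ∈ ({3, 5, 7} : Finset ℕ).filter (· ∣ m), (1 + 1 / ((p : ℝ) - 2)) ≤ singFactor m := by
    refine prod_le_prod_of_subset_of_one_le (fun p hp => ?_) (fun p hp => ?_) fun p hp _ => ?_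
    · rw [mem_filter] at hp
      have := h1 p hp.1
      rw [mem_erase, Nat.mem_primeFactors]
      exact ⟨by omega, this.1, hp.2, hm⟩
    · have := (h1 p (mem_filter.1 hp).1).2
      have : (3 : ℝ) ≤ p := by exact_mod_cast this
      have : 0 < (p : ℝ) - 2 := by linarith
      positivity
    · rw [mem_erase, Nat.mem_primeFactors] at hp
      have h3 : (2 : ℝ) ≤ p := by exact_mod_cast hp.2.1.two_le
      have : 0 ≤ 1 / ((p : ℝ) - 2) := by
        apply div_nonneg zero_le_one; linarith
      linarith
  have h3 : (smallFac m : ℝ) =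
      15 * ∏ p ∈ ({3, 5, 7} : Finset ℕ).filter (· ∣ m), (1 + 1 / ((p : ℝ) - 2)) := by
    rw [prod_filter, prod_insert (by decide), prod_insert (by decide), prod_singleton, smallFac]
    simp only [Nat.dvd_iff_mod_eq_zero]
    split_ifs <;> norm_num
  rw [h3]
  linarith

lemma sum_singFactor_ge {N t : ℕ}
    (h : ∀ ν ∈ Fintype.piFinset (fun _ : Fin 7 => Ioc 0 (12 * t)), ∑ i, 2 ^ ν i < N) :
    1.455 * ((12 * t : ℕ) : ℝ) ^ 7 ≤
      ∑ ν ∈ Fintype.piFinset (fun _ : Fin 7 => Ioc 0 (12 * t)), singFactor (N - ∑ i, 2 ^ ν i) := by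
  have h1 : ∑ ν ∈ Fintype.piFinset (fun _ : Fin 7 => Ioc 0 (12 * t)),
      (smallFac (N + 104 * ∑ i, 2 ^ ν i) : ℝ) ≤
      ∑ ν ∈ Fintype.piFinset (fun _ : Fin 7 => Ioc 0 (12 * t)),
        15 * singFactor (N - ∑ i, 2 ^ ν i) := by
    refine sum_le_sum fun ν hν => ?_
    have h2 := h ν hν
    have h3 : smallFac (N + 104 * ∑ i, 2 ^ ν i) = smallFac (N - ∑ i, 2 ^ ν i) := by
      have : N + 104 * ∑ i, 2 ^ ν i = N - ∑ i, 2 ^ ν i + 105 * ∑ i, 2 ^ ν i := by omega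
      rw [this, smallFac, smallFac]
      congr 1
      · congr 1
        · congr 2; omega
        · congr 2; omega
      · congr 2; omega
    rw [h3]
    exact smallFac_le_singFactor (by omega)
  have h2 : (15 * 1455 * 12 ^ 7 : ℝ) ≤ 1000 * (powConv^[7] smallFac N : ℕ) := by
    exact_mod_cast le_powConv_iterate N
  rw [← mul_sum, ← Nat.cast_sum, sum_piFinset_smallFac] at h1
  push_cast at h1 ⊢
  rw [mul_pow]
  have h3 := mul_le_mul_of_nonneg_left h2 (by positivity : (0 : ℝ) ≤ (t : ℝ) ^ 7)
  nlinarith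

end LinnikGRH

namespace LinnikGRH
open Finset

/-- The correlation `∑ f(n) g(h + σ n)` over `0 ≤ n < N`. -/
noncomputable def corr (N : ℕ) (f g : ℤ → ℝ) (h σ : ℤ) : ℝ := ∑ n ∈ range N, f n * g (h + σ * n)

lemma corr_sub_sub (N : ℕ) (f g : ℤ → ℝ) (h σ : ℤ) : corr N (f - g) (f - g) h σ =
    corr N f f h σ - corr N f g h σ - corr N g f h σ + corr N g g h σ := by
  simp only [corr, Pi.sub_apply]
  rw [← sum_sub_distrib, ← sum_sub_distrib, ← sum_add_distrib]
  exact sum_congr rfl fun n _ => by ring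

lemma sum_range_eq_finsum {N : ℕ} {F : ℤ → ℝ} (hF : ∀ k, F k ≠ 0 → 0 ≤ k ∧ k < N) :
    ∑ n ∈ range N, F n = ∑ᶠ k, F k := by
  have h1 : (∑ᶠ k, F k) = ∑ k ∈ Ico (0 : ℤ) N, F k :=
    finsum_eq_sum_of_support_subset _ fun k hk => by
      have := hF k hk
      simpa using this
  rw [h1]
  refine sum_bij' (fun n _ => (n : ℤ)) (fun k _ => k.toNat) ?_ ?_ ?_ ?_ ?_
  · intro n hn; simp at hn ⊢; exact hn
  · intro k hk; simp at hk ⊢; omega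
  · intro n _; simp
  · intro k hk; simp at hk ⊢; omega
  · intro n _; rfl

lemma corr_swap {N : ℕ} {f g : ℤ → ℝ} (hf : ∀ k, f k ≠ 0 → 0 ≤ k ∧ k < N)
    (hg : ∀ k, g k ≠ 0 → 0 ≤ k ∧ k < N) (h : ℤ) {σ : ℤ} (hσ : σ = 1 ∨ σ = -1) :
    corr N g f h σ = corr N f g (-(σ * h)) σ := by
  have hσ2 : σ * σ = 1 := by rcases hσ with rfl | rfl <;> norm_num
  let e : ℤ ≃ ℤ := ⟨fun n => h + σ * n, fun k => σ * (k - h), fun n => by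
    linear_combination n * hσ2, fun k => by linear_combination (k - h) * hσ2⟩
  rw [corr, corr, sum_range_eq_finsum (F := fun n => g n * f (h + σ * n))
    (fun k hk => hg k (left_ne_zero_of_mul hk)),
    sum_range_eq_finsum (F := fun n => f n * g (-(σ * h) + σ * n))
    (fun k hk => hf k (left_ne_zero_of_mul hk)),
    ← finsum_comp_equiv e (f := fun n => f n * g (-(σ * h) + σ * n))]
  refine finsum_congr fun n => ?_
  change g n * f (h + σ * n) = f (h + σ * n) * g (-(σ * h) + σ * (h + σ * n))
  have : -(σ * h) + σ * (h + σ * n) = n := by linear_combination n * hσ2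
  rw [this, mul_comm]

/-- The weighted von Mangoldt function on the integers. -/
noncomputable def vmZ (N : ℕ) (k : ℤ) : ℝ := ArithmeticFunction.vonMangoldt k.toNat * wt (k / N)

/-- The weighted model on the integers. -/
noncomputable def mdZ (N : ℕ) (k : ℤ) : ℝ := model (lev N) k * wt (k / N)

lemma wt_div_ne_zero {N : ℕ} {k : ℤ} (h : wt (k / N) ≠ 0) : 0 ≤ k ∧ k < N := by
  rcases Nat.eq_zero_or_pos N with rfl | hN
  · simp [wt_of_le] at h
  have hN0 : (0 : ℝ) < N := by exact_mod_cast hN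
  constructor
  · by_contra! hk
    refine h (wt_of_le (div_nonpos_of_nonpos_of_nonneg ?_ hN0.le))
    exact_mod_cast hk.le
  · by_contra! hk
    refine h (wt_of_ge ((one_le_div hN0).2 ?_))
    exact_mod_cast hk

lemma vmZ_ne_zero {N : ℕ} (k : ℤ) (h : vmZ N k ≠ 0) : 0 ≤ k ∧ k < N :=
  wt_div_ne_zero (right_ne_zero_of_mul h)

lemma mdZ_ne_zero {N : ℕ} (k : ℤ) (h : mdZ N k ≠ 0) : 0 ≤ k ∧ k < N :=
  wt_div_ne_zero (right_ne_zero_of_mul h)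

lemma vmZ_sub_mdZ_natCast (N n : ℕ) : (vmZ N - mdZ N) n = err N n := by
  simp [vmZ, mdZ, err, sub_mul]

lemma div_add_mul_div (N : ℕ) (h σ : ℤ) (n : ℕ) :
    ((h + σ * n : ℤ) : ℝ) / N = h / N + (σ : ℝ) * (n / N) := by
  push_cast; ring

lemma corr_mdZ_eq {N : ℕ} (g : ℕ → ℝ) (h σ : ℤ) (f : ℤ → ℝ) (hf : ∀ n : ℕ, f n = g n * wt (n / N)) :
    (corr N f (mdZ N) h σ : ℂ) = ∑ n ∈ range N, g n *
      (fun x : ℝ => wtc x * wtc ((h / N : ℝ) + (σ : ℝ) * x)) (n / N) * model (lev N) (h + σ * n) := by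
  rw [corr, Complex.ofReal_sum]
  refine sum_congr rfl fun n _ => ?_
  rw [hf, mdZ, div_add_mul_div]
  simp only [wtc]
  push_cast
  ring

lemma corr_mdZ_mdZ_sub_le {N : ℕ} (hN : 1 ≤ N) (h : ℤ) {σ : ℤ} (hσ : σ = 1 ∨ σ = -1) :
    |corr N (mdZ N) (mdZ N) h σ - singTrunc (lev N) h * (N * wtCorr (h / N) σ)| ≤
      4 * (N : ℝ) ^ (0.999 : ℝ) := by
  have hσ' : (σ : ℝ) = 1 ∨ (σ : ℝ) = -1 := by rcases hσ with rfl | rfl <;> simp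
  have hw := isWeight_wtc_mul_affine (h / N) hσ'
  have h1 := norm_sum_mul_model_sub_le (Q := lev N) (N := N) (g := fun n => model (lev N) n)
    (u := fun x : ℝ => wtc x * wtc ((h / N : ℝ) + (σ : ℝ) * x))
    (J := N * (wtCorr (h / N) σ : ℂ)) (E := 4 * (lev N : ℝ) ^ 3) (fun q hq hqQ a ha => by
      have h2 := norm_sum_model_twist_sub_le hw hN hq hqQ ha
      rw [integral_wtc_mul_affine] at h2
      refine h2.trans ?_
      have : (q : ℝ) ≤ lev N := by exact_mod_cast hqQ
      calc 2 * 1 * 2 * (q : ℝ) * (lev N : ℝ) ^ 2 ≤ 2 * 1 * 2 * (lev N : ℝ) * (lev N : ℝ) ^ 2 := by gcongr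
        _ = _ := by ring) h hσ
  have h2 := corr_mdZ_eq (N := N) (fun n => model (lev N) n) h σ (mdZ N) (fun n => by simp [mdZ])
  rw [← h2] at h1
  have h3 : |corr N (mdZ N) (mdZ N) h σ - singTrunc (lev N) h * (N * wtCorr (h / N) σ)| ≤
      lev N * (4 * (lev N : ℝ) ^ 3) := by
    rw [← Real.norm_eq_abs, ← Complex.norm_real]
    push_cast
    exact h1
  refine h3.trans ?_
  calc (lev N : ℝ) * (4 * (lev N : ℝ) ^ 3) = 4 * (lev N : ℝ) ^ 4 := by ring
    _ ≤ 4 * ((N : ℝ) ^ (999 / 4000 : ℝ)) ^ 4 := by gcongr; exact lev_le N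
    _ = _ := by
      rw [← Real.rpow_natCast, ← Real.rpow_mul (by positivity)]
      norm_num

section
variable (GRH : ∀ (q : ℕ) [NeZero q] (χ : DirichletCharacter ℂ q) (s : ℂ),
      0 < s.re → s.re < 1 → DirichletCharacter.LFunction χ s = 0 → s.re = 1 / 2)
include GRH

lemma corr_vmZ_mdZ_sub_le {N : ℕ} (hN : 1 ≤ N) (h : ℤ) {σ : ℤ} (hσ : σ = 1 ∨ σ = -1) :
    |corr N (vmZ N) (mdZ N) h σ - singTrunc (lev N) h * (N * wtCorr (h / N) σ)| ≤
      4 * 10 ^ 12 * (N : ℝ) ^ (0.999 : ℝ) := by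
  have hσ' : (σ : ℝ) = 1 ∨ (σ : ℝ) = -1 := by rcases hσ with rfl | rfl <;> simp
  have hw := isWeight_wtc_mul_affine (h / N) hσ'
  have hN1 : (1 : ℝ) ≤ N := by exact_mod_cast hN
  have hN0 : (0 : ℝ) < N := by linarith
  have h1 := norm_sum_mul_model_sub_le (Q := lev N) (N := N)
    (g := fun n => ArithmeticFunction.vonMangoldt n)
    (u := fun x : ℝ => wtc x * wtc ((h / N : ℝ) + (σ : ℝ) * x))
    (J := N * (wtCorr (h / N) σ : ℂ)) (E := 2 * 10 ^ 12 * (2 * (N : ℝ) ^ (0.749 : ℝ)))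
    (fun q hq hqQ a ha => by
      have : NeZero q := ⟨by omega⟩
      have h2 := norm_sum_twist_sub_le GRH (η := 1 / 100) (by norm_num) (by norm_num) ha hw hN
      rw [integral_wtc_mul_affine] at h2
      refine h2.trans ?_
      have hq' : (q : ℝ) ≤ (N : ℝ) ^ (999 / 4000 : ℝ) := le_trans (by exact_mod_cast hqQ) (lev_le N)
      calc 2000000 / (1 / 100 : ℝ) ^ 3 * 1 * (N * q * 2 : ℝ) ^ (1 / 2 + 1 / 100 : ℝ)
          ≤ 2000000 / (1 / 100 : ℝ) ^ 3 * 1 *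
            (N * (N : ℝ) ^ (999 / 4000 : ℝ) * 2 : ℝ) ^ (1 / 2 + 1 / 100 : ℝ) := by gcongr
        _ = 2 * 10 ^ 12 * ((2 : ℝ) ^ (1 / 2 + 1 / 100 : ℝ) *
            (N : ℝ) ^ ((1 + 999 / 4000) * (1 / 2 + 1 / 100) : ℝ)) := by
          rw [Real.mul_rpow (by positivity) (by norm_num), Real.rpow_mul hN0.le, Real.rpow_add hN0,
            Real.rpow_one]
          norm_num
          ring
        _ ≤ 2 * 10 ^ 12 * (2 * (N : ℝ) ^ (0.749 : ℝ)) := by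
          have h3 : (2 : ℝ) ^ (1 / 2 + 1 / 100 : ℝ) ≤ 2 ^ (1 : ℝ) :=
            Real.rpow_le_rpow_of_exponent_le (by norm_num) (by norm_num)
          rw [Real.rpow_one] at h3
          have h4 : (N : ℝ) ^ ((1 + 999 / 4000) * (1 / 2 + 1 / 100) : ℝ) ≤ (N : ℝ) ^ (0.749 : ℝ) :=
            Real.rpow_le_rpow_of_exponent_le hN1 (by norm_num)
          gcongr) h hσ
  have h2 := corr_mdZ_eq (N := N) (fun n => ArithmeticFunction.vonMangoldt n) h σ (vmZ N)
    (fun n => by simp [vmZ])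
  rw [← h2] at h1
  have h3 : |corr N (vmZ N) (mdZ N) h σ - singTrunc (lev N) h * (N * wtCorr (h / N) σ)| ≤
      lev N * (2 * 10 ^ 12 * (2 * (N : ℝ) ^ (0.749 : ℝ))) := by
    rw [← Real.norm_eq_abs, ← Complex.norm_real]
    push_cast
    exact h1
  refine h3.trans ?_
  calc (lev N : ℝ) * (2 * 10 ^ 12 * (2 * (N : ℝ) ^ (0.749 : ℝ)))
      ≤ (N : ℝ) ^ (999 / 4000 : ℝ) * (2 * 10 ^ 12 * (2 * (N : ℝ) ^ (0.749 : ℝ))) := by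
        gcongr; exact lev_le N
    _ = 4 * 10 ^ 12 * (N : ℝ) ^ (999 / 4000 + 0.749 : ℝ) := by rw [Real.rpow_add hN0]; ring
    _ ≤ _ := by
      gcongr
      norm_num

end

lemma abs_wt_sub_le (x y : ℝ) : |wt x - wt y| ≤ |x - y| := by
  have := Convex.norm_image_sub_le_of_norm_hasDerivWithin_le (s := Set.univ)
    (f := wt) (f' := wtDeriv) (C := 1) (x := y) (y := x)
    (fun z _ => (hasDerivAt_wt z).hasDerivWithinAt) (fun z _ => abs_wtDeriv_le z) convex_univ
    trivial trivial
  simpa using this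

lemma abs_wtCorr_sub_le (c d σ : ℝ) : |wtCorr c σ - wtCorr d σ| ≤ |c - d| := by
  have hc : ∀ c : ℝ, Continuous fun x => wt x * wt (c + σ * x) := fun c =>
    continuous_wt.mul (continuous_wt.comp (by fun_prop))
  rw [wtCorr, wtCorr, ← intervalIntegral.integral_sub ((hc c).intervalIntegrable 0 1)
    ((hc d).intervalIntegrable 0 1)]
  have := intervalIntegral.norm_integral_le_of_norm_le_const (a := 0) (b := 1) (C := |c - d|)
    (f := fun x => wt x * wt (c + σ * x) - wt x * wt (d + σ * x)) (fun x _ => by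
      rw [← mul_sub, norm_mul, Real.norm_eq_abs, Real.norm_eq_abs, abs_of_nonneg (wt_nonneg x)]
      have h1 := abs_wt_sub_le (c + σ * x) (d + σ * x)
      rw [add_sub_add_right_eq_sub] at h1
      calc _ ≤ 1 * |c - d| := mul_le_mul (wt_le x) h1 (abs_nonneg _) zero_le_one
        _ = _ := one_mul _)
  simpa using this

lemma wtCorr_one_neg_one : wtCorr 1 (-1) = wtCorr 0 1 := by
  rw [wtCorr, wtCorr]
  congr 1
  ext x
  rw [zero_add, one_mul, ← wt_one_sub x]
  ring_nf

lemma wtCorr_zero_one_pos : 0 < wtCorr 0 1 := by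
  have hc : Continuous fun x => wt x * wt (0 + 1 * x) :=
    continuous_wt.mul (continuous_wt.comp (by fun_prop))
  refine intervalIntegral.intervalIntegral_pos_of_pos_on (hc.intervalIntegrable 0 1) (fun x hx => ?_)
    zero_lt_one
  have h1 : 0 < wt x := by
    rw [wt]
    have : 0 < x * (1 - x) := mul_pos hx.1 (by linarith [hx.2])
    have : 0 < max 0 (x * (1 - x)) := lt_max_of_lt_right this
    positivity
  rw [zero_add, one_mul]
  positivity

end LinnikGRH

namespace LinnikGRH
open Finset

lemma exists_singTrunc_lev_ge : ∃ C : ℝ, 0 < C ∧ ∀ N : ℕ, 1 ≤ N → ∀ m : ℤ, m ≠ 0 → Even m →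
    m.natAbs ≤ N → 1.31 * singFactor m.natAbs - C * (N : ℝ) ^ (-0.1 : ℝ) ≤ singTrunc (lev N) m := by
  obtain ⟨C, hC, h⟩ := exists_singTrunc_ge 0.02 (by norm_num)
  refine ⟨2 * C, by positivity, fun N hN m hm hev hmN => ?_⟩
  refine le_trans ?_ (h m hm hev (lev N) (one_le_lev hN))
  have hN1 : (1 : ℝ) ≤ N := by exact_mod_cast hN
  have hN0 : (0 : ℝ) < N := by linarith
  have hlev : (1 : ℝ) ≤ lev N := by exact_mod_cast one_le_lev hN
  have hm' : (m.natAbs : ℝ) ≤ N := by exact_mod_cast hmN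
  refine sub_le_sub_left ?_ _
  rw [div_le_iff₀ (by positivity)]
  have h1 : (N : ℝ) ^ (0.12 : ℝ) ≤ 2 * (lev N : ℝ) ^ (1 / 2 : ℝ) := by
    have h2 := lt_lev_add_one N
    have h3 : (N : ℝ) ^ (0.24 : ℝ) ≤ 4 * lev N :=
      (Real.rpow_le_rpow_of_exponent_le hN1
        (show (0.24 : ℝ) ≤ 999 / 4000 by norm_num)).trans (by linarith)
    calc (N : ℝ) ^ (0.12 : ℝ) = ((N : ℝ) ^ (0.24 : ℝ)) ^ (1 / 2 : ℝ) := by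
          rw [← Real.rpow_mul hN0.le]; norm_num
      _ ≤ (4 * (lev N : ℝ)) ^ (1 / 2 : ℝ) := by gcongr
      _ = 2 * (lev N : ℝ) ^ (1 / 2 : ℝ) := by
        rw [Real.mul_rpow (by norm_num) (by positivity), ← Real.sqrt_eq_rpow 4,
          show (4 : ℝ) = 2 ^ 2 by norm_num, Real.sqrt_sq (by norm_num)]
  calc C * (m.natAbs : ℝ) ^ (0.02 : ℝ) ≤ C * (N : ℝ) ^ (0.02 : ℝ) := by gcongr
    _ = C * (N : ℝ) ^ (-0.1 : ℝ) * (N : ℝ) ^ (0.12 : ℝ) := by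
      rw [mul_assoc, ← Real.rpow_add hN0]; norm_num
    _ ≤ C * (N : ℝ) ^ (-0.1 : ℝ) * (2 * (lev N : ℝ) ^ (1 / 2 : ℝ)) := by gcongr
    _ = _ := by ring

/-- The weighted difference between the von Mangoldt function and its model, on the integers. -/
noncomputable def errZ (N : ℕ) : ℤ → ℝ := vmZ N - mdZ N

lemma errZ_ne_zero {N : ℕ} (k : ℤ) (h : errZ N k ≠ 0) : 0 ≤ k ∧ k < N := by
  by_contra hk
  have h1 : vmZ N k = 0 := by by_contra h; exact hk (vmZ_ne_zero k h)
  have h2 : mdZ N k = 0 := by by_contra h; exact hk (mdZ_ne_zero k h)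
  exact h (by simp [errZ, h1, h2])

lemma corr_neg {N : ℕ} {f : ℤ → ℝ} (hf : ∀ k, f k ≠ 0 → 0 ≤ k ∧ k < N) (h : ℤ) :
    corr N f f (-h) 1 = corr N f f h 1 := by
  rw [corr_swap hf hf h (Or.inl rfl), one_mul]

lemma corr_errZ {N : ℕ} (h : ℤ) {σ : ℤ} (hσ : σ = 1 ∨ σ = -1) : corr N (errZ N) (errZ N) h σ =
    corr N (vmZ N) (vmZ N) h σ - corr N (vmZ N) (mdZ N) h σ - corr N (vmZ N) (mdZ N) (-(σ * h)) σ +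
      corr N (mdZ N) (mdZ N) h σ := by
  rw [errZ, corr_sub_sub, corr_swap vmZ_ne_zero mdZ_ne_zero h hσ]

lemma sum_Ioc_symm (F : ℕ → ℕ → ℝ) (hF : ∀ a b, F a b = F b a) (L : ℕ) :
    ∑ ν ∈ Ioc 0 L, ∑ μ ∈ Ioc 0 L, F ν μ =
      ∑ ν ∈ Ioc 0 L, F ν ν + 2 * ∑ ν ∈ Ioc 0 L, ∑ μ ∈ Ioo 0 ν, F ν μ := by
  induction L with
  | zero => simp
  | succ L ih =>
    have h1 : ∀ f : ℕ → ℝ, ∑ ν ∈ Ioc 0 (L + 1), f ν = ∑ ν ∈ Ioc 0 L, f ν + f (L + 1) := fun f =>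
      sum_Ioc_succ_top (Nat.zero_le L) f
    have h2 : Ioo 0 (L + 1) = Ioc 0 L := by ext i; simp
    have h3 : ∑ ν ∈ Ioc 0 L, F ν (L + 1) = ∑ ν ∈ Ioc 0 L, F (L + 1) ν :=
      sum_congr rfl fun ν _ => hF _ _
    simp only [h1, h2, sum_add_distrib]
    rw [ih, h3]
    ring

section
variable (GRH : ∀ (q : ℕ) [NeZero q] (χ : DirichletCharacter ℂ q) (s : ℂ),
      0 < s.re → s.re < 1 → DirichletCharacter.LFunction χ s = 0 → s.re = 1 / 2)
include GRH

lemma exists_corr_errZ_le : ∃ C : ℝ, 0 < C ∧ ∀ᶠ N : ℕ in Filter.atTop, ∀ h : ℕ, Even h → h ≠ 0 →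
    h ≤ N → corr N (errZ N) (errZ N) h 1 ≤
      4.03 * singFactor h * (N * (wtCorr 0 1 + h / N)) + C * (N : ℝ) ^ (0.9999 : ℝ) := by
  obtain ⟨C, hC, hS⟩ := exists_singTrunc_lev_ge
  refine ⟨C + 2 * 10 ^ 13, by positivity, ?_⟩
  filter_upwards [eventually_sum_pair_le GRH, Filter.eventually_ge_atTop 1] with N hpair hN h he h0 hhN
  have hN1 : (1 : ℝ) ≤ N := by exact_mod_cast hN
  have hN0 : (0 : ℝ) < N := by linarith
  have h1 : corr N (vmZ N) (vmZ N) h 1 ≤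
      5.34 * singFactor h * (N * wtCorr (-(h / N)) 1) + (N : ℝ) ^ (1 - 1 / 10000 : ℝ) := by
    refine le_trans (le_of_eq ?_) (hpair h he h0)
    refine sum_congr rfl fun n _ => ?_
    have : ((h : ℤ) + 1 * (n : ℤ)).toNat = n + h := by omega
    rw [vmZ, vmZ, this, Int.toNat_natCast]
    push_cast
    rw [one_mul, add_comm (h : ℝ)]
    ring
  have h2 := corr_vmZ_mdZ_sub_le GRH hN h (Or.inl rfl)
  have h3 := corr_mdZ_mdZ_sub_le hN h (Or.inl rfl)
  have h4 := corr_vmZ_mdZ_sub_le GRH hN (-h) (Or.inl rfl)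
  have h5 := hS N hN (-h) (by simpa using h0) (by simpa using he) (by simpa using hhN)
  rw [Int.natAbs_neg, Int.natAbs_natCast] at h5
  have hc : (((-(h : ℤ)) : ℤ) : ℝ) / N = -(h / N) := by push_cast; ring
  rw [hc] at h4
  rw [Int.cast_one] at h2 h3 h4
  set W := wtCorr (-(h / N)) 1 with hW
  have hW0 : 0 ≤ W := wtCorr_nonneg _ _
  have hW1 : W ≤ 1 := wtCorr_le_one _ _
  have hWI : W ≤ wtCorr 0 1 + h / N := by
    have := abs_wtCorr_sub_le (-(h / N)) 0 1
    rw [sub_zero, abs_neg, abs_of_nonneg (by positivity : (0 : ℝ) ≤ h / N)] at this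
    linarith [le_abs_self (wtCorr (-(h / N)) 1 - wtCorr 0 1)]
  have hP := one_le_singFactor h
  set P := singFactor h with hPdef
  have h6 : 1.31 * P * (N * W) - C * (N : ℝ) ^ (0.9999 : ℝ) ≤ singTrunc (lev N) (-h) * (N * W) := by
    have h7 := mul_le_mul_of_nonneg_right h5 (by positivity : 0 ≤ N * W)
    have h8 : C * (N : ℝ) ^ (-0.1 : ℝ) * (N * W) ≤ C * (N : ℝ) ^ (0.9999 : ℝ) := by
      calc C * (N : ℝ) ^ (-0.1 : ℝ) * (N * W) ≤ C * (N : ℝ) ^ (-0.1 : ℝ) * (N * 1) := by gcongr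
        _ = C * (N : ℝ) ^ (-0.1 + 1 : ℝ) := by rw [Real.rpow_add hN0, Real.rpow_one]; ring
        _ ≤ _ := by gcongr; norm_num
    linarith
  have h9 : (N : ℝ) ^ (0.999 : ℝ) ≤ (N : ℝ) ^ (0.9999 : ℝ) :=
    Real.rpow_le_rpow_of_exponent_le hN1 (by norm_num)
  have h10 : (N : ℝ) ^ (1 - 1 / 10000 : ℝ) = (N : ℝ) ^ (0.9999 : ℝ) := by norm_num
  have h11 : 4.03 * P * (N * W) ≤ 4.03 * P * (N * (wtCorr 0 1 + h / N)) := by gcongr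
  rw [corr_errZ h (Or.inl rfl), one_mul]
  rw [abs_le] at h2 h3 h4
  rw [h10] at h1
  have h12 : (0 : ℝ) ≤ (N : ℝ) ^ (0.9999 : ℝ) := by positivity
  linarith [h2.1, h3.2, h4.1]

lemma corr_errZ_zero_le {N : ℕ} (hN : 1 ≤ N) : corr N (errZ N) (errZ N) 0 1 ≤
    Real.log N * (N * wtCorr 0 1 + 4 * 10 ^ 12 * (N : ℝ) ^ (0.999 : ℝ)) +
      10 ^ 13 * (N : ℝ) ^ (0.999 : ℝ) := by
  have hN1 : (1 : ℝ) ≤ N := by exact_mod_cast hN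
  have hN0 : (0 : ℝ) < N := by linarith
  have hlog : 0 ≤ Real.log N := Real.log_natCast_nonneg N
  have h2 := corr_vmZ_mdZ_sub_le GRH hN 0 (Or.inl rfl)
  have h3 := corr_mdZ_mdZ_sub_le hN 0 (Or.inl rfl)
  rw [Int.cast_zero, Int.cast_one, zero_div] at h2 h3
  have hI := wtCorr_zero_one_pos
  have h4 : 0 ≤ singTrunc (lev N) 0 * (N * wtCorr 0 1) :=
    mul_nonneg (singTrunc_zero_nonneg _) (by positivity)
  have h5 : corr N (vmZ N) (vmZ N) 0 1 ≤
      Real.log N * (N * wtCorr 0 1 + 4 * 10 ^ 12 * (N : ℝ) ^ (0.999 : ℝ)) := by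
    have h6 : corr N (vmZ N) (vmZ N) 0 1 ≤ Real.log N *
        ∑ n ∈ range N, ArithmeticFunction.vonMangoldt n * (wt (n / N) * wt (0 + 1 * (n / N))) := by
      rw [corr, mul_sum]
      refine sum_le_sum fun n _ => ?_
      simp only [zero_add, one_mul, vmZ, Int.toNat_natCast, Int.cast_natCast]
      have h7 := mul_le_mul_of_nonneg_left (vonMangoldt_mul_wt_le (m := n) (N := N))
        (mul_nonneg (ArithmeticFunction.vonMangoldt_nonneg (n := n)) (wt_nonneg (n / N)))
      linarith
    refine h6.trans (mul_le_mul_of_nonneg_left ?_ hlog)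
    have h8 := norm_sum_twist_sub_le GRH (η := 1 / 100) (by norm_num) (by norm_num) (q := 1) (a := 0)
      (by simp) (isWeight_wtc_mul_affine 0 (Or.inl rfl)) hN
    rw [integral_wtc_mul_affine] at h8
    have h9 : ‖((∑ n ∈ range N, ArithmeticFunction.vonMangoldt n * (wt (n / N) * wt (0 + 1 * (n / N))) -
        N * wtCorr 0 1 : ℝ) : ℂ)‖ ≤ 2000000 / (1 / 100 : ℝ) ^ 3 * 1 * (N * (1 : ℕ) * 2 : ℝ) ^ (1 / 2 + 1 / 100 : ℝ) := by
      refine le_trans (le_of_eq ?_) h8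
      congr 1
      simp [wtc, ex_zero]
    rw [Complex.norm_real, Real.norm_eq_abs] at h9
    have h10 : 2000000 / (1 / 100 : ℝ) ^ 3 * 1 * (N * (1 : ℕ) * 2 : ℝ) ^ (1 / 2 + 1 / 100 : ℝ) ≤
        4 * 10 ^ 12 * (N : ℝ) ^ (0.999 : ℝ) := by
      rw [Nat.cast_one, mul_one, mul_one, Real.mul_rpow hN0.le (by norm_num)]
      have h3 : (2 : ℝ) ^ (1 / 2 + 1 / 100 : ℝ) ≤ 2 ^ (1 : ℝ) :=
        Real.rpow_le_rpow_of_exponent_le (by norm_num) (by norm_num)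
      rw [Real.rpow_one] at h3
      have h4 : (N : ℝ) ^ (1 / 2 + 1 / 100 : ℝ) ≤ (N : ℝ) ^ (0.999 : ℝ) :=
        Real.rpow_le_rpow_of_exponent_le hN1 (by norm_num)
      calc _ ≤ 2000000 / (1 / 100 : ℝ) ^ 3 * ((N : ℝ) ^ (0.999 : ℝ) * 2) := by gcongr
        _ = _ := by ring
    linarith [(abs_le.1 h9).2]
  rw [corr_errZ 0 (Or.inl rfl), one_mul, neg_zero]
  rw [abs_le] at h2 h3
  have h12 : (0 : ℝ) ≤ (N : ℝ) ^ (0.999 : ℝ) := by positivity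
  linarith [h2.1, h3.2]

lemma exists_sum_corr_errZ_le : ∃ C : ℝ, 0 < C ∧ ∀ᶠ N : ℕ in Filter.atTop, ∀ L : ℕ, 2 ^ L ≤ N →
    ∑ ν ∈ Ioc 0 L, ∑ μ ∈ Ioc 0 L, corr N (errZ N) (errZ N) (2 ^ ν - 2 ^ μ) 1 ≤
      L * Real.log N * (N * wtCorr 0 1) +
      8.9869 * (L : ℝ) ^ 2 * (N * (wtCorr 0 1 + 2 ^ L / N)) +
      C * ((L : ℝ) + 1) * (L + Real.log N) * (N : ℝ) ^ (0.9999 : ℝ) := by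
  obtain ⟨C, hC, hcorr⟩ := exists_corr_errZ_le GRH
  refine ⟨2 * C + 2 * 10 ^ 13, by positivity, ?_⟩
  filter_upwards [hcorr, Filter.eventually_ge_atTop 1, eventually_le_log_natCast 1]
    with N hcorr hN hlogN L hL
  have hN1 : (1 : ℝ) ≤ N := by exact_mod_cast hN
  have hN0 : (0 : ℝ) < N := by linarith
  have hL' : (2 : ℝ) ^ L ≤ N := by exact_mod_cast hL
  rw [sum_Ioc_symm (fun ν μ => corr N (errZ N) (errZ N) (2 ^ ν - 2 ^ μ) 1) (fun a b => by
    rw [← corr_neg errZ_ne_zero, neg_sub])]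
  set X := (N : ℝ) ^ (0.9999 : ℝ) with hX
  have hX0 : 0 < X := by positivity
  have hX1 : (N : ℝ) ^ (0.999 : ℝ) ≤ X := Real.rpow_le_rpow_of_exponent_le hN1 (by norm_num)
  set I := wtCorr 0 1 with hI
  have hI0 : 0 < I := wtCorr_zero_one_pos
  have hdiag : ∑ ν ∈ Ioc 0 L, corr N (errZ N) (errZ N) (2 ^ ν - 2 ^ ν) 1 ≤
      L * (Real.log N * (N * I) + 2 * 10 ^ 13 * Real.log N * X) := by
    simp only [sub_self, sum_const, Nat.card_Ioc, tsub_zero, nsmul_eq_mul]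
    refine mul_le_mul_of_nonneg_left ?_ (Nat.cast_nonneg _)
    have h1 := corr_errZ_zero_le GRH hN
    rw [← hI] at h1
    have h2 : (N : ℝ) ^ (0.999 : ℝ) * Real.log N ≤ X * Real.log N := by gcongr
    have h3 : (N : ℝ) ^ (0.999 : ℝ) ≤ X * Real.log N := hX1.trans (le_mul_of_one_le_right hX0.le hlogN)
    have h4 : 0 ≤ X * Real.log N := by positivity
    linarith
  have hoff : ∑ ν ∈ Ioc 0 L, ∑ μ ∈ Ioo 0 ν, corr N (errZ N) (errZ N) (2 ^ ν - 2 ^ μ) 1 ≤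
      ∑ ν ∈ Ioc 0 L, ∑ μ ∈ Ioo 0 ν,
        (singFactor (2 ^ ν - 2 ^ μ) * (4.03 * (N * (I + 2 ^ L / N))) + C * X) := by
    refine sum_le_sum fun ν hν => sum_le_sum fun μ hμ => ?_
    rw [mem_Ioc] at hν
    rw [mem_Ioo] at hμ
    have h1 : 2 ^ μ < 2 ^ ν := Nat.pow_lt_pow_right (by norm_num) hμ.2
    have h2 : 2 ^ ν ≤ 2 ^ L := Nat.pow_le_pow_right (by norm_num) hν.2
    have h3 : ((2 : ℤ) ^ ν - 2 ^ μ) = ((2 ^ ν - 2 ^ μ : ℕ) : ℤ) := by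
      rw [Nat.cast_sub h1.le]; push_cast; rfl
    have h4 : Even (2 ^ ν - 2 ^ μ) := (Nat.even_pow.2 ⟨even_two, by omega⟩).tsub
      (Nat.even_pow.2 ⟨even_two, by omega⟩)
    have h6 : 2 ^ ν - 2 ^ μ ≤ 2 ^ L := (Nat.sub_le _ _).trans h2
    rw [h3]
    refine (hcorr (2 ^ ν - 2 ^ μ) h4 (by omega) (h6.trans hL)).trans ?_
    have h5 : ((2 ^ ν - 2 ^ μ : ℕ) : ℝ) ≤ 2 ^ L := by exact_mod_cast h6
    have hP := one_le_singFactor (2 ^ ν - 2 ^ μ)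
    refine add_le_add ?_ le_rfl
    calc _ ≤ 4.03 * singFactor (2 ^ ν - 2 ^ μ) * (N * (I + 2 ^ L / N)) := by gcongr
      _ = _ := by ring
  have hoff2 : 2 * ∑ ν ∈ Ioc 0 L, ∑ μ ∈ Ioo 0 ν,
      (singFactor (2 ^ ν - 2 ^ μ) * (4.03 * (N * (I + 2 ^ L / N))) + C * X) ≤
      2.23 * (L : ℝ) ^ 2 * (4.03 * (N * (I + 2 ^ L / N))) + (L : ℝ) ^ 2 * (2 * C * X) := by
    have h1 : ∑ ν ∈ Ioc 0 L, ∑ μ ∈ Ioo 0 ν,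
        singFactor (2 ^ ν - 2 ^ μ) * (4.03 * (N * (I + 2 ^ L / N))) =
        (∑ ν ∈ Ioc 0 L, ∑ μ ∈ Ioo 0 ν, singFactor (2 ^ ν - 2 ^ μ)) *
          (4.03 * (N * (I + 2 ^ L / N))) := by simp only [sum_mul]
    simp only [sum_add_distrib]
    rw [h1, mul_add, ← mul_assoc]
    refine add_le_add (mul_le_mul_of_nonneg_right (sum_singFactor_sub_le L) (by positivity)) ?_
    have : ∑ ν ∈ Ioc 0 L, ∑ _μ ∈ Ioo 0 ν, C * X ≤ ∑ _ν ∈ Ioc 0 L, L * (C * X) := by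
      refine sum_le_sum fun ν hν => ?_
      rw [mem_Ioc] at hν
      rw [sum_const, Nat.card_Ioo, nsmul_eq_mul]
      gcongr
      omega
    rw [sum_const, Nat.card_Ioc, tsub_zero, nsmul_eq_mul] at this
    calc _ ≤ 2 * (L * (L * (C * X))) := by gcongr
      _ = _ := by ring
  have hextra : 0 ≤ ((2 * C) * (L * Real.log N + L + Real.log N) +
      2 * 10 ^ 13 * ((L : ℝ) ^ 2 + L + Real.log N)) * X := by positivity
  calc _ ≤ L * (Real.log N * (N * I) + 2 * 10 ^ 13 * Real.log N * X) +
        (2.23 * (L : ℝ) ^ 2 * (4.03 * (N * (I + 2 ^ L / N))) + (L : ℝ) ^ 2 * (2 * C * X)) :=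
      add_le_add hdiag ((mul_le_mul_of_nonneg_left hoff zero_le_two).trans hoff2)
    _ ≤ _ := by linarith

end

end LinnikGRH

namespace LinnikGRH
open Finset

lemma sum_errSum_mul_ex {N M : ℕ} (hM : M ≠ 0) {h σ : ℤ} (hσ : σ = 1 ∨ σ = -1)
    (hNM : h.natAbs + 2 * N ≤ M) :
    ∑ j ∈ range M, errSum N (j / M) * errSum N (-σ * (j / M)) * ex (σ * h * (j / M)) =
      (M * corr N (errZ N) (errZ N) h σ : ℝ) := by
  have h1 : ∀ j : ℕ, errSum N (j / M) * errSum N (-σ * (j / M)) * ex (σ * h * (j / M)) =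
      ∑ n ∈ range N, ∑ k ∈ range N, (err N n * err N k : ℂ) *
        ex ((n - σ * k + σ * h : ℤ) * (j / M)) := by
    intro j
    rw [errSum, errSum, sum_mul_sum, sum_mul]
    refine sum_congr rfl fun n _ => ?_
    rw [sum_mul]
    refine sum_congr rfl fun k _ => ?_
    have : ((n - σ * k + σ * h : ℤ) * (j / M) : ℝ) =
        n * (j / M) + (k * (-σ * (j / M)) + σ * h * (j / M)) := by push_cast; ring
    rw [this, ex_add, ex_add]
    ring
  simp_rw [h1]
  rw [sum_comm, corr, Complex.ofReal_mul, Complex.ofReal_sum, mul_sum]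
  refine sum_congr rfl fun n hn => ?_
  rw [mem_range] at hn
  rw [sum_comm]
  have h2 : ∀ k ∈ range N, ∑ j ∈ range M, (err N n * err N k : ℂ) *
      ex ((n - σ * k + σ * h : ℤ) * (j / M)) =
      if ((k : ℤ) = h + σ * n) then (M * (errZ N n * errZ N k) : ℂ) else 0 := by
    intro k hk
    rw [mem_range] at hk
    have h3 : (M : ℤ) ∣ n - σ * k + σ * h ↔ (k : ℤ) = h + σ * n := by
      constructor
      · intro hd
        have := Int.eq_zero_of_abs_lt_dvd hd (by
          rw [abs_lt]; rcases hσ with rfl | rfl <;> constructor <;> omega)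
        rcases hσ with rfl | rfl <;> omega
      · intro hk
        rw [hk]
        rcases hσ with rfl | rfl <;> ring_nf <;> exact dvd_zero _
    rw [← mul_sum, sum_ex_div M hM]
    simp only [h3, errZ, vmZ_sub_mdZ_natCast]
    split_ifs
    · ring
    · ring
  rw [sum_congr rfl h2]
  by_cases hk : 0 ≤ h + σ * n ∧ h + σ * n < N
  · obtain ⟨k, hk1⟩ := Int.eq_ofNat_of_zero_le hk.1
    rw [sum_eq_single k]
    · rw [if_pos hk1.symm, hk1]; push_cast; rfl
    · intro b _ hb
      rw [if_neg]
      omega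
    · intro hkN
      rw [mem_range] at hkN
      omega
  · have : errZ N (h + σ * n) = 0 := by
      by_contra h0; exact hk (errZ_ne_zero _ h0)
    rw [this, sum_eq_zero]
    · simp
    · intro k hk'
      rw [mem_range] at hk'
      rw [if_neg]
      omega

lemma errSum_neg (N : ℕ) (α : ℝ) : errSum N (-α) = (starRingEnd ℂ) (errSum N α) := by
  rw [errSum, errSum, map_sum]
  refine sum_congr rfl fun n _ => ?_
  rw [map_mul, Complex.conj_ofReal, conj_ex, mul_neg]

lemma sum_normSq_errSum_mul_powSum {N M L : ℕ} (hM : M ≠ 0) (hNM : 2 ^ L + 2 * N ≤ M) :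
    ∑ j ∈ range M, ‖errSum N (j / M)‖ ^ 2 * ‖powSum L (j / M)‖ ^ 2 =
      M * ∑ ν ∈ Ioc 0 L, ∑ μ ∈ Ioc 0 L, corr N (errZ N) (errZ N) (2 ^ ν - 2 ^ μ) 1 := by
  apply Complex.ofReal_injective
  have h1 : ∀ j : ℕ, ((‖errSum N (j / M)‖ ^ 2 * ‖powSum L (j / M)‖ ^ 2 : ℝ) : ℂ) =
      ∑ ν ∈ Ioc 0 L, ∑ μ ∈ Ioc 0 L, errSum N (j / M) * errSum N (-(1 : ℤ) * (j / M)) *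
        ex ((1 : ℤ) * (2 ^ ν - 2 ^ μ : ℤ) * (j / M)) := by
    intro j
    push_cast
    rw [← Complex.mul_conj', ← Complex.mul_conj', neg_mul, one_mul, errSum_neg]
    simp_rw [← mul_sum]
    congr 1
    rw [powSum, map_sum, sum_mul_sum]
    refine sum_congr rfl fun ν _ => sum_congr rfl fun μ _ => ?_
    rw [conj_ex, ← ex_add]
    congr 1
    ring
  rw [Complex.ofReal_sum]
  simp_rw [h1]
  rw [sum_comm, Complex.ofReal_mul, Complex.ofReal_sum, mul_sum]
  refine sum_congr rfl fun ν hν => ?_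
  rw [sum_comm, Complex.ofReal_sum, mul_sum]
  refine sum_congr rfl fun μ hμ => ?_
  rw [mem_Ioc] at hν hμ
  have h2 : 2 ^ ν ≤ 2 ^ L := Nat.pow_le_pow_right (by norm_num) hν.2
  have h3 : 2 ^ μ ≤ 2 ^ L := Nat.pow_le_pow_right (by norm_num) hμ.2
  have h4 : ((2 : ℤ) ^ ν - 2 ^ μ).natAbs ≤ 2 ^ L := by
    zify at h2 h3
    have h5 : (0 : ℤ) < 2 ^ ν := by positivity
    have h6 : (0 : ℤ) < 2 ^ μ := by positivity
    zify
    rw [abs_le]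
    constructor <;> linarith
  rw [sum_errSum_mul_ex hM (Or.inl rfl) (by omega)]
  push_cast
  rfl

lemma powSum_pow (L k : ℕ) (x : ℝ) : powSum L x ^ k =
    ∑ ν ∈ Fintype.piFinset (fun _ : Fin k => Ioc 0 L), ex ((∑ i, 2 ^ ν i : ℕ) * x) := by
  have h1 := prod_univ_sum (fun _ : Fin k => Ioc 0 L) fun _ ν => ex (2 ^ ν * x)
  rw [prod_const, card_univ, Fintype.card_fin] at h1
  rw [powSum, h1]
  refine sum_congr rfl fun ν _ => ?_
  push_cast
  rw [sum_mul]
  have : ∀ s : Finset (Fin k), ∏ i ∈ s, ex (2 ^ ν i * x) = ex (∑ i ∈ s, 2 ^ ν i * x) := by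
    intro s
    induction s using Finset.induction_on with
    | empty => simp [ex_zero]
    | insert a s ha ih => rw [prod_insert ha, sum_insert ha, ex_add, ih]
  exact this univ

lemma sum_sq_errSum_mul_powSum_pow {N M L : ℕ} (hM : M ≠ 0) (hL : 7 * 2 ^ L ≤ N) (hNM : 3 * N ≤ M) :
    ∑ j ∈ range M, errSum N (j / M) ^ 2 * powSum L (j / M) ^ 7 * ex (-(N * (j / M))) =
      (M * ∑ ν ∈ Fintype.piFinset (fun _ : Fin 7 => Ioc 0 L),
        corr N (errZ N) (errZ N) (N - ∑ i, 2 ^ ν i : ℕ) (-1) : ℝ) := by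
  have h1 : ∀ ν ∈ Fintype.piFinset (fun _ : Fin 7 => Ioc 0 L), ∑ i, 2 ^ ν i ≤ N := by
    intro ν hν
    rw [Fintype.mem_piFinset] at hν
    refine le_trans ?_ hL
    calc ∑ i, 2 ^ ν i ≤ ∑ _i : Fin 7, 2 ^ L := sum_le_sum fun i _ =>
          Nat.pow_le_pow_right (by norm_num) (mem_Ioc.1 (hν i)).2
      _ = 7 * 2 ^ L := by simp
  simp_rw [powSum_pow, mul_sum, sum_mul]
  rw [sum_comm, Complex.ofReal_sum]
  refine sum_congr rfl fun ν hν => ?_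
  have h2 := h1 ν hν
  rw [← sum_errSum_mul_ex hM (Or.inr rfl) (by rw [Int.natAbs_natCast]; omega)]
  refine sum_congr rfl fun j _ => ?_
  rw [mul_assoc, ← ex_add, sq]
  congr 2
  · congr 1; push_cast; ring
  · rw [Nat.cast_sub h2]; push_cast; ring

lemma abs_sum_corr_errZ_le {N M L : ℕ} (hM : M ≠ 0) (hL : 7 * 2 ^ L ≤ N) (hNM : 3 * N ≤ M) {B : ℝ}
    (hB : ∀ α, ‖errSum N α‖ ≤ B) :
    |∑ ν ∈ Fintype.piFinset (fun _ : Fin 7 => Ioc 0 L),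
        corr N (errZ N) (errZ N) (N - ∑ i, 2 ^ ν i : ℕ) (-1)| ≤
      (0.72 * (L : ℝ)) ^ 5 *
        (∑ ν ∈ Ioc 0 L, ∑ μ ∈ Ioc 0 L, corr N (errZ N) (errZ N) (2 ^ ν - 2 ^ μ) 1) +
      (L : ℝ) ^ 7 * B ^ 2 * ((largeSet L M).card / M) := by
  have hM0 : (0 : ℝ) < M := by positivity
  have hB0 : 0 ≤ B := (norm_nonneg _).trans (hB 0)
  have h1 := congrArg norm (sum_sq_errSum_mul_powSum_pow hM hL hNM)
  rw [Complex.norm_real, Real.norm_eq_abs, abs_mul, abs_of_pos hM0] at h1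
  have h2 : ∀ j ∈ range M, ‖errSum N (j / M) ^ 2 * powSum L (j / M) ^ 7 * ex (-(N * (j / M)))‖ ≤
      (0.72 * (L : ℝ)) ^ 5 * (‖errSum N (j / M)‖ ^ 2 * ‖powSum L (j / M)‖ ^ 2) +
        if j ∈ largeSet L M then (L : ℝ) ^ 7 * B ^ 2 else 0 := by
    intro j hj
    rw [norm_mul, norm_mul, norm_pow, norm_pow, norm_ex, mul_one]
    have hT := norm_powSum_le L (j / M)
    have hE := hB (j / M)
    split_ifs with hjl
    · have : ‖errSum N (j / M)‖ ^ 2 * ‖powSum L (j / M)‖ ^ 7 ≤ B ^ 2 * (L : ℝ) ^ 7 := by gcongr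
      have : 0 ≤ (0.72 * (L : ℝ)) ^ 5 * (‖errSum N (j / M)‖ ^ 2 * ‖powSum L (j / M)‖ ^ 2) := by
        positivity
      linarith
    · have h3 : ‖powSum L (j / M)‖ ≤ 0.72 * (L : ℝ) := by
        by_contra! h
        exact hjl (mem_filter.2 ⟨hj, h.le⟩)
      rw [add_zero]
      calc ‖errSum N (j / M)‖ ^ 2 * ‖powSum L (j / M)‖ ^ 7 =
          ‖powSum L (j / M)‖ ^ 5 * (‖errSum N (j / M)‖ ^ 2 * ‖powSum L (j / M)‖ ^ 2) := by ring
        _ ≤ _ := by gcongr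
  have h3 : M * |∑ ν ∈ Fintype.piFinset (fun _ : Fin 7 => Ioc 0 L),
        corr N (errZ N) (errZ N) (N - ∑ i, 2 ^ ν i : ℕ) (-1)| ≤
      (0.72 * (L : ℝ)) ^ 5 * (M *
        ∑ ν ∈ Ioc 0 L, ∑ μ ∈ Ioc 0 L, corr N (errZ N) (errZ N) (2 ^ ν - 2 ^ μ) 1) +
        (largeSet L M).card * ((L : ℝ) ^ 7 * B ^ 2) := by
    have h4 : range M ∩ largeSet L M = largeSet L M := inter_eq_right.2 (filter_subset _ _)
    have h5 : 2 ^ L + 2 * N ≤ M := by omega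
    rw [← h1, ← sum_normSq_errSum_mul_powSum hM h5]
    refine ((norm_sum_le _ _).trans (sum_le_sum h2)).trans (le_of_eq ?_)
    rw [sum_add_distrib, ← mul_sum, sum_ite_mem, h4, sum_const, nsmul_eq_mul]
  refine le_of_mul_le_mul_left (h3.trans (le_of_eq ?_)) hM0
  field_simp

end LinnikGRH

namespace LinnikGRH
open Finset

/-- The part of `vmZ N` supported on proper prime powers. -/
noncomputable def vmZNotPrime (N : ℕ) (k : ℤ) : ℝ := if k.toNat.Prime then 0 else vmZ N k

lemma vmZ_nonneg (N : ℕ) (k : ℤ) : 0 ≤ vmZ N k :=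
  mul_nonneg ArithmeticFunction.vonMangoldt_nonneg (wt_nonneg _)

lemma vmZ_le_log (N : ℕ) (k : ℤ) : vmZ N k ≤ Real.log N := by
  rcases le_or_gt k 0 with hk | hk
  · rw [vmZ, Int.toNat_of_nonpos hk]
    simpa using Real.log_natCast_nonneg N
  · have h1 := vonMangoldt_mul_wt_le (m := k.toNat) (N := N)
    have h2 : ((k.toNat : ℕ) : ℝ) = k := by exact_mod_cast Int.toNat_of_nonneg hk.le
    rw [h2] at h1
    exact h1.trans (mul_le_of_le_one_right (Real.log_natCast_nonneg N) (wt_le _))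

lemma corr_vmZNotPrime_le {N : ℕ} (hN : 1 ≤ N) (h σ : ℤ) :
    corr N (vmZNotPrime N) (vmZ N) h σ ≤ 2 * √N * Real.log N * Real.log N := by
  have hlog : 0 ≤ Real.log N := Real.log_natCast_nonneg N
  have h1 : ∑ n ∈ range N, vmZNotPrime N n ≤ 2 * √N * Real.log N := by
    refine le_trans ?_ ((le_abs_self _).trans
      (Chebyshev.abs_psi_sub_theta_le_sqrt_mul_log (x := N) (by exact_mod_cast hN)))
    rw [Chebyshev.psi_sub_theta_eq_sum_not_prime, Nat.floor_natCast, sum_filter]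
    have h2 : ∀ n ∈ range N, vmZNotPrime N n ≤
        if ¬ n.Prime then ArithmeticFunction.vonMangoldt n else 0 := by
      intro n _
      rw [vmZNotPrime, Int.toNat_natCast, ite_not]
      split_ifs
      · rfl
      · exact mul_le_of_le_one_right ArithmeticFunction.vonMangoldt_nonneg (wt_le _)
    refine (sum_le_sum h2).trans ?_
    have h3 : ∀ n, 0 ≤ if ¬ n.Prime then ArithmeticFunction.vonMangoldt n else 0 := by
      intro n
      split_ifs
      · rfl
      · exact ArithmeticFunction.vonMangoldt_nonneg
    rw [range_eq_Ico, sum_eq_sum_Ico_succ_bot hN, ArithmeticFunction.map_zero, ite_self, zero_add]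
    refine sum_le_sum_of_subset_of_nonneg (fun n hn => ?_) fun n _ _ => h3 n
    rw [mem_Ico] at hn
    rw [mem_Ioc]
    omega
  rw [corr]
  calc _ ≤ ∑ n ∈ range N, vmZNotPrime N n * Real.log N := by
        refine sum_le_sum fun n _ => mul_le_mul_of_nonneg_left (vmZ_le_log _ _) ?_
        rw [vmZNotPrime]
        split_ifs
        · rfl
        · exact vmZ_nonneg _ _
    _ ≤ _ := by
      rw [← sum_mul]
      gcongr

lemma corr_vmZ_le_of_forall_add_ne {N m : ℕ} (hN : 1 ≤ N)
    (hm : ∀ p q : ℕ, p.Prime → q.Prime → p + q ≠ m) :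
    corr N (vmZ N) (vmZ N) m (-1) ≤ 4 * √N * Real.log N * Real.log N := by
  have hf : ∀ k, vmZNotPrime N k ≠ 0 → 0 ≤ k ∧ k < N := by
    intro k hk
    rw [vmZNotPrime] at hk
    split_ifs at hk
    · exact absurd rfl hk
    · exact vmZ_ne_zero k hk
  have h1 : corr N (vmZ N) (vmZ N) m (-1) ≤
      corr N (vmZNotPrime N) (vmZ N) m (-1) + corr N (vmZ N) (vmZNotPrime N) m (-1) := by
    rw [corr, corr, corr, ← sum_add_distrib]
    refine sum_le_sum fun n _ => ?_
    have ha := vmZ_nonneg N n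
    have hb := vmZ_nonneg N (m + -1 * n)
    have hab := mul_nonneg ha hb
    simp only [vmZNotPrime]
    split_ifs with hp hq hq
    · rw [Int.toNat_natCast] at hp
      exact absurd (by have := hq.pos; omega) (hm _ _ hp hq)
    all_goals linarith
  rw [corr_swap hf vmZ_ne_zero m (Or.inr rfl)] at h1
  linarith [corr_vmZNotPrime_le hN m (-1), corr_vmZNotPrime_le hN (-(-1 * m)) (-1)]

section
variable (GRH : ∀ (q : ℕ) [NeZero q] (χ : DirichletCharacter ℂ q) (s : ℂ),
      0 < s.re → s.re < 1 → DirichletCharacter.LFunction χ s = 0 → s.re = 1 / 2)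
include GRH

lemma exists_corr_vmZ_ge : ∃ C : ℝ, 0 < C ∧ ∀ N : ℕ, 1 ≤ N → ∀ m : ℕ, Even m → m ≠ 0 → m ≤ N →
    ∀ δ : ℝ, (N - m : ℝ) / N ≤ δ →
    1.31 * singFactor m * (N * (wtCorr 0 1 - δ)) - C * (N : ℝ) ^ (0.9999 : ℝ) +
      corr N (errZ N) (errZ N) m (-1) ≤ corr N (vmZ N) (vmZ N) m (-1) := by
  obtain ⟨C, hC, hS⟩ := exists_singTrunc_lev_ge
  refine ⟨C + 2 * 10 ^ 13, by positivity, fun N hN m he h0 hmN δ hδ => ?_⟩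
  have hN1 : (1 : ℝ) ≤ N := by exact_mod_cast hN
  have hN0 : (0 : ℝ) < N := by linarith
  have h2 := corr_vmZ_mdZ_sub_le GRH hN m (Or.inr rfl)
  have h3 := corr_mdZ_mdZ_sub_le hN m (Or.inr rfl)
  have h5 := hS N hN m (by exact_mod_cast h0) (by exact_mod_cast he) (by simpa using hmN)
  rw [Int.natAbs_natCast] at h5
  rw [Int.cast_neg, Int.cast_one, Int.cast_natCast] at h2 h3
  set W := wtCorr (m / N) (-1) with hW
  have hW0 : 0 ≤ W := wtCorr_nonneg _ _
  have hW1 : W ≤ 1 := wtCorr_le_one _ _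
  have hWI : wtCorr 0 1 - δ ≤ W := by
    have h6 := abs_wtCorr_sub_le 1 (m / N) (-1)
    have h7 : (1 : ℝ) - m / N = (N - m : ℝ) / N := by field_simp
    have h8 : (m : ℝ) ≤ N := by exact_mod_cast hmN
    rw [wtCorr_one_neg_one, h7, abs_of_nonneg (div_nonneg (by linarith) hN0.le)] at h6
    linarith [le_abs_self (wtCorr 0 1 - W)]
  have hP := one_le_singFactor m
  set P := singFactor m with hPdef
  have h6 : 1.31 * P * (N * W) - C * (N : ℝ) ^ (0.9999 : ℝ) ≤ singTrunc (lev N) m * (N * W) := by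
    have h7 := mul_le_mul_of_nonneg_right h5 (by positivity : 0 ≤ N * W)
    have h8 : C * (N : ℝ) ^ (-0.1 : ℝ) * (N * W) ≤ C * (N : ℝ) ^ (0.9999 : ℝ) := by
      calc C * (N : ℝ) ^ (-0.1 : ℝ) * (N * W) ≤ C * (N : ℝ) ^ (-0.1 : ℝ) * (N * 1) := by gcongr
        _ = C * (N : ℝ) ^ (-0.1 + 1 : ℝ) := by rw [Real.rpow_add hN0, Real.rpow_one]; ring
        _ ≤ _ := by gcongr; norm_num
    linarith
  have h9 : (N : ℝ) ^ (0.999 : ℝ) ≤ (N : ℝ) ^ (0.9999 : ℝ) :=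
    Real.rpow_le_rpow_of_exponent_le hN1 (by norm_num)
  have h11 : 1.31 * P * (N * (wtCorr 0 1 - δ)) ≤ 1.31 * P * (N * W) := by gcongr
  have h13 : corr N (errZ N) (errZ N) m (-1) = _ := corr_errZ m (Or.inr rfl)
  rw [show -(-1 * (m : ℤ)) = m by ring] at h13
  rw [h13]
  rw [abs_le] at h2 h3
  have h12 : (0 : ℝ) ≤ (N : ℝ) ^ (0.9999 : ℝ) := by positivity
  linarith [h2.1, h3.2]

end

lemma eventually_exists_length : ∀ᶠ N : ℕ in Filter.atTop, ∃ t : ℕ,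
    (2 : ℝ) ^ (12 * t) ≤ (N : ℝ) ^ (1 - 1 / 4000 : ℝ) ∧
    (N : ℝ) ^ (1 - 1 / 4000 : ℝ) ≤ 4096 * 2 ^ (12 * t) ∧
    Real.log N ≤ 0.694 * (12 * t : ℕ) ∧ 1 ≤ t := by
  filter_upwards [Filter.eventually_ge_atTop 1, eventually_le_log_natCast 20000] with N hN hlog
  have hN1 : (1 : ℝ) ≤ N := by exact_mod_cast hN
  have hN0 : (0 : ℝ) < N := by linarith
  set X := (N : ℝ) ^ (1 - 1 / 4000 : ℝ) with hX
  have hX1 : 1 ≤ X := Real.one_le_rpow hN1 (by norm_num)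
  have hf : 1 ≤ ⌊X⌋₊ := Nat.one_le_floor_iff _ |>.2 hX1
  set l := Nat.log 2 ⌊X⌋₊
  have h1 : 2 ^ (12 * (l / 12)) ≤ ⌊X⌋₊ := (Nat.pow_le_pow_right (by norm_num) (by omega)).trans
    (Nat.pow_log_le_self 2 (by omega : ⌊X⌋₊ ≠ 0))
  have h2 : ⌊X⌋₊ + 1 ≤ 2 ^ (12 * (l / 12) + 12) := (Nat.lt_pow_succ_log_self (by norm_num) _).trans_le
    (Nat.pow_le_pow_right (by norm_num) (by omega))
  have h3 : X ≤ 4096 * 2 ^ (12 * (l / 12)) := by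
    refine (Nat.lt_floor_add_one X).le.trans ?_
    have : ((⌊X⌋₊ + 1 : ℕ) : ℝ) ≤ (2 ^ (12 * (l / 12) + 12) : ℕ) := by exact_mod_cast h2
    push_cast at this
    rw [pow_add] at this
    linarith
  have h4 : (1 - 1 / 4000) * Real.log N ≤ 0.6931472 * ((12 * (l / 12) : ℕ) + 12) := by
    have h5 := Real.log_le_log (by positivity) h3
    rw [hX, Real.log_rpow hN0, Real.log_mul (by norm_num) (by positivity), Real.log_pow,
      show (4096 : ℝ) = 2 ^ 12 by norm_num, Real.log_pow] at h5
    have h6 := Real.log_two_lt_d9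
    have h7 : (0 : ℝ) ≤ (12 * (l / 12) : ℕ) := Nat.cast_nonneg _
    push_cast at h5 h7 ⊢
    nlinarith
  refine ⟨l / 12, ?_, h3, by linarith, ?_⟩
  · refine le_trans ?_ (Nat.floor_le (by positivity))
    exact_mod_cast h1
  · by_contra! h
    have : l / 12 = 0 := by omega
    rw [this] at h4
    norm_num at h4
    linarith

end LinnikGRH

namespace LinnikGRH
open Finset

lemma card_largeSet_div_le {N L K : ℕ} (hN : 1 ≤ N) (hLK : L < K)
    (hX : (N : ℝ) ^ (1 - 1 / 4000 : ℝ) ≤ 4096 * 2 ^ L) :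
    ((largeSet L (2 ^ K)).card : ℝ) / (2 ^ K : ℕ) ≤ 6700 * 4096 * (N : ℝ) ^ (-0.5018 : ℝ) := by
  have hN1 : (1 : ℝ) ≤ N := by exact_mod_cast hN
  have hN0 : (0 : ℝ) < N := by linarith
  have h1 := card_powSum_ge_le hLK
  have h2 : (N : ℝ) ^ (0.5018 : ℝ) ≤ 4096 * (2 : ℝ) ^ (0.502 * (L : ℝ)) := by
    calc (N : ℝ) ^ (0.5018 : ℝ) ≤ (N : ℝ) ^ ((1 - 1 / 4000) * 0.502 : ℝ) :=
          Real.rpow_le_rpow_of_exponent_le hN1 (by norm_num)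
      _ = ((N : ℝ) ^ (1 - 1 / 4000 : ℝ)) ^ (0.502 : ℝ) := Real.rpow_mul hN0.le _ _
      _ ≤ (4096 * 2 ^ L) ^ (0.502 : ℝ) := by gcongr
      _ = 4096 ^ (0.502 : ℝ) * (2 : ℝ) ^ (0.502 * (L : ℝ)) := by
        rw [Real.mul_rpow (by norm_num) (by positivity), ← Real.rpow_natCast, ← Real.rpow_mul (by norm_num),
          mul_comm (L : ℝ)]
      _ ≤ _ := by
        gcongr
        exact (Real.rpow_le_rpow_of_exponent_le (by norm_num) (by norm_num : (0.502 : ℝ) ≤ 1)).trans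
          (Real.rpow_one _).le
  rw [div_le_iff₀ (by positivity), Real.rpow_neg hN0.le, mul_assoc, mul_comm (_⁻¹), ← div_eq_mul_inv,
    mul_div_assoc', le_div_iff₀ (by positivity)]
  push_cast
  calc ((largeSet L (2 ^ K)).card : ℝ) * (N : ℝ) ^ (0.5018 : ℝ) ≤
      (largeSet L (2 ^ K)).card * (4096 * (2 : ℝ) ^ (0.502 * (L : ℝ))) := by gcongr
    _ = 4096 * ((largeSet L (2 ^ K)).card * (2 : ℝ) ^ (0.502 * (L : ℝ))) := by ring
    _ ≤ 4096 * (6700 * 2 ^ K) := by gcongr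
    _ = _ := by ring

section
variable (GRH : ∀ (q : ℕ) [NeZero q] (χ : DirichletCharacter ℂ q) (s : ℂ),
      0 < s.re → s.re < 1 → DirichletCharacter.LFunction χ s = 0 → s.re = 1 / 2)
include GRH

lemma exists_abs_sum_corr_errZ_le : ∃ C : ℝ, 0 < C ∧ ∀ᶠ N : ℕ in Filter.atTop, ∀ L : ℕ,
    7 * 2 ^ L ≤ N → (2 : ℝ) ^ L ≤ (N : ℝ) ^ (1 - 1 / 4000 : ℝ) →
    (N : ℝ) ^ (1 - 1 / 4000 : ℝ) ≤ 4096 * 2 ^ L → Real.log N ≤ 0.694 * L → 1 ≤ L →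
    |∑ ν ∈ Fintype.piFinset (fun _ : Fin 7 => Ioc 0 L),
        corr N (errZ N) (errZ N) (N - ∑ i, 2 ^ ν i : ℕ) (-1)| ≤
      (L : ℝ) ^ 7 * (1.8733 * (N * wtCorr 0 1) + C * (N : ℝ) ^ (0.9999 : ℝ)) := by
  obtain ⟨C, hC, hsum⟩ := exists_sum_corr_errZ_le GRH
  obtain ⟨B, hB, hsup⟩ := exists_norm_errSum_le GRH
  refine ⟨9 + 4 * C + B ^ 2 * (6700 * 4096), by positivity, ?_⟩
  filter_upwards [hsum, Filter.eventually_ge_atTop 16] with N hsum hN L hL7 hLX hXL hlog hL1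
  have hN1 : (1 : ℝ) ≤ N := by exact_mod_cast (by omega : 1 ≤ N)
  have hN0 : (0 : ℝ) < N := by linarith
  have hL1' : (1 : ℝ) ≤ L := by exact_mod_cast hL1
  have hLN : 2 ^ L ≤ N := by omega
  set X := (N : ℝ) ^ (0.9999 : ℝ) with hX
  have hX0 : 0 < X := by positivity
  set I := wtCorr 0 1 with hI
  have hI0 : 0 < I := wtCorr_zero_one_pos
  have hK1 : L < Nat.log 2 N + 3 := by
    have := Nat.le_log_of_pow_le (by norm_num : 1 < 2) hLN
    omega
  have hK2 : 3 * N ≤ 2 ^ (Nat.log 2 N + 3) := by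
    have := Nat.lt_pow_succ_log_self (by norm_num : 1 < 2) N
    rw [pow_succ] at this
    rw [pow_add]
    omega
  refine (abs_sum_corr_errZ_le (by positivity) hL7 hK2 (hsup N hN)).trans ?_
  have h1 := hsum L hLN
  have h2 : L * Real.log N * (N * I) + 8.9869 * (L : ℝ) ^ 2 * (N * (I + 2 ^ L / N)) +
      C * ((L : ℝ) + 1) * (L + Real.log N) * X ≤
      (L : ℝ) ^ 2 * (9.6809 * (N * I) + (9 + 4 * C) * X) := by
    have h3 : (2 : ℝ) ^ L ≤ X := hLX.trans (Real.rpow_le_rpow_of_exponent_le hN1 (by norm_num))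
    have h4 : N * (I + 2 ^ L / N) ≤ N * I + X := by
      rw [mul_add, mul_div_cancel₀ _ hN0.ne']
      linarith
    calc _ ≤ L * (0.694 * L) * (N * I) + 8.9869 * (L : ℝ) ^ 2 * (N * I + X) +
          C * (2 * L) * (2 * L) * X := by
            gcongr
            · linarith
            · linarith
      _ = (L : ℝ) ^ 2 * (9.6809 * (N * I) + (8.9869 + 4 * C) * X) := by ring
      _ ≤ _ := by gcongr; norm_num
  have h5 := card_largeSet_div_le (by omega : 1 ≤ N) hK1 hXL
  have h6 : (B * (N : ℝ) ^ (3 / 4 + 1 / 2000 : ℝ)) ^ 2 * (6700 * 4096 * (N : ℝ) ^ (-0.5018 : ℝ)) ≤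
      B ^ 2 * (6700 * 4096) * X := by
    calc _ = B ^ 2 * (6700 * 4096) * (N : ℝ) ^ ((3 / 4 + 1 / 2000) * 2 + -0.5018 : ℝ) := by
          rw [mul_pow, Real.rpow_add hN0 ((3 / 4 + 1 / 2000) * 2), Real.rpow_mul hN0.le,
            ← Real.rpow_natCast ((N : ℝ) ^ (3 / 4 + 1 / 2000 : ℝ)) 2]
          push_cast
          ring
      _ ≤ _ := mul_le_mul_of_nonneg_left
        (Real.rpow_le_rpow_of_exponent_le hN1 (by norm_num)) (by positivity)
  calc _ ≤ (0.72 * (L : ℝ)) ^ 5 * ((L : ℝ) ^ 2 * (9.6809 * (N * I) + (9 + 4 * C) * X)) +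
        (L : ℝ) ^ 7 * (B * (N : ℝ) ^ (3 / 4 + 1 / 2000 : ℝ)) ^ 2 *
          (6700 * 4096 * (N : ℝ) ^ (-0.5018 : ℝ)) := by
        gcongr
        exact h1.trans h2
    _ = (L : ℝ) ^ 7 * (0.72 ^ 5 * (9.6809 * (N * I) + (9 + 4 * C) * X) +
        (B * (N : ℝ) ^ (3 / 4 + 1 / 2000 : ℝ)) ^ 2 * (6700 * 4096 * (N : ℝ) ^ (-0.5018 : ℝ))) := by
        ring
    _ ≤ _ := by
      have hNI : 0 < N * I := by positivity
      have hCX : 0 < (9 + 4 * C) * X := by positivity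
      refine mul_le_mul_of_nonneg_left ?_ (by positivity)
      linarith

lemma eventually_sum_corr_vmZ_ge : ∀ᶠ N : ℕ in Filter.atTop, Even N → ∃ L : ℕ, 1 ≤ L ∧
    (∀ ν ∈ Fintype.piFinset (fun _ : Fin 7 => Ioc 0 L), ∑ i, 2 ^ ν i < N) ∧
    (L : ℝ) ^ 7 * (0.02 * (N * wtCorr 0 1)) ≤
      ∑ ν ∈ Fintype.piFinset (fun _ : Fin 7 => Ioc 0 L),
        corr N (vmZ N) (vmZ N) (N - ∑ i, 2 ^ ν i : ℕ) (-1) := by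
  obtain ⟨C, hC, herr⟩ := exists_abs_sum_corr_errZ_le GRH
  obtain ⟨D, hD, hge⟩ := exists_corr_vmZ_ge GRH
  have hI0 : 0 < wtCorr 0 1 := wtCorr_zero_one_pos
  filter_upwards [herr, eventually_exists_length, Filter.eventually_ge_atTop 1,
    eventually_le_natCast_rpow 8 (by norm_num : (0 : ℝ) < 1 / 4000),
    eventually_le_natCast_rpow (7 / wtCorr 0 1) (by norm_num : (0 : ℝ) < 1 / 4000),
    eventually_le_natCast_rpow ((14 + C + D) / (0.01 * wtCorr 0 1)) (by norm_num : (0 : ℝ) < 0.0001)]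
    with N herr hlen hN h8 h7 hbig hev
  obtain ⟨t, hLX, hXL, hlog, ht⟩ := hlen
  have hN1 : (1 : ℝ) ≤ N := by exact_mod_cast hN
  have hN0 : (0 : ℝ) < N := by linarith
  have h8L : 8 * 2 ^ (12 * t) ≤ N := by
    have : (8 : ℝ) * 2 ^ (12 * t) ≤ N := by
      calc (8 : ℝ) * 2 ^ (12 * t) ≤ (N : ℝ) ^ (1 / 4000 : ℝ) * (N : ℝ) ^ (1 - 1 / 4000 : ℝ) := by gcongr
        _ = N := by rw [← Real.rpow_add hN0]; norm_num
    exact_mod_cast this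
  have hpos : 0 < 2 ^ (12 * t) := by positivity
  have hsum7 : ∀ ν ∈ Fintype.piFinset (fun _ : Fin 7 => Ioc 0 (12 * t)),
      ∑ i, 2 ^ ν i ≤ 7 * 2 ^ (12 * t) := by
    intro ν hν
    rw [Fintype.mem_piFinset] at hν
    calc ∑ i, 2 ^ ν i ≤ ∑ _i : Fin 7, 2 ^ (12 * t) := sum_le_sum fun i _ =>
          Nat.pow_le_pow_right (by norm_num) (mem_Ioc.1 (hν i)).2
      _ = 7 * 2 ^ (12 * t) := by simp
  have hlt : ∀ ν ∈ Fintype.piFinset (fun _ : Fin 7 => Ioc 0 (12 * t)), ∑ i, 2 ^ ν i < N := by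
    intro ν hν
    have := hsum7 ν hν
    omega
  refine ⟨12 * t, by omega, hlt, ?_⟩
  have h1 := herr (12 * t) (by omega) hLX hXL hlog (by omega)
  have h2 := sum_singFactor_ge hlt
  set L := 12 * t with hL
  set I := wtCorr 0 1 with hI
  set X := (N : ℝ) ^ (0.9999 : ℝ) with hX
  set δ := 7 * (2 : ℝ) ^ L / N with hδ
  have hX0 : 0 < X := by positivity
  have hNX : (N : ℝ) ^ (1 - 1 / 4000 : ℝ) ≤ X := Real.rpow_le_rpow_of_exponent_le hN1 (by norm_num)
  have hδI : δ ≤ I := by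
    rw [hδ, div_le_iff₀ hN0]
    rw [div_le_iff₀ hI0] at h7
    calc 7 * (2 : ℝ) ^ L ≤ (N : ℝ) ^ (1 / 4000 : ℝ) * I * (N : ℝ) ^ (1 - 1 / 4000 : ℝ) := by gcongr
      _ = I * ((N : ℝ) ^ (1 / 4000 : ℝ) * (N : ℝ) ^ (1 - 1 / 4000 : ℝ)) := by ring
      _ = I * N := by rw [← Real.rpow_add hN0]; norm_num
  have h3 : ∑ ν ∈ Fintype.piFinset (fun _ : Fin 7 => Ioc 0 L),
      (singFactor (N - ∑ i, 2 ^ ν i) * (1.31 * (N * (I - δ))) - D * X +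
        corr N (errZ N) (errZ N) (N - ∑ i, 2 ^ ν i : ℕ) (-1)) ≤
      ∑ ν ∈ Fintype.piFinset (fun _ : Fin 7 => Ioc 0 L),
        corr N (vmZ N) (vmZ N) (N - ∑ i, 2 ^ ν i : ℕ) (-1) := by
    refine sum_le_sum fun ν hν => ?_
    have h4 := hlt ν hν
    have hevs : Even (∑ i, 2 ^ ν i) := by
      refine even_iff_two_dvd.2 (dvd_sum fun i _ => dvd_pow_self 2 ?_)
      have := mem_Ioc.1 (Fintype.mem_piFinset.1 hν i)
      omega
    refine le_trans (le_of_eq ?_) (hge N hN (N - ∑ i, 2 ^ ν i) (hev.tsub hevs) (by omega)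
      (Nat.sub_le _ _) δ ?_)
    · ring
    · rw [Nat.cast_sub h4.le, sub_sub_cancel, hδ]
      have : ((∑ i, 2 ^ ν i : ℕ) : ℝ) ≤ 7 * 2 ^ L := by exact_mod_cast hsum7 ν hν
      gcongr
  rw [sum_add_distrib, sum_sub_distrib, ← sum_mul, sum_const, Fintype.card_piFinset] at h3
  simp only [Nat.card_Ioc, tsub_zero, prod_const, card_univ, Fintype.card_fin, nsmul_eq_mul,
    Nat.cast_pow] at h3
  have h4 : 1.455 * (L : ℝ) ^ 7 * (1.31 * (N * (I - δ))) ≤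
      (∑ ν ∈ Fintype.piFinset (fun _ : Fin 7 => Ioc 0 L), singFactor (N - ∑ i, 2 ^ ν i)) *
        (1.31 * (N * (I - δ))) :=
    mul_le_mul_of_nonneg_right h2 (mul_nonneg (by norm_num)
      (mul_nonneg hN0.le (sub_nonneg.2 hδI)))
  have h5 : N * δ ≤ 7 * X := by
    rw [hδ, mul_div_cancel₀ _ hN0.ne']
    linarith
  have h6 : (14 + C + D) * X ≤ 0.01 * (N * I) := by
    rw [div_le_iff₀ (by positivity)] at hbig
    calc (14 + C + D) * X ≤ (N : ℝ) ^ (0.0001 : ℝ) * (0.01 * I) * X := by gcongr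
      _ = 0.01 * ((N : ℝ) ^ (0.0001 : ℝ) * X * I) := by ring
      _ = 0.01 * (N * I) := by rw [hX, ← Real.rpow_add hN0]; norm_num
  have h9 : (L : ℝ) ^ 7 * (0.02 * (N * I)) ≤ (L : ℝ) ^ 7 *
      (1.455 * (1.31 * (N * (I - δ))) - D * X - (1.8733 * (N * I) + C * X)) := by
    gcongr
    have : 0 < N * I := by positivity
    linarith
  linarith [(abs_le.1 h1).1]

/-- Under the generalized Riemann hypothesis, large even integers are sums of two primes and seven
powers of two. -/
theorem exists_primes_add_powers_of_two : ∃ N₀ : ℕ, ∀ N : ℕ, N₀ ≤ N → Even N →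
      ∃ (p₁ p₂ : ℕ) (ν : Fin 7 → ℕ), p₁.Prime ∧ p₂.Prime ∧ (∀ i, 1 ≤ ν i) ∧
        N = p₁ + p₂ + ∑ i, 2 ^ ν i := by
  have hI0 : 0 < wtCorr 0 1 := wtCorr_zero_one_pos
  rw [← Filter.eventually_atTop]
  filter_upwards [eventually_sum_corr_vmZ_ge GRH, Filter.eventually_ge_atTop 1,
    eventually_le_natCast_rpow (400 / (0.01 * wtCorr 0 1)) (by norm_num : (0 : ℝ) < 0.3)]
    with N hsum hN hbig hev
  have hN1 : (1 : ℝ) ≤ N := by exact_mod_cast hN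
  have hN0 : (0 : ℝ) < N := by linarith
  obtain ⟨L, hL, hlt, hge⟩ := hsum hev
  by_contra! hno
  have h1 : 4 * √N * Real.log N * Real.log N ≤ 0.01 * (N * wtCorr 0 1) := by
    rw [div_le_iff₀ (by positivity)] at hbig
    have hlog := Real.log_le_rpow_div hN0.le (by norm_num : (0 : ℝ) < 0.1)
    have hlog0 : 0 ≤ Real.log N := Real.log_natCast_nonneg N
    calc 4 * √N * Real.log N * Real.log N ≤
        4 * (N : ℝ) ^ (1 / 2 : ℝ) * ((N : ℝ) ^ (0.1 : ℝ) / 0.1) * ((N : ℝ) ^ (0.1 : ℝ) / 0.1) := by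
          rw [← Real.sqrt_eq_rpow]; gcongr
      _ = 400 * (N : ℝ) ^ (0.7 : ℝ) := by
        rw [show (0.7 : ℝ) = 1 / 2 + 0.1 + 0.1 by norm_num, Real.rpow_add hN0, Real.rpow_add hN0]
        ring
      _ ≤ (N : ℝ) ^ (0.3 : ℝ) * (0.01 * wtCorr 0 1) * (N : ℝ) ^ (0.7 : ℝ) := by gcongr
      _ = 0.01 * ((N : ℝ) ^ (0.3 : ℝ) * (N : ℝ) ^ (0.7 : ℝ) * wtCorr 0 1) := by ring
      _ = _ := by rw [← Real.rpow_add hN0]; norm_num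
  have h2 : ∀ ν ∈ Fintype.piFinset (fun _ : Fin 7 => Ioc 0 L),
      corr N (vmZ N) (vmZ N) (N - ∑ i, 2 ^ ν i : ℕ) (-1) ≤ 0.01 * (N * wtCorr 0 1) := by
    intro ν hν
    refine (corr_vmZ_le_of_forall_add_ne hN fun p q hp hq hpq => ?_).trans h1
    refine hno p q ν hp hq (fun i => (mem_Ioc.1 (Fintype.mem_piFinset.1 hν i)).1) ?_
    have := hlt ν hν
    omega
  have h3 := hge.trans (sum_le_sum h2)
  rw [sum_const, Fintype.card_piFinset] at h3
  simp only [Nat.card_Ioc, tsub_zero, prod_const, card_univ, Fintype.card_fin, nsmul_eq_mul,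
    Nat.cast_pow] at h3
  have hL0 : (0 : ℝ) < (L : ℝ) ^ 7 := by positivity
  have h4 := le_of_mul_le_mul_left h3 hL0
  have : 0 < N * wtCorr 0 1 := by positivity
  linarith

end

end LinnikGRH

/-- **Linnik's problem with 7 powers of two, under GRH.** Assuming the Generalized Riemann
Hypothesis for all Dirichlet L-functions, every sufficiently large even integer is a sum of
two primes and exactly seven powers of `2` (repetitions allowed, exponents positive). -/
theorem sum_two_primes_seven_powers_of_two_of_GRH
    (GRH : ∀ (q : ℕ) [NeZero q] (χ : DirichletCharacter ℂ q) (s : ℂ),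
      0 < s.re → s.re < 1 → DirichletCharacter.LFunction χ s = 0 → s.re = 1 / 2) :
    ∃ N₀ : ℕ, ∀ N : ℕ, N₀ ≤ N → Even N →
      ∃ (p₁ p₂ : ℕ) (ν : Fin 7 → ℕ), p₁.Prime ∧ p₂.Prime ∧ (∀ i, 1 ≤ ν i) ∧
        N = p₁ + p₂ + ∑ i, 2 ^ ν i := by
  exact LinnikGRH.exists_primes_add_powers_of_two GRH
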